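/- Let n ≥ 2, 1 ≤ q ≤ n−1, s, k positive integers, 0 < λ < λ' < 1, n/2 < δ < n with δ ≠ n−1, μ > 0, T > 0. Then the nonlinear map u ↦ Φ_q d_q Ψ_{μ,q} N_q(u) from F^{k,s(s,λ,λ',δ)}_{T,Λ^q,D_{d⊕d*}} ∩ S_{d*} to itself is continuous and compact, and the map I + Φ_q d_q Ψ_{μ,q} N_q from F^{k,s(s,λ,λ',δ)}_{T,Λ^q,D_{d⊕d*}} ∩ S_{d*} to itself is continuous, Fredholm, injective and open. -/

import Mathlib

open scoped BigOperators ENNReal Classical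
open Filter MeasureTheory

noncomputable section

namespace NSdeRham

/-- Euclidean space `ℝⁿ`. -/
abbrev Spc (n : ℕ) := EuclideanSpace ℝ (Fin n)

variable {n : ℕ}

/-- The weight `w(x) = √(1+|x|²)`. -/
def wt (x : Spc n) : ℝ := Real.sqrt (1 + ‖x‖ ^ 2)

/-- `w(x,y) = max (w x) (w y)`. -/
def wt2 (x y : Spc n) : ℝ := max (wt x) (wt y)

/-- Partial derivative in the `i`-th coordinate direction. -/
def pd (i : Fin n) (f : Spc n → ℝ) (x : Spc n) : ℝ :=
  fderiv ℝ f x (EuclideanSpace.single i 1)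

/-- The Laplace operator `Δ = ∑ ∂²/∂xᵢ²`. -/
def lap (f : Spc n → ℝ) (x : Spc n) : ℝ := ∑ i : Fin n, pd i (pd i f) x

section enorms

variable {F : Type*} [NormedAddCommGroup F]

/-- Weighted sup-"norm" `sup_x w(x)^δ ‖g x‖` (with values in `ℝ≥0∞`). -/
def eWSup (δ : ℝ) (g : Spc n → F) : ℝ≥0∞ :=
  ⨆ x : Spc n, ENNReal.ofReal (wt x ^ δ * ‖g x‖)

/-- Weighted Hölder seminorm `⟨g⟩_{λ,δ}`. -/
def eWHold (lam δ : ℝ) (g : Spc n → F) : ℝ≥0∞ :=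
  ⨆ (x : Spc n) (y : Spc n) (_ : x ≠ y ∧ ‖x - y‖ ≤ ‖x‖ / 2),
    ENNReal.ofReal (wt2 x y ^ (δ + lam) * ‖g x - g y‖ / ‖x - y‖ ^ lam)

/-- The ordinary Hölder norm on the (closed) unit ball around the origin. -/
def eOHold (lam : ℝ) (g : Spc n → F) : ℝ≥0∞ :=
  (⨆ (x : Spc n) (_ : ‖x‖ ≤ 1), ENNReal.ofReal ‖g x‖) +
    ⨆ (x : Spc n) (y : Spc n) (_ : ‖x‖ ≤ 1 ∧ ‖y‖ ≤ 1 ∧ x ≠ y),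
      ENNReal.ofReal (‖g x - g y‖ / ‖x - y‖ ^ lam)

/-- The norm of `C^{0,λ,δ}`; for `λ = 0` this is just the weighted sup-norm. -/
def eHol0 (lam δ : ℝ) (g : Spc n → F) : ℝ≥0∞ :=
  if lam = 0 then eWSup δ g else eOHold lam g + eWSup δ g + eWHold lam δ g

/-- The norm of the base anisotropic space `C^{𝐬(0,λ,δ)}_T`. -/
def eAniso0 (T lam δ : ℝ) (v : ℝ → Spc n → F) : ℝ≥0∞ :=
  (⨆ t : Set.Icc (0 : ℝ) T, eHol0 lam δ (v t)) +
    if lam = 0 then 0 else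
      ⨆ (t₁ : Set.Icc (0 : ℝ) T) (t₂ : Set.Icc (0 : ℝ) T) (_ : (t₁ : ℝ) ≠ (t₂ : ℝ))
        (x : Spc n),
        ENNReal.ofReal (wt x ^ δ * ‖v t₁ x - v t₂ x‖ / |(t₁ : ℝ) - (t₂ : ℝ)| ^ (lam / 2))

end enorms

/-- The norm of the static weighted Hölder space `C^{s,λ,δ}`. -/
def eHolS (s : ℕ) (lam δ : ℝ) (g : Spc n → ℝ) : ℝ≥0∞ :=
  ∑ m ∈ Finset.range (s + 1), eHol0 lam (δ + m) (iteratedFDeriv ℝ m g)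

/-- Membership in the static weighted Hölder space `C^{s,λ,δ}`. -/
def HolSMem (s : ℕ) (lam δ : ℝ) (g : Spc n → ℝ) : Prop :=
  ContDiff ℝ s g ∧ eHolS s lam δ g ≠ ⊤

/-- Time derivative of order `j` (within `[0,T]`). -/
def tDeriv (T : ℝ) (j : ℕ) (u : ℝ → Spc n → ℝ) (t : ℝ) (x : Spc n) : ℝ :=
  iteratedDerivWithin j (fun τ => u τ x) (Set.Icc 0 T) t

/-- Mixed derivative `∂_x^m ∂_t^j`. -/
def mixDeriv (T : ℝ) (m j : ℕ) (u : ℝ → Spc n → ℝ) (t : ℝ) :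
    Spc n → ContinuousMultilinearMap ℝ (fun _ : Fin m => Spc n) ℝ :=
  iteratedFDeriv ℝ m (fun x => tDeriv T j u t x)

/-- The norm of the anisotropic weighted parabolic Hölder space `C^{k,𝐬(s,λ,δ)}_T`. -/
def eAnisoKS (T : ℝ) (k s : ℕ) (lam δ : ℝ) (u : ℝ → Spc n → ℝ) : ℝ≥0∞ :=
  ∑ b ∈ Finset.range (k + 1), ∑ m ∈ Finset.range (2 * s + 1), ∑ j ∈ Finset.range (s + 1),
    if m + 2 * j ≤ 2 * s then eAniso0 T lam (δ + b + m) (mixDeriv T (b + m) j u) else 0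

/-- Regularity required of members of `C^{k,𝐬(s,λ,δ)}_T`. -/
def AnisoReg (T : ℝ) (k s : ℕ) (u : ℝ → Spc n → ℝ) : Prop :=
  (∀ x : Spc n, ContDiffOn ℝ s (fun t => u t x) (Set.Icc 0 T)) ∧
  (∀ j : ℕ, j ≤ s → ∀ t ∈ Set.Icc (0 : ℝ) T,
    ContDiff ℝ (2 * (s - j) + k) (fun x => tDeriv T j u t x)) ∧
  (∀ j m : ℕ, j ≤ s → m + 2 * j ≤ 2 * s + k →
    Continuous fun p : Set.Icc (0 : ℝ) T × Spc n => mixDeriv T m j u p.1 p.2)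

/-- Membership in `C^{k,𝐬(s,λ,δ)}_T`. -/
def AnisoMem (T : ℝ) (k s : ℕ) (lam δ : ℝ) (u : ℝ → Spc n → ℝ) : Prop :=
  AnisoReg T k s u ∧ eAnisoKS T k s lam δ u ≠ ⊤

/-- The norm of `𝓕^{k,𝐬(s,λ,λ',δ)}_T = C^{k+1,𝐬(s,λ,δ)}_T ∩ C^{k,𝐬(s,λ',δ)}_T`. -/
def eFn (T : ℝ) (k s : ℕ) (lam lam' δ : ℝ) (u : ℝ → Spc n → ℝ) : ℝ≥0∞ :=
  eAnisoKS T (k + 1) s lam δ u + eAnisoKS T k s lam' δ u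

/-- Membership in `𝓕^{k,𝐬(s,λ,λ',δ)}_T`. -/
def FMem (T : ℝ) (k s : ℕ) (lam lam' δ : ℝ) (u : ℝ → Spc n → ℝ) : Prop :=
  AnisoReg T (k + 1) s u ∧ eFn T k s lam lam' δ u ≠ ⊤

/-- Index set of a basis of `Λ^q`. -/
abbrev Idx (n q : ℕ) := {I : Finset (Fin n) // I.card = q}

/-- Static differential `q`-forms: coefficient functions. -/
abbrev FormS (n q : ℕ) := Idx n q → Spc n → ℝ

/-- Time-dependent differential `q`-forms. -/
abbrev FormT (n q : ℕ) := Idx n q → ℝ → Spc n → ℝ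

/-- Fibre of the bundle `Λ^q`. -/
abbrev Fib (n q : ℕ) := Idx n q → ℝ

/-- The exterior derivative `d_q` on static `q`-forms. -/
def dS {q : ℕ} (u : FormS n q) : FormS n (q + 1) := fun J x =>
  ∑ i : Fin n,
    if h : i ∈ J.1 then
      (-1 : ℝ) ^ (J.1.filter fun j => j < i).card *
        pd i (u ⟨J.1.erase i, by simp [Finset.card_erase_of_mem h, J.2]⟩) x
    else 0

/-- The exterior derivative `d_{q-1}` mapping `(q-1)`-forms to `q`-forms. -/
def dLowS {q : ℕ} (p : FormS n (q - 1)) : FormS n q := fun J x =>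
  ∑ i : Fin n,
    if h : i ∈ J.1 ∧ (J.1.erase i).card = q - 1 then
      (-1 : ℝ) ^ (J.1.filter fun j => j < i).card * pd i (p ⟨J.1.erase i, h.2⟩) x
    else 0

/-- The formal adjoint `d_{q-1}^*` mapping `q`-forms to `(q-1)`-forms. -/
def coDS {q : ℕ} (u : FormS n q) : FormS n (q - 1) := fun K x =>
  -∑ i : Fin n,
    if h : i ∉ K.1 ∧ (insert i K.1).card = q then
      (-1 : ℝ) ^ (K.1.filter fun j => j < i).card * pd i (u ⟨insert i K.1, h.2⟩) x
    else 0

/-- `d_q` on time-dependent forms. -/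
def dT {q : ℕ} (u : FormT n q) : FormT n (q + 1) := fun J t => dS (fun I => u I t) J

/-- `d_{q-1}` on time-dependent forms. -/
def dLowT {q : ℕ} (p : FormT n (q - 1)) : FormT n q := fun J t => dLowS (fun I => p I t) J

/-- `d_{q-1}^*` on time-dependent forms. -/
def coDT {q : ℕ} (u : FormT n q) : FormT n (q - 1) := fun K t => coDS (fun I => u I t) K

/-- Norm of `C^{k,𝐬(s,λ,δ)}_{T,Λ^q}`. -/
def eAnisoKSF {q : ℕ} (T : ℝ) (k s : ℕ) (lam δ : ℝ) (u : FormT n q) : ℝ≥0∞ :=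
  ∑ I : Idx n q, eAnisoKS T k s lam δ (u I)

/-- Membership in `C^{k,𝐬(s,λ,δ)}_{T,Λ^q}`. -/
def CMemF {q : ℕ} (T : ℝ) (k s : ℕ) (lam δ : ℝ) (u : FormT n q) : Prop :=
  (∀ I, AnisoReg T k s (u I)) ∧ eAnisoKSF T k s lam δ u ≠ ⊤

/-- Graph norm of `C^{k,𝐬(s,λ,δ)}_{T,Λ^q,𝒟_{d⊕d*}}`. -/
def eCD {q : ℕ} (T : ℝ) (k s : ℕ) (lam δ : ℝ) (u : FormT n q) : ℝ≥0∞ :=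
  eAnisoKSF T k s lam δ u + eAnisoKSF T k s lam (δ + 1) (dT u) +
    eAnisoKSF T k s lam (δ + 1) (coDT u)

/-- Membership in `C^{k,𝐬(s,λ,δ)}_{T,Λ^q,𝒟_{d⊕d*}}`. -/
def CMemD {q : ℕ} (T : ℝ) (k s : ℕ) (lam δ : ℝ) (u : FormT n q) : Prop :=
  CMemF T k s lam δ u ∧ CMemF T k s lam (δ + 1) (dT u) ∧ CMemF T k s lam (δ + 1) (coDT u)

/-- Norm of `𝓕^{k,𝐬(s,λ,λ',δ)}_{T,Λ^q}`. -/
def eFF {q : ℕ} (T : ℝ) (k s : ℕ) (lam lam' δ : ℝ) (u : FormT n q) : ℝ≥0∞ :=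
  ∑ I : Idx n q, eFn T k s lam lam' δ (u I)

/-- Membership in `𝓕^{k,𝐬(s,λ,λ',δ)}_{T,Λ^q}`. -/
def FMemF {q : ℕ} (T : ℝ) (k s : ℕ) (lam lam' δ : ℝ) (u : FormT n q) : Prop :=
  (∀ I, AnisoReg T (k + 1) s (u I)) ∧ eFF T k s lam lam' δ u ≠ ⊤

/-- Graph norm of `𝓕^{k,𝐬(s,λ,λ',δ)}_{T,Λ^q,𝒟_{d⊕d*}}`. -/
def eFD {q : ℕ} (T : ℝ) (k s : ℕ) (lam lam' δ : ℝ) (u : FormT n q) : ℝ≥0∞ :=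
  eFF T k s lam lam' δ u + eFF T k s lam lam' (δ + 1) (dT u) +
    eFF T k s lam lam' (δ + 1) (coDT u)

/-- Membership in `𝓕^{k,𝐬(s,λ,λ',δ)}_{T,Λ^q,𝒟_{d⊕d*}}`. -/
def FMemD {q : ℕ} (T : ℝ) (k s : ℕ) (lam lam' δ : ℝ) (u : FormT n q) : Prop :=
  FMemF T k s lam lam' δ u ∧ FMemF T k s lam lam' (δ + 1) (dT u) ∧
    FMemF T k s lam lam' (δ + 1) (coDT u)

/-- Norm of the static space `C^{s,λ,δ}_{Λ^q}`. -/
def eHolSF {q : ℕ} (s : ℕ) (lam δ : ℝ) (g : FormS n q) : ℝ≥0∞ :=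
  ∑ I : Idx n q, eHolS s lam δ (g I)

/-- Membership in the static space `C^{s,λ,δ}_{Λ^q}`. -/
def HolMemF {q : ℕ} (s : ℕ) (lam δ : ℝ) (g : FormS n q) : Prop :=
  (∀ I, ContDiff ℝ s (g I)) ∧ eHolSF s lam δ g ≠ ⊤

/-- Equality of time-dependent forms on `ℝⁿ × [0,T]`. -/
def EqOnT {q : ℕ} (T : ℝ) (u v : FormT n q) : Prop :=
  ∀ I, ∀ t ∈ Set.Icc (0 : ℝ) T, ∀ x, u I t x = v I t x

/-- The form `u` is co-closed (`d^* u = 0`) on `ℝⁿ × [0,T]`. -/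
def CoClosed {q : ℕ} (T : ℝ) (u : FormT n q) : Prop :=
  ∀ K, ∀ t ∈ Set.Icc (0 : ℝ) T, ∀ x, coDT u K t x = 0

/-- Type of the bilinear zero order operator `M₁^{(q)}`. -/
abbrev M1Type (n q : ℕ) := (Fib n (q + 1) × Fib n (q - 1)) →ₗ[ℝ] Fib n q →ₗ[ℝ] Fib n q

/-- Type of the bilinear zero order operator `M₂^{(q)}`. -/
abbrev M2Type (n q : ℕ) := Fib n q →ₗ[ℝ] Fib n q →ₗ[ℝ] Fib n (q - 1)

/-- Value of a time-dependent form at a point, as an element of the fibre. -/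
def fib {q : ℕ} (u : FormT n q) (t : ℝ) (x : Spc n) : Fib n q := fun I => u I t x

/-- Value of `(d_q ⊕ d_{q-1}^*) u` at a point. -/
def ddFib {q : ℕ} (u : FormT n q) (t : ℝ) (x : Spc n) : Fib n (q + 1) × Fib n (q - 1) :=
  (fun J => dT u J t x, fun K => coDT u K t x)

/-- The operator `W_q u = M₁((d⊕d^*)u, w) + M₁((d⊕d^*)w, u)`. -/
def Wop {q : ℕ} (M₁ : M1Type n q) (w u : FormT n q) : FormT n q := fun I t x =>
  M₁ (ddFib u t x) (fib w t x) I + M₁ (ddFib w t x) (fib u t x) I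

/-- The symmetric bilinearization `B_q(w,u)` of the nonlinearity. -/
def Bop {q : ℕ} (M₁ : M1Type n q) (M₂ : M2Type n q) (w u : FormT n q) : FormT n q :=
  fun I t x =>
    Wop M₁ w u I t x +
      dLowT (fun K t' x' =>
        M₂ (fib u t' x') (fib w t' x') K + M₂ (fib w t' x') (fib u t' x') K) I t x

/-- The nonlinearity `𝒩_q u = M₁((d⊕d^*)u, u) + d_{q-1} M₂(u,u)`. -/
def Nop {q : ℕ} (M₁ : M1Type n q) (M₂ : M2Type n q) (u : FormT n q) : FormT n q :=
  fun I t x =>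
    M₁ (ddFib u t x) (fib u t x) I +
      dLowT (fun K t' x' => M₂ (fib u t' x') (fib u t' x') K) I t x

/-- Fundamental solution of the heat operator `∂_t - μΔ`. -/
def heatKer (μ : ℝ) (x : Spc n) (t : ℝ) : ℝ :=
  if 0 < t then (4 * Real.pi * μ * t) ^ (-(n : ℝ) / 2) * Real.exp (-‖x‖ ^ 2 / (4 * μ * t))
  else 0

/-- Volume heat potential `Ψ_μ`. -/
def volPot (μ : ℝ) (f : ℝ → Spc n → ℝ) (t : ℝ) (x : Spc n) : ℝ :=
  ∫ τ in Set.Ioc (0 : ℝ) t, ∫ y : Spc n, heatKer μ (x - y) (t - τ) * f τ y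

/-- Poisson heat potential `Ψ_{μ,0}`. -/
def poisPot (μ : ℝ) (g : Spc n → ℝ) (t : ℝ) (x : Spc n) : ℝ :=
  ∫ y : Spc n, heatKer μ (x - y) t * g y

/-- Volume heat potential acting coefficient-wise on forms. -/
def volPotF {q : ℕ} (μ : ℝ) (f : FormT n q) : FormT n q := fun I => volPot μ (f I)

/-- Poisson heat potential acting coefficient-wise on forms. -/
def poisPotF {q : ℕ} (μ : ℝ) (g : FormS n q) : FormT n q := fun I => poisPot μ (g I)

/-- Area of the unit sphere in `ℝⁿ`. -/
def sphArea (n : ℕ) : ℝ := 2 * Real.pi ^ ((n : ℝ) / 2) / Real.Gamma ((n : ℝ) / 2)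

/-- Standard fundamental solution of the Laplace operator in `ℝⁿ`. -/
def lapKer (n : ℕ) (x : Spc n) : ℝ :=
  if n = 2 then (1 / Real.pi) * Real.log ‖x‖
  else ‖x‖ ^ (2 - (n : ℝ)) / (sphArea n * (2 - (n : ℝ)))

/-- Newtonian potential. -/
def newtPot (f : Spc n → ℝ) (x : Spc n) : ℝ := ∫ y : Spc n, lapKer n (x - y) * f y

/-- The integral operator `Φ_q` mapping `(q+1)`-forms to `q`-forms;
concretely `Φ_q f = -d^* (e * f)`. -/
def PhiOp {q : ℕ} (f : FormT n (q + 1)) : FormT n q := fun K t x =>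
  -coDS (n := n) (q := q + 1) (fun J y => newtPot (fun z => f J t z) y) K x

/-- Squared `L²` norm of a form at time `t`. -/
def l2Sq {q : ℕ} (u : FormT n q) (t : ℝ) : ℝ :=
  ∑ I : Idx n q, ∫ x : Spc n, (u I t x) ^ 2

/-- Squared `L²` norm of the spatial gradient of a form at time `t`. -/
def gradSq {q : ℕ} (u : FormT n q) (t : ℝ) : ℝ :=
  ∑ I : Idx n q, ∑ i : Fin n, ∫ x : Spc n, (pd i (fun y => u I t y) x) ^ 2

/-- The norm of `C^{0,𝐬(0,0,δ)}_{T,Λ^q}` (weighted sup-norm). -/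
def eSupT {q : ℕ} (T δ : ℝ) (u : FormT n q) : ℝ≥0∞ :=
  ∑ I : Idx n q,
    ⨆ (t : Set.Icc (0 : ℝ) T) (x : Spc n), ENNReal.ofReal (wt x ^ δ * |u I t x|)

/-- The norm `‖∇u‖_{C^{0,𝐬(0,0,δ)}_{T}}` of the spatial gradient. -/
def eSupGradT {q : ℕ} (T δ : ℝ) (u : FormT n q) : ℝ≥0∞ :=
  ∑ I : Idx n q, ∑ i : Fin n,
    ⨆ (t : Set.Icc (0 : ℝ) T) (x : Spc n),
      ENNReal.ofReal (wt x ^ δ * |pd i (fun y => u I t y) x|)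

/-- `q`-form with coefficients harmonic polynomials of degree at most `m`. -/
def HarmPolyForm {q : ℕ} (m : ℕ) (h : FormS n q) : Prop :=
  ∀ I, (∃ P : MvPolynomial (Fin n) ℝ, P.totalDegree ≤ m ∧
      ∀ x : Spc n, h I x = MvPolynomial.eval (fun i => x i) P) ∧
    ∀ x : Spc n, lap (h I) x = 0

/-- Classical solution of the Cauchy problem
`∂_t u - μ Δ u + extra = f` on `ℝⁿ × (0,T)`, `u(·,0) = u₀`. -/
def CauchySol {q : ℕ} (T μ : ℝ) (u extra f : FormT n q) (u₀ : FormS n q) : Prop :=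
  (∀ I, ∀ t ∈ Set.Ioo (0 : ℝ) T, ∀ x,
    deriv (fun τ => u I τ x) t - μ * lap (fun y => u I t y) x + extra I t x = f I t x) ∧
  ∀ I x, u I 0 x = u₀ I x

/-- `Ψ_{μ,q} 𝒩_q u`. -/
def NopPot {q : ℕ} (μ : ℝ) (M₁ : M1Type n q) (M₂ : M2Type n q) (u : FormT n q) : FormT n q :=
  volPotF μ (Nop M₁ M₂ u)

/-- `u + Ψ_{μ,q} 𝒩_q u`. -/
def TmapN {q : ℕ} (μ : ℝ) (M₁ : M1Type n q) (M₂ : M2Type n q) (u : FormT n q) : FormT n q :=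
  u + NopPot μ M₁ M₂ u

/-- The linearization `u + Ψ_{μ,q} B_q(v,u)`. -/
def LmapB {q : ℕ} (μ : ℝ) (M₁ : M1Type n q) (M₂ : M2Type n q) (v u : FormT n q) :
    FormT n q :=
  u + volPotF μ (Bop M₁ M₂ v u)

/-- `Φ_q d_q Ψ_{μ,q} 𝒩_q u`. -/
def PhiNpot {q : ℕ} (μ : ℝ) (M₁ : M1Type n q) (M₂ : M2Type n q) (u : FormT n q) :
    FormT n q :=
  PhiOp (dT (volPotF μ (Nop M₁ M₂ u)))

/-- `u + Φ_q d_q Ψ_{μ,q} 𝒩_q u`. -/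
def PhiNmap {q : ℕ} (μ : ℝ) (M₁ : M1Type n q) (M₂ : M2Type n q) (u : FormT n q) :
    FormT n q :=
  u + PhiNpot μ M₁ M₂ u

/-- The linearization `u + Φ_q d_q Ψ_{μ,q} B_q(v,u)`. -/
def PhiLmap {q : ℕ} (μ : ℝ) (M₁ : M1Type n q) (M₂ : M2Type n q) (v u : FormT n q) :
    FormT n q :=
  u + PhiOp (dT (volPotF μ (Bop M₁ M₂ v u)))

section

open Real
open Finset (sum_congr mul_sum sum_mul sum_nonneg sum_le_sum single_le_sum range mem_range univ
  mem_univ card_univ sum_neg_distrib sum_eq_zero sum_add_distrib sum_const sum_insert sum_comm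
  induction_on mem_insert_self mem_insert_of_mem mem_filter)
open Set (Icc Ioc Ico Ioo Ioi Iio Ioc_subset_Icc_self projIcc projIcc_of_mem uIcc uIcc_of_le
  uIoc_of_le mem_iInter Icc_subset_Icc_right)
open ENNReal (ofReal ofReal_le_ofReal ofReal_add ofReal_mul add_ne_top)
open EuclideanSpace (single proj)
variable {n : ℕ}
local notation "∇" => iteratedFDeriv ℝ
local notation "𝓕" => Spc n → ℝ
local notation "𝓣" => ℝ → Spc n → ℝ
variable {T W V C C' t θ μ a b σ B r ε : ℝ} {N M s p q : ℕ} {f g ζ : Spc n → ℝ} {u v w : FormT n q}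

section weights

lemma one_le_wt (x : Spc n) : 1 ≤ wt x := by
  rw [wt, one_le_sqrt]; nlinarith [sq_nonneg ‖x‖]

lemma wt_pos (x : Spc n) : 0 < wt x := zero_lt_one.trans_le (one_le_wt x)

lemma wt_sq (x : Spc n) : wt x ^ 2 = 1 + ‖x‖ ^ 2 := sq_sqrt (by positivity)

lemma le_of_sq_le_sq (h : a ^ 2 ≤ b ^ 2) (hb : 0 ≤ b) : a ≤ b := by nlinarith

lemma norm_le_wt (x : Spc n) : ‖x‖ ≤ wt x := by
  refine le_of_sq_le_sq ?_ (wt_pos x).le; rw [wt_sq]; linarith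

lemma wt_le (x : Spc n) : wt x ≤ 1 + ‖x‖ := by
  rw [wt, sqrt_le_left (by positivity)]; nlinarith [norm_nonneg x]

lemma wt_neg (x : Spc n) : wt (-x) = wt x := by simp [wt]

lemma wt_sub_comm (x y : Spc n) : wt (x - y) = wt (y - x) := by simp [wt, norm_sub_rev]

lemma wt_mono {x y : Spc n} (h : ‖x‖ ≤ ‖y‖) : wt x ≤ wt y :=
  sqrt_le_sqrt (by gcongr)

lemma wt_add_le (x y : Spc n) : wt (x + y) ≤ 2 * (wt x * wt y) := by
  have h2 := norm_add_le x y
  have hx := wt_pos x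
  have hy := wt_pos y
  refine le_of_sq_le_sq ?_ (by positivity)
  have h3 : ‖x + y‖ ^ 2 ≤ (‖x‖ + ‖y‖) ^ 2 := by gcongr
  rw [mul_pow, mul_pow, wt_sq, wt_sq, wt_sq]
  nlinarith [sq_nonneg (‖x‖ - ‖y‖), mul_nonneg (sq_nonneg ‖x‖) (sq_nonneg ‖y‖)]

lemma wt_rpow_le_sub (x z : Spc n) (hW : 0 ≤ W) :
    wt x ^ W ≤ 2 ^ W * wt z ^ W * wt (x - z) ^ W := by
  rw [← mul_rpow (by norm_num) (wt_pos _).le,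
    ← mul_rpow (by have := wt_pos z; positivity) (wt_pos _).le]
  apply rpow_le_rpow (wt_pos x).le _ hW
  have := wt_add_le (x - z) z
  rw [sub_add_cancel] at this
  linarith

lemma wt_rpow_pos (x : Spc n) (W : ℝ) : 0 < wt x ^ W := rpow_pos_of_pos (wt_pos x) W

lemma one_le_wt_rpow (x : Spc n) (hW : 0 ≤ W) : 1 ≤ wt x ^ W :=
  one_le_rpow (one_le_wt x) hW

lemma wt_rpow_mono (x : Spc n) (h : W ≤ V) : wt x ^ W ≤ wt x ^ V :=
  rpow_le_rpow_of_exponent_le (one_le_wt x) h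

lemma continuous_wt : Continuous (wt : 𝓕) := by unfold wt; fun_prop

lemma continuous_wt_rpow (W : ℝ) : Continuous (fun x : Spc n => wt x ^ W) :=
  continuous_wt.rpow_const fun x => Or.inl (wt_pos x).ne'

end weights

/-- Weighted `C^N` functions, with decay rate improving by one for each derivative. -/
def GX (N : ℕ) (W C : ℝ) (f : 𝓕) : Prop :=
  ContDiff ℝ N f ∧ ∀ m ≤ N, ∀ x, wt x ^ (W + m) * ‖∇ m f x‖ ≤ C

namespace GX

lemma nonneg (h : GX N W C f) : 0 ≤ C :=
  (mul_nonneg (wt_rpow_pos 0 _).le (norm_nonneg _)).trans (h.2 0 (Nat.zero_le _) 0)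

lemma cont (h : GX N W C f) : Continuous f := h.1.continuous

lemma mono (h : GX N W C f) (hC : C ≤ C') : GX N W C' f :=
  ⟨h.1, fun m hm x => (h.2 m hm x).trans hC⟩

lemma mono_N (h : GX N W C f) (hM : M ≤ N) : GX M W C f :=
  ⟨h.1.of_le (by exact_mod_cast hM), fun m hm x => h.2 m (hm.trans hM) x⟩

lemma mono_W (h : GX N W C f) (hV : V ≤ W) : GX N V C f :=
  ⟨h.1, fun m hm x => (mul_le_mul_of_nonneg_right (wt_rpow_mono x (by linarith))
    (norm_nonneg _)).trans (h.2 m hm x)⟩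

lemma abs_le (h : GX N W C f) (x : Spc n) : wt x ^ W * |f x| ≤ C := by
  simpa using h.2 0 (Nat.zero_le _) x

lemma norm_le (h : GX N W C f) {m : ℕ} (hm : m ≤ N) (x : Spc n) :
    ‖∇ m f x‖ ≤ C * wt x ^ (-(W + m)) := by
  rw [rpow_neg (wt_pos x).le, ← div_eq_mul_inv, le_div_iff₀ (wt_rpow_pos x _), mul_comm]
  exact h.2 m hm x

lemma abs_le' (h : GX N W C f) (x : Spc n) : |f x| ≤ C * wt x ^ (-W) := by
  simpa using h.norm_le (Nat.zero_le _) x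

lemma abs_le_const (h : GX N W C f) (hW : 0 ≤ W) (x : Spc n) : |f x| ≤ C :=
  (le_mul_of_one_le_left (abs_nonneg _) (one_le_wt_rpow x hW)).trans (h.abs_le x)

lemma norm_le_const (h : GX N W C f) (hW : 0 ≤ W) {m : ℕ} (hm : m ≤ N) (x : Spc n) :
    ‖∇ m f x‖ ≤ C :=
  (le_mul_of_one_le_left (norm_nonneg _) (one_le_wt_rpow x (by positivity))).trans (h.2 m hm x)

lemma zero : GX N W 0 (fun _ : Spc n => (0 : ℝ)) :=
  ⟨contDiff_const, fun m _ x => by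
    have : ∇ m (fun _ : Spc n => (0 : ℝ)) = 0 := iteratedFDeriv_fun_zero
    simp [this]⟩

lemma contDiffAt (h : GX N W C f) {m : ℕ} (hm : m ≤ N) (x : Spc n) : ContDiffAt ℝ m f x :=
  (h.1.of_le (by exact_mod_cast hm)).contDiffAt

lemma add (hf : GX N W C f) (hg : GX N W C' g) : GX N W (C + C') (fun x => f x + g x) := by
  refine ⟨hf.1.add hg.1, fun m hm x => ?_⟩
  rw [fun_iteratedFDeriv_add_apply (hf.contDiffAt hm x) (hg.contDiffAt hm x)]
  have := norm_add_le (∇ m f x) (∇ m g x)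
  nlinarith [hf.2 m hm x, hg.2 m hm x, wt_rpow_pos x (W + m)]

lemma smul (hf : GX N W C f) (c : ℝ) : GX N W (|c| * C) (fun x => c * f x) := by
  refine ⟨contDiff_const.mul hf.1, fun m hm x => ?_⟩
  have : ∇ m (fun x => c * f x) x = c • ∇ m f x :=
    iteratedFDeriv_const_smul_apply (a := c) (hf.contDiffAt hm x)
  rw [this, norm_smul, norm_eq_abs]
  nlinarith [hf.2 m hm x, abs_nonneg c]

lemma neg (hf : GX N W C f) : GX N W C (fun x => -f x) := by simpa using hf.smul (-1)

lemma sub (hf : GX N W C f) (hg : GX N W C' g) : GX N W (C + C') (fun x => f x - g x) := by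
  simpa [sub_eq_add_neg] using hf.add hg.neg

lemma sum {ι : Type*} (s : Finset ι) {F : ι → 𝓕} {c : ι → ℝ}
    (h : ∀ i ∈ s, GX N W (c i) (F i)) : GX N W (∑ i ∈ s, c i) (fun x => ∑ i ∈ s, F i x) := by
  induction s using induction_on with
  | empty => simpa using zero
  | insert a s ha ih =>
    simp only [sum_insert ha]
    exact (h a (by simp)).add (ih fun i hi => h i (by simp [hi]))

lemma mul (hf : GX N W C f) (hg : GX N V C' g) :
    GX N (W + V) (2 ^ N * (C * C')) (fun x => f x * g x) := by
  refine ⟨hf.1.mul hg.1, fun m hm x => ?_⟩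
  have h := norm_iteratedFDeriv_mul_le hf.1 hg.1 x (n := m) (by exact_mod_cast hm)
  have hC := hf.nonneg
  have hC' := hg.nonneg
  calc wt x ^ (W + V + m) * ‖∇ m (fun x => f x * g x) x‖
      ≤ wt x ^ (W + V + m) * ∑ i ∈ range (m + 1), (m.choose i : ℝ) *
        ‖∇ i f x‖ * ‖∇ (m - i) g x‖ :=
        mul_le_mul_of_nonneg_left h (wt_rpow_pos _ _).le
    _ ≤ ∑ i ∈ range (m + 1), (m.choose i : ℝ) * (C * C') := by
        rw [mul_sum]
        apply sum_le_sum
        intro i hi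
        have hi' : i ≤ m := by simpa [Nat.lt_succ_iff] using hi
        have e : wt x ^ (W + V + m) = wt x ^ (W + i) * wt x ^ (V + (m - i : ℕ)) := by
          rw [← rpow_add (wt_pos x)]; congr 1; push_cast [hi']; ring
        rw [e]
        have h1 := hf.2 i (hi'.trans hm) x
        have h2 := hg.2 (m - i) ((Nat.sub_le _ _).trans hm) x
        calc _ = (m.choose i : ℝ) * ((wt x ^ (W + i) * ‖∇ i f x‖) *
              (wt x ^ (V + (m - i : ℕ)) * ‖∇ (m - i) g x‖)) := by ring
          _ ≤ _ := by
            gcongr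
            exact mul_nonneg (wt_rpow_pos _ _).le (norm_nonneg _)
    _ = 2 ^ m * (C * C') := by
        rw [← sum_mul, ← Nat.cast_sum, Nat.sum_range_choose]; simp
    _ ≤ _ := by gcongr; norm_num

lemma pd (hf : GX (N + 1) W C f) (i : Fin n) : GX N (W + 1) C (pd i f) := by
  have hd : ContDiff ℝ N (fderiv ℝ f) := hf.1.fderiv_right (by norm_cast)
  refine ⟨hd.clm_apply contDiff_const, fun m hm x => ?_⟩
  have h1 := norm_iteratedFDeriv_clm_apply_const (𝕜 := ℝ) (f := fderiv ℝ f) (x := x) (n := m)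
    (c := single i (1 : ℝ)) (N := N) hd.contDiffAt (by exact_mod_cast hm)
  rw [norm_iteratedFDeriv_fderiv] at h1
  simp only [PiLp.norm_single, norm_one, one_mul] at h1
  refine (mul_le_mul_of_nonneg_left h1 (wt_rpow_pos _ _).le).trans ?_
  have := hf.2 (m + 1) (by omega) x
  push_cast at this
  rwa [show W + 1 + m = W + (m + 1) by ring]

end GX

lemma fderiv_eq_sum_pd (x : Spc n) :
    fderiv ℝ f x = ∑ i, pd i f x • (proj i : Spc n →L[ℝ] ℝ) := by
  ext v
  conv_lhs => rw [show v = ∑ i, v i • single i (1 : ℝ) by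
    ext j; simp [Finset.sum_apply, Pi.single_apply]]
  simp [pd, mul_comm]

lemma norm_proj_le (i : Fin n) : ‖(proj i : Spc n →L[ℝ] ℝ)‖ ≤ 1 :=
  ContinuousLinearMap.opNorm_le_bound _ zero_le_one fun x => by
    simpa using PiLp.norm_apply_le x i

lemma GX.succ (hf : Differentiable ℝ f)
    (h0 : ∀ x, wt x ^ W * |f x| ≤ C) (h : ∀ i, GX N (W + 1) C (NSdeRham.pd i f)) :
    GX (N + 1) W ((n + 1) * C) f := by
  have hC : 0 ≤ C := (mul_nonneg (wt_rpow_pos (0 : Spc n) W).le (abs_nonneg _)).trans (h0 0)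
  have hs : ∀ i, ContDiff ℝ N
      (fun x => NSdeRham.pd i f x • (proj i : Spc n →L[ℝ] ℝ)) :=
    fun i => (h i).1.smul contDiff_const
  have e : fderiv ℝ f = fun x => ∑ i, NSdeRham.pd i f x • (proj i : Spc n →L[ℝ] ℝ) :=
    funext fun x => fderiv_eq_sum_pd x
  have hd : ContDiff ℝ N (fderiv ℝ f) := by
    rw [e]; exact ContDiff.sum fun i _ => hs i
  refine ⟨by push_cast; exact contDiff_succ_iff_fderiv.2 ⟨hf, by simp, hd⟩, fun m hm x => ?_⟩
  rcases m with _ | m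
  · simp only [CharP.cast_eq_zero, add_zero, norm_iteratedFDeriv_zero, norm_eq_abs]
    nlinarith [h0 x, (Nat.cast_nonneg n : (0 : ℝ) ≤ n)]
  · have hm' : m ≤ N := by omega
    rw [← norm_iteratedFDeriv_fderiv, e, iteratedFDeriv_fun_sum_apply fun i _ =>
      ((hs i).of_le (by exact_mod_cast hm')).contDiffAt]
    have key : ∀ i, wt x ^ (W + (m + 1 : ℕ)) * ‖∇ m
        (fun x => NSdeRham.pd i f x • (proj i : Spc n →L[ℝ] ℝ)) x‖ ≤ C := by
      intro i
      have h2 := (h i).2 m hm' x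
      have h3 := ContinuousLinearMap.norm_iteratedFDeriv_comp_left
        (𝕜 := ℝ) (((1 : ℝ →L[ℝ] ℝ)).smulRight (proj i : Spc n →L[ℝ] ℝ))
        (f := NSdeRham.pd i f) (x := x) (n := m) (N := N) (h i).1.contDiffAt (by exact_mod_cast hm')
      have h4 : ‖((1 : ℝ →L[ℝ] ℝ)).smulRight (proj i : Spc n →L[ℝ] ℝ)‖ ≤ 1 := by
        rw [ContinuousLinearMap.norm_smulRight_apply]
        simpa using norm_proj_le i
      have h5 : ‖∇ m
        (fun x => NSdeRham.pd i f x • (proj i : Spc n →L[ℝ] ℝ)) x‖ ≤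
          ‖∇ m (NSdeRham.pd i f) x‖ :=
        h3.trans (by nlinarith [norm_nonneg (∇ m (NSdeRham.pd i f) x)])
      refine (mul_le_mul_of_nonneg_left h5 (wt_rpow_pos _ _).le).trans ?_
      push_cast
      rwa [show W + (m + 1 : ℝ) = W + 1 + m by ring]
    calc _ ≤ wt x ^ (W + (m + 1 : ℕ)) * ∑ i, ‖∇ m
            (fun x => NSdeRham.pd i f x • (proj i : Spc n →L[ℝ] ℝ)) x‖ :=
          mul_le_mul_of_nonneg_left (norm_sum_le _ _) (wt_rpow_pos _ _).le
      _ ≤ ∑ _i : Fin n, C := by rw [mul_sum]; exact sum_le_sum fun i _ => key i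
      _ ≤ _ := by simp; nlinarith

lemma GX.of_pd (hf : GX 1 W C f)
    (h : ∀ i, GX N (W + 1) C (NSdeRham.pd i f)) : GX (N + 1) W ((n + 1) * C) f :=
  GX.succ (hf.1.differentiable (by norm_num)) hf.abs_le h

lemma iteratedFDeriv_translate (m : ℕ) (z x : Spc n) :
    ∇ m (fun x => f (x - z)) x = ∇ m f (x - z) := by
  have := iteratedFDeriv_comp_add_right (𝕜 := ℝ) (f := f) m (-z) x
  simpa [sub_eq_add_neg] using this

lemma GX.translate (hW : 0 ≤ W) (hf : GX N W C f) (z : Spc n) :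
    GX N W (2 ^ (W + N) * wt z ^ (W + N) * C) (fun x => f (x - z)) := by
  refine ⟨hf.1.comp (contDiff_id.sub contDiff_const), fun m hm x => ?_⟩
  rw [iteratedFDeriv_translate]
  have hm' : (m : ℝ) ≤ N := by exact_mod_cast hm
  calc _ ≤ (2 ^ (W + m) * wt z ^ (W + m) * wt (x - z) ^ (W + m)) *
        ‖∇ m f (x - z)‖ := by
        gcongr; exact wt_rpow_le_sub x z (by positivity)
    _ = (2 ^ (W + m) * wt z ^ (W + m)) * (wt (x - z) ^ (W + m) *
        ‖∇ m f (x - z)‖) := by ring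
    _ ≤ _ := by
      have := wt_pos z
      gcongr
      · have := wt_pos (x - z); positivity
      · norm_num
      · exact one_le_wt z
      · exact hf.2 m hm _

lemma integral_clm_apply_of_bound {Ω H E : Type*} [MeasurableSpace Ω] {ν : Measure Ω}
    [NormedAddCommGroup H] [NormedSpace ℝ H] [NormedAddCommGroup E] [NormedSpace ℝ E]
    {F : Ω → H →L[ℝ] E} {c : Ω → ℝ} (hm : AEStronglyMeasurable F ν)
    (hb : ∀ᵐ ω ∂ν, ‖F ω‖ ≤ c ω) (hc : Integrable c ν) :
    (∀ v, (∫ ω, F ω ∂ν) v = ∫ ω, F ω v ∂ν) ∧ ∀ v, Integrable (fun ω => F ω v) ν := by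
  have hi := hc.mono' hm hb
  exact ⟨fun v => ContinuousLinearMap.integral_apply hi v,
    fun v => hi.apply_continuousLinearMap v⟩

/-- A parameter integral of weighted functions is a weighted function. -/
lemma GX.integral {Ω : Type*} [MeasurableSpace Ω] {ν : Measure Ω} (hW : 0 ≤ W)
    {F : Ω → 𝓕} {c : Ω → ℝ} (hF : ∀ᵐ ω ∂ν, GX N W (c ω) (F ω)) (hc : Integrable c ν)
    (hm : ∀ m ≤ N, ∀ x, AEStronglyMeasurable (fun ω => ∇ m (F ω) x) ν) :
    GX N W (∫ ω, c ω ∂ν) (fun x => ∫ ω, F ω x ∂ν) ∧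
    ∀ m ≤ N, ∀ x, ∇ m (fun x => ∫ ω, F ω x ∂ν) x =
      ∫ ω, ∇ m (F ω) x ∂ν := by
  have hint : ∀ m ≤ N, ∀ x, Integrable (fun ω => ∇ m (F ω) x) ν := fun m h x =>
    hc.mono' (hm m h x) (hF.mono fun ω hω => hω.norm_le_const hW h x)
  have hT : HasFTaylorSeriesUpTo N (fun x => ∫ ω, F ω x ∂ν)
      (fun x m => ∫ ω, ∇ m (F ω) x ∂ν) := by
    refine ⟨fun x => ?_, fun m hmN x => ?_, fun m hmN => ?_⟩
    · rw [ContinuousMultilinearMap.curry0]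
      have := ContinuousMultilinearMap.integral_apply (hint 0 (Nat.zero_le _) x) 0
      simpa using this
    · have hmN' : m + 1 ≤ N := by exact_mod_cast hmN
      have hms : AEStronglyMeasurable (fun ω => fderiv ℝ (∇ m (F ω)) x) ν := by
        have h1 := (continuousMultilinearCurryLeftEquiv ℝ (fun _ : Fin (m + 1) => Spc n)
          ℝ).continuous.comp_aestronglyMeasurable (hm (m + 1) hmN' x)
        refine h1.congr (Eventually.of_forall fun ω => ?_)
        simp [iteratedFDeriv_succ_eq_comp_left]
      have e : (∫ ω, ∇ (m + 1) (F ω) x ∂ν).curryLeft =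
          ∫ ω, fderiv ℝ (∇ m (F ω)) x ∂ν := by
        have hb : ∀ᵐ ω ∂ν, ‖fderiv ℝ (∇ m (F ω)) x‖ ≤ c ω := hF.mono fun ω hω => by
          rw [norm_fderiv_iteratedFDeriv]; exact hω.norm_le_const hW hmN' x
        obtain ⟨h1, h2⟩ := integral_clm_apply_of_bound hms hb hc
        ext v w
        rw [h1 v, ContinuousMultilinearMap.integral_apply
          (h2 v), ContinuousMultilinearMap.curryLeft_apply,
          ContinuousMultilinearMap.integral_apply (hint (m + 1) hmN' x)]
        refine integral_congr_ae (Eventually.of_forall fun ω => ?_)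
        simp [iteratedFDeriv_succ_apply_left]
      change HasFDerivAt _ (∫ ω, ∇ (m + 1) (F ω) x ∂ν).curryLeft x
      rw [e]
      refine hasFDerivAt_integral_of_dominated_of_fderiv_le (bound := c) (s := Set.univ)
        (F' := fun y ω => fderiv ℝ (∇ m (F ω)) y)
        univ_mem (Eventually.of_forall fun y => hm m (by omega) y) (hint m (by omega) x)
        ?_ ?_ hc ?_
      · exact hms
      · refine hF.mono fun ω hω y _ => ?_
        rw [norm_fderiv_iteratedFDeriv]
        exact hω.norm_le_const hW hmN' y
      · refine hF.mono fun ω hω y _ => ?_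
        exact ((hω.1.differentiable_iteratedFDeriv
          (m := m) (by exact_mod_cast hmN)) y).hasFDerivAt
    · have hmN' : m ≤ N := by exact_mod_cast hmN
      refine continuous_of_dominated (fun x => hm m hmN' x)
        (fun x => hF.mono fun ω hω => hω.norm_le_const hW hmN' x) hc
        (hF.mono fun ω hω => hω.1.continuous_iteratedFDeriv (by exact_mod_cast hmN'))
  have heq : ∀ m ≤ N, ∀ x, ∇ m (fun x => ∫ ω, F ω x ∂ν) x =
      ∫ ω, ∇ m (F ω) x ∂ν := fun m h x =>
    (hT.eq_iteratedFDeriv (by exact_mod_cast h) x).symm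
  refine ⟨⟨hT.contDiff, fun m h x => ?_⟩, heq⟩
  rw [heq m h x]
  calc _ ≤ wt x ^ (W + m) * ∫ ω, ‖∇ m (F ω) x‖ ∂ν :=
        mul_le_mul_of_nonneg_left (norm_integral_le_integral_norm _) (wt_rpow_pos _ _).le
    _ = ∫ ω, wt x ^ (W + m) * ‖∇ m (F ω) x‖ ∂ν := (integral_const_mul _ _).symm
    _ ≤ _ := integral_mono_ae ((hint m h x).norm.const_mul _) hc
        (hF.mono fun ω hω => hω.2 m h x)

/-- Joint continuity on `[0,T] × ℝⁿ` of all spatial derivatives up to order `N`. -/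
def SCt (T : ℝ) (N : ℕ) (f : 𝓣) : Prop :=
  ∀ m ≤ N, ContinuousOn (fun p : ℝ × Spc n => ∇ m (f p.1) p.2)
    (Icc 0 T ×ˢ Set.univ)

/-- Uniform weighted bounds on `[0,T] × ℝⁿ`, with joint continuity. -/
def SG (T : ℝ) (W C : ℝ) (N : ℕ) (f : 𝓣) : Prop :=
  (∀ t ∈ Icc 0 T, GX N W C (f t)) ∧ SCt T N f

/-- `g` is the time derivative of `f` on `[0,T]`, in integrated form. -/
def TD (T : ℝ) (f g : 𝓣) : Prop :=
  ∀ t ∈ Icc 0 T, ∀ x, f t x = f 0 x + ∫ τ in (0 : ℝ)..t, g τ x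

/-- Parabolic regularity scale built from a class `B`: the `j`-th time derivative of `f`
lies in `B (2 (s - j) + p)`. -/
def TGen (T : ℝ) (B : ℕ → (𝓣) → Prop) : ℕ → ℕ → (𝓣) → Prop
  | 0, p, f => B p f
  | s + 1, p, f => B (2 * (s + 1) + p) f ∧ ∃ g, TD T f g ∧ TGen T B s p g

section SCt

variable {f g : ℝ → Spc n → ℝ}

lemma SCt.mono_N (h : SCt T N f) (hM : M ≤ N) : SCt T M f :=
  fun m hm => h m (hm.trans hM)

lemma SCt.zero_cont (h : SCt T N f) :
    ContinuousOn (fun p : ℝ × Spc n => f p.1 p.2) (Icc 0 T ×ˢ Set.univ) := by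
  have h0 := h 0 (Nat.zero_le _)
  have := (continuousMultilinearCurryFin0 ℝ (Spc n) ℝ).continuous.comp_continuousOn h0
  exact this.congr fun p _ => by simp

lemma SCt.of_cont
    (h : ContinuousOn (fun p : ℝ × Spc n => f p.1 p.2) (Icc 0 T ×ˢ Set.univ)) :
    SCt T 0 f := by
  intro m hm
  obtain rfl : m = 0 := by omega
  exact (continuousMultilinearCurryFin0 ℝ (Spc n) ℝ).symm.continuous.comp_continuousOn h

lemma SCt.congr (h : SCt T N f) (e : ∀ t ∈ Icc 0 T, ∀ x, g t x = f t x) : SCt T N g :=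
  fun m hm => (h m hm).congr fun p hp => by rw [show g p.1 = f p.1 from funext (e p.1 hp.1)]

lemma SCt.pd (hs : ∀ t ∈ Icc 0 T, ContDiff ℝ (N + 1) (f t)) (h : SCt T (N + 1) f) (i : Fin n) :
    SCt T N (fun t => pd i (f t)) := by
  intro m hm
  have h1 := h (m + 1) (by omega)
  let L : (Spc n →L[ℝ] ℝ) →L[ℝ] ℝ := ContinuousLinearMap.apply ℝ ℝ (single i 1)
  have e : ∀ p ∈ Icc 0 T ×ˢ (Set.univ : Set (Spc n)),
      ∇ m (NSdeRham.pd i (f p.1)) p.2 =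
      L.compContinuousMultilinearMap (continuousMultilinearCurryRightEquiv' ℝ m (Spc n) ℝ
        (∇ (m + 1) (f p.1) p.2)) := by
    intro p hp
    have hd : ContDiff ℝ N (fderiv ℝ (f p.1)) := (hs p.1 hp.1).fderiv_right le_rfl
    have := L.iteratedFDeriv_comp_left (f := fderiv ℝ (f p.1)) (x := p.2) hd.contDiffAt
      (i := m) (by exact_mod_cast hm)
    refine Eq.trans this ?_
    rw [iteratedFDeriv_succ_eq_comp_right]
    simp
  refine ContinuousOn.congr ?_ e
  exact (ContinuousLinearMap.compContinuousMultilinearMapL ℝ (fun _ : Fin m => Spc n) _ _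
    L).continuous.comp_continuousOn
    ((continuousMultilinearCurryRightEquiv' ℝ m (Spc n) ℝ).continuous.comp_continuousOn h1)

lemma SCt.of_pd (hs : ∀ t ∈ Icc 0 T, ContDiff ℝ (N + 1) (f t)) (h0 : SCt T 0 f)
    (h : ∀ i, SCt T N (fun t => NSdeRham.pd i (f t))) : SCt T (N + 1) f := by
  intro m hm
  rcases m with _ | m
  · exact h0 0 le_rfl
  have hm' : m ≤ N := by omega
  let L : Fin n → (ℝ →L[ℝ] (Spc n →L[ℝ] ℝ)) := fun i =>
    (1 : ℝ →L[ℝ] ℝ).smulRight (proj i : Spc n →L[ℝ] ℝ)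
  have e : ∀ p ∈ Icc 0 T ×ˢ (Set.univ : Set (Spc n)),
      ∇ (m + 1) (f p.1) p.2 =
      (continuousMultilinearCurryRightEquiv' ℝ m (Spc n) ℝ).symm (∑ i,
      (L i).compContinuousMultilinearMap (∇ m (NSdeRham.pd i (f p.1)) p.2)) := by
    intro p hp
    have hd : ∀ i, ContDiff ℝ N (NSdeRham.pd i (f p.1)) := fun i =>
      ((hs p.1 hp.1).fderiv_right le_rfl).clm_apply contDiff_const
    rw [iteratedFDeriv_succ_eq_comp_right]
    change (continuousMultilinearCurryRightEquiv' ℝ m (Spc n) ℝ).symm _ = _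
    congr 1
    have e1 : fderiv ℝ (f p.1) = fun x => ∑ i, (L i ∘ NSdeRham.pd i (f p.1)) x := by
      funext x; rw [fderiv_eq_sum_pd]; simp [L]
    rw [e1, iteratedFDeriv_fun_sum_apply fun i _ =>
      (((L i).contDiff.comp (hd i)).of_le (by exact_mod_cast hm')).contDiffAt]
    refine sum_congr rfl fun i _ => ?_
    exact (L i).iteratedFDeriv_comp_left (hd i).contDiffAt (by exact_mod_cast hm')
  refine ContinuousOn.congr ?_ e
  refine (continuousMultilinearCurryRightEquiv' ℝ m (Spc n) ℝ).symm.continuous.comp_continuousOn ?_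
  refine continuousOn_finsetSum _ fun i _ => ?_
  exact (ContinuousLinearMap.compContinuousMultilinearMapL ℝ (fun _ : Fin m => Spc n) _ _
    (L i)).continuous.comp_continuousOn (h i m hm')

lemma SCt.add (hf : ∀ t ∈ Icc 0 T, ContDiff ℝ N (f t)) (hg : ∀ t ∈ Icc 0 T, ContDiff ℝ N (g t))
    (h : SCt T N f) (h' : SCt T N g) : SCt T N (fun t x => f t x + g t x) := fun m hm =>
  ((h m hm).add (h' m hm)).congr fun p hp => fun_iteratedFDeriv_add_apply
    ((hf p.1 hp.1).of_le (by exact_mod_cast hm)).contDiffAt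
    ((hg p.1 hp.1).of_le (by exact_mod_cast hm)).contDiffAt

lemma SCt.smul (hf : ∀ t ∈ Icc 0 T, ContDiff ℝ N (f t)) (h : SCt T N f) (c : ℝ) :
    SCt T N (fun t x => c * f t x) := fun m hm =>
  ((h m hm).const_smul c).congr fun p hp => iteratedFDeriv_const_smul_apply (a := c)
    ((hf p.1 hp.1).of_le (by exact_mod_cast hm)).contDiffAt

lemma pd_mul {f g : 𝓕} {x : Spc n} (hf : DifferentiableAt ℝ f x)
    (hg : DifferentiableAt ℝ g x) (i : Fin n) :
    pd i (fun x => f x * g x) x = pd i f x * g x + f x * pd i g x := by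
  simp only [pd]; rw [fderiv_fun_mul hf hg]; simp; ring

lemma contDiff_pd {f : 𝓕} (h : ContDiff ℝ (N + 1) f) (i : Fin n) : ContDiff ℝ N (pd i f) :=
  (h.fderiv_right le_rfl).clm_apply contDiff_const

lemma SCt.mul (hf : ∀ t ∈ Icc 0 T, ContDiff ℝ N (f t)) (hg : ∀ t ∈ Icc 0 T, ContDiff ℝ N (g t))
    (h : SCt T N f) (h' : SCt T N g) : SCt T N (fun t x => f t x * g t x) := by
  induction N generalizing f g with
  | zero => exact SCt.of_cont (h.zero_cont.mul h'.zero_cont)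
  | succ N ih =>
    push_cast at hf hg
    have le : (N : WithTop ℕ∞) ≤ N + 1 := by exact_mod_cast Nat.le_succ N
    refine SCt.of_pd (fun t ht => (hf t ht).mul (hg t ht))
      (SCt.of_cont (h.zero_cont.mul h'.zero_cont)) fun i => ?_
    have h1 := ih (fun t ht => contDiff_pd (hf t ht) i) (fun t ht => (hg t ht).of_le le)
      (h.pd hf i) (h'.mono_N N.le_succ)
    have h2 := ih (fun t ht => (hf t ht).of_le le) (fun t ht => contDiff_pd (hg t ht) i)
      (h.mono_N N.le_succ) (h'.pd hg i)
    refine (SCt.add (fun t ht => ?_) (fun t ht => ?_) h1 h2).congr fun t ht x => ?_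
    · exact (contDiff_pd (hf t ht) i).mul ((hg t ht).of_le le)
    · exact ((hf t ht).of_le le).mul (contDiff_pd (hg t ht) i)
    · exact pd_mul (((hf t ht).differentiable (by simp)) x)
        (((hg t ht).differentiable (by simp)) x) i

end SCt

section SG

variable {f g : ℝ → Spc n → ℝ}

lemma SG.contDiff (h : SG T W C N f) : ∀ t ∈ Icc 0 T, ContDiff ℝ N (f t) :=
  fun t ht => (h.1 t ht).1

lemma SG.mono (h : SG T W C N f) (hC : C ≤ C') : SG T W C' N f :=
  ⟨fun t ht => (h.1 t ht).mono hC, h.2⟩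

lemma SG.mono_N (h : SG T W C N f) (hM : M ≤ N) : SG T W C M f :=
  ⟨fun t ht => (h.1 t ht).mono_N hM, h.2.mono_N hM⟩

lemma SG.mono_W (h : SG T W C N f) (hV : V ≤ W) : SG T V C N f :=
  ⟨fun t ht => (h.1 t ht).mono_W hV, h.2⟩

lemma SG.add (h : SG T W C N f) (h' : SG T W C' N g) :
    SG T W (C + C') N (fun t x => f t x + g t x) :=
  ⟨fun t ht => (h.1 t ht).add (h'.1 t ht), h.2.add h.contDiff h'.contDiff h'.2⟩

lemma SG.smul (h : SG T W C N f) (c : ℝ) : SG T W (|c| * C) N (fun t x => c * f t x) :=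
  ⟨fun t ht => (h.1 t ht).smul c, h.2.smul h.contDiff c⟩

lemma SG.mul (h : SG T W C N f) (h' : SG T V C' N g) :
    SG T (W + V) (2 ^ N * (C * C')) N (fun t x => f t x * g t x) :=
  ⟨fun t ht => (h.1 t ht).mul (h'.1 t ht), h.2.mul h.contDiff h'.contDiff h'.2⟩

lemma SG.pd (h : SG T W C (N + 1) f) (i : Fin n) : SG T (W + 1) C N (fun t => pd i (f t)) :=
  ⟨fun t ht => (h.1 t ht).pd i, h.2.pd (by simpa using h.contDiff) i⟩

lemma SG.congr (h : SG T W C N f) (e : ∀ t ∈ Icc 0 T, ∀ x, g t x = f t x) : SG T W C N g :=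
  ⟨fun t ht => by rw [show g t = f t from funext (e t ht)]; exact h.1 t ht, h.2.congr e⟩

lemma SG.zero : SG T W 0 N (fun _ (_ : Spc n) => (0 : ℝ)) := ⟨fun _ _ => GX.zero, fun m hm => by
  have : ∀ p : ℝ × Spc n, ∇ m (fun _ : Spc n => (0 : ℝ)) p.2 = 0 := fun p => by
    rw [show ∇ m (fun _ : Spc n => (0 : ℝ)) = 0 from iteratedFDeriv_fun_zero]; rfl
  simp only [this]; exact continuousOn_const⟩

end SG

/-- Spatially continuous families which depend uniformly on time are jointly continuous. -/
lemma SCt.of_holder {f : 𝓣} (hW : 0 ≤ W) (ha : 0 < a)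
    (hf : ∀ t ∈ Icc 0 T, ContDiff ℝ N (f t))
    (h : ∀ t ∈ Icc 0 T, ∀ t' ∈ Icc 0 T,
      GX N W (C * |t - t'| ^ a) (fun x => f t x - f t' x)) : SCt T N f := by
  rintro m hm ⟨t₀, x₀⟩ ⟨ht₀, -⟩
  simp only at ht₀
  have c1 : Tendsto (fun p : ℝ × Spc n => C * |p.1 - t₀| ^ a +
      ‖∇ m (f t₀) p.2 - ∇ m (f t₀) x₀‖) (nhds (t₀, x₀)) (nhds 0) := by
    have hc : Continuous (∇ m (f t₀)) :=
      (hf t₀ ht₀).continuous_iteratedFDeriv (by exact_mod_cast hm)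
    have : Continuous (fun p : ℝ × Spc n => C * |p.1 - t₀| ^ a +
      ‖∇ m (f t₀) p.2 - ∇ m (f t₀) x₀‖) := by
      refine Continuous.add (continuous_const.mul ?_) (by fun_prop)
      exact Continuous.rpow_const (by fun_prop) fun _ => Or.inr ha.le
    simpa [zero_rpow ha.ne'] using this.tendsto (t₀, x₀)
  rw [ContinuousWithinAt, tendsto_iff_norm_sub_tendsto_zero]
  refine squeeze_zero' (Eventually.of_forall fun _ => norm_nonneg _) ?_
    (c1.mono_left nhdsWithin_le_nhds)
  filter_upwards [self_mem_nhdsWithin] with p hp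
  have h1 := (h p.1 hp.1 t₀ ht₀).norm_le_const hW hm p.2
  rw [fun_iteratedFDeriv_sub_apply ((hf p.1 hp.1).of_le (by exact_mod_cast hm)).contDiffAt
    ((hf t₀ ht₀).of_le (by exact_mod_cast hm)).contDiffAt] at h1
  calc _ ≤ ‖∇ m (f p.1) p.2 - ∇ m (f t₀) p.2‖ + _ :=
        norm_sub_le_norm_sub_add_norm_sub _ _ _
    _ ≤ _ := by gcongr

/-- Composition with a measurable parametrization of a family which is jointly continuous on
`[0,T] × ℝⁿ`. -/
lemma aesm_comp_of_continuousOn (hT : 0 ≤ T) {E Ω : Type*} [MeasurableSpace Ω]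
    {ν : Measure Ω} [TopologicalSpace E] [TopologicalSpace.PseudoMetrizableSpace E]
    {F : ℝ × Spc n → E} (hF : ContinuousOn F (Icc 0 T ×ˢ Set.univ))
    {τ : Ω → ℝ} {z : Ω → Spc n} (hτ : AEMeasurable τ ν) (hz : AEMeasurable z ν)
    (hτI : ∀ᵐ ω ∂ν, τ ω ∈ Icc 0 T) : AEStronglyMeasurable (fun ω => F (τ ω, z ω)) ν := by
  have hc : Continuous (fun p : ℝ × Spc n => F ((projIcc 0 T hT p.1 : ℝ), p.2)) :=
    hF.comp_continuous (by fun_prop) fun p => ⟨(projIcc 0 T hT p.1).2, trivial⟩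
  refine (hc.comp_aestronglyMeasurable (hτ.prodMk hz).aestronglyMeasurable).congr ?_
  filter_upwards [hτI] with ω h
  simp [projIcc_of_mem hT h]

lemma conv_GX {Ω : Type*} [MeasurableSpace Ω] {ν : Measure Ω} (hT : 0 ≤ T)
    (hW : 0 ≤ W) {K : Ω → ℝ} {τ : Ω → ℝ} {z : Ω → Spc n} {c : ℝ → ℝ}
    (hK : AEStronglyMeasurable K ν) (hτ : AEMeasurable τ ν) (hz : AEMeasurable z ν)
    (hτI : ∀ᵐ ω ∂ν, τ ω ∈ Icc 0 T) {f : 𝓣}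
    (hf : ∀ t ∈ Icc 0 T, GX N W (c t) (f t)) (hfc : SCt T N f)
    (hint : Integrable (fun ω => |K ω| * wt (z ω) ^ (W + N) * c (τ ω)) ν) :
    GX N W (2 ^ (W + N) * ∫ ω, |K ω| * wt (z ω) ^ (W + N) * c (τ ω) ∂ν)
      (fun x => ∫ ω, K ω * f (τ ω) (x - z ω) ∂ν) ∧
    (∀ x, Integrable (fun ω => K ω * f (τ ω) (x - z ω)) ν) ∧
    ∀ m ≤ N, ∀ x, ∇ m (fun x => ∫ ω, K ω * f (τ ω) (x - z ω) ∂ν) x =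
      ∫ ω, K ω • ∇ m (f (τ ω)) (x - z ω) ∂ν := by
  have hF : ∀ᵐ ω ∂ν, GX N W (|K ω| * (2 ^ (W + N) * wt (z ω) ^ (W + N) * c (τ ω)))
      (fun x => K ω * f (τ ω) (x - z ω)) := by
    filter_upwards [hτI] with ω h
    exact ((hf _ h).translate hW (z ω)).smul (K ω)
  have e : ∀ᵐ ω ∂ν, ∀ m ≤ N, ∀ x, ∇ m (fun x => K ω * f (τ ω) (x - z ω)) x =
      K ω • ∇ m (f (τ ω)) (x - z ω) := by
    filter_upwards [hτI] with ω h m hm x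
    have : ∇ m (fun x => K ω * f (τ ω) (x - z ω)) x =
        K ω • ∇ m (fun x => f (τ ω) (x - z ω)) x :=
      iteratedFDeriv_const_smul_apply (a := K ω)
        (((hf _ h).translate hW (z ω)).contDiffAt hm x)
    rw [this, iteratedFDeriv_translate]
  have hmeas : ∀ m ≤ N, ∀ x, AEStronglyMeasurable
      (fun ω => K ω • ∇ m (f (τ ω)) (x - z ω)) ν := fun m hm x =>
    hK.smul (aesm_comp_of_continuousOn hT (hfc m hm) hτ (hz.const_sub x) hτI)
  have hc : Integrable (fun ω => |K ω| * (2 ^ (W + N) * wt (z ω) ^ (W + N) * c (τ ω))) ν := by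
    refine (hint.const_mul (2 ^ (W + N))).congr (Eventually.of_forall fun ω => ?_)
    simp only; ring
  obtain ⟨h1, h2⟩ := GX.integral hW hF hc fun m hm x => (hmeas m hm x).congr
    (e.mono fun ω h => (h m hm x).symm)
  refine ⟨?_, fun x => ?_, fun m hm x => ?_⟩
  · rw [← integral_const_mul]
    refine h1.mono (le_of_eq (integral_congr_ae (Eventually.of_forall fun ω => ?_)))
    simp only; ring
  · refine hc.mono' ?_ (hF.mono fun ω h => h.abs_le_const hW x)
    exact hK.mul (aesm_comp_of_continuousOn hT hfc.zero_cont hτ (hz.const_sub x) hτI)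
  · rw [h2 m hm x]
    exact integral_congr_ae (e.mono fun ω h => h m hm x)

lemma pd_eq_iteratedFDeriv (i : Fin n) (f : 𝓕) (x : Spc n) :
    pd i f x = ∇ 1 f x (fun _ => single i 1) := by
  rw [iteratedFDeriv_one_apply]; rfl

lemma conv_pd {Ω : Type*} [MeasurableSpace Ω] {ν : Measure Ω} (hT : 0 ≤ T)
    (hW : 0 ≤ W) {K : Ω → ℝ} {τ : Ω → ℝ} {z : Ω → Spc n} {c : ℝ → ℝ}
    (hK : AEStronglyMeasurable K ν) (hτ : AEMeasurable τ ν) (hz : AEMeasurable z ν)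
    (hτI : ∀ᵐ ω ∂ν, τ ω ∈ Icc 0 T) {f : 𝓣}
    (hf : ∀ t ∈ Icc 0 T, GX (N + 1) W (c t) (f t)) (hfc : SCt T (N + 1) f)
    (hint : Integrable (fun ω => |K ω| * wt (z ω) ^ (W + (N + 1 : ℕ)) * c (τ ω)) ν) (i : Fin n)
    (x : Spc n) : pd i (fun x => ∫ ω, K ω * f (τ ω) (x - z ω) ∂ν) x =
      ∫ ω, K ω * pd i (f (τ ω)) (x - z ω) ∂ν := by
  obtain ⟨-, -, h⟩ := conv_GX hT hW hK hτ hz hτI hf hfc hint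
  rw [pd_eq_iteratedFDeriv, h 1 (by omega) x]
  have hI : Integrable (fun ω => K ω • ∇ 1 (f (τ ω)) (x - z ω)) ν := by
    refine (hint.const_mul (2 ^ (W + (N + 1 : ℕ)))).mono'
      (hK.smul (aesm_comp_of_continuousOn hT (hfc 1 (by omega)) hτ (hz.const_sub x) hτI)) ?_
    filter_upwards [hτI] with ω h
    have h1 := (((hf _ h).translate hW (z ω))).norm_le_const hW (m := 1) (by omega) x
    rw [iteratedFDeriv_translate] at h1
    rw [norm_smul, norm_eq_abs]
    calc _ ≤ |K ω| * _ := mul_le_mul_of_nonneg_left h1 (abs_nonneg _)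
      _ = _ := by ring
  rw [ContinuousMultilinearMap.integral_apply hI]
  refine integral_congr_ae (Eventually.of_forall fun ω => ?_)
  simp [pd_eq_iteratedFDeriv]

section TD

variable {f g f' g' : ℝ → Spc n → ℝ}

lemma SCt.time_cont (h : SCt T N f) (x : Spc n) :
    ContinuousOn (fun t => f t x) (Icc 0 T) :=
  h.zero_cont.comp (f := fun t => (t, x)) (by fun_prop) fun _ ht => ⟨ht, trivial⟩

lemma TD.congr (h : TD T f g) (hT : 0 ≤ T) (e : ∀ t ∈ Icc 0 T, ∀ x, f' t x = f t x)
    (e' : ∀ t ∈ Icc 0 T, ∀ x, g' t x = g t x) : TD T f' g' := fun t ht x => by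
  rw [e t ht, e 0 ⟨le_rfl, hT⟩, h t ht x]
  congr 1
  refine intervalIntegral.integral_congr fun τ hτ => ?_
  rw [uIcc_of_le ht.1] at hτ
  exact (e' τ ⟨hτ.1, hτ.2.trans ht.2⟩ x).symm

lemma TD.hasDeriv (h : TD T f g) {x : Spc n} (hg : ContinuousOn (fun t => g t x) (Icc 0 T))
     (ht : t ∈ Icc 0 T) :
    HasDerivWithinAt (fun τ => f τ x) (g t x) (Icc 0 T) t := by
  have hT : 0 ≤ T := ht.1.trans ht.2
  have hc : Continuous (fun τ => g (projIcc 0 T hT τ) x) :=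
    hg.comp_continuous (by fun_prop) fun τ => (projIcc 0 T hT τ).2
  have hd := (hc.integral_hasStrictDerivAt 0 t).hasDerivAt.const_add (f 0 x)
  simp only [projIcc_of_mem hT ht] at hd
  refine (hd.hasDerivWithinAt (s := Icc 0 T)).congr_of_mem (fun τ hτ => ?_) ht
  rw [h τ hτ x]
  congr 1
  refine intervalIntegral.integral_congr fun r hr => ?_
  rw [uIcc_of_le hτ.1] at hr
  simp [projIcc_of_mem hT ⟨hr.1, hr.2.trans hτ.2⟩]

lemma TD.of_hasDeriv (hg : ∀ x, ContinuousOn (fun t => g t x) (Icc 0 T))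
    (hf : ∀ x, ContinuousOn (fun t => f t x) (Icc 0 T))
    (h : ∀ x, ∀ t ∈ Ioo 0 T, HasDerivAt (fun τ => f τ x) (g t x) t) : TD T f g := by
  intro t ht x
  have hs : Icc 0 t ⊆ Icc 0 T := Icc_subset_Icc_right ht.2
  have := intervalIntegral.integral_eq_sub_of_hasDerivAt_of_le ht.1 ((hf x).mono hs)
    (fun τ hτ => h x τ ⟨hτ.1, hτ.2.trans_le ht.2⟩)
    (((hg x).mono hs).intervalIntegrable_of_Icc ht.1)
  rw [this]; ring

lemma TD.intervalIntegrable (hg : ContinuousOn (fun t => g t x) (Icc 0 T))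
    (ht : t ∈ Icc 0 T) : IntervalIntegrable (fun t => g t x) volume 0 t :=
  (hg.mono (Icc_subset_Icc_right ht.2)).intervalIntegrable_of_Icc ht.1

lemma TD.add (h : TD T f g) (h' : TD T f' g')
    (hg : ∀ x, ContinuousOn (fun t => g t x) (Icc 0 T))
    (hg' : ∀ x, ContinuousOn (fun t => g' t x) (Icc 0 T)) :
    TD T (fun t x => f t x + f' t x) (fun t x => g t x + g' t x) := fun t ht x => by
  beta_reduce
  rw [h t ht x, h' t ht x, intervalIntegral.integral_add (TD.intervalIntegrable (hg x) ht)
    (TD.intervalIntegrable (hg' x) ht)]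
  ring

lemma TD.smul (h : TD T f g) (c : ℝ) :
    TD T (fun t x => c * f t x) (fun t x => c * g t x) := fun t ht x => by
  beta_reduce
  rw [h t ht x, intervalIntegral.integral_const_mul]; ring

lemma TD.mul (h : TD T f g) (h' : TD T f' g')
    (hg : ∀ x, ContinuousOn (fun t => g t x) (Icc 0 T))
    (hg' : ∀ x, ContinuousOn (fun t => g' t x) (Icc 0 T)) :
    TD T (fun t x => f t x * f' t x) (fun t x => g t x * f' t x + f t x * g' t x) := by
  have hf : ∀ x, ContinuousOn (fun t => f t x) (Icc 0 T) := fun x t ht =>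
    (h.hasDeriv (hg x) ht).continuousWithinAt
  have hf' : ∀ x, ContinuousOn (fun t => f' t x) (Icc 0 T) := fun x t ht =>
    (h'.hasDeriv (hg' x) ht).continuousWithinAt
  refine TD.of_hasDeriv (fun x => ((hg x).mul (hf' x)).add ((hf x).mul (hg' x)))
    (fun x => (hf x).mul (hf' x)) fun x t ht => ?_
  have hn : Icc 0 T ∈ nhds t := Icc_mem_nhds ht.1 ht.2
  have hm : t ∈ Icc 0 T := ⟨ht.1.le, ht.2.le⟩
  exact ((h.hasDeriv (hg x) hm).hasDerivAt hn).mul ((h'.hasDeriv (hg' x) hm).hasDerivAt hn)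

lemma TD.unique (hT : 0 < T) (h : TD T f g) (h' : TD T f g')
    (hg : ∀ x, ContinuousOn (fun t => g t x) (Icc 0 T))
    (hg' : ∀ x, ContinuousOn (fun t => g' t x) (Icc 0 T)) :
    ∀ t ∈ Icc 0 T, ∀ x, g t x = g' t x := fun t ht x =>
  (uniqueDiffOn_Icc hT t ht).eq_deriv _ (h.hasDeriv (hg x) ht) (h'.hasDeriv (hg' x) ht)

/-- Time derivatives commute with integral operators acting in the space variable. -/
lemma TD.conv {Ω : Type*} [MeasurableSpace Ω] {ν : Measure Ω} [SFinite ν] {K : Ω → ℝ}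
    {z : Ω → Spc n} (hK : AEStronglyMeasurable K ν) (hz : AEMeasurable z ν)
    (hint : Integrable K ν) (h : TD T f g) (hf : ∀ x, |f 0 x| ≤ C)
    (hf0 : Continuous (f 0)) (hgc : SCt T 0 g)
    (hg : ∀ t ∈ Icc 0 T, ∀ x, |g t x| ≤ C) :
    TD T (fun t x => ∫ ω, K ω * f t (x - z ω) ∂ν) (fun t x => ∫ ω, K ω * g t (x - z ω) ∂ν) := by
  intro t ht x
  have hT : 0 ≤ T := ht.1.trans ht.2
  have hsub : ∀ τ ∈ Ioc 0 t, τ ∈ Icc 0 T := fun τ hτ => ⟨hτ.1.le, hτ.2.trans ht.2⟩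
  have h0 : Integrable (fun ω => K ω * f 0 (x - z ω)) ν := by
    refine (hint.norm.mul_const C).mono' (hK.mul
      (hf0.comp_aestronglyMeasurable (hz.const_sub x).aestronglyMeasurable)) ?_
    refine Eventually.of_forall fun ω => ?_
    rw [norm_mul]
    exact mul_le_mul_of_nonneg_left (hf _) (norm_nonneg _)
  have hae : ∀ᵐ p ∂((volume.restrict (Ioc 0 t)).prod ν), p.1 ∈ Icc 0 T := by
    refine Measure.quasiMeasurePreserving_fst.ae (p := fun τ => τ ∈ Icc 0 T) ?_
    filter_upwards [ae_restrict_mem measurableSet_Ioc] with τ hτ using hsub τ hτ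
  have hp : Integrable (Function.uncurry fun (τ : ℝ) (ω : Ω) => K ω * g τ (x - z ω))
      ((volume.restrict (Ioc 0 t)).prod ν) := by
    have hb : Integrable (fun p : ℝ × Ω => (1 : ℝ) * (‖K p.2‖ * C))
        ((volume.restrict (Ioc 0 t)).prod ν) :=
      Integrable.mul_prod (integrable_const (1 : ℝ)) (hint.norm.mul_const C)
    refine hb.mono' ?_ ?_
    · refine (hK.comp_snd).mul ?_
      exact aesm_comp_of_continuousOn hT hgc.zero_cont (measurable_fst.aemeasurable)
        ((hz.comp_snd).const_sub x) hae
    · filter_upwards [hae] with p hp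
      simp only [Function.uncurry, norm_mul, one_mul]
      exact mul_le_mul_of_nonneg_left (hg _ hp _) (norm_nonneg _)
  have e : ∀ ω, K ω * f t (x - z ω) = K ω * f 0 (x - z ω) +
      ∫ τ in Ioc 0 t, K ω * g τ (x - z ω) := fun ω => by
    rw [h t ht, intervalIntegral.integral_of_le ht.1, integral_const_mul]; ring
  simp only [e]
  have hr : Integrable (fun ω => ∫ τ in Ioc 0 t, K ω * g τ (x - z ω)) ν :=
    hp.integral_prod_right
  rw [integral_add h0 hr, intervalIntegral.integral_of_le ht.1,
    integral_integral_swap hp]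

lemma TD.pd (hW : 0 ≤ W) (h : TD T f g) (hf : SG T W C (N + 1) f)
    (hg : SG T W C' (N + 1) g) (i : Fin n) : TD T (fun t => pd i (f t)) (fun t => pd i (g t)) := by
  intro t ht x
  have hT : 0 ≤ T := ht.1.trans ht.2
  have hsub : ∀ᵐ τ ∂(volume.restrict (Ioc 0 t)), τ ∈ Icc 0 T := by
    filter_upwards [ae_restrict_mem measurableSet_Ioc] with τ hτ
    exact ⟨hτ.1.le, hτ.2.trans ht.2⟩
  have hm : AEStronglyMeasurable (fun _ : ℝ => (1 : ℝ)) (volume.restrict (Ioc 0 t)) :=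
    aestronglyMeasurable_const
  have hI : Integrable (fun ω : ℝ => |(1 : ℝ)| * wt (0 : Spc n) ^ (W + (N + 1 : ℕ)) * C')
      (volume.restrict (Ioc 0 t)) := integrable_const _
  have e := conv_pd (z := fun _ => 0) hT hW hm aemeasurable_id aemeasurable_const hsub hg.1 hg.2 hI i x
  obtain ⟨h1, -, -⟩ := conv_GX (z := fun _ => 0) hT hW hm aemeasurable_id aemeasurable_const hsub
    hg.1 hg.2 hI
  simp only [id, one_mul, sub_zero] at e h1
  have e2 : f t = fun x => f 0 x + ∫ τ in Ioc 0 t, g τ x := by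
    funext x; rw [h t ht x, intervalIntegral.integral_of_le ht.1]
  show NSdeRham.pd i (f t) x = NSdeRham.pd i (f 0) x + ∫ τ in (0 : ℝ)..t, NSdeRham.pd i (g τ) x
  rw [e2, intervalIntegral.integral_of_le ht.1, ← e, NSdeRham.pd, fderiv_fun_add
    (((hf.1 0 ⟨le_rfl, hT⟩).1.differentiable (by simp)) x)
    ((h1.1.differentiable (by simp)) x)]
  rfl

end TD

section TGen

variable {B B₁ B₂ : ℕ → (ℝ → Spc n → ℝ) → Prop}

lemma TGen.mono {f : 𝓣} (h : TGen T B s p f)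
    (hB : ∀ N f, B N f → B₁ N f) : TGen T B₁ s p f := by
  induction s generalizing f with
  | zero => exact hB _ _ h
  | succ s ih => exact ⟨hB _ _ h.1, h.2.imp fun g hg => ⟨hg.1, ih hg.2⟩⟩

lemma TGen.base {f : 𝓣} (h : TGen T B s p f) : B (2 * s + p) f := by
  cases s with
  | zero => simpa [TGen] using h
  | succ s => exact h.1

/-- Transport along an operator which commutes with time derivatives. -/
lemma TGen.map (L : (𝓣) → (𝓣)) {p' : ℕ} {f : 𝓣}
    (h : TGen T B s p f) (hB : ∀ s f, B (2 * s + p) f → B₁ (2 * s + p') (L f))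
    (hL : ∀ s f g, TD T f g → B (2 * (s + 1) + p) f → B (2 * s + p) g → TD T (L f) (L g)) :
    TGen T B₁ s p' (L f) := by
  induction s generalizing f with
  | zero => simpa [TGen] using hB 0 f (by simpa [TGen] using h)
  | succ s ih =>
    obtain ⟨h1, g, h2, h3⟩ := h
    exact ⟨hB _ _ h1, L g, hL _ _ _ h2 h1 h3.base, ih h3⟩

/-- Transport along a binary operation which commutes with time derivatives. -/
lemma TGen.map₂ (L : (𝓣) → (𝓣) → (𝓣))
    {f f' : 𝓣}
    (h : TGen T B s p f) (h' : TGen T B₁ s p f')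
    (hB : ∀ N f f', B N f → B₁ N f' → B₂ N (L f f'))
    (hL : ∀ N f f' g g', TD T f g → TD T f' g' → B N g → B₁ N g' → TD T (L f f') (L g g')) :
    TGen T B₂ s p (L f f') := by
  induction s generalizing f f' with
  | zero => exact hB _ _ _ h h'
  | succ s ih =>
    obtain ⟨h1, g, h2, h3⟩ := h
    obtain ⟨h1', g', h2', h3'⟩ := h'
    exact ⟨hB _ _ _ h1 h1', L g g', hL _ _ _ _ _ h2 h2' h3.base h3'.base, ih h3 h3'⟩

lemma TGen.lower {f : 𝓣} (hB : ∀ N M f, M ≤ N → B N f → B M f)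
    (h : TGen T B (s + 1) p f) : TGen T B s p f := by
  induction s generalizing f with
  | zero => exact hB _ _ _ (by omega) h.1
  | succ s ih =>
    obtain ⟨h1, g, h2, h3⟩ := h
    exact ⟨hB _ _ _ (by omega) h1, g, h2, ih h3⟩

lemma TGen.congr {f g : 𝓣} (hT : 0 ≤ T) (h : TGen T B s p f)
    (hB : ∀ N f g, (∀ t ∈ Icc 0 T, ∀ x, g t x = f t x) → B N f → B N g)
    (e : ∀ t ∈ Icc 0 T, ∀ x, g t x = f t x) : TGen T B s p g := by
  cases s with
  | zero => exact hB _ _ _ e h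
  | succ s =>
    obtain ⟨h1, g', h2, h3⟩ := h
    exact ⟨hB _ _ _ e h1, g', h2.congr hT e fun _ _ _ => rfl, h3⟩

/-- The chain of time derivatives. -/
lemma TGen_iff_chain {f : 𝓣} :
    TGen T B s p f ↔ ∃ g : ℕ → 𝓣, g 0 = f ∧ (∀ j < s, TD T (g j) (g (j + 1))) ∧
      ∀ j ≤ s, B (2 * (s - j) + p) (g j) := by
  induction s generalizing f with
  | zero =>
    constructor
    · exact fun h => ⟨fun _ => f, rfl, by simp, fun j hj => by simpa [TGen] using h⟩
    · rintro ⟨g, rfl, -, h⟩; simpa [TGen] using h 0 le_rfl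
  | succ s ih =>
    constructor
    · rintro ⟨h1, g', h2, h3⟩
      obtain ⟨g, rfl, h4, h5⟩ := ih.1 h3
      refine ⟨fun j => Nat.casesOn j f g, rfl, fun j hj => ?_, fun j hj => ?_⟩
      · cases j with
        | zero => exact h2
        | succ j => exact h4 j (by omega)
      · cases j with
        | zero => exact h1
        | succ j => simpa using h5 j (by omega)
    · rintro ⟨g, rfl, h1, h2⟩
      refine ⟨h2 0 (Nat.zero_le _), g 1, h1 0 (by omega), ih.2 ⟨fun j => g (j + 1), rfl,
        fun j hj => h1 _ (by omega), fun j hj => ?_⟩⟩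
      simpa using h2 (j + 1) (by omega)

variable {f g : ℝ → Spc n → ℝ}

lemma TGen.SG_mono (h : TGen T (SG T W C) s p f) (hC : C ≤ C') : TGen T (SG T W C') s p f :=
  h.mono fun _ _ h => h.mono hC

lemma TGen.SG_add (h : TGen T (SG T W C) s p f) (h' : TGen T (SG T W C') s p g) :
    TGen T (SG T W (C + C')) s p (fun t x => f t x + g t x) :=
  TGen.map₂ (fun f g t x => f t x + g t x) h h' (fun _ _ _ h h' => h.add h')
    fun _ _ _ _ _ h h' hg hg' => h.add h' hg.2.time_cont hg'.2.time_cont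

lemma TGen.SG_smul (h : TGen T (SG T W C) s p f) (c : ℝ) :
    TGen T (SG T W (|c| * C)) s p (fun t x => c * f t x) :=
  TGen.map (fun f t x => c * f t x) h (fun _ _ h => h.smul c) fun _ _ _ h _ _ => h.smul c

lemma TGen.SG_zero : TGen T (SG T W 0) s p (fun _ (_ : Spc n) => (0 : ℝ)) := by
  induction s with
  | zero => exact SG.zero
  | succ s ih => exact ⟨SG.zero, _, fun t ht x => by simp, ih⟩

lemma TGen.SG_sum {ι : Type*} (S : Finset ι) {F : ι → 𝓣} {c : ι → ℝ}
    (h : ∀ i ∈ S, TGen T (SG T W (c i)) s p (F i)) :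
    TGen T (SG T W (∑ i ∈ S, c i)) s p (fun t x => ∑ i ∈ S, F i t x) := by
  induction S using induction_on with
  | empty => simpa using TGen.SG_zero
  | insert a S ha ih =>
    simp only [sum_insert ha]
    exact (h a (by simp)).SG_add (ih fun i hi => h i (by simp [hi]))

lemma TGen.SG_pd (hW : 0 ≤ W) (h : TGen T (SG T W C) s (p + 1) f) (i : Fin n) :
    TGen T (SG T (W + 1) C) s p (fun t => pd i (f t)) :=
  TGen.map (fun f t => pd i (f t)) h (fun _ _ h => h.pd i)
    fun s _ _ h hf hg => h.pd (N := 2 * s + p) hW (hf.mono_N (by omega)) hg i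

lemma TGen.SG_mul (h : TGen T (SG T W C) s p f) (h' : TGen T (SG T V C') s p g) (hC : 0 ≤ C)
    (hC' : 0 ≤ C') :
    TGen T (SG T (W + V) (2 ^ (3 * s + p) * (C * C'))) s p (fun t x => f t x * g t x) := by
  induction s generalizing f g with
  | zero => simpa [TGen] using SG.mul h h'
  | succ s ih =>
    have l := h.lower fun _ _ _ hM h => h.mono_N hM
    have l' := h'.lower fun _ _ _ hM h => h.mono_N hM
    obtain ⟨h1, f₁, h2, h3⟩ := h
    obtain ⟨h1', g₁, h2', h3'⟩ := h'
    refine ⟨(h1.mul h1').mono ?_, _, h2.mul h2' h3.base.2.time_cont h3'.base.2.time_cont, ?_⟩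
    · gcongr
      · norm_num
      · omega
    · refine ((ih h3 l').SG_add (ih l h3')).SG_mono ?_
      have : (2 : ℝ) ^ (3 * s + p) * 2 ≤ 2 ^ (3 * (s + 1) + p) := by
        rw [← pow_succ]; exact pow_le_pow_right₀ (by norm_num) (by omega)
      nlinarith [mul_nonneg hC hC']

end TGen

/-- Differences of translates. -/
lemma GX.diff (hW : 0 ≤ W) (hf : GX (N + 1) W C f)
    (v : Spc n) :
    GX N W (2 ^ (W + N) * C * (‖v‖ * wt v ^ (W + N))) (fun x => f (x - v) - f x) := by
  have hf1 : ContDiff ℝ (N + 1) f := by simpa using hf.1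
  have hf0 : ContDiff ℝ N f := hf1.of_le (by exact_mod_cast Nat.le_succ N)
  have ht : ContDiff ℝ N (fun x => f (x - v)) := hf0.comp (by fun_prop)
  refine ⟨ht.sub hf0, fun m hm x => ?_⟩
  have hmN : ((m : ℕ) : WithTop ℕ∞) ≤ N := by exact_mod_cast hm
  rw [fun_iteratedFDeriv_sub_apply (ht.of_le hmN).contDiffAt (hf0.of_le hmN).contDiffAt,
    iteratedFDeriv_translate]
  have hWm : 0 ≤ W + m := by positivity
  have hd : ∀ y, DifferentiableAt ℝ (∇ m f) y := fun y =>
    (hf1.differentiable_iteratedFDeriv (by exact_mod_cast Nat.lt_succ_of_le hm)) y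
  have hb : ∀ y ∈ segment ℝ x (x - v), ‖fderiv ℝ (∇ m f) y‖ ≤
      C * (2 ^ (W + m) * wt v ^ (W + m) * wt x ^ (-(W + m))) := by
    intro y hy
    obtain ⟨s, hs, rfl⟩ := (segment_eq_image' ℝ x (x - v)) ▸ hy
    rw [norm_fderiv_iteratedFDeriv]
    refine (hf.norm_le (by omega) _).trans (mul_le_mul_of_nonneg_left ?_ hf.nonneg)
    have e1 : x + s • (x - v - x) = x - s • v := by simp [sub_eq_add_neg]
    beta_reduce
    rw [e1]
    have h1 := wt_rpow_le_sub x (s • v) hWm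
    have h2 : wt (s • v) ^ (W + m) ≤ wt v ^ (W + m) := by
      refine rpow_le_rpow (wt_pos _).le (wt_mono ?_) hWm
      rw [norm_smul, norm_eq_abs, abs_of_nonneg hs.1]
      exact mul_le_of_le_one_left (norm_nonneg _) hs.2
    have h3 : wt (x - s • v) ^ (-(W + (m + 1 : ℕ))) ≤ wt (x - s • v) ^ (-(W + m)) :=
      wt_rpow_mono _ (by push_cast; linarith)
    refine h3.trans ?_
    rw [rpow_neg (wt_pos _).le, rpow_neg (wt_pos _).le, ← div_eq_mul_inv,
      le_div_iff₀ (wt_rpow_pos _ _), inv_mul_le_iff₀ (wt_rpow_pos _ _)]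
    refine h1.trans ?_
    rw [mul_comm]
    have := (wt_rpow_pos (x - s • v) (W + m)).le
    gcongr
  have h := (convex_segment x (x - v)).norm_image_sub_le_of_norm_hasFDerivWithin_le
    (fun y _ => (hd y).hasFDerivAt.hasFDerivWithinAt) hb (left_mem_segment ℝ _ _)
    (right_mem_segment ℝ _ _)
  rw [show x - v - x = -v by abel, norm_neg] at h
  have hp := wt_rpow_pos x (W + m)
  calc wt x ^ (W + m) * _ ≤ wt x ^ (W + m) *
        (C * (2 ^ (W + m) * wt v ^ (W + m) * wt x ^ (-(W + m))) * ‖v‖) := by gcongr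
    _ = (2 ^ (W + m) * C * (‖v‖ * wt v ^ (W + m))) := by
        rw [rpow_neg (wt_pos _).le]; field_simp
    _ ≤ _ := by
        have := hf.nonneg
        have hm' : (m : ℝ) ≤ N := by exact_mod_cast hm
        have hv := (wt_rpow_pos v (W + m)).le
        gcongr
        · norm_num
        · exact one_le_wt v

/-- Rapidly decaying profiles with a rapidly decaying Hölder modulus. -/
def Prof (θ : ℝ) (ζ : 𝓕) : Prop :=
  Continuous ζ ∧ ∀ m : ℝ, 0 ≤ m → ∃ C, 0 ≤ C ∧ (∀ y, |ζ y| ≤ C * wt y ^ (-m)) ∧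
    ∀ a b, |ζ a - ζ b| ≤ C * ‖a - b‖ ^ θ * (wt a ^ (-m) + wt b ^ (-m))

lemma Prof.of_GX (hθ0 : 0 < θ) (hθ1 : θ ≤ 1)
    (h : ∀ m : ℝ, 0 ≤ m → ∃ C, GX 1 m C ζ) : Prof θ ζ := by
  refine ⟨(h 0 le_rfl).choose_spec.cont, fun m hm => ?_⟩
  obtain ⟨C, hC⟩ := h m hm
  have h0 := hC.nonneg
  refine ⟨2 ^ m * C * 2 ^ m + C, by positivity, fun y => ?_, fun a b => ?_⟩
  · refine (hC.abs_le' y).trans (mul_le_mul_of_nonneg_right ?_ (wt_rpow_pos _ _).le)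
    have : 0 ≤ (2 : ℝ) ^ m * C * 2 ^ m := by positivity
    linarith
  have wa := (wt_rpow_pos a (-m)).le
  have wb := (wt_rpow_pos b (-m)).le
  by_cases hab : ‖a - b‖ ≤ 1
  · have h1 := (GX.diff (N := 0) hm hC (a - b)).abs_le' a
    simp only [sub_sub_cancel, Nat.cast_zero, add_zero] at h1
    rw [abs_sub_comm] at h1
    refine h1.trans ?_
    have h2 : wt (a - b) ^ m ≤ 2 ^ m :=
      rpow_le_rpow (wt_pos _).le ((wt_le _).trans (by linarith)) hm
    have h3 : ‖a - b‖ ≤ ‖a - b‖ ^ θ := by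
      rcases (norm_nonneg (a - b)).eq_or_lt with h | h
      · rw [← h]; exact rpow_nonneg le_rfl _
      · simpa using rpow_le_rpow_of_exponent_ge h hab hθ1
    have h4 := (wt_rpow_pos (a - b) m).le
    calc _ ≤ 2 ^ m * C * (‖a - b‖ ^ θ * 2 ^ m) * wt a ^ (-m) := by gcongr
      _ ≤ _ := by
        have : 0 ≤ ‖a - b‖ ^ θ := by positivity
        have e : (2 ^ m * C * 2 ^ m + C) * ‖a - b‖ ^ θ * (wt a ^ (-m) + wt b ^ (-m)) =
          2 ^ m * C * (‖a - b‖ ^ θ * 2 ^ m) * wt a ^ (-m) + (C * ‖a - b‖ ^ θ * wt a ^ (-m) +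
          (2 ^ m * C * 2 ^ m + C) * ‖a - b‖ ^ θ * wt b ^ (-m)) := by ring
        rw [e]
        exact le_add_of_nonneg_right (by positivity)
  · have h3 : 1 ≤ ‖a - b‖ ^ θ := one_le_rpow (not_le.1 hab).le hθ0.le
    calc |ζ a - ζ b| ≤ |ζ a| + |ζ b| := abs_sub _ _
      _ ≤ C * wt a ^ (-m) + C * wt b ^ (-m) := add_le_add (hC.abs_le' a) (hC.abs_le' b)
      _ = C * 1 * (wt a ^ (-m) + wt b ^ (-m)) := by ring
      _ ≤ _ := by
        gcongr
        have : 0 ≤ (2 : ℝ) ^ m * C * 2 ^ m := by positivity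
        linarith

/-- The Gaussian profile. -/
def gam (μ : ℝ) (y : Spc n) : ℝ :=
  (4 * Real.pi * μ) ^ (-(n : ℝ) / 2) * exp (-‖y‖ ^ 2 / (4 * μ))

lemma contDiff_gam (μ : ℝ) {N : WithTop ℕ∞} : ContDiff ℝ N (gam μ : 𝓕) := by
  unfold gam
  exact contDiff_const.mul (contDiff_exp.comp ((contDiff_norm_sq ℝ).neg.div_const _))

lemma pd_coord (i j : Fin n) : pd j (fun x : Spc n => x i) = fun _ => if i = j then 1 else 0 := by
  funext x
  have : HasFDerivAt (fun x : Spc n => x i) (proj i : Spc n →L[ℝ] ℝ) x :=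
    (proj i : Spc n →L[ℝ] ℝ).hasFDerivAt
  rw [pd, this.fderiv]
  simp

lemma GX.const (c : ℝ) : GX N 0 |c| (fun _ : Spc n => c) := by
  refine ⟨contDiff_const, fun m _ x => ?_⟩
  rcases m with _ | m
  · simp
  · rw [iteratedFDeriv_const_of_ne (by omega)]; simp

lemma GX.coord (i : Fin n) : GX N (-1) (n + 1) (fun x : Spc n => x i) := by
  have hd : ContDiff ℝ N (fun x : Spc n => x i) :=
    (proj i : Spc n →L[ℝ] ℝ).contDiff
  have h0 : ∀ x : Spc n, wt x ^ (-1 : ℝ) * |x i| ≤ 1 := fun x => by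
    rw [rpow_neg_one, inv_mul_le_iff₀ (wt_pos x), mul_one]
    exact (PiLp.norm_apply_le x i).trans (norm_le_wt x)
  cases N with
  | zero =>
    refine ⟨hd, fun m hm x => ?_⟩
    obtain rfl : m = 0 := by omega
    simp only [Nat.cast_zero, add_zero, norm_iteratedFDeriv_zero, norm_eq_abs]
    exact (h0 x).trans (by linarith [(Nat.cast_nonneg n : (0:ℝ) ≤ n)])
  | succ N =>
    have := GX.succ (N := N) (C := 1) (f := fun x : Spc n => x i)
      (proj i : Spc n →L[ℝ] ℝ).differentiable h0 fun j => by
        rw [pd_coord]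
        refine (neg_add_cancel (1 : ℝ)).symm ▸ (GX.const _).mono ?_
        split_ifs <;> simp
    simpa using this

lemma pd_gam (i : Fin n) :
    pd i (gam μ : 𝓕) = fun y => (-(1 / (2 * μ))) * (y i * gam μ y) := by
  funext y
  have h1 : HasFDerivAt (fun y : Spc n => -‖y‖ ^ 2 / (4 * μ))
      ((4 * μ)⁻¹ • (-((2 : ℕ) • innerSL ℝ y))) y := by
    have := ((hasStrictFDerivAt_norm_sq y).hasFDerivAt.neg).mul_const (4 * μ)⁻¹
    exact this
  have h2 := (h1.exp).const_mul ((4 * Real.pi * μ) ^ (-(n : ℝ) / 2))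
  have h3 : HasFDerivAt (gam μ : 𝓕) _ y := h2
  rw [pd, h3.fderiv]
  simp [gam, PiLp.inner_apply]
  ring

lemma exp_le_wt {c : ℝ} (hc : 0 < c) (m : ℝ) :
    ∃ C, ∀ y : Spc n, wt y ^ m * exp (-‖y‖ ^ 2 / c) ≤ C := by
  obtain ⟨k, hk⟩ := exists_nat_ge m
  refine ⟨(k.factorial * (c + 1) ^ k) * exp (1 / c), fun y => ?_⟩
  have h1 : wt y ^ m ≤ (wt y ^ 2) ^ k := by
    rw [← pow_mul]
    refine (wt_rpow_mono y (hk.trans ?_)).trans (rpow_natCast _ _).le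
    push_cast; nlinarith [(Nat.cast_nonneg k : (0:ℝ) ≤ k)]
  have h2 : (wt y ^ 2 / c) ^ k / k.factorial ≤ exp (wt y ^ 2 / c) :=
    pow_div_factorial_le_exp _ (by positivity) k
  have h3 : exp (-‖y‖ ^ 2 / c) = exp (1 / c) * (exp (wt y ^ 2 / c))⁻¹ := by
    rw [← exp_neg, ← exp_add, wt_sq]; congr 1; ring
  have hf : (0 : ℝ) < k.factorial := by exact_mod_cast k.factorial_pos
  rw [div_pow, div_div, div_le_iff₀ (by positivity)] at h2
  rw [h3]
  have hE := exp_pos (wt y ^ 2 / c)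
  calc _ ≤ (exp (wt y ^ 2 / c) * (c ^ k * k.factorial)) *
        (exp (1 / c) * (exp (wt y ^ 2 / c))⁻¹) := by
        gcongr; exact h1.trans h2
    _ = (k.factorial * c ^ k) * exp (1 / c) := by field_simp
    _ ≤ _ := by gcongr; linarith

lemma gam_GX (hμ : 0 < μ) (N : ℕ) (m : ℝ) : ∃ C, GX N m C (gam μ : 𝓕) := by
  induction N generalizing m with
  | zero =>
    obtain ⟨C, hC⟩ := exp_le_wt (n := n) (c := 4 * μ) (by positivity) m
    refine ⟨(4 * Real.pi * μ) ^ (-(n : ℝ) / 2) * C, contDiff_gam μ, fun k hk x => ?_⟩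
    obtain rfl : k = 0 := by omega
    simp only [Nat.cast_zero, add_zero, norm_iteratedFDeriv_zero, norm_eq_abs]
    have hp : 0 < (4 * Real.pi * μ) ^ (-(n : ℝ) / 2) := by positivity
    rw [gam, abs_of_pos (mul_pos hp (exp_pos _)), mul_left_comm]
    exact mul_le_mul_of_nonneg_left (hC x) hp.le
  | succ N ih =>
    obtain ⟨C, hC⟩ := ih (m + 2)
    obtain ⟨C', hC'⟩ := ih m
    refine ⟨_, GX.succ (C := max C' (|(-(1 / (2 * μ)))| * (2 ^ N * ((n + 1) * C))))
      ((contDiff_gam μ (N := 1)).differentiable (by simp))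
      (fun x => (hC'.abs_le x).trans (le_max_left _ _)) fun i => ?_⟩
    rw [pd_gam]
    have := ((GX.coord (N := N) i).mul hC).smul (-(1 / (2 * μ)))
    rw [show -1 + (m + 2) = m + 1 by ring] at this
    exact this.mono (le_max_right _ _)

lemma GX_all_pd (h : ∀ N m, ∃ C, GX N m C f) (i : Fin n) (N : ℕ) (m : ℝ) :
    ∃ C, GX N m C (pd i f) := by
  obtain ⟨C, hC⟩ := h (N + 1) (m - 1)
  exact ⟨C, by simpa using hC.pd i⟩

/-- Parabolic rescaling of a profile. -/
def kf (r : ℝ) (ζ : 𝓕) (σ : ℝ) (z : Spc n) : ℝ :=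
  if 0 < σ then σ ^ (-((n + r) / 2)) * ζ (σ ^ (-(1 / 2) : ℝ) • z) else 0

lemma rpow_neg_half_sq (h : 0 < σ) : (σ ^ (-(1 / 2) : ℝ)) ^ 2 = σ⁻¹ := by
  rw [← rpow_natCast, ← rpow_mul h.le, ← rpow_neg_one]; norm_num

lemma heatKer_eq (hμ : 0 < μ) (z : Spc n) (σ : ℝ) : heatKer μ z σ = kf 0 (gam μ) σ z := by
  unfold heatKer kf gam
  split_ifs with h
  · rw [mul_rpow (by positivity) h.le, norm_smul, norm_eq_abs, mul_pow, sq_abs,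
      rpow_neg_half_sq h, show -((n + 0 : ℝ) / 2) = -(n : ℝ) / 2 by ring,
      show -‖z‖ ^ 2 / (4 * μ * σ) = -(σ⁻¹ * ‖z‖ ^ 2) / (4 * μ) by field_simp]
    ring
  · rfl

lemma integrable_wt_rpow {m : ℝ} (hm : (n : ℝ) < m) :
    Integrable (fun y : Spc n => wt y ^ (-m)) := by
  have := integrable_rpow_neg_one_add_norm_sq (E := Spc n) (μ := volume) (r := m) (by simpa using hm)
  refine this.congr (Eventually.of_forall fun y => ?_)
  simp only [wt]
  rw [sqrt_eq_rpow, ← rpow_mul (by positivity)]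
  congr 1; ring

/-- Integral bound for rescaled weights. -/
lemma kf_weight (hB : 0 ≤ B) (hσ : 0 < σ) (hσT : σ ≤ T) :
    Integrable (fun z : Spc n =>
      σ ^ (-(n / 2 : ℝ)) * wt (σ ^ (-(1 / 2) : ℝ) • z) ^ (-(B + n + 1)) * wt z ^ B) ∧
    ∫ z : Spc n, σ ^ (-(n / 2 : ℝ)) * wt (σ ^ (-(1 / 2) : ℝ) • z) ^ (-(B + n + 1)) * wt z ^ B ≤
      (1 + T) ^ B * ∫ y : Spc n, wt y ^ (-(n + 1 : ℝ)) := by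
  have hR : (0 : ℝ) < σ ^ (-(1 / 2) : ℝ) := rpow_pos_of_pos hσ _
  have h0 := integrable_wt_rpow (n := n) (m := n + 1) (by linarith)
  have h1 : Integrable (fun z : Spc n => σ ^ (-(n / 2 : ℝ)) * (1 + T) ^ B *
      wt (σ ^ (-(1 / 2) : ℝ) • z) ^ (-(n + 1 : ℝ))) :=
    ((integrable_comp_smul_iff volume (fun y : Spc n => wt y ^ (-(n + 1 : ℝ))) hR.ne').2 h0).const_mul _
  have hle : ∀ z : Spc n, σ ^ (-(n / 2 : ℝ)) * wt (σ ^ (-(1 / 2) : ℝ) • z) ^ (-(B + n + 1)) *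
      wt z ^ B ≤ σ ^ (-(n / 2 : ℝ)) * (1 + T) ^ B * wt (σ ^ (-(1 / 2) : ℝ) • z) ^ (-(n + 1 : ℝ)) := by
    intro z
    set y := σ ^ (-(1 / 2) : ℝ) • z with hy
    have hw : wt z ≤ (1 + T) * wt y := by
      refine le_of_sq_le_sq ?_ (by have := (wt_pos y).le; have := hσ.le.trans hσT; positivity)
      rw [mul_pow, wt_sq, wt_sq]
      have e : ‖z‖ ^ 2 = σ * ‖y‖ ^ 2 := by
        rw [hy, norm_smul, mul_pow, norm_eq_abs, sq_abs, rpow_neg_half_sq hσ]; field_simp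
      rw [e]
      nlinarith [sq_nonneg ‖y‖, sq_nonneg T, mul_nonneg (sq_nonneg T) (sq_nonneg ‖y‖),
        mul_le_mul_of_nonneg_right hσT (sq_nonneg ‖y‖), hσ.le.trans hσT,
        mul_nonneg (hσ.le.trans hσT) (sq_nonneg ‖y‖)]
    have h2 : wt z ^ B ≤ (1 + T) ^ B * wt y ^ B := by
      rw [← mul_rpow (by linarith) (wt_pos y).le]
      exact rpow_le_rpow (wt_pos z).le hw hB
    have h3 : wt y ^ (-(B + n + 1)) * wt y ^ B = wt y ^ (-(n + 1 : ℝ)) := by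
      rw [← rpow_add (wt_pos y)]; congr 1; ring
    have := (wt_rpow_pos y (-(B + n + 1))).le
    calc _ ≤ σ ^ (-(n / 2 : ℝ)) * wt y ^ (-(B + n + 1)) * ((1 + T) ^ B * wt y ^ B) := by gcongr
      _ = σ ^ (-(n / 2 : ℝ)) * (1 + T) ^ B * (wt y ^ (-(B + n + 1)) * wt y ^ B) := by ring
      _ = _ := by rw [h3]
  have hnn : ∀ z : Spc n, 0 ≤ σ ^ (-(n / 2 : ℝ)) * wt (σ ^ (-(1 / 2) : ℝ) • z) ^ (-(B + n + 1)) *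
      wt z ^ B := fun z => by
    have := (wt_rpow_pos (σ ^ (-(1 / 2) : ℝ) • z) (-(B + n + 1))).le
    have := (wt_rpow_pos z B).le
    positivity
  have hI := h1.mono' (f := fun z : Spc n => σ ^ (-(n / 2 : ℝ)) *
      wt (σ ^ (-(1 / 2) : ℝ) • z) ^ (-(B + n + 1)) * wt z ^ B)
    (((continuous_const.mul ((continuous_wt_rpow _).comp (by fun_prop))).mul
      (continuous_wt_rpow _)).aestronglyMeasurable)
    (Eventually.of_forall fun z => by rw [norm_of_nonneg (hnn z)]; exact hle z)
  refine ⟨hI, (integral_mono hI h1 hle).trans (le_of_eq ?_)⟩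
  rw [integral_const_mul, Measure.integral_comp_smul volume (fun y : Spc n => wt y ^ (-(n + 1 : ℝ)))]
  have : |((σ ^ (-(1 / 2) : ℝ)) ^ Module.finrank ℝ (Spc n))⁻¹| = σ ^ ((n : ℝ) / 2) := by
    rw [finrank_euclideanSpace_fin, abs_of_pos (by positivity), ← rpow_natCast,
      ← rpow_mul hσ.le, ← rpow_neg hσ.le]
    congr 1; ring
  rw [this, smul_eq_mul, rpow_neg hσ.le]
  field_simp

/-- `∫ |g| w^B ≤ a`, with integrability. -/
def WInt (B a : ℝ) (g : 𝓕) : Prop :=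
  Integrable (fun z => |g z| * wt z ^ B) ∧ ∫ z, |g z| * wt z ^ B ≤ a

lemma WInt.of_le {h : 𝓕} (hg : AEStronglyMeasurable g volume)
    (hh : Integrable (fun z => h z * wt z ^ B)) (ha : ∫ z, h z * wt z ^ B ≤ a)
    (hle : ∀ z, |g z| ≤ h z) : WInt B a g := by
  have hI : Integrable (fun z => |g z| * wt z ^ B) := by
    refine hh.mono' (hg.norm.mul (continuous_wt_rpow B).aestronglyMeasurable)
      (Eventually.of_forall fun z => ?_)
    rw [norm_of_nonneg (mul_nonneg (abs_nonneg _) (wt_rpow_pos z B).le)]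
    exact mul_le_mul_of_nonneg_right (hle z) (wt_rpow_pos z B).le
  exact ⟨hI, (integral_mono hI hh fun z =>
    mul_le_mul_of_nonneg_right (hle z) (wt_rpow_pos z B).le).trans ha⟩

lemma WInt.mono (h : WInt B a g) (hab : a ≤ b) : WInt B b g :=
  ⟨h.1, h.2.trans hab⟩

lemma WInt.of_abs_le_add {h h' : 𝓕} (hg : AEStronglyMeasurable g volume)
    (hh : WInt B a h) (hh' : WInt B b h') (hle : ∀ z, |g z| ≤ |h z| + |h' z|) :
    WInt B (a + b) g := by
  refine WInt.of_le (h := fun z => |h z| + |h' z|) hg ?_ ?_ hle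
  · simp only [add_mul]; exact hh.1.add hh'.1
  · simp only [add_mul]; rw [integral_add hh.1 hh'.1]; exact add_le_add hh.2 hh'.2

lemma WInt.translate (hB : 0 ≤ B) (hg : Continuous g) (h : WInt B a g)
    (v : Spc n) : WInt B (2 ^ B * wt v ^ B * a) (fun z => g (z - v)) := by
  have h1 : Integrable (fun z : Spc n => 2 ^ B * wt v ^ B * (|g (z - v)| * wt (z - v) ^ B)) :=
    (h.1.comp_sub_right v).const_mul _
  have hle : ∀ z, |g (z - v)| * wt z ^ B ≤ 2 ^ B * wt v ^ B * (|g (z - v)| * wt (z - v) ^ B) :=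
    fun z => by
    calc _ ≤ |g (z - v)| * (2 ^ B * wt v ^ B * wt (z - v) ^ B) :=
          mul_le_mul_of_nonneg_left (wt_rpow_le_sub z v hB) (abs_nonneg _)
      _ = _ := by ring
  have hI : Integrable (fun z => |g (z - v)| * wt z ^ B) := by
    refine h1.mono' ?_ (Eventually.of_forall fun z => ?_)
    · exact ((hg.comp (by fun_prop)).abs.mul (continuous_wt_rpow B)).aestronglyMeasurable
    rw [norm_of_nonneg (mul_nonneg (abs_nonneg _) (wt_rpow_pos z B).le)]
    exact hle z
  refine ⟨hI, (integral_mono hI h1 hle).trans ?_⟩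
  rw [integral_const_mul, integral_sub_right_eq_self (fun z => |g z| * wt z ^ B) v]
  have := (wt_rpow_pos v B).le
  exact mul_le_mul_of_nonneg_left h.2 (by positivity)

section kernel

lemma kf_of_pos (h : 0 < σ) (z : Spc n) :
    kf r ζ σ z = σ ^ (-((n + r) / 2)) * ζ (σ ^ (-(1 / 2) : ℝ) • z) := if_pos h

lemma kf_of_nonpos (h : σ ≤ 0) (z : Spc n) : kf r ζ σ z = 0 := if_neg h.not_gt

lemma continuous_kf (hζ : Continuous ζ) (σ : ℝ) : Continuous (kf r ζ σ) := by
  rcases lt_or_ge 0 σ with h | h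
  · simp only [funext (kf_of_pos (r := r) (ζ := ζ) h)]; fun_prop
  · simp only [funext (kf_of_nonpos (r := r) (ζ := ζ) h)]; fun_prop

lemma rpow_split (h : 0 < σ) (b : ℝ) :
    σ ^ (-((n + r) / 2)) * b = σ ^ (-(r / 2)) * (σ ^ (-(n / 2 : ℝ)) * b) := by
  rw [← mul_assoc, ← rpow_add h]; congr 2; ring

lemma kf_profile_bound (hB : 0 ≤ B) (hσ : 0 < σ) (hσT : σ ≤ T) (ha : 0 ≤ a)
    (hC : ((1 + T) ^ B * ∫ y : Spc n, wt y ^ (-(n + 1 : ℝ))) ≤ C)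
     (hg : AEStronglyMeasurable g volume)
    (hle : ∀ z, |g z| ≤ a * (σ ^ (-(n / 2 : ℝ)) * wt (σ ^ (-(1 / 2) : ℝ) • z) ^ (-(B + n + 1)))) :
    WInt B (a * C) g := by
  obtain ⟨h1, h2⟩ := kf_weight (n := n) hB hσ hσT
  refine WInt.of_le hg ?_ ?_ hle
  · simp only [mul_assoc]; simpa only [mul_assoc] using h1.const_mul a
  · simp only [mul_assoc]; rw [integral_const_mul]
    simp only [mul_assoc] at h2
    exact mul_le_mul_of_nonneg_left (h2.trans hC) ha

set_option maxHeartbeats 2000000 in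
lemma kf_bounds (hn : 2 ≤ n) (hθ0 : 0 < θ) (hθ1 : θ ≤ 1) (hr : 0 ≤ r) (hζ : Prof θ ζ)
    (hB : 0 ≤ B) (hT : 0 ≤ T) : ∃ A, 0 ≤ A ∧
    (∀ σ, 0 < σ → σ ≤ T → WInt B (A * σ ^ (-(r / 2))) (kf r ζ σ)) ∧
    (∀ σ, 0 < σ → σ ≤ T → ∀ v : Spc n, ‖v‖ ≤ 1 →
      WInt B (A * (‖v‖ ^ θ * σ ^ (-((r + θ) / 2)))) (fun z => kf r ζ σ (z - v) - kf r ζ σ z)) ∧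
    (∀ σ h, 0 < σ → 0 < h → σ + h ≤ T →
      WInt B (A * (h ^ (θ / 2) * σ ^ (-((r + θ) / 2))))
        (fun z => kf r ζ (σ + h) z - kf r ζ σ z)) := by
  obtain ⟨hcont, hdec⟩ := hζ
  set m : ℝ := B + n + 1 with hm
  have hm0 : 0 ≤ m := by positivity
  obtain ⟨C, hC, hC1, hC2⟩ := hdec (m + 1) (by positivity)
  have hmm : ∀ y : Spc n, wt y ^ (-(m + 1)) ≤ wt y ^ (-m) := fun y => wt_rpow_mono y (by linarith)
  set J := (1 + T) ^ B * ∫ y : Spc n, wt y ^ (-(n + 1 : ℝ)) with hJ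
  have hJ0 : 0 ≤ J := mul_nonneg (by positivity)
    (integral_nonneg fun y => (wt_rpow_pos y _).le)
  have H0 : ∀ σ, 0 < σ → σ ≤ T → WInt B (C * J * σ ^ (-(r / 2))) (kf r ζ σ) := by
    intro σ hσ hσT
    have h0 : 0 ≤ σ ^ (-(r / 2)) := by positivity
    have := kf_profile_bound (a := σ ^ (-(r / 2)) * C) hB hσ hσT (by positivity) le_rfl
      (continuous_kf (r := r) hcont σ).aestronglyMeasurable fun z => ?_
    · exact this.mono (le_of_eq (by ring))
    rw [kf_of_pos hσ, abs_mul, abs_of_pos (rpow_pos_of_pos hσ _), rpow_split hσ, mul_assoc,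
      mul_left_comm C]
    have := (hC1 (σ ^ (-(1 / 2) : ℝ) • z)).trans (mul_le_mul_of_nonneg_left (hmm _) hC)
    gcongr
  have hrn : 1 ≤ (n + r) / 2 := by
    have : (2 : ℝ) ≤ n := by exact_mod_cast hn
    linarith
  have hθσ : ∀ σ : ℝ, 0 < σ → ∀ h : ℝ, 0 ≤ h → ∀ a, h ^ a * σ ^ (-(r / 2 + a)) =
      (h / σ) ^ a * σ ^ (-(r / 2)) := fun σ hσ h hh a => by
    rw [div_rpow hh hσ.le, neg_add, rpow_add hσ, rpow_neg hσ.le a]; ring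
  set A1 := C * J * (1 + 2 ^ B * 2 ^ B) with hA1
  set A2 := ((n + r) / 2 * C * 2 ^ (m + 1) + C * (1 + 2 ^ (m + 1))) * J with hA2
  have hA10 : 0 ≤ A1 := by positivity
  have hA20 : 0 ≤ A2 := by positivity
  have hCJ : 0 ≤ C * J := by positivity
  refine ⟨2 * (C * J) + A1 + A2, by positivity, fun σ hσ hσT => (H0 σ hσ hσT).mono ?_,
    fun σ hσ hσT v hv => ?_, fun σ h hσ hh hσT => ?_⟩
  · have : 0 ≤ σ ^ (-(r / 2)) := by positivity
    gcongr; linarith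
  · -- spatial differences
    set s := σ ^ (-(1 / 2) : ℝ) with hs
    have hs0 : 0 < s := rpow_pos_of_pos hσ _
    have hsθ : s ^ θ = σ ^ (-(θ / 2)) := by rw [hs, ← rpow_mul hσ.le]; congr 1; ring
    set g : 𝓕 := fun z => σ ^ (-(n / 2 : ℝ)) * wt (s • z) ^ (-m) with hg
    have hgc : Continuous g := continuous_const.mul ((continuous_wt_rpow _).comp (by fun_prop))
    have hg0 : ∀ z, 0 ≤ g z := fun z => by
      have := (wt_rpow_pos (s • z) (-m)).le
      simp only [hg]; positivity
    have hgI : WInt B J g := by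
      have := kf_profile_bound (a := 1) hB hσ hσT zero_le_one le_rfl hgc.aestronglyMeasurable
        (g := g) fun z => by rw [abs_of_nonneg (hg0 z), one_mul]
      simpa only [one_mul] using this
    have ht := (hgI.translate hB hgc v)
    set D := C * (‖v‖ ^ θ * σ ^ (-((r + θ) / 2))) with hD
    have hD0 : 0 ≤ D := by positivity
    have e1 : WInt B (D * J) (fun z => D * g z) := by
      refine ⟨?_, ?_⟩
      · simpa only [abs_mul, mul_assoc] using hgI.1.const_mul |D|
      · simp only [abs_mul, mul_assoc]; rw [integral_const_mul, abs_of_nonneg hD0]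
        exact mul_le_mul_of_nonneg_left hgI.2 hD0
    have e2 : WInt B (D * (2 ^ B * wt v ^ B * J)) (fun z => D * g (z - v)) := by
      refine ⟨?_, ?_⟩
      · simpa only [abs_mul, mul_assoc] using ht.1.const_mul |D|
      · simp only [abs_mul, mul_assoc]; rw [integral_const_mul, abs_of_nonneg hD0]
        exact mul_le_mul_of_nonneg_left (by simpa only [mul_assoc] using ht.2) hD0
    have hk := continuous_kf (r := r) hcont σ
    refine (WInt.of_abs_le_add ((hk.comp (by fun_prop)).sub hk).aestronglyMeasurable e1 e2
      fun z => ?_).mono ?_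
    · change |kf r ζ σ (z - v) - kf r ζ σ z| ≤ _
      rw [kf_of_pos hσ, kf_of_pos hσ, ← mul_sub, abs_mul, abs_of_pos (rpow_pos_of_pos hσ _),
        abs_mul D, abs_mul D, abs_of_nonneg hD0, abs_of_nonneg (hg0 _), abs_of_nonneg (hg0 _)]
      have h1 := hC2 (s • (z - v)) (s • z)
      rw [← smul_sub, sub_sub_cancel_left, smul_neg, norm_neg, norm_smul, norm_eq_abs,
        abs_of_pos hs0, mul_rpow hs0.le (norm_nonneg _), hsθ] at h1
      have h2 := hmm (s • (z - v))
      have h3 := hmm (s • z)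
      calc _ ≤ σ ^ (-((n + r) / 2)) * (C * (σ ^ (-(θ / 2)) * ‖v‖ ^ θ) *
            (wt (s • (z - v)) ^ (-m) + wt (s • z) ^ (-m))) := by
            refine mul_le_mul_of_nonneg_left (h1.trans ?_) (by positivity)
            gcongr
        _ = _ := by
          rw [rpow_split hσ]
          simp only [hD, hg]
          rw [show -((r + θ) / 2) = -(r / 2) + -(θ / 2) by ring, rpow_add hσ]
          ring
    · have hw : wt v ^ B ≤ 2 ^ B :=
        rpow_le_rpow (wt_pos _).le ((wt_le _).trans (by linarith)) hB
      have hX : 0 ≤ ‖v‖ ^ θ * σ ^ (-((r + θ) / 2)) := by positivity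
      calc D * J + D * (2 ^ B * wt v ^ B * J) ≤ D * J + D * (2 ^ B * 2 ^ B * J) := by gcongr
        _ = A1 * (‖v‖ ^ θ * σ ^ (-((r + θ) / 2))) := by simp only [hA1, hD]; ring
        _ ≤ _ := by gcongr; linarith
  · -- time differences
    have hσ' : 0 < σ + h := by linarith
    have hk := continuous_kf (r := r) hcont σ
    have hk' := continuous_kf (r := r) hcont (σ + h)
    have hX : 0 ≤ h ^ (θ / 2) * σ ^ (-((r + θ) / 2)) := by positivity
    have eX : h ^ (θ / 2) * σ ^ (-((r + θ) / 2)) = (h / σ) ^ (θ / 2) * σ ^ (-(r / 2)) := by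
      rw [← hθσ σ hσ h hh.le]; congr 2; ring
    have hr0 : 0 ≤ σ ^ (-(r / 2)) := by positivity
    rcases le_or_gt σ h with hc | hc
    · refine (WInt.of_abs_le_add (hk'.sub hk).aestronglyMeasurable (H0 (σ + h) hσ' hσT)
        (H0 σ hσ (by linarith)) fun z => abs_sub _ _).mono ?_
      have h1 : (σ + h) ^ (-(r / 2)) ≤ σ ^ (-(r / 2)) :=
        rpow_le_rpow_of_nonpos hσ (by linarith) (by linarith)
      have h2 : 1 ≤ (h / σ) ^ (θ / 2) := one_le_rpow ((one_le_div hσ).2 hc) (by linarith)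
      rw [eX]
      calc _ ≤ C * J * σ ^ (-(r / 2)) + C * J * σ ^ (-(r / 2)) := by gcongr
        _ = 2 * (C * J) * (1 * σ ^ (-(r / 2))) := by ring
        _ ≤ _ := by gcongr; linarith
    · set x := σ / (σ + h) with hx
      have hx1 : x ≤ 1 := (div_le_one hσ').2 (by linarith)
      have hx2 : 1 / 2 ≤ x := by rw [hx, div_le_div_iff₀ (by norm_num) hσ']; linarith
      have hx0 : 0 < x := by linarith
      have hxe : 1 - x ≤ h / σ := by
        rw [hx, one_sub_div hσ'.ne', add_sub_cancel_left]; gcongr; linarith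
      have hhσ : h / σ ≤ 1 := (div_le_one hσ).2 hc.le
      have hhσ0 : 0 < h / σ := div_pos hh hσ
      set ρ := x ^ (1 / 2 : ℝ) with hρ
      have hρ1 : ρ ≤ 1 := rpow_le_one hx0.le hx1 (by norm_num)
      have hρx : x ≤ ρ := by
        have := rpow_le_rpow_of_exponent_ge hx0 hx1 (show (1 / 2 : ℝ) ≤ 1 by norm_num)
        rwa [rpow_one] at this
      have hss : (σ + h) ^ (-(1 / 2) : ℝ) = ρ * σ ^ (-(1 / 2) : ℝ) := by
        rw [hρ, hx, div_rpow hσ.le hσ'.le, rpow_neg hσ'.le, rpow_neg hσ.le]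
        have := (rpow_pos_of_pos hσ (1 / 2)).ne'
        field_simp
      have hse : (σ + h) ^ (-((n + r) / 2)) = x ^ ((n + r) / 2) * σ ^ (-((n + r) / 2)) := by
        rw [hx, div_rpow hσ.le hσ'.le, rpow_neg hσ'.le, rpow_neg hσ.le]
        have := (rpow_pos_of_pos hσ ((n + r) / 2)).ne'
        field_simp
      have hb1 : 1 - x ^ ((n + r) / 2) ≤ (n + r) / 2 * (h / σ) := by
        have := one_add_mul_self_le_rpow_one_add (s := x - 1) (by linarith) hrn
        rw [add_sub_cancel] at this
        nlinarith
      have hb0 : x ^ ((n + r) / 2) ≤ 1 := rpow_le_one hx0.le hx1 (by linarith)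
      have hp : h / σ ≤ (h / σ) ^ (θ / 2) := by
        have := rpow_le_rpow_of_exponent_ge hhσ0 hhσ (show θ / 2 ≤ 1 by linarith)
        rwa [rpow_one] at this
      have hp' : (h / σ) ^ θ ≤ (h / σ) ^ (θ / 2) :=
        rpow_le_rpow_of_exponent_ge hhσ0 hhσ (by linarith)
      set y : ℝ := (h / σ) ^ (θ / 2) with hy
      have hy0 : 0 ≤ y := by positivity
      have := kf_profile_bound (B := B) (T := T) (σ := σ)
        (a := y * σ ^ (-(r / 2)) * ((n + r) / 2 * C * 2 ^ (m + 1) + C * (1 + 2 ^ (m + 1))))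
        (g := fun z => kf r ζ (σ + h) z - kf r ζ σ z) hB hσ (by linarith) (by positivity) le_rfl
        (hk'.sub hk).aestronglyMeasurable fun z => ?_
      · refine this.mono ?_
        rw [eX]
        calc _ = A2 * (y * σ ^ (-(r / 2))) := by simp only [hA2]; ring
          _ ≤ _ := by gcongr; linarith
      rw [kf_of_pos hσ, kf_of_pos hσ', hss, hse, mul_smul]
      generalize σ ^ (-(1 / 2) : ℝ) • z = a
      have hwa := wt_pos a
      have w1 : wt (ρ • a) ^ (-(m + 1)) ≤ 2 ^ (m + 1) * wt a ^ (-(m + 1)) := by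
        have : wt a ≤ 2 * wt (ρ • a) := by
          refine le_of_sq_le_sq ?_ (by have := (wt_pos (ρ • a)).le; positivity)
          rw [mul_pow, wt_sq, wt_sq, norm_smul, mul_pow, norm_eq_abs, sq_abs]
          have : 1 / 4 ≤ ρ ^ 2 := by nlinarith
          nlinarith [sq_nonneg ‖a‖]
        rw [rpow_neg (wt_pos _).le, rpow_neg hwa.le, ← div_eq_mul_inv,
          le_div_iff₀ (by positivity), inv_mul_le_iff₀ (wt_rpow_pos _ _), mul_comm,
          ← mul_rpow (by norm_num) (wt_pos _).le]
        exact rpow_le_rpow hwa.le this (by linarith)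
      have hζb : |ζ (ρ • a)| ≤ C * (2 ^ (m + 1) * wt a ^ (-m)) := by
        refine (hC1 _).trans (mul_le_mul_of_nonneg_left (w1.trans ?_) hC)
        exact mul_le_mul_of_nonneg_left (hmm a) (by positivity)
      have hζd : |ζ (ρ • a) - ζ a| ≤ C * (1 + 2 ^ (m + 1)) * (y * wt a ^ (-m)) := by
        have h1 := hC2 (ρ • a) a
        have h2 : ‖ρ • a - a‖ ≤ h / σ * wt a := by
          rw [show ρ • a - a = (ρ - 1) • a by rw [sub_smul, one_smul], norm_smul, norm_eq_abs,
            abs_of_nonpos (by linarith)]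
          have := norm_le_wt a
          gcongr; linarith
        have h3 : ‖ρ • a - a‖ ^ θ ≤ y * wt a := by
          refine (rpow_le_rpow (norm_nonneg _) h2 hθ0.le).trans ?_
          rw [mul_rpow hhσ0.le hwa.le]
          have : wt a ^ θ ≤ wt a := by simpa using wt_rpow_mono a hθ1
          gcongr
        have h4 : wt a * wt a ^ (-(m + 1)) = wt a ^ (-m) := by
          nth_rewrite 1 [← rpow_one (wt a)]
          rw [← rpow_add hwa]; congr 1; ring
        calc _ ≤ C * (y * wt a) * (2 ^ (m + 1) * wt a ^ (-(m + 1)) + wt a ^ (-(m + 1))) := by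
              refine h1.trans ?_
              have := (wt_rpow_pos a (-(m+1))).le
              have := (wt_rpow_pos (ρ • a) (-(m+1))).le
              gcongr
          _ = C * (1 + 2 ^ (m + 1)) * (y * (wt a * wt a ^ (-(m + 1)))) := by ring
          _ = _ := by rw [h4]
      have hwm := (wt_rpow_pos a (-m)).le
      have key : |x ^ ((n + r) / 2) * ζ (ρ • a) - ζ a| ≤
          y * ((n + r) / 2 * C * 2 ^ (m + 1) + C * (1 + 2 ^ (m + 1))) * wt a ^ (-m) := by
        calc _ = |(ζ (ρ • a) - ζ a) - (1 - x ^ ((n + r) / 2)) * ζ (ρ • a)| := by congr 1; ring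
          _ ≤ |ζ (ρ • a) - ζ a| + |(1 - x ^ ((n + r) / 2)) * ζ (ρ • a)| := abs_sub _ _
          _ ≤ C * (1 + 2 ^ (m + 1)) * (y * wt a ^ (-m)) +
              ((n + r) / 2 * y) * (C * (2 ^ (m + 1) * wt a ^ (-m))) := by
            rw [abs_mul, abs_of_nonneg (by linarith : 0 ≤ 1 - x ^ ((n + r) / 2))]
            gcongr
            exact hb1.trans (by gcongr)
          _ = _ := by ring
      calc _ = σ ^ (-((n + r) / 2)) * |x ^ ((n + r) / 2) * ζ (ρ • a) - ζ a| := by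
            rw [← abs_of_pos (rpow_pos_of_pos hσ (-((n + r) / 2))), ← abs_mul,
              abs_of_pos (rpow_pos_of_pos hσ (-((n + r) / 2)))]
            congr 1; ring
        _ ≤ σ ^ (-((n + r) / 2)) * (y * ((n + r) / 2 * C * 2 ^ (m + 1) +
            C * (1 + 2 ^ (m + 1))) * wt a ^ (-m)) :=
          mul_le_mul_of_nonneg_left key (rpow_nonneg hσ.le _)
        _ = _ := by rw [rpow_split hσ]; ring

end kernel

/-- The truncated singular weight `σ^{-β}`. -/
def sgw (β σ : ℝ) : ℝ := if 0 < σ then σ ^ (-β) else 0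

lemma sgw_nonneg (β σ : ℝ) : 0 ≤ sgw β σ := by unfold sgw; split_ifs <;> positivity

lemma measurable_sgw (β : ℝ) : Measurable (sgw β) :=
  Measurable.ite measurableSet_Ioi (by fun_prop) measurable_const

lemma sgw_intervalIntegrable {β : ℝ} (hβ : β < 1) (a b : ℝ) :
    IntervalIntegrable (sgw β) volume a b := by
  have h := (intervalIntegral.intervalIntegrable_rpow' (a := a) (b := b) (r := -β) (by linarith))
  refine h.mono_fun (measurable_sgw β).aestronglyMeasurable (Eventually.of_forall fun x => ?_)
  simp only [sgw]
  split_ifs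
  · exact le_rfl
  · simp

/-- `τ ↦ (t - τ)_+^{-β}` has bounded integral over `(0,T]`. -/
lemma sgw_bound {β : ℝ} (hβ : β < 1) : ∃ A, 0 ≤ A ∧ ∀ t ∈ Icc 0 T,
    Integrable (fun τ => sgw β (t - τ)) (volume.restrict (Ioc 0 T)) ∧
    ∫ τ in Ioc 0 T, sgw β (t - τ) ≤ A := by
  refine ⟨|∫ σ in (-T)..T, sgw β σ|, abs_nonneg _, fun t ht => ?_⟩
  have hT : 0 ≤ T := ht.1.trans ht.2
  have hi : IntervalIntegrable (fun τ => sgw β (t - τ)) volume 0 T := by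
    simpa using (sgw_intervalIntegrable hβ t (t - T)).comp_sub_left t
  refine ⟨(intervalIntegrable_iff_integrableOn_Ioc_of_le hT).1 hi, ?_⟩
  rw [← intervalIntegral.integral_of_le hT, intervalIntegral.integral_comp_sub_left, sub_zero]
  refine le_trans ?_ (le_abs_self _)
  exact intervalIntegral.integral_mono_interval (by linarith [ht.1]) (by linarith [ht.2]) ht.2
    (Eventually.of_forall fun x => sgw_nonneg β x) (sgw_intervalIntegrable hβ _ _)

/-- The measure on `(0,T] × ℝⁿ`. -/
def slabM (n : ℕ) (T : ℝ) : Measure (ℝ × Spc n) :=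
  (volume.restrict (Ioc 0 T)).prod volume

lemma slabM_ae {P : ℝ → Prop} (h : ∀ τ ∈ Ioc 0 T, P τ) :
    ∀ᵐ p ∂slabM n T, P p.1 := by
  refine Measure.quasiMeasurePreserving_fst.ae (p := P) ?_
  filter_upwards [ae_restrict_mem measurableSet_Ioc] with τ hτ using h τ hτ

lemma slab_integrable {K : ℝ × Spc n → ℝ} (hK : Measurable K) {φ : ℝ → ℝ}
    (hφ : Integrable φ (volume.restrict (Ioc 0 T)))
    (h : ∀ τ ∈ Ioc 0 T, WInt B (φ τ) fun z => K (τ, z)) :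
    Integrable (fun p => |K p| * wt p.2 ^ B) (slabM n T) ∧
    ∫ p, |K p| * wt p.2 ^ B ∂slabM n T ≤ ∫ τ in Ioc 0 T, φ τ := by
  have hae : ∀ᵐ τ ∂(volume.restrict (Ioc 0 T)), WInt B (φ τ) fun z => K (τ, z) := by
    filter_upwards [ae_restrict_mem measurableSet_Ioc] with τ hτ using h τ hτ
  have hm : AEStronglyMeasurable (fun p : ℝ × Spc n => |K p| * wt p.2 ^ B) (slabM n T) :=
    ((hK.norm).mul ((continuous_wt_rpow B).measurable.comp measurable_snd)).aestronglyMeasurable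
  have hnn : ∀ p : ℝ × Spc n, 0 ≤ |K p| * wt p.2 ^ B := fun p =>
    mul_nonneg (abs_nonneg _) (wt_rpow_pos _ _).le
  have hI : Integrable (fun p => |K p| * wt p.2 ^ B) (slabM n T) := by
    refine (integrable_prod_iff hm).2 ⟨hae.mono fun τ h => h.1, ?_⟩
    refine hφ.mono' hm.norm.integral_prod_right' (hae.mono fun τ h => ?_)
    simp only [norm_of_nonneg (hnn _)]
    rw [norm_of_nonneg (integral_nonneg fun z => hnn (τ, z))]
    exact h.2
  refine ⟨hI, ?_⟩
  rw [slabM, integral_prod _ hI]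
  exact integral_mono_ae hI.integral_prod_left hφ (hae.mono fun τ h => h.2)

/-- Weighted bounds with Hölder control of time differences and of spatial increments. -/
def HV (T θ : ℝ) (W C : ℝ) (N : ℕ) (f : 𝓣) : Prop :=
  (∀ t ∈ Icc 0 T, GX N W C (f t)) ∧
  (∀ t ∈ Icc 0 T, ∀ t' ∈ Icc 0 T,
    GX N W (C * |t - t'| ^ (θ / 2)) (fun x => f t x - f t' x)) ∧
  ∀ t ∈ Icc 0 T, ∀ v : Spc n, ‖v‖ ≤ 1 →
    GX N W (C * ‖v‖ ^ θ) (fun x => f t (x - v) - f t x)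

section HV

variable {f g : ℝ → Spc n → ℝ}

lemma GX.congr {f g : 𝓕} (h : GX N W C f) (e : ∀ x, g x = f x) : GX N W C g := by
  rwa [funext e]

lemma HV.mono (h : HV T θ W C N f) (hC : C ≤ C') : HV T θ W C' N f :=
  ⟨fun t ht => (h.1 t ht).mono hC,
    fun t ht t' ht' => (h.2.1 t ht t' ht').mono (by gcongr),
    fun t ht v hv => (h.2.2 t ht v hv).mono (by gcongr)⟩

lemma HV.mono_N (h : HV T θ W C N f) (hM : M ≤ N) : HV T θ W C M f :=
  ⟨fun t ht => (h.1 t ht).mono_N hM, fun t ht t' ht' => (h.2.1 t ht t' ht').mono_N hM,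
    fun t ht v hv => (h.2.2 t ht v hv).mono_N hM⟩

lemma HV.mono_W (h : HV T θ W C N f) (hV : V ≤ W) : HV T θ V C N f :=
  ⟨fun t ht => (h.1 t ht).mono_W hV, fun t ht t' ht' => (h.2.1 t ht t' ht').mono_W hV,
    fun t ht v hv => (h.2.2 t ht v hv).mono_W hV⟩

lemma HV.congr (h : HV T θ W C N f) (e : ∀ t ∈ Icc 0 T, ∀ x, g t x = f t x) :
    HV T θ W C N g :=
  ⟨fun t ht => (h.1 t ht).congr (e t ht),
    fun t ht t' ht' => (h.2.1 t ht t' ht').congr fun x => by rw [e t ht, e t' ht'],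
    fun t ht v hv => (h.2.2 t ht v hv).congr fun x => by rw [e t ht, e t ht]⟩

lemma HV.add (h : HV T θ W C N f) (h' : HV T θ W C' N g) :
    HV T θ W (C + C') N (fun t x => f t x + g t x) :=
  ⟨fun t ht => (h.1 t ht).add (h'.1 t ht),
    fun t ht t' ht' => (((h.2.1 t ht t' ht').add (h'.2.1 t ht t' ht')).mono
      (le_of_eq (by ring))).congr fun x => by ring,
    fun t ht v hv => (((h.2.2 t ht v hv).add (h'.2.2 t ht v hv)).mono
      (le_of_eq (by ring))).congr fun x => by ring⟩

lemma HV.smul (h : HV T θ W C N f) (c : ℝ) : HV T θ W (|c| * C) N (fun t x => c * f t x) :=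
  ⟨fun t ht => (h.1 t ht).smul c,
    fun t ht t' ht' => (((h.2.1 t ht t' ht').smul c).mono (le_of_eq (by ring))).congr
      fun x => by ring,
    fun t ht v hv => (((h.2.2 t ht v hv).smul c).mono (le_of_eq (by ring))).congr
      fun x => by ring⟩

lemma HV.sct (hW : 0 ≤ W) (hθ : 0 < θ) (h : HV T θ W C N f) : SCt T N f :=
  SCt.of_holder hW (half_pos hθ) (fun t ht => (h.1 t ht).1) h.2.1

lemma HV.sg (hW : 0 ≤ W) (hθ : 0 < θ) (h : HV T θ W C N f) : SG T W C N f :=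
  ⟨h.1, h.sct hW hθ⟩

lemma HV.nonneg (hT : 0 ≤ T) (h : HV T θ W C N f) : 0 ≤ C := (h.1 0 ⟨le_rfl, hT⟩).nonneg

lemma pd_sub {f g : 𝓕} (hf : Differentiable ℝ f) (hg : Differentiable ℝ g) (i : Fin n) :
    pd i (fun x => f x - g x) = fun x => pd i f x - pd i g x := by
  funext x
  simp only [pd]
  rw [fderiv_fun_sub (hf x) (hg x)]
  rfl

lemma pd_add {f g : 𝓕} (hf : Differentiable ℝ f) (hg : Differentiable ℝ g) (i : Fin n) :
    pd i (fun x => f x + g x) = fun x => pd i f x + pd i g x := by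
  funext x
  simp only [pd]
  rw [fderiv_fun_add (hf x) (hg x)]
  rfl

lemma pd_const_mul (c : ℝ) {f : 𝓕} (i : Fin n) :
    pd i (fun x => c * f x) = fun x => c * pd i f x := by
  funext x
  simp only [pd]
  have : (fun x => c * f x) = c • f := rfl
  rw [this, fderiv_const_smul_field]
  rfl

lemma pd_translate (f : 𝓕) (v : Spc n) (i : Fin n) :
    pd i (fun x => f (x - v)) = fun x => pd i f (x - v) := by
  funext x
  simp only [pd, sub_eq_add_neg, fderiv_comp_add_right]

lemma pd_sum {ι : Type*} (S : Finset ι) {F : ι → 𝓕} (h : ∀ a ∈ S, Differentiable ℝ (F a))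
    (i : Fin n) : pd i (fun x => ∑ a ∈ S, F a x) = fun x => ∑ a ∈ S, pd i (F a) x := by
  funext x
  simp only [pd]
  rw [fderiv_fun_sum fun a ha => h a ha x]
  simp

lemma HV.differentiable (h : HV T θ W C (N + 1) f) (ht : t ∈ Icc 0 T) :
    Differentiable ℝ (f t) := (h.1 t ht).1.differentiable (by simp)

lemma HV.pd (h : HV T θ W C (N + 1) f) (i : Fin n) :
    HV T θ (W + 1) C N (fun t => pd i (f t)) := by
  refine ⟨fun t ht => (h.1 t ht).pd i, fun t ht t' ht' => ?_, fun t ht v hv => ?_⟩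
  · refine ((h.2.1 t ht t' ht').pd i).congr fun x => ?_
    rw [pd_sub (h.differentiable ht) (h.differentiable ht')]
  · refine ((h.2.2 t ht v hv).pd i).congr fun x => ?_
    rw [pd_sub (f := fun x => f t (x - v))
      ((h.differentiable ht).comp (by fun_prop : Differentiable ℝ fun x : Spc n => x - v))
      (h.differentiable ht), pd_translate]

lemma HV.of_pd (h1 : HV T θ W C 1 f) (h : ∀ i, HV T θ (W + 1) C N (fun t => NSdeRham.pd i (f t))) :
    HV T θ W ((n + 1) * C) (N + 1) f := by
  have hd : ∀ t ∈ Icc 0 T, Differentiable ℝ (f t) := fun t ht => HV.differentiable h1 ht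
  refine ⟨fun t ht => GX.of_pd (h1.1 t ht) fun i => (h i).1 t ht, fun t ht t' ht' => ?_,
    fun t ht v hv => ?_⟩
  · refine (GX.of_pd (h1.2.1 t ht t' ht') fun i => ?_).mono (le_of_eq (by ring))
    rw [pd_sub (hd t ht) (hd t' ht')]
    exact (h i).2.1 t ht t' ht'
  · refine (GX.of_pd (h1.2.2 t ht v hv) fun i => ?_).mono (le_of_eq (by ring))
    rw [pd_sub (f := fun x => f t (x - v))
      ((hd t ht).comp (by fun_prop : Differentiable ℝ fun x : Spc n => x - v)) (hd t ht),
      pd_translate]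
    exact (h i).2.2 t ht v hv

end HV

/-- Potential of `f` with a parabolically scaled kernel of profile `ζ`. -/
def VP (T r : ℝ) (ζ : 𝓕) (f : 𝓣) (t : ℝ) (x : Spc n) : ℝ :=
  ∫ p, kf r ζ (t - p.1) p.2 * f p.1 (x - p.2) ∂slabM n T

lemma measurable_kf (hζ : Continuous ζ) :
    Measurable fun p : ℝ × Spc n => kf r ζ p.1 p.2 := by
  unfold kf
  refine Measurable.ite (measurableSet_lt measurable_const measurable_fst) ?_ measurable_const
  refine (measurable_fst.pow_const _).mul (hζ.measurable.comp ?_)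
  exact (measurable_fst.pow_const _).smul measurable_snd

lemma measurable_kf_sub (hζ : Continuous ζ) (t : ℝ) (v : Spc n) :
    Measurable fun p : ℝ × Spc n => kf r ζ (t - p.1) (p.2 - v) :=
  (measurable_kf (r := r) hζ).comp (by fun_prop : Measurable fun p : ℝ × Spc n => (t - p.1, p.2 - v))

lemma WInt.zero : WInt B 0 (fun _ : Spc n => 0) := by
  simp [WInt]

section VP

variable {f : ℝ → Spc n → ℝ}

lemma slab_conv (hT : 0 ≤ T) (hW : 0 ≤ W) {K : ℝ × Spc n → ℝ} (hK : Measurable K) {φ : ℝ → ℝ}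
    (hφ : Integrable φ (volume.restrict (Ioc 0 T)))
    (ha : ∫ τ in Ioc 0 T, φ τ ≤ a)
    (h : ∀ τ ∈ Ioc 0 T, WInt (W + N) (φ τ) fun z => K (τ, z)) (hf : SG T W C N f) :
    GX N W (2 ^ (W + N) * (a * C)) (fun x => ∫ p, K p * f p.1 (x - p.2) ∂slabM n T) ∧
    (∀ x, Integrable (fun p => K p * f p.1 (x - p.2)) (slabM n T)) := by
  obtain ⟨hI, hle⟩ := slab_integrable hK hφ h
  have hC := (hf.1 0 ⟨le_rfl, hT⟩).nonneg
  obtain ⟨h1, h2, -⟩ := conv_GX (ν := slabM n T) (τ := Prod.fst) (z := Prod.snd) (c := fun _ => C)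
    hT hW hK.aestronglyMeasurable measurable_fst.aemeasurable measurable_snd.aemeasurable
    (slabM_ae fun τ hτ => ⟨hτ.1.le, hτ.2⟩) hf.1 hf.2 (hI.mul_const C)
  refine ⟨h1.mono ?_, h2⟩
  rw [integral_mul_const]
  gcongr
  exact hle.trans ha

lemma kf_zero_WInt (h : σ ≤ 0) : WInt B 0 (kf r ζ σ : 𝓕) := by
  rw [show kf r ζ σ = fun _ => (0 : ℝ) from funext fun z => kf_of_nonpos h z]
  exact WInt.zero

lemma VP_HV (hn : 2 ≤ n) (hθ0 : 0 < θ) (hθ1 : θ ≤ 1) (hr : 0 ≤ r) (hrθ : r + θ < 2)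
    (hζ : Prof θ ζ) (hT : 0 ≤ T) (hW : 0 ≤ W) (N : ℕ) :
    ∃ A, 0 ≤ A ∧ ∀ C f, SG T W C N f → HV T θ W (A * C) N (VP T r ζ f) := by
  obtain ⟨A, hA, H0, H1, H2⟩ := kf_bounds (B := W + N) (T := T) hn hθ0 hθ1 hr hζ (by positivity) hT
  obtain ⟨S0, hS0, hS0'⟩ := sgw_bound (β := r / 2) (T := T) (by linarith)
  obtain ⟨S1, hS1, hS1'⟩ := sgw_bound (β := (r + θ) / 2) (T := T) (by linarith)
  set D : ℝ := 2 ^ (W + N) with hD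
  have hD0 : 0 ≤ D := by positivity
  have hζc := hζ.1
  have m0 : ∀ t, Measurable fun p : ℝ × Spc n => kf r ζ (t - p.1) p.2 := fun t => by
    simpa using measurable_kf_sub (r := r) hζc t 0
  have G0 : ∀ t ∈ Icc 0 T, ∀ τ ∈ Ioc 0 T,
      WInt (W + N) (A * sgw (r / 2) (t - τ)) (kf r ζ (t - τ)) := by
    intro t ht τ hτ
    rcases lt_or_ge 0 (t - τ) with h | h
    · rw [sgw, if_pos h]; exact H0 _ h (by linarith [hτ.1, ht.2])
    · rw [sgw, if_neg h.not_gt, mul_zero]; exact kf_zero_WInt h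
  have K0 : ∀ C f, SG T W C N f → ∀ t ∈ Icc 0 T, _ := fun C f hf t ht =>
    slab_conv (φ := fun τ => A * sgw (r / 2) (t - τ)) (a := A * S0)
      (K := fun p => kf r ζ (t - p.1) p.2) hT hW (m0 t)
      ((hS0' t ht).1.const_mul A)
      (by rw [integral_const_mul]; exact mul_le_mul_of_nonneg_left (hS0' t ht).2 hA) (G0 t ht) hf
  have tdiff : ∀ C f, SG T W C N f → ∀ t ∈ Icc 0 T, ∀ t' ∈ Icc 0 T, t' < t →
      GX N W (D * (A * |t - t'| ^ (θ / 2) * (2 * S1) * C))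
        (fun x => VP T r ζ f t x - VP T r ζ f t' x) := by
    intro C f hf t ht t' ht' htt
    set h := t - t' with hh
    have hh0 : 0 < h := by linarith
    rw [abs_of_pos hh0]
    have G2 : ∀ τ ∈ Ioc 0 T, WInt (W + N)
        (A * h ^ (θ / 2) * (sgw ((r + θ) / 2) (t' - τ) + sgw ((r + θ) / 2) (t - τ)))
        (fun z => kf r ζ (t - τ) z - kf r ζ (t' - τ) z) := by
      intro τ hτ
      have hs1 := sgw_nonneg ((r + θ) / 2) (t' - τ)
      have hs2 := sgw_nonneg ((r + θ) / 2) (t - τ)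
      have hhp : 0 ≤ h ^ (θ / 2) := by positivity
      rcases lt_or_ge 0 (t' - τ) with h1 | h1
      · have := H2 (t' - τ) h h1 hh0 (by linarith [hτ.1, ht.2])
        rw [show t' - τ + h = t - τ by rw [hh]; ring] at this
        refine this.mono ?_
        have e : sgw ((r + θ) / 2) (t' - τ) = (t' - τ) ^ (-((r + θ) / 2)) := if_pos h1
        rw [← e, mul_assoc]
        gcongr
        linarith
      · have e1 : (fun z => kf r ζ (t - τ) z - kf r ζ (t' - τ) z) = kf r ζ (t - τ) := by
          funext z; rw [kf_of_nonpos h1, sub_zero]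
        rw [e1]
        refine (G0 t ht τ hτ).mono ?_
        rw [mul_assoc]
        refine mul_le_mul_of_nonneg_left ?_ hA
        rcases lt_or_ge 0 (t - τ) with h2 | h2
        · have e : sgw ((r + θ) / 2) (t - τ) = (t - τ) ^ (-((r + θ) / 2)) := if_pos h2
          have e' : sgw (r / 2) (t - τ) = (t - τ) ^ (θ / 2) * (t - τ) ^ (-((r + θ) / 2)) := by
            rw [← rpow_add h2, sgw, if_pos h2]; congr 1; ring
          have h3 : (t - τ) ^ (θ / 2) ≤ h ^ (θ / 2) :=
            rpow_le_rpow h2.le (by linarith) (by linarith)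
          rw [e', ← e]
          have := mul_nonneg hhp hs1
          nlinarith [mul_le_mul_of_nonneg_right h3 hs2]
        · rw [sgw, if_neg h2.not_gt]; positivity
    obtain ⟨g1, -⟩ := slab_conv (f := f) (C := C)
      (φ := fun τ => A * h ^ (θ / 2) * (sgw ((r + θ) / 2) (t' - τ) + sgw ((r + θ) / 2) (t - τ)))
      (a := A * h ^ (θ / 2) * (2 * S1))
      (K := fun p => kf r ζ (t - p.1) p.2 - kf r ζ (t' - p.1) p.2) hT hW
      ((m0 t).sub (m0 t'))
      (((hS1' t' ht').1.add (hS1' t ht).1).const_mul _)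
      (by
        rw [integral_const_mul, integral_add (hS1' t' ht').1 (hS1' t ht).1]
        have h1 := (hS1' t' ht').2
        have h2 := (hS1' t ht).2
        refine mul_le_mul_of_nonneg_left (by linarith) (by positivity)) G2 hf
    refine g1.congr fun x => ?_
    simp only [VP, sub_mul]
    rw [integral_sub ((K0 C f hf t ht).2 x) ((K0 C f hf t' ht').2 x)]
  have vdiff : ∀ C f, SG T W C N f → ∀ t ∈ Icc 0 T, ∀ v : Spc n, ‖v‖ ≤ 1 →
      GX N W (D * (A * ‖v‖ ^ θ * S1 * C)) (fun x => VP T r ζ f t (x - v) - VP T r ζ f t x) := by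
    intro C f hf t ht v hv
    have G1 : ∀ τ ∈ Ioc 0 T, WInt (W + N) (A * ‖v‖ ^ θ * sgw ((r + θ) / 2) (t - τ))
        (fun z => kf r ζ (t - τ) (z - v) - kf r ζ (t - τ) z) := by
      intro τ hτ
      rcases lt_or_ge 0 (t - τ) with h1 | h1
      · rw [sgw, if_pos h1, mul_assoc]; exact H1 _ h1 (by linarith [hτ.1, ht.2]) v hv
      · rw [sgw, if_neg h1.not_gt, mul_zero]
        simp only [kf_of_nonpos h1, sub_zero]
        exact WInt.zero
    have m1 := measurable_kf_sub (r := r) hζc t v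
    obtain ⟨g1, i1⟩ := slab_conv (f := f) (C := C)
      (φ := fun τ => A * ‖v‖ ^ θ * sgw ((r + θ) / 2) (t - τ)) (a := A * ‖v‖ ^ θ * S1)
      (K := fun p => kf r ζ (t - p.1) (p.2 - v) - kf r ζ (t - p.1) p.2) hT hW (m1.sub (m0 t))
      ((hS1' t ht).1.const_mul _)
      (by
        rw [integral_const_mul]
        exact mul_le_mul_of_nonneg_left (hS1' t ht).2 (by positivity)) G1 hf
    refine g1.congr fun x => ?_
    have i0 := (K0 C f hf t ht).2
    have i2 : Integrable (fun p : ℝ × Spc n => kf r ζ (t - p.1) (p.2 - v) * f p.1 (x - p.2))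
        (slabM n T) := by
      have := (i1 x).add (i0 x)
      refine this.congr (Eventually.of_forall fun p => ?_)
      simp only [Pi.add_apply]; ring
    have e1 : VP T r ζ f t (x - v) =
        ∫ p, kf r ζ (t - p.1) (p.2 - v) * f p.1 (x - p.2) ∂slabM n T := by
      have i3 := i0 (x - v)
      rw [VP]
      unfold slabM at i2 i3 ⊢
      rw [integral_prod _ i2, integral_prod _ i3]
      refine integral_congr_ae (Eventually.of_forall fun τ => ?_)
      change ∫ z, kf r ζ (t - τ) z * f τ (x - v - z) = ∫ z, kf r ζ (t - τ) (z - v) * f τ (x - z)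
      rw [← integral_sub_right_eq_self (fun z => kf r ζ (t - τ) z * f τ (x - v - z)) v]
      refine integral_congr_ae (Eventually.of_forall fun z => ?_)
      simp only [sub_sub_sub_cancel_right]
    rw [e1, VP, ← integral_sub i2 (i0 x)]
    simp only [sub_mul]
  refine ⟨D * A * (S0 + 2 * S1), by positivity, fun C f hf => ?_⟩
  have hC := (hf.1 0 ⟨le_rfl, hT⟩).nonneg
  refine ⟨fun t ht => (K0 C f hf t ht).1.mono ?_, fun t ht t' ht' => ?_, fun t ht v hv =>
    (vdiff C f hf t ht v hv).mono ?_⟩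
  · rw [← hD]
    nlinarith [mul_nonneg (mul_nonneg hD0 hA) (mul_nonneg hS1 hC)]
  · have hle : ∀ s : ℝ, 0 ≤ s → D * (A * s * (2 * S1) * C) ≤ D * A * (S0 + 2 * S1) * C * s :=
      fun s hs => by
      nlinarith [mul_nonneg (mul_nonneg hD0 hA) (mul_nonneg (mul_nonneg hS0 hC) hs)]
    rcases lt_trichotomy t' t with h | h | h
    · exact (tdiff C f hf t ht t' ht' h).mono (hle _ (by positivity))
    · subst h
      refine (GX.zero.mono ?_).congr fun x => sub_self _
      positivity
    · have := (tdiff C f hf t' ht' t ht h).neg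
      rw [abs_sub_comm] at this
      exact (this.mono (hle _ (by positivity))).congr fun x => by ring
  · have : 0 ≤ ‖v‖ ^ θ := by positivity
    nlinarith [mul_nonneg (mul_nonneg hD0 hA) (mul_nonneg (mul_nonneg hS0 hC) this),
      mul_nonneg (mul_nonneg hD0 hA) (mul_nonneg (mul_nonneg hS1 hC) this)]

end VP

lemma GX.integrable (hW : (n : ℝ) < W) (hf : GX N W C f) :
    Integrable f :=
  ((integrable_wt_rpow hW).const_mul C).mono' hf.cont.aestronglyMeasurable
    (ae_of_all _ fun x => by simpa using hf.abs_le' x)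

lemma integrable_bdd_mul (hζ : Integrable ζ) (hg : Continuous g)
    (hC : ∀ x, |g x| ≤ C) : Integrable (fun y => ζ y * g y) :=
  hζ.mul_bdd hg.aestronglyMeasurable (ae_of_all _ fun x => by simpa using hC x)

lemma gam_integrable (hμ : 0 < μ) : Integrable (gam μ : 𝓕) := by
  obtain ⟨C, h⟩ := gam_GX (n := n) hμ 0 (n + 1)
  exact h.integrable (by linarith)

lemma pd_gam_integrable (hμ : 0 < μ) (i : Fin n) :
    Integrable (pd i (gam μ : 𝓕)) := by
  obtain ⟨C, h⟩ := GX_all_pd (gam_GX (n := n) hμ) i 0 (n + 1)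
  exact h.integrable (by linarith)

lemma integral_gam (hμ : 0 < μ) : ∫ y : Spc n, gam μ y = 1 := by
  have h4 : (0 : ℝ) < 1 / (4 * μ) := by positivity
  have := GaussianFourier.integral_rexp_neg_mul_sq_norm (V := Spc n) h4
  simp only [gam]
  rw [integral_const_mul]
  have e : (fun y : Spc n => exp (-‖y‖ ^ 2 / (4 * μ))) =
      fun y => exp (-(1 / (4 * μ)) * ‖y‖ ^ 2) := by
    funext y; congr 1; ring
  rw [e, this, finrank_euclideanSpace, Fintype.card_fin,
    show Real.pi / (1 / (4 * μ)) = 4 * Real.pi * μ by field_simp, ← rpow_add (by positivity),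
    show -(n : ℝ) / 2 + n / 2 = 0 by ring, rpow_zero]

lemma integral_kf_zero {G : 𝓕} (hσ : 0 < σ) :
    ∫ z, kf 0 ζ σ z * G z = ∫ y, ζ y * G (√σ • y) := by
  have hR : 0 < σ ^ (-(1 / 2) : ℝ) := rpow_pos_of_pos hσ _
  have e := Measure.integral_comp_smul (volume : Measure (Spc n))
    (fun y => ζ y * G (√σ • y)) (σ ^ (-(1 / 2) : ℝ))
  have h1 : √σ * σ ^ (-(1 / 2) : ℝ) = 1 := by
    rw [sqrt_eq_rpow, ← rpow_add hσ]; norm_num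
  have h2 : |((σ ^ (-(1 / 2) : ℝ)) ^ Module.finrank ℝ (Spc n))⁻¹| * σ ^ (-((n + 0 : ℝ) / 2)) = 1 := by
    rw [abs_of_pos (by positivity), finrank_euclideanSpace, Fintype.card_fin, ← rpow_natCast,
      ← rpow_mul hσ.le, ← rpow_neg hσ.le, ← rpow_add hσ]
    convert rpow_zero σ using 2
    ring
  have e2 : (fun z => kf 0 ζ σ z * G z) = fun z => σ ^ (-((n + 0 : ℝ) / 2)) *
      (ζ (σ ^ (-(1 / 2) : ℝ) • z) * G (√σ • (σ ^ (-(1 / 2) : ℝ) • z))) := by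
    funext z
    rw [kf_of_pos hσ, smul_smul, h1, one_smul]; ring
  rw [e2, integral_const_mul, e, smul_eq_mul, ← mul_assoc, mul_comm (σ ^ _), h2, one_mul]

/-- Parametrised heat average. -/
def heatAv (μ : ℝ) (g : 𝓕) (t : ℝ) (x : Spc n) : ℝ :=
  ∫ y, gam μ y * g (x - √t • y)

lemma continuous_heatAv (hμ : 0 < μ) (hg : Continuous g)
    (hC : ∀ x, |g x| ≤ C) (x : Spc n) : Continuous fun t => heatAv μ g t x := by
  refine continuous_of_dominated (bound := fun y => |gam μ y| * C) (fun t => ?_)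
    (fun t => ae_of_all _ fun y => ?_) ((gam_integrable hμ).abs.mul_const C)
    (ae_of_all _ fun y => ?_)
  · have := (contDiff_gam (n := n) μ (N := 0)).continuous
    exact (by fun_prop : Continuous _).aestronglyMeasurable
  · rw [norm_eq_abs, abs_mul]
    exact mul_le_mul_of_nonneg_left (hC _) (abs_nonneg _)
  · have h : Continuous fun t => x - √t • y := by fun_prop
    exact continuous_const.mul (hg.comp h)

lemma heatAv_zero (hμ : 0 < μ) (g : 𝓕) (x : Spc n) : heatAv μ g 0 x = g x := by
  simp [heatAv, integral_mul_const, integral_gam hμ]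

lemma fderiv_apply_eq_sum (x v : Spc n) :
    fderiv ℝ f x v = ∑ i, pd i f x * v i := by
  rw [fderiv_eq_sum_pd]; simp

lemma pd_comp_scale (hg : Differentiable ℝ g) (x : Spc n) (s : ℝ) (i : Fin n)
    (y : Spc n) : pd i (fun y => g (x - s • y)) y = -s * pd i g (x - s • y) := by
  have h : HasFDerivAt (fun y : Spc n => x - s • y) (-(s • ContinuousLinearMap.id ℝ (Spc n))) y := by
    simpa using ((hasFDerivAt_id y).const_smul s).const_sub x
  have := ((hg (x - s • y)).hasFDerivAt.comp y h).fderiv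
  rw [pd, show (fun y => g (x - s • y)) = g ∘ fun y => x - s • y from rfl, this]
  simp [pd]

lemma hasDerivAt_heatAv (hμ : 0 < μ) (hg : GX 2 0 C g)
    (x : Spc n) (ht : 0 < t) :
    HasDerivAt (fun t => heatAv μ g t x) (μ * heatAv μ (lap g) t x) t := by
  have hgd : Differentiable ℝ g := hg.1.differentiable (by norm_num)
  have hg1 : ∀ i, GX 1 1 C (pd i g) := fun i => by simpa using hg.pd i
  have hg2 : ∀ i, GX 0 2 C (pd i (pd i g)) := fun i => by
    have := (hg1 i).pd i; norm_num at this; exact this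
  have hγc := (contDiff_gam (n := n) μ (N := 0)).continuous
  have hγd : Differentiable ℝ (gam μ : 𝓕) :=
    (contDiff_gam μ (N := 1)).differentiable (by norm_num)
  have hb1 : ∀ i z, |pd i g z| ≤ C := fun i z => (hg1 i).abs_le_const (by norm_num) z
  have hc1 : ∀ i, Continuous (pd i g) := fun i => (hg1 i).cont
  have hb2 : ∀ i z, |pd i (pd i g) z| ≤ C := fun i z => (hg2 i).abs_le_const (by norm_num) z
  have hb0 : ∀ z, |g z| ≤ C := fun z => hg.abs_le_const le_rfl z
  have key := hasDerivAt_integral_of_dominated_loc_of_deriv_le (μ := (volume : Measure (Spc n)))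
    (F := fun t y => gam μ y * g (x - √t • y))
    (F' := fun t y => ∑ i, (μ / √t) * (pd i (gam μ) y * pd i g (x - √t • y)))
    (bound := fun y => ∑ i, (μ / √(t / 2)) * (|pd i (gam μ) y| * C))
    (x₀ := t) (s := Ioi (t / 2)) (Ioi_mem_nhds (by linarith))
    (Eventually.of_forall fun t => by
      have := hg.cont
      exact (by fun_prop : Continuous _).aestronglyMeasurable)
    (integrable_bdd_mul (gam_integrable hμ) (hg.cont.comp (by fun_prop)) fun y => hb0 _)
    (by
      refine Continuous.aestronglyMeasurable (continuous_finsetSum _ fun i _ => ?_)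
      have h1 : Continuous (pd i (gam μ : 𝓕)) := by
        obtain ⟨C, h⟩ := GX_all_pd (gam_GX (n := n) hμ) i 0 0
        exact h.cont
      have := hc1 i
      fun_prop)
    (ae_of_all _ fun y s hs => by
      refine (norm_sum_le _ _).trans (sum_le_sum fun i _ => ?_)
      have hs' : t / 2 < s := hs
      have h1 : 0 < √(t / 2) := sqrt_pos.2 (by linarith)
      have h2 : √(t / 2) ≤ √s := sqrt_le_sqrt hs'.le
      rw [norm_eq_abs, abs_mul, abs_mul, abs_of_nonneg (a := μ / √s) (by positivity)]
      have := hb1 i (x - √s • y)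
      gcongr)
    (integrable_finsetSum _ fun i _ =>
      (((pd_gam_integrable hμ i).abs.mul_const C).const_mul _))
    (ae_of_all _ fun y s hs => by
      have hs' : 0 < s := lt_trans (by linarith) (Set.mem_Ioi.1 hs)
      have h1 : HasDerivAt (fun s => x - √s • y) (-((1 / (2 * √s)) • y)) s := by
        simpa using ((hasDerivAt_sqrt hs'.ne').smul_const y).const_sub x
      have h2 := ((hgd (x - √s • y)).hasFDerivAt.comp_hasDerivAt s h1).const_mul (gam μ y)
      refine h2.congr_deriv ?_
      rw [fderiv_apply_eq_sum, mul_sum]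
      refine sum_congr rfl fun i _ => ?_
      rw [pd_gam]
      simp only [PiLp.neg_apply, PiLp.smul_apply, smul_eq_mul]
      have := sqrt_pos.2 hs'
      field_simp)
  have e : ∫ y, ∑ i, (μ / √t) * (pd i (gam μ) y * pd i g (x - √t • y)) =
      μ * heatAv μ (lap g) t x := by
    have hst : 0 < √t := sqrt_pos.2 ht
    have hI : ∀ i, Integrable fun y => pd i (gam μ) y * pd i g (x - √t • y) := fun i =>
      integrable_bdd_mul (pd_gam_integrable hμ i) ((hc1 i).comp (by fun_prop)) fun y => hb1 i _
    have hI2 : ∀ i, Integrable fun y => gam μ y * pd i (pd i g) (x - √t • y) := fun i =>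
      integrable_bdd_mul (gam_integrable hμ) ((hg2 i).cont.comp (by fun_prop)) fun y => hb2 i _
    have hd1 : ∀ i, Differentiable ℝ (pd i g) := fun i =>
      (hg1 i).1.differentiable (by norm_num)
    rw [integral_finsetSum _ fun i _ => (hI i).const_mul _]
    simp only [heatAv, lap, mul_sum]
    rw [integral_finsetSum _ fun i _ => hI2 i, mul_sum]
    refine sum_congr rfl fun i _ => ?_
    rw [integral_const_mul]
    have hsc : ∀ y, fderiv ℝ (fun y => pd i g (x - √t • y)) y (single i 1) =
      -√t * pd i (pd i g) (x - √t • y) := fun y =>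
        pd_comp_scale (hd1 i) x (√t) i y
    have ibp := integral_mul_fderiv_eq_neg_fderiv_mul_of_integrable (μ := (volume : Measure (Spc n)))
      (f := gam μ) (g := fun y => pd i g (x - √t • y)) (v := single i 1)
      (hI i)
      (by
        simp only [hsc]
        exact ((hI2 i).const_mul (-√t)).congr (ae_of_all _ fun y => by simp only; ring))
      (integrable_bdd_mul (gam_integrable hμ) ((hc1 i).comp (by fun_prop)) fun y => hb1 i _)
      (fun y _ => hγd y) (fun y _ => (hd1 i).differentiableAt.comp y (by fun_prop))
    simp only [hsc] at ibp
    have ibp' : ∫ y, pd i (gam μ) y * pd i g (x - √t • y) =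
        √t * ∫ y, gam μ y * pd i (pd i g) (x - √t • y) := by
      have e3 : ∫ y, gam μ y * (-√t * pd i (pd i g) (x - √t • y)) =
        -√t * ∫ y, gam μ y * pd i (pd i g) (x - √t • y) := by
        rw [← integral_const_mul]; congr 1; funext y; ring
      rw [e3] at ibp
      have : ∫ y, fderiv ℝ (gam μ) y (single i 1) *
        pd i g (x - √t • y) = ∫ y, pd i (gam μ) y * pd i g (x - √t • y) := rfl
      linarith
    rw [ibp']; field_simp
  rw [← e]
  exact key.2

lemma heat_identity (hμ : 0 < μ) (hg : GX 2 0 C g)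
    (x : Spc n) (ht : 0 ≤ t) :
    heatAv μ g t x = g x + μ * ∫ ρ in (0 : ℝ)..t, heatAv μ (lap g) ρ x := by
  have hl : Continuous (lap g) := continuous_finsetSum _ fun i _ => by
    have h : GX 0 _ C (pd i (pd i g)) := (show GX (0 + 1) _ C (pd i g) from hg.pd i).pd i
    exact h.cont
  have hlb : ∀ x, |lap g x| ≤ n * C := fun x => by
    refine (Finset.abs_sum_le_sum_abs _ _).trans ?_
    refine (sum_le_sum (g := fun _ => C) fun i _ => ?_).trans (by simp)
    have h : GX 0 _ C (pd i (pd i g)) := (show GX (0 + 1) _ C (pd i g) from hg.pd i).pd i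
    exact h.abs_le_const (by norm_num) x
  have hc := continuous_heatAv hμ hl hlb x
  have := intervalIntegral.integral_eq_sub_of_hasDerivAt_of_le ht
    (continuous_heatAv hμ hg.cont (fun z => hg.abs_le_const le_rfl z) x).continuousOn
    (fun s hs => hasDerivAt_heatAv hμ hg x hs.1) ((hc.const_smul μ).intervalIntegrable _ _)
  simp only [intervalIntegral.integral_const_mul, heatAv_zero hμ] at this
  linarith

lemma kf_integrable (hn : 2 ≤ n) (hθ0 : 0 < θ) (hθ1 : θ ≤ 1)
    (hr : 0 ≤ r) (hζ : Prof θ ζ) (σ : ℝ) : Integrable (kf r ζ σ) := by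
  rcases le_or_gt σ 0 with h | h
  · rw [show kf r ζ σ = fun _ => 0 from funext fun z => kf_of_nonpos h z]
    exact integrable_zero _ _ _
  · obtain ⟨A, -, H, -⟩ := kf_bounds (B := 0) (T := σ) hn hθ0 hθ1 hr hζ le_rfl h.le
    have := (H σ h le_rfl).1
    simp only [rpow_zero, mul_one] at this
    exact (integrable_norm_iff (continuous_kf hζ.1 σ).aestronglyMeasurable).1 this

lemma VP_slab (hn : 2 ≤ n) (hθ0 : 0 < θ) (hθ1 : θ ≤ 1)
    (hr : 0 ≤ r) (hr2 : r < 2) (hζ : Prof θ ζ) (hT : 0 ≤ T) (hW : 0 ≤ W) (N : ℕ) :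
    (∃ A, 0 ≤ A ∧ ∀ C f, SG T W C N f → ∀ t ∈ Icc 0 T, GX N W (A * C) (VP T r ζ f t) ∧
      ∀ x, Integrable (fun p => kf r ζ (t - p.1) p.2 * f p.1 (x - p.2)) (slabM n T)) ∧
    ∀ t ∈ Icc 0 T, Integrable
      (fun p : ℝ × Spc n => |kf r ζ (t - p.1) p.2| * wt p.2 ^ (W + N)) (slabM n T) := by
  obtain ⟨A, hA, H0, -⟩ := kf_bounds (B := W + N) (T := T) hn hθ0 hθ1 hr hζ (by positivity) hT
  obtain ⟨S0, hS0, hS0'⟩ := sgw_bound (β := r / 2) (T := T) (by linarith)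
  have m0 : ∀ t, Measurable fun p : ℝ × Spc n => kf r ζ (t - p.1) p.2 := fun t => by
    simpa using measurable_kf_sub (r := r) hζ.1 t 0
  have G0 : ∀ t ∈ Icc 0 T, ∀ τ ∈ Ioc 0 T,
      WInt (W + N) (A * sgw (r / 2) (t - τ)) (kf r ζ (t - τ)) := by
    intro t ht τ hτ
    rcases lt_or_ge 0 (t - τ) with h | h
    · rw [sgw, if_pos h]; exact H0 _ h (by linarith [hτ.1, ht.2])
    · rw [sgw, if_neg h.not_gt, mul_zero]; exact kf_zero_WInt h
  refine ⟨⟨2 ^ (W + N) * (A * S0), by positivity, fun C f hf t ht => ?_⟩, fun t ht =>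
    (slab_integrable (m0 t) ((hS0' t ht).1.const_mul A) (G0 t ht)).1⟩
  have := slab_conv (φ := fun τ => A * sgw (r / 2) (t - τ)) (a := A * S0)
    (K := fun p => kf r ζ (t - p.1) p.2) hT hW (m0 t)
    ((hS0' t ht).1.const_mul A)
    (by rw [integral_const_mul]; exact mul_le_mul_of_nonneg_left (hS0' t ht).2 hA) (G0 t ht) hf
  exact ⟨by rw [mul_assoc]; exact this.1, this.2⟩

lemma pd_kf (hζ : Differentiable ℝ ζ) (i : Fin n) (z : Spc n) :
    pd i (kf 0 ζ σ) z = kf 1 (pd i ζ) σ z := by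
  rcases le_or_gt σ 0 with h | h
  · rw [kf_of_nonpos h, show kf 0 ζ σ = fun _ => 0 from funext fun z => kf_of_nonpos h z]
    simp [pd]
  · have e : kf 0 ζ σ = fun z => σ ^ (-((n + 0 : ℝ) / 2)) * ζ (0 - (-(σ ^ (-(1 / 2) : ℝ))) • z) := by
      funext z; rw [kf_of_pos h]; simp
    rw [kf_of_pos h, e, pd_const_mul]
    show _ * pd i (fun z => ζ (0 - (-(σ ^ (-(1 / 2) : ℝ))) • z)) z = _
    rw [pd_comp_scale hζ, neg_neg, ← mul_assoc, ← rpow_add h]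
    congr 2
    · ring
    · simp

lemma kf_ibp (hn : 2 ≤ n) (hμ : 0 < μ) (hg : GX 1 0 C g)
    (i : Fin n) (σ : ℝ) (x : Spc n) :
    ∫ z, kf 0 (gam μ) σ z * pd i g (x - z) = ∫ z, kf 1 (pd i (gam μ)) σ z * g (x - z) := by
  have hd : Differentiable ℝ g := hg.1.differentiable (by norm_num)
  have hg1 : GX 0 _ C (pd i g) := (show GX (0 + 1) 0 C g from hg).pd i
  have hγd : Differentiable ℝ (gam μ : 𝓕) :=
    (contDiff_gam μ (N := 1)).differentiable (by norm_num)
  have P0 := Prof.of_GX (n := n) one_pos le_rfl fun m _ => gam_GX hμ 1 m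
  have P1 := Prof.of_GX (n := n) one_pos le_rfl fun m _ => GX_all_pd (gam_GX hμ) i 1 m
  have I0 := kf_integrable hn one_pos le_rfl le_rfl P0 σ
  have I1 := kf_integrable hn one_pos le_rfl zero_le_one P1 σ
  have hkd : Differentiable ℝ (kf 0 (gam μ) σ : 𝓕) := by
    rcases le_or_gt σ 0 with h | h
    · rw [show kf 0 (gam μ) σ = fun _ : Spc n => (0 : ℝ) from funext fun z => kf_of_nonpos h z]
      exact differentiable_const _
    · rw [show kf 0 (gam μ) σ = _ from funext fun z => kf_of_pos h z]
      exact (hγd.comp (by fun_prop : Differentiable ℝ fun z : Spc n => σ ^ (-(1 / 2) : ℝ) • z)).const_mul _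
  have e1 : ∀ z, fderiv ℝ (fun z => g (x - z)) z (single i 1) = -pd i g (x - z) := by
    intro z
    have := pd_comp_scale hd x 1 i z
    simpa [pd] using this
  have ibp := integral_mul_fderiv_eq_neg_fderiv_mul_of_integrable (μ := (volume : Measure (Spc n)))
    (f := kf 0 (gam μ) σ) (g := fun z => g (x - z)) (v := single i 1)
    (by
      have : ∀ z, fderiv ℝ (kf 0 (gam μ) σ) z (single i 1) =
        kf 1 (pd i (gam μ)) σ z := fun z => pd_kf hγd i z
      simp only [this]
      exact integrable_bdd_mul I1 (hg.cont.comp (by fun_prop)) fun y => hg.abs_le_const le_rfl _)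
    (by
      simp only [e1]
      exact integrable_bdd_mul I0 (hg1.cont.comp (by fun_prop)).neg fun y => by
        rw [abs_neg]; exact hg1.abs_le_const (by norm_num) _)
    (integrable_bdd_mul I0 (hg.cont.comp (by fun_prop)) fun y => hg.abs_le_const le_rfl _)
    (fun z _ => hkd z) (fun z _ => (hd _).comp z (by fun_prop))
  have e2 : ∀ z, fderiv ℝ (kf 0 (gam μ) σ) z (single i 1) =
        kf 1 (pd i (gam μ)) σ z := fun z => pd_kf hγd i z
  simp only [e1, e2, mul_neg, integral_neg, neg_inj] at ibp
  exact ibp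

section potential

variable {f : ℝ → Spc n → ℝ}

lemma gam_prof (hμ : 0 < μ) (h0 : 0 < θ) (h1 : θ ≤ 1) : Prof θ (gam μ : 𝓕) :=
  Prof.of_GX h0 h1 fun m _ => gam_GX hμ 1 m

lemma pd_gam_prof (hμ : 0 < μ) (h0 : 0 < θ) (h1 : θ ≤ 1) (i : Fin n) :
    Prof θ (pd i (gam μ : 𝓕)) :=
  Prof.of_GX h0 h1 fun m _ => GX_all_pd (gam_GX hμ) i 1 m

lemma VP_integrable (hn : 2 ≤ n) (hμ : 0 < μ) (hT : 0 ≤ T) (hf : SG T 0 C 0 f)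
     (ht : t ∈ Icc 0 T) (x : Spc n) :
    Integrable (fun p => kf 0 (gam μ) (t - p.1) p.2 * f p.1 (x - p.2)) (slabM n T) := by
  obtain ⟨⟨A, -, h⟩, -⟩ := VP_slab (T := T) (W := 0) hn one_pos le_rfl le_rfl zero_lt_two
    (gam_prof (n := n) hμ one_pos le_rfl) hT le_rfl 0
  exact (h C f hf t ht).2 x

lemma VP_eq_iterated (hn : 2 ≤ n) (hμ : 0 < μ) (hT : 0 ≤ T) (hf : SG T 0 C 0 f)
     (ht : t ∈ Icc 0 T) (x : Spc n) :
    VP T 0 (gam μ) f t x =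
      ∫ τ in Ioc 0 T, ∫ z, kf 0 (gam μ) (t - τ) z * f τ (x - z) := by
  have h := VP_integrable hn hμ hT hf ht x
  unfold VP; unfold slabM at h ⊢
  exact integral_prod _ h

lemma volPot_eq_VP (hn : 2 ≤ n) (hμ : 0 < μ) (hT : 0 ≤ T) (hf : SG T 0 C 0 f)
     (ht : t ∈ Icc 0 T) (x : Spc n) : volPot μ f t x = VP T 0 (gam μ) f t x := by
  rw [VP_eq_iterated hn hμ hT hf ht, volPot]
  have e : ∀ τ, ∫ y, heatKer μ (x - y) (t - τ) * f τ y =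
      ∫ z, kf 0 (gam μ) (t - τ) z * f τ (x - z) := fun τ => by
    rw [← integral_sub_left_eq_self (fun y => heatKer μ (x - y) (t - τ) * f τ y) volume x]
    simp only [sub_sub_cancel, heatKer_eq hμ]
  simp only [e]
  refine (setIntegral_eq_of_subset_of_forall_sdiff_eq_zero measurableSet_Ioc
    (Set.Ioc_subset_Ioc_right ht.2) fun τ hτ => ?_).symm
  have : t - τ ≤ 0 := by
    by_contra hc
    exact hτ.2 ⟨hτ.1.1, by linarith⟩
  simp [kf_of_nonpos this]

lemma pd_VP (hn : 2 ≤ n) (hμ : 0 < μ) (hT : 0 ≤ T) (hf : SG T 0 C 1 f)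
     (ht : t ∈ Icc 0 T) (i : Fin n) (x : Spc n) :
    pd i (VP T 0 (gam μ) f t) x = VP T 0 (gam μ) (fun τ => pd i (f τ)) t x := by
  obtain ⟨-, h⟩ := VP_slab (T := T) (W := 0) hn one_pos le_rfl le_rfl zero_lt_two
    (gam_prof (n := n) hμ one_pos le_rfl) hT le_rfl 1
  have m0 : Measurable fun p : ℝ × Spc n => kf 0 (gam μ) (t - p.1) p.2 := by
    simpa using measurable_kf_sub (r := 0) (gam_prof (n := n) hμ one_pos le_rfl).1 t 0
  exact conv_pd (N := 0) (W := 0) (c := fun _ => C) hT le_rfl m0.aestronglyMeasurable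
    measurable_fst.aemeasurable measurable_snd.aemeasurable
    (slabM_ae fun τ hτ => Ioc_subset_Icc_self hτ) hf.1 hf.2
    (by simpa using (h t ht).mul_const C) i x

lemma VP_ibp (hn : 2 ≤ n) (hμ : 0 < μ) (hT : 0 ≤ T) (hf : SG T 0 C 1 f)
     (ht : t ∈ Icc 0 T) (i : Fin n) (x : Spc n) :
    VP T 0 (gam μ) (fun τ => pd i (f τ)) t x = VP T 1 (pd i (gam μ)) f t x := by
  have hf1 : SG T 0 C 0 (fun τ => pd i (f τ)) :=
    ((show SG T 0 C (0 + 1) f from hf).pd i).mono_W (by norm_num)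
  rw [VP_eq_iterated hn hμ hT hf1 ht]
  obtain ⟨⟨A, -, h⟩, -⟩ := VP_slab (T := T) (W := 0) hn one_pos le_rfl zero_le_one one_lt_two
    (pd_gam_prof (n := n) hμ one_pos le_rfl i) hT le_rfl 0
  have h2 := (h C f (hf.mono_N zero_le_one) t ht).2 x
  unfold VP; unfold slabM at h2 ⊢
  rw [integral_prod _ h2]
  refine setIntegral_congr_fun measurableSet_Ioc fun τ hτ => ?_
  exact kf_ibp hn hμ (hf.1 τ (Ioc_subset_Icc_self hτ)) i _ x

lemma VP_smoothing (hn : 2 ≤ n) (hμ : 0 < μ) (hT : 0 ≤ T) (hθ0 : 0 < θ) (hθ1 : θ < 1)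
    (hW : 1 ≤ W) (N : ℕ) (hN : 1 ≤ N) :
    ∃ A, 0 ≤ A ∧ ∀ C (f : 𝓣), SG T W C N f → HV T θ (W - 1) (A * C) (N + 1) (VP T 0 (gam μ) f) := by
  have hW0 : 0 ≤ W := by linarith
  obtain ⟨A0, hA0, h0⟩ := VP_HV (T := T) hn hθ0 hθ1.le le_rfl (by linarith)
    (gam_prof (n := n) hμ hθ0 hθ1.le) hT hW0 1
  have hp := fun i => VP_HV (T := T) hn hθ0 hθ1.le zero_le_one (by linarith)
    (pd_gam_prof (n := n) hμ hθ0 hθ1.le i) hT hW0 N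
  choose A1 hA1 h1 using hp
  have hB : 0 ≤ A0 + ∑ i, A1 i := add_nonneg hA0 (sum_nonneg fun i _ => hA1 i)
  refine ⟨(n + 1) * (A0 + ∑ i, A1 i), by positivity, fun C f hf => ?_⟩
  have hC : 0 ≤ C := (hf.1 0 ⟨le_rfl, hT⟩).nonneg
  have hf1 : SG T 0 C 1 f := (hf.mono_N hN).mono_W hW0
  rw [mul_assoc]
  refine HV.of_pd (((h0 C f (hf.mono_N hN)).mono_W (by linarith)).mono ?_) fun i => ?_
  · exact mul_le_mul_of_nonneg_right
      (le_add_of_nonneg_right (sum_nonneg fun i _ => hA1 i)) hC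
  · rw [sub_add_cancel]
    refine ((h1 i C f hf).mono (mul_le_mul_of_nonneg_right ?_ hC)).congr fun t ht x => ?_
    · exact (single_le_sum (fun i _ => hA1 i) (mem_univ i)).trans
        (le_add_of_nonneg_left hA0)
    · rw [pd_VP hn hμ hT hf1 ht, VP_ibp hn hμ hT hf1 ht]

end potential

lemma SG.sum {ι : Type*} (S : Finset ι) {F : ι → 𝓣} {c : ι → ℝ}
    (h : ∀ i ∈ S, SG T W (c i) N (F i)) :
    SG T W (∑ i ∈ S, c i) N (fun t x => ∑ i ∈ S, F i t x) :=
  TGen.SG_sum (s := 0) (p := N) S h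

lemma SG.lap {f : 𝓣} (h : SG T W C (N + 2) f) :
    SG T (W + 2) (n * C) N (fun t => lap (f t)) := by
  have := SG.sum (univ : Finset (Fin n)) (F := fun i t => NSdeRham.pd i (NSdeRham.pd i (f t)))
    (T := T) (W := W + 2) (N := N) (c := fun _ => C) fun i _ => by
      have := (SG.pd (N := N + 1) h i).pd i
      rwa [add_assoc, one_add_one_eq_two] at this
  simp only [sum_const, card_univ, Fintype.card_fin, nsmul_eq_mul] at this
  exact this

section

variable {f : ℝ → Spc n → ℝ}

lemma kf_integral_bound (hμ : 0 < μ) (hg : ∀ x, |g x| ≤ C) (σ : ℝ) (x : Spc n) :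
    |∫ z, kf 0 (gam μ) σ z * g (x - z)| ≤ (∫ y : Spc n, |gam μ y|) * C := by
  rcases le_or_gt σ 0 with h | h
  · simp only [kf_of_nonpos h, zero_mul, integral_zero, abs_zero]
    exact mul_nonneg (integral_nonneg fun _ => abs_nonneg _) ((abs_nonneg _).trans (hg 0))
  · rw [integral_kf_zero (G := fun z => g (x - z)) h, ← integral_mul_const]
    refine norm_integral_le_of_norm_le (μ := volume) (f := fun y => gam μ y * g (x - √σ • y)) ((gam_integrable hμ).abs.mul_const C) (ae_of_all _ fun y => ?_)
    rw [norm_eq_abs, abs_mul]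
    exact mul_le_mul_of_nonneg_left (hg _) (abs_nonneg _)

lemma VP_swap_integrable (hμ : 0 < μ) (hT : 0 ≤ T) (hf : SG T 0 C 0 f) (x : Spc n) :
    Integrable (Function.uncurry fun r τ => ∫ z, kf 0 (gam μ) (r - τ) z * f τ (x - z))
      ((volume.restrict (Ioc 0 t)).prod (volume.restrict (Ioc 0 T))) := by
  have h1 : ∀ᵐ τ ∂(volume.restrict (Ioc 0 T)), τ ∈ Icc 0 T :=
    (ae_restrict_mem measurableSet_Ioc).mono fun _ h => Ioc_subset_Icc_self h
  refine Integrable.of_bound (C := (∫ y : Spc n, |gam μ y|) * C) ?_ ?_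
  · refine AEStronglyMeasurable.integral_prod_right' (ν := (volume : Measure (Spc n)))
      (f := fun p : (ℝ × ℝ) × Spc n => kf 0 (gam μ) (p.1.1 - p.1.2) p.2 * f p.1.2 (x - p.2)) ?_
    refine AEStronglyMeasurable.mul ?_ ?_
    · have : Measurable fun p : (ℝ × ℝ) × Spc n => (p.1.1 - p.1.2, p.2) := by fun_prop
      exact ((measurable_kf (r := 0) (gam_prof (n := n) hμ one_pos le_rfl).1).comp this).aestronglyMeasurable
    · refine aesm_comp_of_continuousOn hT hf.2.zero_cont (τ := fun p : (ℝ × ℝ) × Spc n => p.1.2)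
        (z := fun p => x - p.2) (by fun_prop) (by fun_prop) ?_
      exact Measure.quasiMeasurePreserving_fst.ae (Measure.quasiMeasurePreserving_snd.ae h1)
  · refine (Measure.quasiMeasurePreserving_snd.ae h1).mono fun p hp => ?_
    exact kf_integral_bound hμ (fun z => (hf.1 _ hp).abs_le_const le_rfl z) _ x

lemma VP_swap (hn : 2 ≤ n) (hμ : 0 < μ) (hT : 0 ≤ T) (hf : SG T 0 C 0 f)
    (ht : t ∈ Icc 0 T) (x : Spc n) :
    ∫ r in (0 : ℝ)..t, VP T 0 (gam μ) f r x =
      ∫ τ in Ioc 0 T, ∫ r in Ioc 0 t, ∫ z, kf 0 (gam μ) (r - τ) z * f τ (x - z) := by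
  rw [intervalIntegral.integral_of_le ht.1]
  rw [setIntegral_congr_fun measurableSet_Ioc fun r hr =>
    VP_eq_iterated hn hμ hT hf ⟨hr.1.le, hr.2.trans ht.2⟩ x]
  exact integral_integral_swap (VP_swap_integrable hμ hT hf x)

lemma kf_heat_identity (hμ : 0 < μ) (hg : GX 2 0 C g) {τ : ℝ} (h0 : 0 < τ)
    (x : Spc n) : ∫ z, kf 0 (gam μ) (t - τ) z * g (x - z) =
      (if τ < t then g x else 0) +
        μ * ∫ r in Ioc 0 t, ∫ z, kf 0 (gam μ) (r - τ) z * lap g (x - z) := by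
  rcases lt_or_ge τ t with h | h
  · rw [if_pos h]
    have e1 := integral_kf_zero (ζ := gam μ) (G := fun z => g (x - z)) (sub_pos.2 h)
    rw [e1]
    have := heat_identity hμ hg x (sub_pos.2 h).le
    rw [heatAv] at this
    rw [this]
    congr 2
    have e2 : ∫ ρ in (0 : ℝ)..(t - τ), heatAv μ (lap g) ρ x =
        ∫ r in τ..t, heatAv μ (lap g) (r - τ) x := by
      rw [intervalIntegral.integral_comp_sub_right (fun ρ => heatAv μ (lap g) ρ x), sub_self]
    rw [e2, intervalIntegral.integral_of_le h.le]
    have e3 : ∫ r in Ioc τ t, heatAv μ (lap g) (r - τ) x =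
        ∫ r in Ioc τ t, ∫ z, kf 0 (gam μ) (r - τ) z * lap g (x - z) :=
      setIntegral_congr_fun measurableSet_Ioc fun r hr =>
        (integral_kf_zero (ζ := gam μ) (G := fun z => lap g (x - z)) (sub_pos.2 hr.1)).symm
    rw [e3]
    refine (setIntegral_eq_of_subset_of_forall_sdiff_eq_zero measurableSet_Ioc
      (Set.Ioc_subset_Ioc_left h0.le) fun r hr => ?_).symm
    have : r - τ ≤ 0 := by
      by_contra hc
      exact hr.2 ⟨by linarith, hr.1.2⟩
    simp [kf_of_nonpos this]
  · rw [if_neg h.not_gt]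
    have : ∫ r in Ioc 0 t, ∫ z, kf 0 (gam μ) (r - τ) z * lap g (x - z) = 0 :=
      (setIntegral_congr_fun measurableSet_Ioc fun r hr => by
        have : r - τ ≤ 0 := by linarith [hr.2]
        simp only [kf_of_nonpos this, zero_mul, integral_zero]).trans (integral_zero _ _)
    rw [this]
    have : t - τ ≤ 0 := by linarith
    simp [kf_of_nonpos this]

lemma TD_VP (hn : 2 ≤ n) (hμ : 0 < μ) (hT : 0 ≤ T) (hf : SG T 0 C 2 f) :
    TD T (VP T 0 (gam μ) f)
      (fun t x => f t x + μ * VP T 0 (gam μ) (fun t => lap (f t)) t x) := by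
  intro t ht x
  have hl : SG T 0 (n * C) 0 (fun t => lap (f t)) :=
    (SG.lap (N := 0) hf).mono_W (by norm_num)
  have hf0 := hf.mono_N (Nat.zero_le 2)
  have z0 : VP T 0 (gam μ) f 0 x = 0 := by
    rw [VP_eq_iterated hn hμ hT hf0 ⟨le_rfl, hT⟩]
    refine (setIntegral_congr_fun measurableSet_Ioc fun r hr => ?_).trans (integral_zero _ _)
    have : 0 - r ≤ 0 := by linarith [hr.1]
    simp only [kf_of_nonpos this, zero_mul, integral_zero]
  have hIcc : uIcc 0 t ⊆ Icc 0 T := by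
    rw [uIcc_of_le ht.1]; exact Icc_subset_Icc_right ht.2
  have hcV : IntervalIntegrable (fun r => VP T 0 (gam μ) (fun t => lap (f t)) r x) volume 0 t := by
    obtain ⟨A, -, h⟩ := VP_HV (T := T) (W := 0) (θ := 1) hn one_pos le_rfl le_rfl (by norm_num)
      (gam_prof (n := n) hμ one_pos le_rfl) hT le_rfl 0
    exact (((h _ _ hl).sct le_rfl one_pos).time_cont x |>.mono hIcc).intervalIntegrable
  have hcf : IntervalIntegrable (fun r => f r x) volume 0 t :=
    ((hf.2.time_cont x).mono hIcc).intervalIntegrable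
  rw [z0, zero_add, intervalIntegral.integral_add hcf (hcV.const_mul μ),
    intervalIntegral.integral_const_mul, VP_swap hn hμ hT hl ht, VP_eq_iterated hn hμ hT hf0 ht]
  rw [setIntegral_congr_fun measurableSet_Ioc fun τ hτ =>
    kf_heat_identity (t := t) hμ (hf.1 τ (Ioc_subset_Icc_self hτ)) hτ.1 x]
  have hI1 : IntegrableOn (fun τ => if τ < t then f τ x else 0) (Ioc 0 T) := by
    have hb : ContinuousOn (fun τ => f τ x) (Icc 0 T) := hf.2.time_cont x
    have h1 : IntegrableOn (fun τ => f τ x) (Ioc 0 T) :=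
      (hb.integrableOn_Icc).mono_set Ioc_subset_Icc_self
    exact (h1.indicator (measurableSet_Iio (a := t))).congr (ae_of_all _ fun τ => by
      simp [Set.indicator])
  have e1 : ∫ τ in Ioc 0 T, (if τ < t then f τ x else 0) = ∫ τ in (0 : ℝ)..t, f τ x := by
    have e : (fun τ => if τ < t then f τ x else 0) = (Iio t).indicator fun τ => f τ x := by
      funext τ; simp [Set.indicator]
    have e' : Ioc 0 T ∩ Iio t = Ioo 0 t := by
      ext τ
      exact ⟨fun h => ⟨h.1.1, h.2⟩, fun h => ⟨⟨h.1, h.2.le.trans ht.2⟩, h.2⟩⟩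
    rw [e, setIntegral_indicator measurableSet_Iio, e', intervalIntegral.integral_of_le ht.1,
      integral_Ioc_eq_integral_Ioo]
  rw [integral_add hI1 ?_, e1, integral_const_mul]
  exact ((VP_swap_integrable hμ hT hl x).integral_prod_right).const_mul μ

end

/-- Interpolation: a function which is small together with bounded second order derivatives
has a gradient of intermediate size. -/
lemma GX.interp (hT : 0 ≤ T) (hW : 1 ≤ W) (N : ℕ) :
    ∃ A, 0 ≤ A ∧ ∀ (C h : ℝ) (g : 𝓕), 0 < h → h ≤ T → GX N W (C * h) g → GX (N + 2) W C g →
      GX (N + 1) (W - 1) (A * C * h ^ (1 / 2 : ℝ)) g := by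
  have hW0 : 0 ≤ W := by linarith
  set B : ℝ := 2 ^ (W + N) * (1 + T ^ (1 / 2 : ℝ)) ^ (W + N) with hB
  have hB0 : 0 ≤ B := by positivity
  have hTs : 0 ≤ T ^ (1 / 2 : ℝ) := by positivity
  refine ⟨(n + 1) * ((B + 1) + B + T ^ (1 / 2 : ℝ)), by positivity, fun C h g h0 hhT hg hg2 => ?_⟩
  have hC : 0 ≤ C := hg2.nonneg
  set s : ℝ := h ^ (1 / 2 : ℝ) with hs
  have s0 : 0 < s := rpow_pos_of_pos h0 _
  have ss : s * s = h := by
    rw [hs, ← rpow_add h0]; norm_num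
  have sT : s ≤ T ^ (1 / 2 : ℝ) := rpow_le_rpow h0.le hhT (by norm_num)
  have hwt : ∀ ρ : ℝ, 0 ≤ ρ → ρ ≤ s → ∀ i : Fin n,
      2 ^ (W + N) * wt (-(ρ • single i (1 : ℝ)) : Spc n) ^ (W + N) ≤ B := by
    intro ρ h1 h2 i
    rw [hB]
    gcongr
    · exact (wt_pos _).le
    · refine (wt_le _).trans ?_
      rw [norm_neg, norm_smul, norm_of_nonneg h1]
      simp only [EuclideanSpace.norm_single, norm_one, mul_one]
      linarith
  have hdiff : Differentiable ℝ g := hg2.1.differentiable (by simp)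
  have key : ∀ i, GX N W ((B + 1) * (C * s) + B * (C * s)) (NSdeRham.pd i g) := by
    intro i
    set e : Spc n := single i (1 : ℝ) with he
    have hp : GX (N + 1) W C (NSdeRham.pd i g) := (hg2.pd i).mono_W (by linarith)
    have hpc : Continuous (NSdeRham.pd i g) := hp.cont
    have t1 : GX N W ((B + 1) * (C * s)) (fun x => s⁻¹ * (g (x - -(s • e)) - g x)) := by
      have h1 := ((hg.translate hW0 (-(s • e))).sub hg).smul s⁻¹
      refine h1.mono ?_
      rw [abs_of_pos (inv_pos.2 s0), ← ss]
      have := hwt s s0.le le_rfl i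
      calc s⁻¹ * (2 ^ (W + N) * wt (-(s • e)) ^ (W + N) * (C * (s * s)) + C * (s * s))
          ≤ s⁻¹ * (B * (C * (s * s)) + C * (s * s)) := by gcongr
        _ = _ := by field_simp
    have t2 : GX N W (B * (C * s)) (fun x => s⁻¹ * ∫ ρ in Ioc 0 s,
        (NSdeRham.pd i g (x - -(ρ • e)) - NSdeRham.pd i g x)) := by
      have h2 := (GX.integral (ν := volume.restrict (Ioc 0 s)) (N := N) hW0
        (F := fun ρ x => NSdeRham.pd i g (x - -(ρ • e)) - NSdeRham.pd i g x)
        (c := fun _ => B * (C * s)) ?_ (integrable_const _) ?_).1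
      · refine (h2.smul s⁻¹).mono (le_of_eq ?_)
        rw [abs_of_pos (inv_pos.2 s0)]
        simp only [integral_const, smul_eq_mul, measureReal_restrict_apply_univ,
          volume_real_Ioc_of_le s0.le]
        field_simp
        ring
      · refine (ae_restrict_iff' measurableSet_Ioc).2 (ae_of_all _ fun ρ hρ => ?_)
        refine (hp.diff hW0 (-(ρ • e))).mono ?_
        have := hwt ρ hρ.1.le hρ.2 i
        have e1 : ‖-(ρ • e)‖ = ρ := by
          rw [norm_neg, norm_smul, norm_of_nonneg hρ.1.le, he]; simp
        rw [e1]
        calc 2 ^ (W + N) * C * (ρ * wt (-(ρ • e)) ^ (W + N))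
            = (2 ^ (W + N) * wt (-(ρ • e)) ^ (W + N)) * (C * ρ) := by ring
          _ ≤ B * (C * s) := by
              have := hρ.1.le
              gcongr
              exact hρ.2
      · intro m hm x
        have e2 : ∀ ρ : ℝ, ∇ m (fun x => NSdeRham.pd i g (x - -(ρ • e))
            - NSdeRham.pd i g x) x = ∇ m (NSdeRham.pd i g) (x - -(ρ • e))
              - ∇ m (NSdeRham.pd i g) x := by
          intro ρ
          have hm' : ContDiff ℝ m (NSdeRham.pd i g) :=
            hp.1.of_le (by exact_mod_cast hm.trans N.le_succ)
          have := iteratedFDeriv_sub (𝕜 := ℝ) (i := m) (f := fun x => NSdeRham.pd i g (x - -(ρ • e)))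
            (g := NSdeRham.pd i g) (hm'.comp (contDiff_id.sub contDiff_const)) hm'
          have h3 := congrFun this x
          rw [Pi.sub_apply, iteratedFDeriv_translate] at h3
          exact h3
        simp only [e2]
        have hc : Continuous (∇ m (NSdeRham.pd i g)) :=
          hp.1.continuous_iteratedFDeriv (by exact_mod_cast hm.trans N.le_succ)
        exact (Continuous.sub (hc.comp (by fun_prop)) continuous_const).aestronglyMeasurable
    refine GX.congr (t1.sub t2) fun x => ?_
    have hder : ∀ ρ ∈ uIcc 0 s, HasDerivAt (fun ρ : ℝ => g (x - -(ρ • e)))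
        (NSdeRham.pd i g (x - -(ρ • e))) ρ := by
      intro ρ _
      have h1 : HasDerivAt (fun ρ : ℝ => x - -(ρ • e)) e ρ := by
        simpa using ((((hasDerivAt_id ρ).smul_const e).neg).const_sub x)
      exact (hdiff (x - -(ρ • e))).hasFDerivAt.comp_hasDerivAt ρ h1
    have hci : Continuous fun ρ : ℝ => NSdeRham.pd i g (x - -(ρ • e)) :=
      hpc.comp (by fun_prop)
    have ftc := intervalIntegral.integral_eq_sub_of_hasDerivAt hder (hci.intervalIntegrable _ _)
    rw [intervalIntegral.integral_of_le s0.le] at ftc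
    rw [integral_sub (hci.integrableOn_Ioc) (integrable_const _), ftc]
    simp only [zero_smul, neg_zero, sub_zero, integral_const, smul_eq_mul,
      measureReal_restrict_apply_univ, volume_real_Ioc_of_le s0.le]
    field_simp
    ring
  refine (GX.succ (C := ((B + 1) + B + T ^ (1 / 2 : ℝ)) * (C * s)) hdiff ?_ fun i => ?_).mono
    (le_of_eq (by ring))
  · intro x
    have h1 := hg.abs_le x
    have h2 : wt x ^ (W - 1) ≤ wt x ^ W := wt_rpow_mono x (by linarith)
    calc wt x ^ (W - 1) * |g x| ≤ wt x ^ W * |g x| := by gcongr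
      _ ≤ C * h := h1
      _ = s * (C * s) := by rw [← ss]; ring
      _ ≤ _ := by
        gcongr
        linarith
  · rw [sub_add_cancel]
    refine (key i).mono ?_
    have : 0 ≤ T ^ (1 / 2 : ℝ) * (C * s) := by positivity
    nlinarith

lemma GX.translate_sub_GX (hW : 0 ≤ W) (hθ1 : θ ≤ 1)
    (hf : GX (N + 1) W C f) {v : Spc n} (hv : ‖v‖ ≤ 1) :
    GX N W (2 ^ (W + N) * 2 ^ (W + N) * C * ‖v‖ ^ θ) (fun x => f (x - v) - f x) := by
  refine (hf.diff hW v).mono ?_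
  have hC := hf.nonneg
  rcases (norm_nonneg v).eq_or_lt with h | h
  · rw [← h]; simp only [zero_mul, mul_zero]; positivity
  have h1 : ‖v‖ ≤ ‖v‖ ^ θ := by
    simpa using rpow_le_rpow_of_exponent_ge h hv hθ1
  have h2 : wt v ^ (W + N) ≤ 2 ^ (W + N) :=
    rpow_le_rpow (wt_pos v).le ((wt_le v).trans (by linarith)) (by positivity)
  have : 0 ≤ wt v ^ (W + N) := (wt_rpow_pos v _).le
  calc 2 ^ (W + N) * C * (‖v‖ * wt v ^ (W + N))
      ≤ 2 ^ (W + N) * C * (‖v‖ ^ θ * 2 ^ (W + N)) := by gcongr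
    _ = _ := by ring

/-- A function which is continuously differentiable in time gains a spatial derivative
with values in Hölder spaces. -/
lemma HV.of_TD (hT : 0 ≤ T) (hθ0 : 0 < θ) (hθ1 : θ < 1) (hW : 1 ≤ W) (N : ℕ) :
    ∃ A, 0 ≤ A ∧ ∀ (C : ℝ) (f g : 𝓣), SG T W C (N + 2) f → TD T f g → SG T W C N g →
      HV T θ (W - 1) (A * C) (N + 1) f := by
  obtain ⟨A, hA, hint⟩ := GX.interp (n := n) hT hW N
  have hW0 : 0 ≤ W := by linarith
  have hW1 : 0 ≤ W - 1 := by linarith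
  set A' : ℝ := 2 ^ (W + N) + 2 with hA'
  set D : ℝ := 2 ^ (W - 1 + (N + 1 : ℕ)) * 2 ^ (W - 1 + (N + 1 : ℕ)) with hD
  have hD0 : 0 ≤ D := by positivity
  refine ⟨1 + A * A' * T ^ ((1 - θ) / 2) + D, by positivity, fun C f g hf hfg hg => ?_⟩
  have hA'0 : 0 < A' := by positivity
  have hb : ∀ {C' : ℝ}, 0 ≤ C' → 0 ≤ A * A' * T ^ ((1 - θ) / 2) * C' := fun h => by positivity
  have main : ∀ t ∈ Icc 0 T, ∀ t' ∈ Icc 0 T, t' < t →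
      GX (N + 1) (W - 1) (A * A' * T ^ ((1 - θ) / 2) * C * |t - t'| ^ (θ / 2))
        (fun x => f t x - f t' x) := by
    intro t ht t' ht' htt
    have hC := (hf.1 t ht).nonneg
    have h0 : 0 < t - t' := by linarith
    have hsub : Ioc t' t ⊆ Icc 0 T :=
      fun r hr => ⟨ht'.1.trans hr.1.le, hr.2.trans ht.2⟩
    have e0 : ∀ x, f t x - f t' x = ∫ ω in Ioc t' t, 1 * g ω (x - 0) := by
      intro x
      have i1 := TD.intervalIntegrable (hg.2.time_cont x) ht
      have i2 := TD.intervalIntegrable (hg.2.time_cont x) ht'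
      simp only [one_mul, sub_zero]
      rw [hfg t ht x, hfg t' ht' x, ← intervalIntegral.integral_of_le htt.le,
        ← intervalIntegral.integral_interval_sub_left i1 i2]
      ring
    have hsmall : GX N W (2 ^ (W + N) * C * (t - t')) (fun x => f t x - f t' x) := by
      refine GX.congr (GX.mono (conv_GX (ν := volume.restrict (Ioc t' t)) hT hW0
        (K := fun _ => 1) (τ := id) (z := fun _ => 0) (c := fun _ => C) (by fun_prop) (by fun_prop)
        (by fun_prop) ?_ hg.1 hg.2 (integrable_const _)).1 (le_of_eq ?_)) e0
      · exact (ae_restrict_iff' measurableSet_Ioc).2 (ae_of_all _ fun r hr => hsub hr)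
      · simp only [abs_one, one_mul, integral_const, smul_eq_mul, wt, norm_zero,
          measureReal_restrict_apply_univ, volume_real_Ioc_of_le htt.le]
        norm_num
        ring
    have hbig : GX (N + 2) W (2 * C) (fun x => f t x - f t' x) :=
      ((hf.1 t ht).sub (hf.1 t' ht')).mono (by linarith)
    have h2C : 2 * C ≤ A' * C := by
      have : 0 ≤ (2 : ℝ) ^ (W + N) * C := by positivity
      rw [hA']; linarith
    have := hint (A' * C) (t - t') _ h0 (by linarith [ht.2, ht'.1])
      (hsmall.mono (by rw [hA']; nlinarith)) (hbig.mono h2C)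
    refine this.mono ?_
    rw [abs_of_pos h0]
    have e : (t - t') ^ (1 / 2 : ℝ) = (t - t') ^ ((1 - θ) / 2) * (t - t') ^ (θ / 2) := by
      rw [← rpow_add h0]; congr 1; ring
    have l : (t - t') ^ ((1 - θ) / 2) ≤ T ^ ((1 - θ) / 2) :=
      rpow_le_rpow h0.le (by linarith [ht.2, ht'.1]) (by linarith)
    rw [e]
    calc A * (A' * C) * ((t - t') ^ ((1 - θ) / 2) * (t - t') ^ (θ / 2))
        ≤ A * (A' * C) * (T ^ ((1 - θ) / 2) * (t - t') ^ (θ / 2)) := by gcongr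
      _ = _ := by ring
  refine ⟨fun t ht => ?_, fun t ht t' ht' => ?_, fun t ht v hv => ?_⟩
  · have hC := (hf.1 t ht).nonneg
    refine (((hf.1 t ht).mono_N (Nat.le_succ (N + 1))).mono_W (by linarith)).mono ?_
    have := hb hC
    have : 0 ≤ D * C := by positivity
    nlinarith
  · have hC := (hf.1 t ht).nonneg
    have hle : A * A' * T ^ ((1 - θ) / 2) * C * |t - t'| ^ (θ / 2) ≤
        (1 + A * A' * T ^ ((1 - θ) / 2) + D) * C * |t - t'| ^ (θ / 2) := by
      gcongr
      linarith
    rcases lt_trichotomy t t' with h | h | h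
    · refine GX.congr ((main t' ht' t ht h).neg.mono ?_) (fun x => by ring)
      rwa [abs_sub_comm]
    · subst h
      refine (GX.congr (GX.zero (N := N + 1) (W := W - 1)) fun x => by ring).mono (by positivity)
    · exact (main t ht t' ht' h).mono hle
  · have hC := (hf.1 t ht).nonneg
    refine (GX.translate_sub_GX hW1 hθ1.le ((hf.1 t ht).mono_W (by linarith)) hv).mono ?_
    have h1 := hb hC
    have : 0 ≤ ‖v‖ ^ θ := by positivity
    rw [← hD]
    gcongr
    linarith [mul_nonneg (mul_nonneg hA hA'0.le) (rpow_nonneg hT ((1 - θ) / 2))]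

lemma TGen.drop_last {B : ℕ → (𝓣) → Prop} {f : 𝓣}
    (h : TGen T B (s + 1) p f) : TGen T B s (p + 2) f := by
  obtain ⟨g, h0, h1, h2⟩ := TGen_iff_chain.1 h
  refine TGen_iff_chain.2 ⟨g, h0, fun j hj => h1 j (by omega), fun j hj => ?_⟩
  have := h2 j (by omega)
  rwa [show 2 * (s + 1 - j) + p = 2 * (s - j) + (p + 2) by omega] at this

lemma TGen.HV_add {e : ℕ} {f g : 𝓣} (hW : 0 ≤ W) (hθ : 0 < θ)
    (h : TGen T (fun N => HV T θ W C (N + e)) s p f)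
    (h' : TGen T (fun N => HV T θ W C' (N + e)) s p g) :
    TGen T (fun N => HV T θ W (C + C') (N + e)) s p (fun t x => f t x + g t x) :=
  TGen.map₂ (fun f g t x => f t x + g t x) h h' (fun _ _ _ h h' => h.add h')
    fun _ _ _ _ _ h h' hb hb' => h.add h' (fun x => (hb.sct hW hθ).time_cont x)
      fun x => (hb'.sct hW hθ).time_cont x

lemma TGen.HV_smul {e : ℕ} {f : 𝓣}
    (h : TGen T (fun N => HV T θ W C (N + e)) s p f) (c : ℝ) :
    TGen T (fun N => HV T θ W (|c| * C) (N + e)) s p (fun t x => c * f t x) :=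
  TGen.map (fun f t x => c * f t x) h (fun _ _ h => h.smul c) fun _ _ _ h _ _ => h.smul c

lemma TGen.SG_lap {f : 𝓣} (hW : 0 ≤ W)
    (h : TGen T (SG T W C) s (p + 2) f) :
    TGen T (SG T (W + 2) (n * C)) s p (fun t => lap (f t)) := by
  have := TGen.SG_sum univ fun i _ => by
      have := TGen.SG_pd (by linarith) (TGen.SG_pd hW h i) i
      rwa [add_assoc, one_add_one_eq_two] at this
  simp only [sum_const, card_univ, Fintype.card_fin, nsmul_eq_mul] at this
  exact this

lemma TGen.HV_of_succ (hT : 0 ≤ T) (hθ0 : 0 < θ) (hθ1 : θ < 1) (hW : 1 ≤ W) (s p : ℕ) :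
    ∃ A, 0 ≤ A ∧ ∀ (C : ℝ) (f : 𝓣), TGen T (SG T W C) (s + 1) p f →
      TGen T (fun N => HV T θ (W - 1) (A * C) (N + 1)) s p f := by
  choose A hA h using fun N => HV.of_TD hT hθ0 hθ1 hW N
  refine ⟨∑ N ∈ range (2 * s + p + 1), A N, sum_nonneg fun i _ => hA i,
    fun C f hf => ?_⟩
  obtain ⟨g, h0, h1, h2⟩ := TGen_iff_chain.1 hf
  refine TGen_iff_chain.2 ⟨g, h0, fun j hj => h1 j (by omega), fun j hj => ?_⟩
  have e1 := h2 j (by omega)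
  have e2 := h2 (j + 1) (by omega)
  rw [show 2 * (s + 1 - j) + p = 2 * (s - j) + p + 2 by omega] at e1
  rw [show 2 * (s + 1 - (j + 1)) + p = 2 * (s - j) + p by omega] at e2
  refine (h _ C _ _ e1 (h1 j (by omega)) e2).mono (mul_le_mul_of_nonneg_right ?_
      ((e1.1 0 ⟨le_rfl, hT⟩).nonneg))
  exact single_le_sum (fun i _ => hA i) (mem_range.2 (by omega))

/-- The volume heat potential gains one spatial derivative, together with Hölder continuity. -/
lemma TGen.VP (hn : 2 ≤ n) (hμ : 0 < μ) (hT : 0 ≤ T) (hθ0 : 0 < θ) (hθ1 : θ < 1)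
    (hW : 1 ≤ W) (s p : ℕ) (hp : 1 ≤ p) :
    ∃ A, 0 ≤ A ∧ ∀ (C : ℝ) (f : 𝓣), TGen T (SG T W C) s p f →
      TGen T (fun N => HV T θ (W - 1) (A * C) (N + 1)) s p (VP T 0 (gam μ) f) := by
  have hW0 : 0 ≤ W := by linarith
  induction s with
  | zero =>
    obtain ⟨A, hA, h⟩ := VP_smoothing hn hμ hT hθ0 hθ1 hW p hp
    exact ⟨A, hA, fun C f hf => h C f hf⟩
  | succ s ih =>
    obtain ⟨A, hA, ih⟩ := ih
    obtain ⟨A1, hA1, h1⟩ := VP_smoothing hn hμ hT hθ0 hθ1 hW (2 * (s + 1) + p) (by omega)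
    obtain ⟨A2, hA2, h2⟩ := TGen.HV_of_succ hT hθ0 hθ1 hW s p
    refine ⟨A1 + (A2 + μ * (A * n)), by positivity, fun C f hf => ?_⟩
    have hC := (hf.base.1 0 ⟨le_rfl, hT⟩).nonneg
    refine ⟨(h1 C f hf.base).mono ?_, _, TD_VP hn hμ hT
      ((hf.base.mono_W hW0).mono_N (by omega)), ?_⟩
    · have : 0 ≤ (A2 + μ * (A * n)) * C := by positivity
      linarith
    have hl := ih _ _ (((hf.drop_last).SG_lap hW0).mono fun N f h => h.mono_W
        (by linarith : W ≤ W + 2))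
    refine ((h2 C f hf).HV_add (by linarith) hθ0 (hl.HV_smul μ)).mono fun N f h => h.mono ?_
    rw [abs_of_pos hμ]
    have : 0 ≤ A1 * C := by positivity
    linarith

/-- An envelope for the singular kernels of potential theory. -/
def env (z : Spc n) : ℝ := ‖z‖ ^ (-((n : ℝ) - 1)) + ‖z‖ + 1

/-- Kernels dominated by the envelope. -/
def EK (c : ℝ) (K : 𝓕) : Prop := AEStronglyMeasurable K ∧ ∀ z, |K z| ≤ c * env z

lemma one_le_env (z : Spc n) : 1 ≤ env z := by
  unfold env
  have := norm_nonneg z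
  have : 0 ≤ ‖z‖ ^ (-((n : ℝ) - 1)) := by positivity
  linarith

lemma norm_le_env (z : Spc n) : ‖z‖ ≤ env z := by
  unfold env
  have : 0 ≤ ‖z‖ ^ (-((n : ℝ) - 1)) := by positivity
  linarith

lemma rpow_le_env (z : Spc n) : ‖z‖ ^ (-((n : ℝ) - 1)) ≤ env z := by
  unfold env
  have := norm_nonneg z
  linarith

lemma integrable_norm_rpow_wt (hn : 2 ≤ n) (hW : 1 < W) :
    Integrable (fun z : Spc n => ‖z‖ ^ (-((n : ℝ) - 1)) * wt z ^ (-W)) := by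
  have : Nontrivial (Spc n) := by
    have : Nonempty (Fin n) := ⟨⟨0, by omega⟩⟩
    infer_instance
  have h := (integrable_fun_norm_addHaar (volume : Measure (Spc n))
    (f := fun r : ℝ => r ^ (-((n : ℝ) - 1)) * √(1 + r ^ 2) ^ (-W))).2 ?_
  · exact h
  have hi : Integrable (fun r : ℝ => (1 + ‖r‖ ^ 2) ^ (-W / 2)) :=
    integrable_rpow_neg_one_add_norm_sq (by simpa using hW)
  refine (hi.integrableOn (s := Ioi 0)).congr_fun (fun r hr => ?_) measurableSet_Ioi
  have hr : 0 < r := hr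
  have e1 : r ^ (Module.finrank ℝ (Spc n) - 1) = r ^ ((n : ℝ) - 1) := by
    rw [finrank_euclideanSpace_fin, ← rpow_natCast, Nat.cast_sub (by omega), Nat.cast_one]
  simp only [smul_eq_mul]
  rw [e1, ← mul_assoc, ← rpow_add hr, sqrt_eq_rpow, ← rpow_mul (by positivity)]
  simp only [add_neg_cancel, rpow_zero, one_mul, norm_eq_abs, sq_abs]
  congr 1
  ring

lemma env_integrable (hn : 2 ≤ n) (hW : (n : ℝ) + 1 < W) :
    Integrable (fun z : Spc n => env z * wt z ^ (-W)) := by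
  have hn' : (2 : ℝ) ≤ n := by exact_mod_cast hn
  have h1 := integrable_norm_rpow_wt hn (W := W) (by linarith)
  have h2 : Integrable (fun z : Spc n => ‖z‖ * wt z ^ (-W)) := by
    refine (integrable_wt_rpow (m := W - 1) (by linarith)).mono'
      ((continuous_norm.mul (continuous_wt_rpow _)).aestronglyMeasurable) (ae_of_all _ fun z => ?_)
    rw [norm_of_nonneg (by have := (wt_rpow_pos z (-W)).le; positivity)]
    calc ‖z‖ * wt z ^ (-W) ≤ wt z * wt z ^ (-W) :=
          mul_le_mul_of_nonneg_right (norm_le_wt z) (wt_rpow_pos z _).le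
      _ = wt z ^ (-(W - 1)) := by
          rw [← rpow_one_add' (wt_pos z).le (by linarith)]; congr 1; ring
  refine ((h1.add h2).add (integrable_wt_rpow (m := W) (by linarith))).congr (ae_of_all _ fun z => ?_)
  simp only [Pi.add_apply, env]
  ring

lemma wt_sub_rpow_neg_le (hW : 0 ≤ W) (x z : Spc n) :
    wt (x - z) ^ (-W) ≤ 2 ^ W * wt x ^ W * wt z ^ (-W) := by
  have h := wt_rpow_le_sub z x hW
  rw [wt_sub_comm] at h
  rw [rpow_neg (wt_pos _).le, rpow_neg (wt_pos _).le,
    inv_le_iff_one_le_mul₀ (wt_rpow_pos _ _)]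
  have hz := wt_rpow_pos z W
  calc (1 : ℝ) = wt z ^ W * (wt z ^ W)⁻¹ := by field_simp
    _ ≤ 2 ^ W * wt x ^ W * wt (x - z) ^ W * (wt z ^ W)⁻¹ := by gcongr
    _ = _ := by ring

section conv

variable {c : ℝ} {K : Spc n → ℝ}

lemma EK.bound (hK : EK c K) (hc : 0 ≤ c) (hW : 0 ≤ W) (hC : 0 ≤ C) (x z : Spc n) {R : ℝ}
    (hx : wt x ≤ R) (hb : |b| ≤ C * wt (x - z) ^ (-W)) :
    |K z * b| ≤ c * C * (2 ^ W * R ^ W) * (env z * wt z ^ (-W)) := by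
  have hR : 0 ≤ R := (wt_pos x).le.trans hx
  have he : 0 ≤ env z := zero_le_one.trans (one_le_env z)
  have hw := (wt_rpow_pos z (-W)).le
  have := hK.2 z
  rw [abs_mul]
  calc |K z| * |b| ≤ (c * env z) * (C * (2 ^ W * wt x ^ W * wt z ^ (-W))) := by
        gcongr
        exact hb.trans (mul_le_mul_of_nonneg_left (wt_sub_rpow_neg_le hW x z) hC)
    _ ≤ (c * env z) * (C * (2 ^ W * R ^ W * wt z ^ (-W))) := by
        have := (wt_pos x).le
        gcongr
    _ = _ := by ring

lemma EK.nonneg (hK : EK c K) : 0 ≤ c := by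
  have h1 := hK.2 0
  have h2 := one_le_env (0 : Spc n)
  by_contra h
  have := abs_nonneg (K 0)
  nlinarith

lemma EK.integrable (hn : 2 ≤ n) (hK : EK c K) (hW : (n : ℝ) + 1 < W) (hf : GX 0 W C f)
    (x : Spc n) : Integrable (fun z => K z * f (x - z)) := by
  have hW0 : 0 ≤ W := by have : (0 : ℝ) ≤ n := n.cast_nonneg
                         linarith
  refine ((env_integrable hn hW).const_mul (c * C * (2 ^ W * wt x ^ W))).mono'
    (hK.1.mul (hf.cont.comp (by fun_prop)).aestronglyMeasurable) (ae_of_all _ fun z => ?_)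
  exact hK.bound hK.nonneg hW0 hf.nonneg x z le_rfl (hf.abs_le' _)

/-- Convolutions with kernels dominated by the envelope may be differentiated under the
integral. -/
lemma EK.hasFDerivAt (hn : 2 ≤ n) (hK : EK c K) (hW : (n : ℝ) + 1 < W) (hf : GX 1 W C f) :
    Differentiable ℝ (fun x => ∫ z, K z * f (x - z)) ∧
      ∀ i x, pd i (fun x => ∫ z, K z * f (x - z)) x = ∫ z, K z * pd i f (x - z) := by
  have hW0 : 0 ≤ W := by have : (0 : ℝ) ≤ n := n.cast_nonneg
                         linarith
  have hd : Differentiable ℝ f := hf.1.differentiable (by norm_num)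
  have hfc : Continuous (fderiv ℝ f) := hf.1.continuous_fderiv (by norm_num)
  have hfd : ∀ x, ‖fderiv ℝ f x‖ ≤ C * wt x ^ (-W) := fun x => by
    have h := hf.norm_le le_rfl x
    rw [norm_iteratedFDeriv_one] at h
    refine h.trans (mul_le_mul_of_nonneg_left ?_ hf.nonneg)
    exact wt_rpow_mono x (by simp)
  have hmeas : ∀ x, AEStronglyMeasurable (fun z => K z • fderiv ℝ f (x - z)) := fun x =>
    hK.1.smul (hfc.comp (by fun_prop)).aestronglyMeasurable
  have key : ∀ x₀, HasFDerivAt (fun x => ∫ z, K z * f (x - z))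
      (∫ z, K z • fderiv ℝ f (x₀ - z)) x₀ ∧
      Integrable (fun z => ‖K z • fderiv ℝ f (x₀ - z)‖) := by
    intro x₀
    have hb : ∀ x ∈ Metric.ball x₀ 1, ∀ z, ‖K z • fderiv ℝ f (x - z)‖ ≤
        c * C * (2 ^ W * (2 + ‖x₀‖) ^ W) * (env z * wt z ^ (-W)) := by
      intro x hx z
      rw [norm_smul, norm_eq_abs]
      have h1 : wt x ≤ 2 + ‖x₀‖ := by
        refine (wt_le x).trans ?_
        have : ‖x‖ ≤ ‖x₀‖ + ‖x - x₀‖ := by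
          simpa using norm_add_le x₀ (x - x₀)
        have h2 : ‖x - x₀‖ < 1 := by simpa [dist_eq_norm] using hx
        linarith
      have := hK.bound hK.nonneg hW0 hf.nonneg x z (b := ‖fderiv ℝ f (x - z)‖) h1
        (by rw [abs_norm]; exact hfd _)
      rwa [abs_mul, abs_norm] at this
    have hint := (env_integrable hn hW).const_mul (c * C * (2 ^ W * (2 + ‖x₀‖) ^ W))
    refine ⟨hasFDerivAt_integral_of_dominated_of_fderiv_le (𝕜 := ℝ)
      (F := fun x z => K z * f (x - z)) (F' := fun x z => K z • fderiv ℝ f (x - z))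
      (Metric.ball_mem_nhds x₀ one_pos) (Eventually.of_forall fun x =>
        (hK.integrable hn hW (hf.mono_N zero_le_one) x).aestronglyMeasurable)
      (hK.integrable hn hW (hf.mono_N zero_le_one) x₀) (hmeas x₀)
      (ae_of_all _ fun z x hx => hb x hx z) hint (ae_of_all _ fun z x _ => ?_), ?_⟩
    · have := ((hd (x - z)).hasFDerivAt.comp x ((hasFDerivAt_id x).sub_const z)).const_mul (K z)
      exact this
    · exact hint.mono' (hmeas x₀).norm (ae_of_all _ fun z => by
        rw [norm_norm]; exact hb x₀ (Metric.mem_ball_self one_pos) z)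
  refine ⟨fun x => (key x).1.differentiableAt, fun i x => ?_⟩
  rw [pd, (key x).1.fderiv]
  have := (integral_clm_apply_of_bound (hmeas x) (ae_of_all _ fun z => le_rfl) (key x).2).1
    (single i 1)
  rw [this]
  rfl

lemma contDiff_succ_of_pd (hd : Differentiable ℝ g)
    (h : ∀ i, ContDiff ℝ N (pd i g)) : ContDiff ℝ (N + 1 : ℕ) g := by
  have : ContDiff ℝ ((N : WithTop ℕ∞) + 1) g := by
    rw [contDiff_succ_iff_fderiv]
    refine ⟨hd, by simp, ?_⟩
    rw [show fderiv ℝ g = _ from funext fun x => fderiv_eq_sum_pd x]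
    exact ContDiff.sum fun i _ => (h i).smul contDiff_const
  exact_mod_cast this

lemma EK.contDiff (hn : 2 ≤ n) (hK : EK c K) (hW : (n : ℝ) + 1 < W) (hf : GX (N + 1) W C f) :
    ContDiff ℝ N (fun x => ∫ z, K z * f (x - z)) := by
  induction N generalizing f with
  | zero =>
    rw [Nat.cast_zero, contDiff_zero]
    exact (hK.hasFDerivAt hn hW hf).1.continuous
  | succ N ih =>
    obtain ⟨h1, h2⟩ := hK.hasFDerivAt hn hW (hf.mono_N (by omega))
    refine contDiff_succ_of_pd h1 fun i => ?_
    rw [show pd i _ = _ from funext fun x => h2 i x]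
    exact ih ((hf.pd i).mono_W (by linarith))

lemma EK.tendsto (hn : 2 ≤ n) {Ks : ℕ → 𝓕} (hKm : ∀ m, AEStronglyMeasurable (Ks m))
    (hKs : ∀ m z, z ≠ 0 → |Ks m z| ≤ env z) (hW : (n : ℝ) + 1 < W) (hf : GX 0 W C f)
    (hlim : ∀ z, z ≠ 0 → Tendsto (fun m => Ks m z) atTop (nhds (K z))) (x : Spc n) :
    Tendsto (fun m => ∫ z, Ks m z * f (x - z)) atTop (nhds (∫ z, K z * f (x - z))) := by
  have hW0 : 0 ≤ W := by have : (0 : ℝ) ≤ n := n.cast_nonneg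
                         linarith
  have : Nontrivial (Spc n) := by
    have : Nonempty (Fin n) := ⟨⟨0, by omega⟩⟩
    infer_instance
  have hae : ∀ᵐ z : Spc n, z ≠ 0 := Measure.ae_ne volume 0
  refine tendsto_integral_of_dominated_convergence
    (fun z => 1 * C * (2 ^ W * wt x ^ W) * (env z * wt z ^ (-W)))
    (fun m => (hKm m).mul (hf.cont.comp (by fun_prop)).aestronglyMeasurable)
    ((env_integrable hn hW).const_mul _) (fun m => ?_) ?_
  · filter_upwards [hae] with z hz
    have hE : EK 1 (fun y : Spc n => if y = z then Ks m z else 0) := by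
      refine ⟨(measurable_const.ite (measurableSet_singleton z)
        measurable_const).aestronglyMeasurable, fun y => ?_⟩
      simp only [one_mul]
      split_ifs with h
      · rw [h]; exact hKs m z hz
      · rw [abs_zero]; exact zero_le_one.trans (one_le_env y)
    have := hE.bound zero_le_one hW0 hf.nonneg x z le_rfl (hf.abs_le' (x - z))
    simpa using this
  · filter_upwards [hae] with z hz
    exact (hlim z hz).mul_const _

lemma EK.ibp (hn : 2 ≤ n) (hK : EK c K) (hKd : Differentiable ℝ K) (i : Fin n) {c' : ℝ}
    (hK' : EK c' (pd i K)) (hW : (n : ℝ) + 1 < W) (hf : GX 1 W C f) (x : Spc n) :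
    ∫ z, K z * pd i f (x - z) = ∫ z, pd i K z * f (x - z) := by
  have hd : Differentiable ℝ f := hf.1.differentiable (by norm_num)
  have hf1 : GX 0 W C (pd i f) := (GX.pd (N := 0) hf i).mono_W (by linarith)
  have e1 : ∀ z, fderiv ℝ (fun z => f (x - z)) z (single i 1) = -pd i f (x - z) := by
    intro z
    have := pd_comp_scale hd x 1 i z
    simpa [pd] using this
  have ibp := integral_mul_fderiv_eq_neg_fderiv_mul_of_integrable (μ := (volume : Measure (Spc n)))
    (f := K) (g := fun z => f (x - z)) (v := single i 1)
    (hK'.integrable hn hW (hf.mono_N zero_le_one) x)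
    (by simp only [e1, mul_neg]; exact (hK.integrable hn hW hf1 x).neg)
    (hK.integrable hn hW (hf.mono_N zero_le_one) x)
    (fun z _ => hKd z) (fun z _ => (hd _).comp z (by fun_prop))
  simp only [e1, mul_neg, integral_neg, neg_inj] at ibp
  exact ibp

end conv

section kernels

/-- Regularised gradient kernel of the Laplace operator (up to a constant). -/
def kapE (ε : ℝ) (i : Fin n) (z : Spc n) : ℝ := z i * (‖z‖ ^ 2 + ε ^ 2) ^ (-(n / 2 : ℝ))

/-- Regularised fundamental solution of the Laplace operator (up to a constant). -/
def lapE (ε : ℝ) (z : Spc n) : ℝ :=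
  if n = 2 then 1 / 2 * log (‖z‖ ^ 2 + ε ^ 2)
  else (‖z‖ ^ 2 + ε ^ 2) ^ ((2 - n) / 2 : ℝ) / (2 - n)

/-- Normalising constant of the fundamental solution. -/
def cLap (n : ℕ) : ℝ := if n = 2 then 1 / Real.pi else 1 / sphArea n

lemma lapKer_eq (z : Spc n) : lapKer n z = cLap n * lapE 0 z := by
  unfold lapKer cLap lapE
  split_ifs with h
  · simp only [ne_eq, OfNat.ofNat_ne_zero, not_false_eq_true, zero_pow, add_zero, log_pow]
    push_cast
    ring
  · have : (‖z‖ ^ 2 + 0 ^ 2) ^ ((2 - n) / 2 : ℝ) = ‖z‖ ^ (2 - n : ℝ) := by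
      rw [zero_pow two_ne_zero, add_zero, ← rpow_natCast, ← rpow_mul (norm_nonneg _)]
      congr 1
      push_cast
      ring
    rw [this, div_mul_eq_div_div, one_div, div_eq_inv_mul _ (sphArea n), mul_div_assoc]

lemma hasFDerivAt_comp_norm_sq {h : ℝ → ℝ} {h' : ℝ} {z : Spc n}
    (hh : HasDerivAt h h' (‖z‖ ^ 2 + ε ^ 2)) :
    DifferentiableAt ℝ (fun z : Spc n => h (‖z‖ ^ 2 + ε ^ 2)) z ∧
      ∀ i, pd i (fun z : Spc n => h (‖z‖ ^ 2 + ε ^ 2)) z = h' * (2 * z i) := by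
  have h1 : HasFDerivAt (fun z : Spc n => ‖z‖ ^ 2 + ε ^ 2) (2 • (innerSL ℝ z)) z :=
    (hasStrictFDerivAt_norm_sq z).hasFDerivAt.add_const _
  have h2 := hh.comp_hasFDerivAt z h1
  refine ⟨h2.differentiableAt, fun i => ?_⟩
  rw [pd, show (fun z : Spc n => h (‖z‖ ^ 2 + ε ^ 2)) = h ∘ fun z : Spc n => ‖z‖ ^ 2 + ε ^ 2 from rfl,
    h2.fderiv]
  simp [EuclideanSpace.inner_single_right]

lemma lapE_pd (hn : 2 ≤ n) (hε : 0 < ε) : Differentiable ℝ (lapE ε : 𝓕) ∧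
    ∀ i, pd i (lapE ε : 𝓕) = kapE ε i := by
  have hn' : (2 : ℝ) ≤ n := by exact_mod_cast hn
  have key : ∀ z : Spc n, DifferentiableAt ℝ (lapE ε : 𝓕) z ∧
      ∀ i, pd i (lapE ε : 𝓕) z = kapE ε i z := by
    intro z
    have hQ : 0 < ‖z‖ ^ 2 + ε ^ 2 := by positivity
    unfold lapE kapE
    split_ifs with h
    · have := hasFDerivAt_comp_norm_sq (z := z) (h := fun s => 1 / 2 * log s)
        ((hasDerivAt_log hQ.ne').const_mul (1 / 2))
      refine ⟨this.1, fun i => (this.2 i).trans ?_⟩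
      have e : (-(n / 2) : ℝ) = -1 := by rw [h]; norm_num
      rw [e, rpow_neg_one]
      ring
    · have h3 : (2 - n : ℝ) ≠ 0 := by
        intro h'
        apply h
        have : (n : ℝ) = 2 := by linarith
        exact_mod_cast this
      have := hasFDerivAt_comp_norm_sq (z := z) (h := fun s => s ^ ((2 - n) / 2 : ℝ) / (2 - n))
        ((hasDerivAt_rpow_const (Or.inl hQ.ne')).div_const _)
      refine ⟨this.1, fun i => (this.2 i).trans ?_⟩
      rw [show ((2 - n) / 2 - 1 : ℝ) = -(n / 2) by ring]
      field_simp
  exact ⟨fun z => (key z).1, fun i => funext fun z => (key z).2 i⟩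

lemma pd_kapE (hε : 0 < ε) (i j : Fin n) : Differentiable ℝ (kapE ε i : 𝓕) ∧
    ∀ z, pd j (kapE ε i) z = (if i = j then 1 else 0) * (‖z‖ ^ 2 + ε ^ 2) ^ (-(n / 2 : ℝ)) -
      n * (z i * z j) * (‖z‖ ^ 2 + ε ^ 2) ^ (-(n / 2 : ℝ) - 1) := by
  have key : ∀ z : Spc n, DifferentiableAt ℝ (fun z : Spc n => (‖z‖ ^ 2 + ε ^ 2) ^ (-(n / 2 : ℝ))) z ∧
      ∀ j, pd j (fun z : Spc n => (‖z‖ ^ 2 + ε ^ 2) ^ (-(n / 2 : ℝ))) z = _ := fun z =>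
    hasFDerivAt_comp_norm_sq (z := z) (h := fun s => s ^ (-(n / 2 : ℝ)))
        (hasDerivAt_rpow_const (Or.inl (by positivity)))
  have hc : ∀ z : Spc n, DifferentiableAt ℝ (fun x : Spc n => x i) z := fun z =>
    (proj i : Spc n →L[ℝ] ℝ).differentiableAt
  refine ⟨fun z => (hc z).mul (key z).1, fun z => ?_⟩
  rw [show kapE ε i = fun z : Spc n => z i * (‖z‖ ^ 2 + ε ^ 2) ^ (-(n / 2 : ℝ)) from rfl,
    pd_mul (hc z) (key z).1, (key z).2, pd_coord]
  ring

lemma continuous_kapE (hε : 0 < ε) (i : Fin n) : Continuous (kapE ε i : 𝓕) :=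
  (pd_kapE hε i i).1.continuous

lemma measurable_kapE (i : Fin n) : Measurable (kapE ε i : 𝓕) := by
  unfold kapE
  exact (proj i : Spc n →L[ℝ] ℝ).continuous.measurable.mul (by fun_prop)

lemma measurable_lapE : Measurable (lapE ε : 𝓕) := by
  unfold lapE
  split_ifs
  · fun_prop
  · fun_prop

lemma abs_coord_le (z : Spc n) (i : Fin n) : |z i| ≤ ‖z‖ := by
  simpa using PiLp.norm_apply_le z i

lemma norm_sq_rpow (z : Spc n) (a : ℝ) : (‖z‖ ^ 2) ^ a = ‖z‖ ^ (2 * a) := by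
  rw [← rpow_natCast, ← rpow_mul (norm_nonneg _)]
  norm_num

lemma kapE_le (i : Fin n) (z : Spc n) : |kapE ε i z| ≤ env z := by
  refine le_trans ?_ (rpow_le_env z)
  rcases (norm_nonneg z).eq_or_lt with h | h
  · have : z i = 0 := by
      have := abs_coord_le z i
      rw [← h] at this
      exact abs_nonpos_iff.1 this
    rw [kapE, this, zero_mul, abs_zero]
    positivity
  · rw [kapE, abs_mul, abs_of_nonneg (by positivity : 0 ≤ (‖z‖ ^ 2 + ε ^ 2) ^ (-(n / 2 : ℝ)))]
    calc |z i| * (‖z‖ ^ 2 + ε ^ 2) ^ (-(n / 2 : ℝ)) ≤ ‖z‖ * (‖z‖ ^ 2) ^ (-(n / 2 : ℝ)) := by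
          refine mul_le_mul (abs_coord_le z i) ?_ (by positivity) h.le
          exact rpow_le_rpow_of_nonpos (by positivity) (by nlinarith [sq_nonneg ε])
            (by have : (0 : ℝ) ≤ n := n.cast_nonneg
                linarith)
      _ = ‖z‖ ^ (-((n : ℝ) - 1)) := by
          rw [norm_sq_rpow]
          nth_rewrite 1 [← rpow_one ‖z‖]
          rw [← rpow_add h]
          congr 1
          ring

lemma lapE_le (hn : 2 ≤ n) (h0 : 0 ≤ ε) (h1 : ε ≤ 1) {z : Spc n} (hz : z ≠ 0) :
    |lapE ε z| ≤ env z := by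
  have hr : 0 < ‖z‖ := norm_pos_iff.2 hz
  unfold lapE
  split_ifs with h
  · have e : env z = ‖z‖⁻¹ + ‖z‖ + 1 := by
      have hc : -((n : ℝ) - 1) = -1 := by rw [h]; norm_num
      rw [env, hc, rpow_neg_one]
    rw [e, abs_le]
    have i0 : 0 < ‖z‖⁻¹ := by positivity
    constructor
    · have l1 : log (‖z‖ ^ 2) ≤ log (‖z‖ ^ 2 + ε ^ 2) :=
        log_le_log (by positivity) (by nlinarith)
      rw [log_pow] at l1
      have l2 := log_le_sub_one_of_pos i0
      rw [log_inv] at l2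
      push_cast at l1
      linarith
    · have l1 : log (‖z‖ ^ 2 + ε ^ 2) ≤ log ((1 + ‖z‖) ^ 2) :=
        log_le_log (by positivity) (by nlinarith)
      have l2 := log_le_sub_one_of_pos (show 0 < 1 + ‖z‖ by positivity)
      rw [log_pow] at l1
      push_cast at l1
      linarith
  · have hn3 : (3 : ℝ) ≤ n := by
      have : 3 ≤ n := by omega
      exact_mod_cast this
    rw [abs_div, abs_of_nonneg (by positivity : 0 ≤ (‖z‖ ^ 2 + ε ^ 2) ^ ((2 - n) / 2 : ℝ)),
      abs_of_neg (by linarith : (2 - n : ℝ) < 0)]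
    have l1 : (‖z‖ ^ 2 + ε ^ 2) ^ ((2 - n) / 2 : ℝ) ≤ ‖z‖ ^ (2 - n : ℝ) := by
      refine (rpow_le_rpow_of_nonpos (by positivity : 0 < ‖z‖ ^ 2) (by nlinarith)
        (by linarith)).trans (le_of_eq ?_)
      rw [norm_sq_rpow]
      congr 1
      ring
    have l2 : ‖z‖ ^ (2 - n : ℝ) ≤ env z := by
      rcases le_total ‖z‖ 1 with h' | h'
      · exact (rpow_le_rpow_of_exponent_ge hr h' (by linarith)).trans (rpow_le_env z)
      · exact (rpow_le_one_of_one_le_of_nonpos h' (by linarith)).trans (one_le_env z)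
    refine (div_le_self (by positivity) (by linarith)).trans (l1.trans l2)

lemma lapE_EK (hn : 2 ≤ n) (h0 : 0 ≤ ε) (h1 : ε ≤ 1) :
    EK (1 + |lapE ε (0 : Spc n)|) (lapE ε : 𝓕) := by
  refine ⟨measurable_lapE.aestronglyMeasurable, fun z => ?_⟩
  have h3 := one_le_env z
  have h4 := abs_nonneg (lapE ε (0 : Spc n))
  by_cases hz : z = 0
  · rw [hz] at h3 ⊢
    nlinarith
  · have := lapE_le hn h0 h1 hz
    nlinarith

lemma kapE_EK (i : Fin n) : EK 1 (kapE ε i : 𝓕) :=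
  ⟨(measurable_kapE i).aestronglyMeasurable, fun z => by rw [one_mul]; exact kapE_le i z⟩

lemma pd_kapE_EK (hε : 0 < ε) (i j : Fin n) :
    EK ((1 + n) * (ε ^ 2) ^ (-(n / 2 : ℝ))) (pd j (kapE ε i) : 𝓕) := by
  refine ⟨(measurable_fderiv_apply_const ℝ _ _).aestronglyMeasurable, fun z => ?_⟩
  rw [(pd_kapE hε i j).2]
  have hQ : 0 < ‖z‖ ^ 2 + ε ^ 2 := by positivity
  have hn0 : (0 : ℝ) ≤ n := n.cast_nonneg
  have l1 : (‖z‖ ^ 2 + ε ^ 2) ^ (-(n / 2 : ℝ)) ≤ (ε ^ 2) ^ (-(n / 2 : ℝ)) :=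
    rpow_le_rpow_of_nonpos (by positivity) (by nlinarith [sq_nonneg ‖z‖]) (by linarith)
  have e1 : (‖z‖ ^ 2 + ε ^ 2) * (‖z‖ ^ 2 + ε ^ 2) ^ (-(n / 2 : ℝ) - 1) =
      (‖z‖ ^ 2 + ε ^ 2) ^ (-(n / 2 : ℝ)) := by
    rw [rpow_sub_one hQ.ne']; field_simp
  have p1 : 0 ≤ (‖z‖ ^ 2 + ε ^ 2) ^ (-(n / 2 : ℝ)) := by positivity
  have p2 : 0 ≤ (‖z‖ ^ 2 + ε ^ 2) ^ (-(n / 2 : ℝ) - 1) := by positivity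
  have l2 : |z i * z j| ≤ ‖z‖ ^ 2 + ε ^ 2 := by
    rw [abs_mul]
    nlinarith [abs_coord_le z i, abs_coord_le z j, abs_nonneg (z i), abs_nonneg (z j), sq_nonneg ε,
      norm_nonneg z]
  calc |(if i = j then 1 else 0) * (‖z‖ ^ 2 + ε ^ 2) ^ (-(n / 2 : ℝ)) -
      n * (z i * z j) * (‖z‖ ^ 2 + ε ^ 2) ^ (-(n / 2 : ℝ) - 1)|
      ≤ |(if i = j then (1 : ℝ) else 0) * (‖z‖ ^ 2 + ε ^ 2) ^ (-(n / 2 : ℝ))| +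
        |n * (z i * z j) * (‖z‖ ^ 2 + ε ^ 2) ^ (-(n / 2 : ℝ) - 1)| := abs_sub _ _
    _ ≤ 1 * (‖z‖ ^ 2 + ε ^ 2) ^ (-(n / 2 : ℝ)) +
        n * (‖z‖ ^ 2 + ε ^ 2) * (‖z‖ ^ 2 + ε ^ 2) ^ (-(n / 2 : ℝ) - 1) := by
        rw [abs_mul, abs_mul, abs_mul (n : ℝ), abs_of_nonneg p1, abs_of_nonneg p2, abs_of_nonneg hn0]
        gcongr
        split_ifs <;> simp
    _ = (1 + n) * (‖z‖ ^ 2 + ε ^ 2) ^ (-(n / 2 : ℝ)) := by rw [mul_assoc (n : ℝ), e1]; ring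
    _ ≤ (1 + n) * (ε ^ 2) ^ (-(n / 2 : ℝ)) * 1 := by rw [mul_one]; gcongr
    _ ≤ _ := by
        gcongr
        exact one_le_env z

lemma sum_pd_kapE (hε : 0 < ε) (z : Spc n) :
    ∑ i, pd i (kapE ε i) z = n * ε ^ 2 * (‖z‖ ^ 2 + ε ^ 2) ^ (-(n / 2 : ℝ) - 1) := by
  have hQ : 0 < ‖z‖ ^ 2 + ε ^ 2 := by positivity
  have e1 : (‖z‖ ^ 2 + ε ^ 2) ^ (-(n / 2 : ℝ)) =
      (‖z‖ ^ 2 + ε ^ 2) * (‖z‖ ^ 2 + ε ^ 2) ^ (-(n / 2 : ℝ) - 1) := by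
    rw [rpow_sub_one hQ.ne']; field_simp
  have e2 : ∑ i, z i * z i = ‖z‖ ^ 2 := by
    rw [EuclideanSpace.real_norm_sq_eq]
    exact sum_congr rfl fun i _ => (sq _).symm
  simp only [(pd_kapE hε _ _).2, if_true, one_mul, Finset.sum_sub_distrib, ← sum_mul,
    ← mul_sum, sum_const, card_univ, Fintype.card_fin, nsmul_eq_mul, e2]
  rw [e1]
  ring

end kernels

section newton

/-- Convolution with the gradient kernel of the Laplace operator. -/
def RK (i : Fin n) (f : 𝓕) (x : Spc n) : ℝ := ∫ z, kapE 0 i z * f (x - z)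

lemma newtPot_eq (f : 𝓕) (x : Spc n) :
    newtPot f x = cLap n * ∫ z, lapE 0 z * f (x - z) := by
  have := integral_sub_left_eq_self (fun z => lapKer n z * f (x - z)) volume x
  simp only [sub_sub_cancel] at this
  rw [newtPot, this, ← integral_const_mul]
  refine integral_congr_ae (Eventually.of_forall fun z => ?_)
  simp only [lapKer_eq]
  ring

lemma tendsto_epsSeq : Tendsto (fun m : ℕ => (1 / ((m : ℝ) + 1))) atTop (nhds 0) :=
  tendsto_one_div_add_atTop_nhds_zero_nat

lemma tendsto_normSq_epsSeq (z : Spc n) :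
    Tendsto (fun m : ℕ => ‖z‖ ^ 2 + (1 / ((m : ℝ) + 1)) ^ 2) atTop (nhds (‖z‖ ^ 2 + 0 ^ 2)) :=
  (tendsto_epsSeq.pow 2).const_add _

lemma lapE_tendsto {z : Spc n} (hz : z ≠ 0) :
    Tendsto (fun m : ℕ => lapE (1 / ((m : ℝ) + 1)) z) atTop (nhds (lapE 0 z)) := by
  have hQ : ‖z‖ ^ 2 + (0 : ℝ) ^ 2 ≠ 0 := by
    have := norm_pos_iff.2 hz
    positivity
  unfold lapE
  split_ifs
  · exact ((tendsto_normSq_epsSeq z).log hQ).const_mul _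
  · exact ((tendsto_normSq_epsSeq z).rpow_const (Or.inl hQ)).div_const _

lemma kapE_tendsto (i : Fin n) {z : Spc n} (hz : z ≠ 0) :
    Tendsto (fun m : ℕ => kapE (1 / ((m : ℝ) + 1)) i z) atTop (nhds (kapE 0 i z)) := by
  have hQ : ‖z‖ ^ 2 + (0 : ℝ) ^ 2 ≠ 0 := by
    have := norm_pos_iff.2 hz
    positivity
  exact ((tendsto_normSq_epsSeq z).rpow_const (Or.inl hQ)).const_mul _

lemma epsSeq_pos (m : ℕ) : 0 < 1 / ((m : ℝ) + 1) := by positivity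

lemma epsSeq_le_one (m : ℕ) : 1 / ((m : ℝ) + 1) ≤ 1 := by
  rw [div_le_one (by positivity)]
  linarith [(m.cast_nonneg : (0 : ℝ) ≤ m)]

lemma lapE_conv_pd (hn : 2 ≤ n) (hW : (n : ℝ) + 1 < W) (hf : GX 1 W C f) (i : Fin n)
    (x : Spc n) : ∫ z, lapE 0 z * pd i f (x - z) = RK i f x := by
  have h1 := EK.tendsto hn (Ks := fun m => lapE (1 / ((m : ℝ) + 1))) (K := lapE 0)
    (fun m => measurable_lapE.aestronglyMeasurable)
    (fun m z hz => lapE_le hn (epsSeq_pos m).le (epsSeq_le_one m) hz)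
    (W := W + 1) (by linarith) (hf.pd i) (fun z hz => lapE_tendsto hz) x
  have h2 := EK.tendsto hn (Ks := fun m => kapE (1 / ((m : ℝ) + 1)) i) (K := kapE 0 i)
    (fun m => (measurable_kapE i).aestronglyMeasurable)
    (fun m z hz => kapE_le i z) hW (hf.mono_N (by omega)) (fun z hz => kapE_tendsto i hz) x
  refine tendsto_nhds_unique h1 (h2.congr fun m => ?_)
  have hL := lapE_pd hn (epsSeq_pos m)
  have := EK.ibp hn (lapE_EK hn (epsSeq_pos m).le (epsSeq_le_one m)) hL.1 i
    (by rw [hL.2 i]; exact kapE_EK i) hW hf x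
  rw [this, hL.2 i]

lemma newtPot_differentiable (hn : 2 ≤ n) (hW : (n : ℝ) + 1 < W) (hf : GX 1 W C f) :
    Differentiable ℝ (newtPot f) := by
  rw [show newtPot f = fun x => cLap n * ∫ z, lapE 0 z * f (x - z) from funext (newtPot_eq f)]
  exact (EK.hasFDerivAt hn (lapE_EK hn le_rfl zero_le_one) hW hf).1.const_mul _

lemma pd_newtPot (hn : 2 ≤ n) (hW : (n : ℝ) + 1 < W) (hf : GX 1 W C f) (i : Fin n) :
    pd i (newtPot f) = newtPot (pd i f) := by
  funext x
  rw [show newtPot f = fun x => cLap n * ∫ z, lapE 0 z * f (x - z) from funext (newtPot_eq f),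
    pd_const_mul, newtPot_eq]
  beta_reduce
  rw [(EK.hasFDerivAt hn (lapE_EK hn le_rfl zero_le_one) hW hf).2]

lemma pd_newtPot_eq_RK (hn : 2 ≤ n) (hW : (n : ℝ) + 1 < W) (hf : GX 1 W C f) (i : Fin n) :
    pd i (newtPot f) = fun x => cLap n * RK i f x := by
  rw [pd_newtPot hn hW hf]
  funext x
  rw [newtPot_eq, lapE_conv_pd hn hW hf]

lemma newtPot_contDiff (hn : 2 ≤ n) (hW : (n : ℝ) + 1 < W) (hf : GX (N + 1) W C f) :
    ContDiff ℝ N (newtPot f) := by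
  rw [show newtPot f = fun x => cLap n * ∫ z, lapE 0 z * f (x - z) from funext (newtPot_eq f)]
  exact contDiff_const.mul (EK.contDiff hn (lapE_EK hn le_rfl zero_le_one) hW hf)

/-- Constant in the identity `∑ R_i ∂_i f = c f`. -/
def cRho (n : ℕ) : ℝ := ∫ y : Spc n, n * wt y ^ (-(n + 2) : ℝ)

lemma rho_integral (hε : 0 < ε) (x : Spc n) (f : 𝓕) :
    ∫ z, n * ε ^ 2 * (‖z‖ ^ 2 + ε ^ 2) ^ (-(n / 2 : ℝ) - 1) * f (x - z) =
      ∫ y, n * wt y ^ (-(n + 2) : ℝ) * f (x - ε • y) := by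
  have h := Measure.integral_comp_smul (volume : Measure (Spc n))
    (fun z => n * ε ^ 2 * (‖z‖ ^ 2 + ε ^ 2) ^ (-(n / 2 : ℝ) - 1) * f (x - z)) ε
  rw [finrank_euclideanSpace_fin, abs_of_pos (by positivity), smul_eq_mul,
    eq_inv_mul_iff_mul_eq₀ (by positivity)] at h
  rw [← h, ← integral_const_mul]
  refine integral_congr_ae (Eventually.of_forall fun y => ?_)
  have e1 : ‖ε • y‖ ^ 2 + ε ^ 2 = ε ^ 2 * wt y ^ 2 := by
    rw [norm_smul, mul_pow, wt_sq, norm_eq_abs, sq_abs]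
    ring
  have e2 : (ε ^ 2 * wt y ^ 2) ^ (-(n / 2 : ℝ) - 1) =
      ε ^ (-(n + 2) : ℝ) * wt y ^ (-(n + 2) : ℝ) := by
    rw [← mul_pow, ← rpow_natCast, ← rpow_mul (mul_nonneg hε.le (wt_pos y).le),
      mul_rpow hε.le (wt_pos y).le]
    congr 2 <;> push_cast <;> ring
  have e3 : ε ^ n * (ε ^ 2 * ε ^ (-(n + 2) : ℝ)) = 1 := by
    rw [← rpow_natCast, ← rpow_natCast, ← rpow_add hε, ← rpow_add hε]
    push_cast
    rw [show (n + (2 + -(n + 2)) : ℝ) = 0 by ring, rpow_zero]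
  beta_reduce
  rw [e1, e2]
  linear_combination (n * wt y ^ (-(n + 2) : ℝ) * f (x - ε • y)) * e3

lemma sum_RK_pd (hn : 2 ≤ n) (hW : (n : ℝ) + 1 < W) (hf : GX 1 W C f) (x : Spc n) :
    ∑ i, RK i (pd i f) x = cRho n * f x := by
  have h1 : Tendsto (fun m : ℕ => ∑ i, ∫ z, kapE (1 / ((m : ℝ) + 1)) i z * pd i f (x - z)) atTop
      (nhds (∑ i, RK i (pd i f) x)) :=
    tendsto_finset_sum _ fun i _ => EK.tendsto hn (Ks := fun m => kapE (1 / ((m : ℝ) + 1)) i)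
      (K := kapE 0 i) (fun m => (measurable_kapE i).aestronglyMeasurable)
      (fun m z hz => kapE_le i z) (W := W + 1) (by linarith) (hf.pd i)
      (fun z hz => kapE_tendsto i hz) x
  refine tendsto_nhds_unique h1 ?_
  have hf0 : GX 0 W C f := hf.mono_N (by omega)
  have hW0 : 0 ≤ W := by
    have := (n.cast_nonneg : (0 : ℝ) ≤ n)
    linarith
  have e : ∀ m : ℕ, ∑ i, ∫ z, kapE (1 / ((m : ℝ) + 1)) i z * pd i f (x - z) =
      ∫ y, n * wt y ^ (-(n + 2) : ℝ) * f (x - (1 / ((m : ℝ) + 1)) • y) := by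
    intro m
    have hε := epsSeq_pos m
    rw [← rho_integral hε]
    simp only [fun i => EK.ibp hn (kapE_EK i) (pd_kapE hε i i).1 i (pd_kapE_EK hε i i) hW hf x]
    rw [← integral_finset_sum _ fun i _ => (pd_kapE_EK hε i i).integrable hn hW hf0 x]
    simp only [← sum_mul, sum_pd_kapE hε]
  simp only [e]
  have hw : Integrable (fun y : Spc n => (n : ℝ) * wt y ^ (-(n + 2) : ℝ)) :=
    (integrable_wt_rpow (by linarith)).const_mul _
  rw [cRho, ← integral_mul_const]
  refine tendsto_integral_of_dominated_convergence
    (fun y => (n : ℝ) * wt y ^ (-(n + 2) : ℝ) * C) (fun m => ?_) (hw.mul_const C) (fun m => ?_) ?_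
  · refine hw.aestronglyMeasurable.mul (Continuous.aestronglyMeasurable ?_)
    exact hf0.cont.comp (by fun_prop)
  · refine Eventually.of_forall fun y => ?_
    rw [norm_mul, norm_of_nonneg (mul_nonneg n.cast_nonneg (wt_rpow_pos y _).le)]
    exact mul_le_mul_of_nonneg_left (hf0.abs_le_const hW0 _)
      (mul_nonneg n.cast_nonneg (wt_rpow_pos y _).le)
  · refine Eventually.of_forall fun y => Tendsto.const_mul _ ?_
    have : Tendsto (fun m : ℕ => x - (1 / ((m : ℝ) + 1)) • y) atTop (nhds (x - (0 : ℝ) • y)) :=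
      (tendsto_epsSeq.smul_const y).const_sub x
    rw [zero_smul, sub_zero] at this
    exact (hf0.cont.tendsto x).comp this

lemma lap_newtPot (hn : 2 ≤ n) (hW : (n : ℝ) + 1 < W) (hf : GX 2 W C f) (x : Spc n) :
    lap (newtPot f) x = cLap n * cRho n * f x := by
  have h1 : GX 1 W C f := hf.mono_N (by omega)
  simp only [lap, pd_newtPot hn hW h1]
  simp only [fun i => pd_newtPot_eq_RK hn (W := W + 1) (by linarith) (hf.pd i) i,
    ← mul_sum, sum_RK_pd hn hW h1]
  ring

end newton

section split

lemma GX.of_hasCompactSupport (hf : ContDiff ℝ N f) (hs : HasCompactSupport f)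
    (W : ℝ) : ∃ C, GX N W C f := by
  have : ∀ m ≤ N, ∃ C, ∀ x, wt x ^ (W + m) * ‖∇ m f x‖ ≤ C := by
    intro m hm
    have hc : Continuous fun x => wt x ^ (W + m) * ‖∇ m f x‖ :=
      (continuous_wt_rpow _).mul (hf.continuous_iteratedFDeriv (by exact_mod_cast hm)).norm
    have hs' : HasCompactSupport fun x => wt x ^ (W + m) * ‖∇ m f x‖ :=
      ((hs.iteratedFDeriv m).norm).mul_left
    obtain ⟨C, hC⟩ := hc.bounded_above_of_compact_support hs'
    exact ⟨C, fun x => (le_abs_self _).trans (hC x)⟩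
  choose! c hc using this
  refine ⟨∑ m ∈ range (N + 1), |c m|, hf, fun m hm x => (hc m hm x).trans ?_⟩
  exact (le_abs_self _).trans (single_le_sum (f := fun m => |c m|)
    (fun _ _ => abs_nonneg _) (mem_range.2 (by omega)))

lemma GX.coord_mul (h : GX N W C f) (i : Fin n) :
    GX N (W - 1) (2 ^ N * ((n + 1) * C)) (fun x => x i * f x) := by
  have := (GX.coord (N := N) i).mul h
  rwa [show (-1 + W : ℝ) = W - 1 by ring] at this

/-- A smooth function comparable to `w²`, with the natural decay of derivatives. -/
def WQ (Q : 𝓕) : Prop := (∀ N, ∃ C, GX N (-2) C Q) ∧ ∀ x, wt x ^ 2 / 2 ≤ Q x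

lemma WQ.pos {Q : 𝓕} (hQ : WQ Q) (x : Spc n) : 0 < Q x :=
  lt_of_lt_of_le (by have := wt_pos x; positivity) (hQ.2 x)

lemma WQ.hasDeriv {Q : 𝓕} (hQ : WQ Q) (a : ℝ) (x : Spc n) :
    DifferentiableAt ℝ (fun x => Q x ^ (-a)) x ∧
    ∀ i, pd i (fun x => Q x ^ (-a)) x = -a * (Q x ^ (-(a + 1)) * pd i Q x) := by
  obtain ⟨C, hC⟩ := hQ.1 1
  have hd : HasFDerivAt Q (fderiv ℝ Q x) x := ((hC.1.differentiable (by simp)) x).hasFDerivAt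
  have h1 := (hasDerivAt_rpow_const (p := -a) (Or.inl (hQ.pos x).ne')).comp_hasFDerivAt x hd
  refine ⟨h1.differentiableAt, fun i => ?_⟩
  rw [pd, show (fun x => Q x ^ (-a)) = (fun s : ℝ => s ^ (-a)) ∘ Q from rfl, h1.fderiv,
    show -(a + 1) = -a - 1 by ring]
  simp [pd, mul_assoc]

lemma WQ.rpow_GX {Q : 𝓕} (hQ : WQ Q) (N : ℕ) :
    ∀ a : ℝ, 0 ≤ a → ∃ C, GX N (2 * a) C (fun x => Q x ^ (-a)) := by
  have base : ∀ a : ℝ, 0 ≤ a → ∀ x : Spc n, wt x ^ (2 * a) * |Q x ^ (-a)| ≤ 2 ^ a := by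
    intro a ha x
    have hp := hQ.pos x
    have hw := wt_pos x
    rw [abs_of_pos (rpow_pos_of_pos hp _)]
    calc wt x ^ (2 * a) * Q x ^ (-a) ≤ wt x ^ (2 * a) * (wt x ^ 2 / 2) ^ (-a) := by
          refine mul_le_mul_of_nonneg_left ?_ (wt_rpow_pos x _).le
          exact rpow_le_rpow_of_nonpos (by positivity) (hQ.2 x) (by linarith)
      _ = 2 ^ a := by
          rw [rpow_neg (by positivity), div_rpow (by positivity) (by norm_num),
            ← rpow_natCast, ← rpow_mul hw.le]
          push_cast
          have : wt x ^ (2 * a) ≠ 0 := (rpow_pos_of_pos hw _).ne'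
          field_simp
  induction N with
  | zero =>
    intro a ha
    refine ⟨2 ^ a, ?_, fun m hm x => ?_⟩
    · have : Continuous (fun x => Q x ^ (-a)) :=
        continuous_iff_continuousAt.2 fun x => (hQ.hasDeriv a x).1.continuousAt
      exact_mod_cast contDiff_zero.2 this
    · obtain rfl : m = 0 := by omega
      simpa using base a ha x
  | succ N ih =>
    intro a ha
    obtain ⟨C1, h1⟩ := ih (a + 1) (by linarith)
    obtain ⟨C2, h2⟩ := hQ.1 (N + 1)
    have h3 : ∀ i, GX N (2 * a + 1) (|-a| * (2 ^ N * (C1 * C2))) (pd i fun x => Q x ^ (-a)) := by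
      intro i
      have := (h1.mul (h2.pd i)).smul (-a)
      rw [show 2 * (a + 1) + (-2 + 1) = 2 * a + 1 by ring] at this
      exact this.congr fun x => (hQ.hasDeriv a x).2 i
    refine ⟨_, GX.succ (C := max (2 ^ a) (|-a| * (2 ^ N * (C1 * C2))))
      (fun x => (hQ.hasDeriv a x).1) (fun x => (base a ha x).trans (le_max_left _ _))
      fun i => (h3 i).mono (le_max_right _ _)⟩

lemma GX.normSq (N : ℕ) : ∃ C, GX N (-2) C (fun x : Spc n => ‖x‖ ^ 2) := by
  have h := GX.sum (univ : Finset (Fin n)) fun i _ =>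
    (GX.coord (N := N) i).coord_mul (n := n) i
  rw [show (-1 - 1 : ℝ) = -2 by norm_num] at h
  refine ⟨_, h.congr fun x => ?_⟩
  rw [EuclideanSpace.real_norm_sq_eq]
  exact sum_congr rfl fun i _ => sq _

lemma WQ_wt_sq : WQ (fun x : Spc n => 1 + ‖x‖ ^ 2) := by
  refine ⟨fun N => ?_, fun x => ?_⟩
  · obtain ⟨C, hC⟩ := GX.normSq (n := n) N
    exact ⟨_, ((GX.const (N := N) 1).mono_W (by norm_num)).add hC⟩
  · rw [wt_sq]
    nlinarith [sq_nonneg ‖x‖]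

/-- A function decays one order faster as soon as its products with the coordinates
keep the original decay. -/
lemma GX.of_coord_mul (N : ℕ) (W : ℝ) : ∃ A, 0 ≤ A ∧ ∀ C (H : 𝓕), GX N W C H →
    (∀ i, GX N W C (fun x => x i * H x)) → GX N (W + 1) (A * C) H := by
  obtain ⟨C1, h1⟩ := (WQ_wt_sq (n := n)).rpow_GX N 1 zero_le_one
  refine ⟨2 ^ N * (C1 * (1 + n * (2 ^ N * (n + 1)))), ?_, fun C H h hi => ?_⟩
  · have := h1.nonneg
    positivity
  · have hs := (h.mono_W (show W - 1 ≤ W by linarith)).add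
      (GX.sum univ fun i _ => (hi i).coord_mul i)
    have h2 := h1.mul hs
    rw [show 2 * 1 + (W - 1) = W + 1 by ring] at h2
    refine (h2.congr fun x => ?_).mono (le_of_eq ?_)
    · have e : ∑ i, x i * (x i * H x) = ‖x‖ ^ 2 * H x := by
        rw [EuclideanSpace.real_norm_sq_eq, sum_mul]
        exact sum_congr rfl fun i _ => by ring
      rw [e, rpow_neg_one]
      have : 1 + ‖x‖ ^ 2 ≠ 0 := by positivity
      field_simp
    · rw [sum_const, card_univ, Fintype.card_fin, nsmul_eq_mul]
      ring

/-- A smooth bump function equal to one on the unit ball. -/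
def bump (n : ℕ) : ContDiffBump (0 : Spc n) := ⟨1, 2, by norm_num, by norm_num⟩

/-- A smooth function equal to `|x|²` for `|x| ≥ 2` and comparable to `w²`. -/
def qfun (x : Spc n) : ℝ := ‖x‖ ^ 2 + bump n x

lemma WQ_qfun : WQ (qfun : 𝓕) := by
  refine ⟨fun N => ?_, fun x => ?_⟩
  · obtain ⟨C, hC⟩ := GX.normSq (n := n) N
    obtain ⟨C', hC'⟩ := GX.of_hasCompactSupport (N := N) ((bump n).contDiff)
      (bump n).hasCompactSupport (-2)
    exact ⟨_, hC.add hC'⟩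
  · rw [wt_sq, qfun]
    rcases le_total ‖x‖ 1 with h | h
    · have : bump n x = 1 := (bump n).one_of_mem_closedBall (by
        rw [mem_closedBall_zero_iff]; exact h)
      rw [this]
      nlinarith [sq_nonneg ‖x‖]
    · have := (bump n).nonneg (x := x)
      nlinarith

/-- Smooth part of the gradient kernel. -/
def kap2 (i : Fin n) (z : Spc n) : ℝ := z i * qfun z ^ (-(n / 2 : ℝ))

/-- Compactly supported singular part of the gradient kernel. -/
def kap1 (i : Fin n) (z : Spc n) : ℝ := kapE 0 i z - kap2 i z

lemma kap2_GX (i : Fin n) (N : ℕ) : ∃ C, GX N (n - 1 : ℝ) C (kap2 i : 𝓕) := by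
  obtain ⟨C, hC⟩ := (WQ_qfun (n := n)).rpow_GX N (n / 2) (by positivity)
  have := hC.coord_mul i
  rw [show (2 * (n / 2) - 1 : ℝ) = n - 1 by ring] at this
  exact ⟨_, this⟩

lemma pd_kap2_GX (i j : Fin n) (N : ℕ) : ∃ C, GX N (n : ℝ) C (pd j (kap2 i) : 𝓕) := by
  obtain ⟨C, hC⟩ := kap2_GX i (N + 1)
  have := hC.pd j
  rw [sub_add_cancel] at this
  exact ⟨_, this⟩

lemma EK.of_GX {k : 𝓕} (hW : 0 ≤ W) (h : GX 0 W C k) : EK C k :=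
  ⟨h.cont.aestronglyMeasurable, fun z => (h.abs_le_const hW z).trans
    (le_mul_of_one_le_right h.nonneg (one_le_env z))⟩

lemma kap1_integrable (hn : 2 ≤ n) (i : Fin n) (B : ℝ) (hB : 0 ≤ B) :
    Integrable (fun z : Spc n => |kap1 i z| * wt z ^ B) := by
  have hn1 : (0 : ℝ) ≤ n - 1 := by
    have : (2 : ℝ) ≤ n := by exact_mod_cast hn
    linarith
  obtain ⟨C, hC⟩ := kap2_GX i 0
  have h2 := EK.of_GX hn1 hC
  have hm : AEStronglyMeasurable (kap1 i : 𝓕) :=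
    (kapE_EK i).1.sub h2.1
  refine ((env_integrable hn (W := n + 2) (by linarith)).const_mul
    ((1 + C) * 3 ^ (B + (n + 2)))).mono'
    (hm.norm.mul (continuous_wt_rpow B).aestronglyMeasurable) (Eventually.of_forall fun z => ?_)
  have h0 : 0 ≤ env z := zero_le_one.trans (one_le_env z)
  have hw := wt_pos z
  have hC0 := hC.nonneg
  rw [norm_mul, norm_eq_abs, abs_abs, norm_of_nonneg (by positivity)]
  by_cases hz : ‖z‖ < 2
  · have hk : |kap1 i z| ≤ (1 + C) * env z := by
      refine (abs_sub _ _).trans ?_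
      have := (kapE_EK (ε := 0) i).2 z
      have := h2.2 z
      linarith
    have hw3 : wt z ^ (B + (n + 2)) ≤ 3 ^ (B + (n + 2)) :=
      rpow_le_rpow hw.le ((wt_le z).trans (by linarith)) (by positivity)
    calc |kap1 i z| * wt z ^ B
        = |kap1 i z| * (wt z ^ (B + (n + 2)) * wt z ^ (-((n : ℝ) + 2))) := by
          rw [← rpow_add hw, add_neg_cancel_right]
      _ ≤ ((1 + C) * env z) * (3 ^ (B + (n + 2)) * wt z ^ (-((n : ℝ) + 2))) := by
          gcongr
      _ = _ := by ring
  · have : kap1 i z = 0 := by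
      have hb : bump n z = 0 := (bump n).zero_of_le_dist (by
        rw [dist_zero_right]; exact not_lt.1 hz)
      rw [kap1, kap2, kapE, qfun, hb]
      simp
    rw [this]
    simp only [abs_zero, zero_mul]
    positivity

/-- Splitting of `R_i ∂_j` into a compactly supported and a smooth kernel. -/
lemma RK_pd_eq (hn : 2 ≤ n) (hW : (n : ℝ) + 1 < W) (hf : GX 1 W C f)
    (i j : Fin n) (x : Spc n) : RK i (pd j f) x =
      (∫ z, kap1 i z * pd j f (x - z)) + ∫ z, pd j (kap2 i) z * f (x - z) := by
  have hn1 : (0 : ℝ) ≤ n - 1 := by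
    have : (2 : ℝ) ≤ n := by exact_mod_cast hn
    linarith
  obtain ⟨C1, h1⟩ := kap2_GX i 1
  have h2 := EK.of_GX hn1 (h1.mono_N (show 0 ≤ 1 by omega))
  have h3 := EK.of_GX (by linarith) (h1.pd j)
  rw [← h2.ibp hn (h1.1.differentiable (by simp)) j h3 hW hf]
  have i1 := (kapE_EK (ε := 0) i).integrable hn (W := W + 1) (by linarith) (hf.pd j) x
  have i2 := h2.integrable hn (W := W + 1) (by linarith) (hf.pd j) x
  have e : ∀ z, kap1 i z * pd j f (x - z) =
      kapE 0 i z * pd j f (x - z) - kap2 i z * pd j f (x - z) := fun z => by rw [kap1]; ring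
  simp only [e]
  rw [integral_sub i1 i2, RK]
  ring

end split

section smooth_conv

lemma conv_weight_bound (hW : (n : ℝ) < W) (x z : Spc n) :
    wt x ^ (n : ℝ) * (wt z ^ (-(n : ℝ)) * wt (x - z) ^ (-W)) ≤
      2 ^ n * (wt z ^ (-W) + 2 * wt (x - z) ^ (-W)) := by
  have hz := wt_pos z
  have hy := wt_pos (x - z)
  have hadd : wt x ≤ wt z + wt (x - z) := by
    refine le_of_sq_le_sq ?_ (by positivity)
    have h1 : ‖x‖ ≤ ‖z‖ + ‖x - z‖ := by simpa using norm_add_le z (x - z)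
    have h2 := norm_le_wt z
    have h3 := norm_le_wt (x - z)
    have h4 := wt_sq z
    have h5 := wt_sq (x - z)
    rw [wt_sq]
    nlinarith [norm_nonneg x, norm_nonneg z, norm_nonneg (x - z),
      mul_le_mul h2 h3 (norm_nonneg _) hz.le]
  have hp : wt x ^ n ≤ 2 ^ n * (wt z ^ n + wt (x - z) ^ n) := by
    refine (pow_le_pow_left₀ (wt_pos x).le hadd n).trans ?_
    refine (add_pow_le hz.le hy.le n).trans ?_
    exact mul_le_mul_of_nonneg_right (pow_le_pow_right₀ (by norm_num) (by omega)) (by positivity)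
  have hmix : wt (x - z) ^ (n : ℝ) * (wt z ^ (-(n : ℝ)) * wt (x - z) ^ (-W)) ≤
      wt z ^ (-W) + wt (x - z) ^ (-W) := by
    have e1 : ∀ u : ℝ, 0 < u → u ^ (-(n : ℝ)) * u ^ ((n : ℝ) - W) = u ^ (-W) := fun u hu => by
      rw [← rpow_add hu]; congr 1; ring
    have e : wt (x - z) ^ (n : ℝ) * (wt z ^ (-(n : ℝ)) * wt (x - z) ^ (-W)) =
        wt z ^ (-(n : ℝ)) * wt (x - z) ^ ((n : ℝ) - W) := by
      rw [show ((n : ℝ) - W) = n + -W by ring, rpow_add hy]; ring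
    rw [e]
    rcases le_total (wt z) (wt (x - z)) with h | h
    · calc wt z ^ (-(n : ℝ)) * wt (x - z) ^ ((n : ℝ) - W)
          ≤ wt z ^ (-(n : ℝ)) * wt z ^ ((n : ℝ) - W) := by
            refine mul_le_mul_of_nonneg_left ?_ (wt_rpow_pos _ _).le
            exact rpow_le_rpow_of_nonpos hz h (by linarith)
        _ = wt z ^ (-W) := e1 _ hz
        _ ≤ _ := by linarith [wt_rpow_pos (x - z) (-W)]
    · calc wt z ^ (-(n : ℝ)) * wt (x - z) ^ ((n : ℝ) - W)
          ≤ wt (x - z) ^ (-(n : ℝ)) * wt (x - z) ^ ((n : ℝ) - W) := by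
            refine mul_le_mul_of_nonneg_right ?_ (wt_rpow_pos _ _).le
            exact rpow_le_rpow_of_nonpos hy h (by simp)
        _ = wt (x - z) ^ (-W) := e1 _ hy
        _ ≤ _ := by linarith [wt_rpow_pos z (-W)]
  have hself : wt z ^ (n : ℝ) * (wt z ^ (-(n : ℝ)) * wt (x - z) ^ (-W)) = wt (x - z) ^ (-W) := by
    rw [← mul_assoc, ← rpow_add hz, add_neg_cancel, rpow_zero, one_mul]
  rw [← rpow_natCast, ← rpow_natCast (wt z), ← rpow_natCast (wt (x - z))] at hp
  have hb : 0 < wt z ^ (-(n : ℝ)) * wt (x - z) ^ (-W) := by positivity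
  calc wt x ^ (n : ℝ) * (wt z ^ (-(n : ℝ)) * wt (x - z) ^ (-W))
      ≤ 2 ^ n * (wt z ^ (n : ℝ) + wt (x - z) ^ (n : ℝ)) *
        (wt z ^ (-(n : ℝ)) * wt (x - z) ^ (-W)) := mul_le_mul_of_nonneg_right hp hb.le
    _ = 2 ^ n * (wt z ^ (n : ℝ) * (wt z ^ (-(n : ℝ)) * wt (x - z) ^ (-W)) +
        wt (x - z) ^ (n : ℝ) * (wt z ^ (-(n : ℝ)) * wt (x - z) ^ (-W))) := by ring
    _ ≤ 2 ^ n * (wt (x - z) ^ (-W) + (wt z ^ (-W) + wt (x - z) ^ (-W))) := by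
        rw [hself]; gcongr
    _ = _ := by ring

lemma smooth_conv_base (hW : (n : ℝ) < W) {k : 𝓕} {Ck : ℝ} (hk : GX 0 n Ck k)
     (hg : GX 0 W C g) (x : Spc n) :
    wt x ^ (n : ℝ) * |∫ z, k z * g (x - z)| ≤
      2 ^ n * (3 * ∫ z : Spc n, wt z ^ (-W)) * Ck * C := by
  have i1 : Integrable (fun z : Spc n => wt z ^ (-W)) := integrable_wt_rpow (by linarith)
  have i2 : Integrable (fun z : Spc n => wt (x - z) ^ (-W)) := i1.comp_sub_left x
  have e2 : ∫ z : Spc n, wt (x - z) ^ (-W) = ∫ z : Spc n, wt z ^ (-W) :=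
    integral_sub_left_eq_self (fun z : Spc n => wt z ^ (-W)) volume x
  have hx := wt_rpow_pos x (n : ℝ)
  rw [← abs_of_pos hx, ← abs_mul, ← integral_const_mul, ← norm_eq_abs]
  refine (norm_integral_le_of_norm_le (g := fun z =>
    2 ^ n * (wt z ^ (-W) + 2 * wt (x - z) ^ (-W)) * (Ck * C))
    (((i1.add (i2.const_mul 2)).const_mul _).mul_const _) (Eventually.of_forall fun z => ?_)).trans
    (le_of_eq ?_)
  · rw [norm_mul, norm_mul, norm_of_nonneg hx.le]
    have h1 := hk.abs_le' z
    have h2 := hg.abs_le' (x - z)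
    have := conv_weight_bound (n := n) (W := W) hW x z
    calc wt x ^ (n : ℝ) * (‖k z‖ * ‖g (x - z)‖)
        ≤ wt x ^ (n : ℝ) * ((Ck * wt z ^ (-(n : ℝ))) * (C * wt (x - z) ^ (-W))) := by
          gcongr
          · exact mul_nonneg hk.nonneg (wt_rpow_pos _ _).le
          · exact h1
          · exact h2
      _ = (wt x ^ (n : ℝ) * (wt z ^ (-(n : ℝ)) * wt (x - z) ^ (-W))) * (Ck * C) := by ring
      _ ≤ _ := mul_le_mul_of_nonneg_right this (mul_nonneg hk.nonneg hg.nonneg)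
  · rw [integral_mul_const, integral_const_mul, integral_add i1 (i2.const_mul 2),
      integral_const_mul, e2]
    ring

lemma conv_integrable {Ca Cb : ℝ} (hb : 0 ≤ b) (hab : (n : ℝ) < a + b) {k : 𝓕}
    (hk : GX 0 a Ca k) (hg : GX 0 b Cb g) (x : Spc n) : Integrable (fun z => k z * g (x - z)) := by
  refine ((integrable_wt_rpow (m := a + b) hab).const_mul (Ca * Cb * (2 ^ b * wt x ^ b))).mono'
    (hk.cont.mul (hg.cont.comp (by fun_prop))).aestronglyMeasurable (ae_of_all _ fun z => ?_)
  rw [norm_mul]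
  calc ‖k z‖ * ‖g (x - z)‖ ≤ (Ca * wt z ^ (-a)) * (Cb * (2 ^ b * wt x ^ b * wt z ^ (-b))) := by
        refine mul_le_mul (hk.abs_le' z) ((hg.abs_le' (x - z)).trans ?_) (norm_nonneg _)
          (mul_nonneg hk.nonneg (wt_rpow_pos _ _).le)
        exact mul_le_mul_of_nonneg_left (wt_sub_rpow_neg_le hb x z) hg.nonneg
    _ = Ca * Cb * (2 ^ b * wt x ^ b) * wt z ^ (-(a + b)) := by
        rw [neg_add, rpow_add (wt_pos z)]; ring

lemma conv_hasFDerivAt (hW : (n : ℝ) < W) {k : 𝓕} {Ck : ℝ} (hk : GX 1 n Ck k)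
    (hg : GX 0 W C g) :
    Differentiable ℝ (fun x => ∫ z, k z * g (x - z)) ∧
      ∀ i x, pd i (fun x => ∫ z, k z * g (x - z)) x = ∫ z, pd i k z * g (x - z) := by
  have hn0 : (0 : ℝ) ≤ n := n.cast_nonneg
  have hd : Differentiable ℝ k := hk.1.differentiable (by norm_num)
  have hkc : Continuous (fderiv ℝ k) := hk.1.continuous_fderiv (by norm_num)
  have hkd : ∀ x, ‖fderiv ℝ k x‖ ≤ Ck := fun x => by
    have h := hk.norm_le_const hn0 le_rfl x
    rwa [norm_iteratedFDeriv_one] at h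
  have hgi : Integrable (fun y => ‖g y‖) :=
    ((integrable_wt_rpow hW).const_mul C).mono' hg.cont.norm.aestronglyMeasurable
      (ae_of_all _ fun y => by rw [norm_norm]; exact hg.abs_le' y)
  have flip : ∀ (h : 𝓕) x, ∫ z, h z * g (x - z) = ∫ y, h (x - y) * g y := fun h x => by
    rw [← integral_sub_left_eq_self (fun z => h z * g (x - z)) volume x]
    simp
  have hmeas : ∀ x, AEStronglyMeasurable (fun y => g y • fderiv ℝ k (x - y)) := fun x =>
    (hg.cont.smul (hkc.comp (by fun_prop))).aestronglyMeasurable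
  have hb : ∀ x y, ‖g y • fderiv ℝ k (x - y)‖ ≤ Ck * ‖g y‖ := fun x y => by
    rw [norm_smul, mul_comm]
    exact mul_le_mul_of_nonneg_right (hkd _) (norm_nonneg _)
  have key : ∀ x₀, HasFDerivAt (fun x => ∫ y, k (x - y) * g y)
      (∫ y, g y • fderiv ℝ k (x₀ - y)) x₀ := by
    intro x₀
    refine hasFDerivAt_integral_of_dominated_of_fderiv_le (𝕜 := ℝ)
      (F := fun x y => k (x - y) * g y) (F' := fun x y => g y • fderiv ℝ k (x - y))
      (Metric.ball_mem_nhds x₀ one_pos) (Eventually.of_forall fun x =>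
        (((hk.cont.comp (by fun_prop)).mul hg.cont).aestronglyMeasurable)) ?_ (hmeas x₀)
      (ae_of_all _ fun y x _ => hb x y) (hgi.const_mul Ck) (ae_of_all _ fun y x _ => ?_)
    · refine (hgi.const_mul Ck).mono' (((hk.cont.comp (by fun_prop)).mul hg.cont).aestronglyMeasurable)
        (ae_of_all _ fun y => ?_)
      rw [norm_mul]
      exact mul_le_mul_of_nonneg_right (hk.abs_le_const hn0 _) (norm_nonneg _)
    · exact ((hd (x - y)).hasFDerivAt.comp x ((hasFDerivAt_id x).sub_const y)).mul_const (g y)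
  simp only [flip]
  refine ⟨fun x => (key x).differentiableAt, fun i x => ?_⟩
  rw [pd, (key x).fderiv, (integral_clm_apply_of_bound (hmeas x) (ae_of_all _ fun y => hb x y)
    (hgi.const_mul Ck)).1 (single i 1)]
  exact integral_congr_ae (ae_of_all _ fun y => mul_comm _ _)

lemma conv_ibp (hn : 2 ≤ n) (hW : (n : ℝ) < W) {k : 𝓕} {Ck : ℝ} (hk : GX 1 n Ck k)
    (hf : GX 1 (W - 1) C f) (i : Fin n) (x : Spc n) :
    ∫ z, k z * pd i f (x - z) = ∫ z, pd i k z * f (x - z) := by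
  have hn' : (2 : ℝ) ≤ n := by exact_mod_cast hn
  have hd : Differentiable ℝ f := hf.1.differentiable (by norm_num)
  have hf1 : GX 0 W C (pd i f) := by simpa using GX.pd (N := 0) hf i
  have hk1 : GX 0 (n + 1) Ck (pd i k) := GX.pd (N := 0) hk i
  have e1 : ∀ z, fderiv ℝ (fun z => f (x - z)) z (single i 1) = -pd i f (x - z) := by
    intro z
    have := pd_comp_scale hd x 1 i z
    simpa [pd] using this
  have ibp := integral_mul_fderiv_eq_neg_fderiv_mul_of_integrable (μ := (volume : Measure (Spc n)))
    (f := k) (g := fun z => f (x - z)) (v := single i 1)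
    (conv_integrable (b := W - 1) (by linarith) (by linarith) hk1 (hf.mono_N zero_le_one) x)
    (by simp only [e1, mul_neg]
        exact (conv_integrable (by linarith) (by linarith) (hk.mono_N zero_le_one) hf1 x).neg)
    (conv_integrable (b := W - 1) (by linarith) (by linarith) (hk.mono_N zero_le_one)
      (hf.mono_N zero_le_one) x)
    (fun z _ => (hk.1.differentiable (by norm_num)) z) (fun z _ => (hd _).comp z (by fun_prop))
  simp only [e1, mul_neg, integral_neg, neg_inj] at ibp
  exact ibp

/-- Convolution with a smooth kernel decaying like `w^{-n}`. -/
lemma smooth_conv_GX (hn : 2 ≤ n) (hW : (n : ℝ) < W) (N : ℕ) :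
    ∀ k : 𝓕, (∀ M, ∃ C, GX M n C k) → ∃ A, 0 ≤ A ∧ ∀ C (g : 𝓕),
      GX N W C g → GX N n (A * C) (fun x => ∫ z, k z * g (x - z)) := by
  have hn0 : (0 : ℝ) ≤ n := n.cast_nonneg
  induction N with
  | zero =>
    intro k hk
    obtain ⟨Ck, h0⟩ := hk 1
    have hi : 0 ≤ ∫ z : Spc n, wt z ^ (-W) := integral_nonneg fun z => (wt_rpow_pos z _).le
    refine ⟨2 ^ n * (3 * ∫ z : Spc n, wt z ^ (-W)) * Ck, ?_, fun C g hg => ⟨?_, fun m hm x => ?_⟩⟩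
    · have := h0.nonneg
      positivity
    · rw [Nat.cast_zero, contDiff_zero]
      exact (conv_hasFDerivAt hW h0 hg).1.continuous
    · obtain rfl : m = 0 := by omega
      simpa using smooth_conv_base hW (h0.mono_N zero_le_one) hg x
  | succ N ih =>
    intro k hk
    obtain ⟨A0, hA0, h0⟩ := ih k hk
    have hkj : ∀ j : Fin n, ∀ M, ∃ C, GX M n C (pd j k) := fun j M => by
      obtain ⟨C, hC⟩ := hk (M + 1)
      exact ⟨C, (hC.pd j).mono_W (by linarith)⟩
    have hk' : ∀ i j : Fin n, ∀ M, ∃ C, GX M n C (fun z => z i * pd j k z) := by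
      intro i j M
      obtain ⟨C, hC⟩ := hk (M + 1)
      have := (hC.pd j).coord_mul i
      rw [add_sub_cancel_right] at this
      exact ⟨_, this⟩
    choose A1 hA1 h1 using fun i j => ih _ (hk' i j)
    choose A3 hA3 h3 using fun j => ih _ (hkj j)
    obtain ⟨A2, hA2, h2⟩ := GX.of_coord_mul (n := n) N n
    obtain ⟨Ck, hCk⟩ := hk 1
    set S := A0 * (2 ^ (N + 1) * (n + 1)) + (∑ j, A3 j) + ∑ i, ∑ j, A1 i j with hS
    have hA1' : ∀ i j, A1 i j ≤ ∑ i, ∑ j, A1 i j := fun i j =>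
      (single_le_sum (f := fun j => A1 i j) (fun j _ => hA1 i j) (mem_univ j)).trans
        (single_le_sum (f := fun i => ∑ j, A1 i j)
          (fun i _ => sum_nonneg fun j _ => hA1 i j) (mem_univ i))
    have hs0 : 0 ≤ ∑ i, ∑ j, A1 i j :=
      sum_nonneg fun i _ => sum_nonneg fun j _ => hA1 i j
    have hA3' : ∀ j, A3 j ≤ ∑ j, A3 j := fun j =>
      single_le_sum (f := A3) (fun j _ => hA3 j) (mem_univ j)
    have hs3 : 0 ≤ ∑ j, A3 j := sum_nonneg fun j _ => hA3 j
    refine ⟨(n + 1) * (A0 + A2 * S), by positivity, fun C g hg => ?_⟩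
    have hC := hg.nonneg
    have hg0 : GX N W C g := hg.mono_N (by omega)
    have hd := conv_hasFDerivAt hW hCk (hg.mono_N (Nat.zero_le (N + 1)))
    have hp0 : 0 ≤ A0 * (2 ^ (N + 1) * ((n : ℝ) + 1)) := by positivity
    have key : ∀ j, GX N (n + 1) (A2 * (S * C)) (pd j fun x => ∫ z, k z * g (x - z)) := by
      intro j
      refine h2 _ _ ?_ fun i => ?_
      · refine ((h3 j C _ hg0).congr fun x => hd.2 j x).mono ?_
        rw [hS]
        have := hA3' j
        gcongr
        linarith
      · have hyg : GX (N + 1) (W - 1) (2 ^ (N + 1) * ((n + 1) * C)) (fun y => y i * g y) :=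
          hg.coord_mul i
        have hyg' : GX N W (2 ^ (N + 1) * ((n + 1) * C)) (pd j fun y => y i * g y) := by
          have := hyg.pd j
          rwa [sub_add_cancel] at this
        obtain ⟨Cz, hCz⟩ := hk' i j 0
        have e : ∀ x, x i * pd j (fun x => ∫ z, k z * g (x - z)) x =
            (∫ z, (fun z => z i * pd j k z) z * g (x - z)) +
              ∫ z, k z * (pd j fun y => y i * g y) (x - z) := by
          intro x
          rw [conv_ibp hn hW hCk (hyg.mono_N (by omega)) j x, hd.2, ← integral_const_mul,
            ← integral_add]
          · refine integral_congr_ae (Eventually.of_forall fun z => ?_)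
            simp only [PiLp.sub_apply]
            ring
          · exact conv_integrable (by linarith) (by linarith) hCz (hg.mono_N (Nat.zero_le _)) x
          · exact conv_integrable (a := n + 1) (b := W - 1)
              (by have : (2 : ℝ) ≤ n := by exact_mod_cast hn
                  linarith) (by linarith) (GX.pd (N := 0) hCk j)
              (hyg.mono_N (Nat.zero_le _)) x
        refine (((h1 i j C g hg0).add (h0 _ _ hyg')).congr e).mono ?_
        have := hA1' i j
        rw [hS, show A1 i j * C + A0 * (2 ^ (N + 1) * ((n + 1) * C)) =
          (A0 * (2 ^ (N + 1) * (n + 1)) + A1 i j) * C by ring]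
        gcongr
        linarith
    have hS0 : 0 ≤ S := by rw [hS]; positivity
    refine (GX.succ (C := (A0 + A2 * S) * C) hd.1 (fun x => ?_) fun j => (key j).mono ?_).mono
      (le_of_eq (by ring))
    · refine ((h0 C g hg0).abs_le x).trans ?_
      have : 0 ≤ A2 * S * C := by positivity
      nlinarith
    · have := mul_nonneg hA0 hC
      nlinarith

end smooth_conv

/-- Weighted Hölder class in space and time with the natural weights for the increments. -/
def HB (T θ W C : ℝ) (N : ℕ) (f : 𝓣) : Prop :=
  (∀ t ∈ Icc 0 T, GX N W C (f t)) ∧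
  (∀ t ∈ Icc 0 T, ∀ t' ∈ Icc 0 T, GX N W (C * |t - t'| ^ (θ / 2))
    (fun x => f t x - f t' x)) ∧
  ∀ t ∈ Icc 0 T, ∀ m ≤ N, ∀ x y : Spc n, ‖x - y‖ ≤ max 1 (‖x‖ / 2) →
    wt x ^ (W + m + θ) * ‖∇ m (f t) x - ∇ m (f t) y‖ ≤
      C * ‖x - y‖ ^ θ

section HB

variable {f g : ℝ → Spc n → ℝ}

lemma HB.mono (h : HB T θ W C N f) (hC : C ≤ C') : HB T θ W C' N f :=
  ⟨fun t ht => (h.1 t ht).mono hC, fun t ht t' ht' => (h.2.1 t ht t' ht').mono (by gcongr),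
    fun t ht m hm x y hxy => (h.2.2 t ht m hm x y hxy).trans (by gcongr)⟩

lemma HB.mono_N (h : HB T θ W C N f) (hM : M ≤ N) : HB T θ W C M f :=
  ⟨fun t ht => (h.1 t ht).mono_N hM, fun t ht t' ht' => (h.2.1 t ht t' ht').mono_N hM,
    fun t ht m hm => h.2.2 t ht m (hm.trans hM)⟩

lemma HB.mono_W (h : HB T θ W C N f) (hV : V ≤ W) : HB T θ V C N f :=
  ⟨fun t ht => (h.1 t ht).mono_W hV, fun t ht t' ht' => (h.2.1 t ht t' ht').mono_W hV,
    fun t ht m hm x y hxy => (mul_le_mul_of_nonneg_right (wt_rpow_mono x (by linarith))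
      (norm_nonneg _)).trans (h.2.2 t ht m hm x y hxy)⟩

lemma HB.congr (h : HB T θ W C N f) (e : ∀ t ∈ Icc 0 T, ∀ x, g t x = f t x) :
    HB T θ W C N g := by
  have e' : ∀ t ∈ Icc 0 T, g t = f t := fun t ht => funext (e t ht)
  refine ⟨fun t ht => by rw [e' t ht]; exact h.1 t ht, fun t ht t' ht' => ?_, fun t ht => ?_⟩
  · rw [e' t ht, e' t' ht']; exact h.2.1 t ht t' ht'
  · rw [e' t ht]; exact h.2.2 t ht

lemma HB.add (h : HB T θ W C N f) (h' : HB T θ W C' N g) :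
    HB T θ W (C + C') N (fun t x => f t x + g t x) := by
  refine ⟨fun t ht => (h.1 t ht).add (h'.1 t ht), fun t ht t' ht' => ?_,
    fun t ht m hm x y hxy => ?_⟩
  · exact (((h.2.1 t ht t' ht').add (h'.2.1 t ht t' ht')).congr fun x => by ring).mono
      (le_of_eq (by ring))
  · have e : ∀ x, ∇ m (fun x => f t x + g t x) x =
        ∇ m (f t) x + ∇ m (g t) x := fun x =>
      iteratedFDeriv_add_apply' ((h.1 t ht).contDiffAt hm x) ((h'.1 t ht).contDiffAt hm x)
    have h1 := h.2.2 t ht m hm x y hxy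
    have h2 := h'.2.2 t ht m hm x y hxy
    have hw := wt_rpow_pos x (W + m + θ)
    rw [e, e, add_sub_add_comm]
    refine (mul_le_mul_of_nonneg_left (norm_add_le _ _) hw.le).trans ?_
    linarith

lemma HB.smul (h : HB T θ W C N f) (c : ℝ) : HB T θ W (|c| * C) N (fun t x => c * f t x) := by
  refine ⟨fun t ht => (h.1 t ht).smul c, fun t ht t' ht' => ?_, fun t ht m hm x y hxy => ?_⟩
  · exact (((h.2.1 t ht t' ht').smul c).congr fun x => by ring).mono (le_of_eq (by ring))
  · have e : ∀ x, ∇ m (fun x => c * f t x) x =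
        c • ∇ m (f t) x := fun x =>
      iteratedFDeriv_const_smul_apply' (a := c) ((h.1 t ht).contDiffAt hm x)
    have h1 := h.2.2 t ht m hm x y hxy
    rw [e, e, ← smul_sub, norm_smul, norm_eq_abs]
    calc _ = |c| * (wt x ^ (W + m + θ) *
          ‖∇ m (f t) x - ∇ m (f t) y‖) := by ring
      _ ≤ |c| * (C * ‖x - y‖ ^ θ) := by gcongr
      _ = _ := by ring

lemma HB.nonneg (hT : 0 ≤ T) (h : HB T θ W C N f) : 0 ≤ C := (h.1 0 ⟨le_rfl, hT⟩).nonneg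

lemma HB.sct (hW : 0 ≤ W) (hθ : 0 < θ) (h : HB T θ W C N f) : SCt T N f :=
  SCt.of_holder hW (half_pos hθ) (fun t ht => (h.1 t ht).1) h.2.1

lemma HB.sg (hW : 0 ≤ W) (hθ : 0 < θ) (h : HB T θ W C N f) : SG T W C N f :=
  ⟨h.1, h.sct hW hθ⟩

lemma HB.zero : HB T θ W 0 N (fun _ (_ : Spc n) => (0 : ℝ)) := by
  refine ⟨fun t _ => GX.zero, fun t _ t' _ => ?_, fun t _ m _ x y _ => ?_⟩
  · simpa using GX.zero
  · have : ∇ m (fun _ : Spc n => (0 : ℝ)) = 0 := iteratedFDeriv_zero_fun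
    simp [this]

lemma HB.sum {ι : Type*} (S : Finset ι) {F : ι → 𝓣} {c : ι → ℝ}
    (h : ∀ i ∈ S, HB T θ W (c i) N (F i)) :
    HB T θ W (∑ i ∈ S, c i) N (fun t x => ∑ i ∈ S, F i t x) := by
  induction S using induction_on with
  | empty => simpa using HB.zero
  | insert a S ha ih =>
    simp only [sum_insert ha]
    exact (h a (mem_insert_self _ _)).add
      (ih fun i hi => h i (mem_insert_of_mem hi))

lemma wt_le_of_near {x u : Spc n} (h : ‖x - u‖ ≤ max 1 (‖x‖ / 2)) : wt x ≤ 4 * wt u := by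
  have h1 := one_le_wt u
  have h2 : ‖x‖ ≤ ‖u‖ + ‖x - u‖ := by simpa using norm_add_le u (x - u)
  have h3 := norm_le_wt u
  have h4 := wt_le x
  rcases le_max_iff.1 h with h | h
  · linarith
  · nlinarith [wt_sq x, wt_sq u, norm_nonneg x, norm_nonneg u, wt_pos x, wt_pos u,
      le_of_sq_le_sq (a := wt x) (b := 2 * wt u)
        (by rw [mul_pow, wt_sq, wt_sq]; nlinarith [norm_nonneg x, norm_nonneg u]) (by linarith)]

lemma near_le_wt {x y : Spc n} (h : ‖x - y‖ ≤ max 1 (‖x‖ / 2)) : ‖x - y‖ ≤ wt x := by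
  have h1 := one_le_wt x
  have h2 := norm_le_wt x
  have := norm_nonneg x
  exact h.trans (max_le h1 (by linarith))

lemma HB.of_HV_succ (hθ0 : 0 < θ) (hθ1 : θ ≤ 1) (hW : 0 ≤ W) (h : HV T θ W C (N + 1) f)
    (hT : 0 ≤ T) : HB T θ W (4 ^ (W + N + 1) * C) N f := by
  have hC := h.nonneg hT
  have h4 : (1 : ℝ) ≤ 4 ^ (W + N + 1) := one_le_rpow (by norm_num) (by positivity)
  have hCC : C ≤ 4 ^ (W + N + 1) * C := le_mul_of_one_le_left hC h4
  refine ⟨fun t ht => ((h.1 t ht).mono_N (by omega)).mono hCC, fun t ht t' ht' =>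
    ((h.2.1 t ht t' ht').mono_N (by omega)).mono (by gcongr), fun t ht m hm x y hxy => ?_⟩
  have hf := h.1 t ht
  have hd : Differentiable ℝ (∇ m (f t)) :=
    hf.1.differentiable_iteratedFDeriv (by exact_mod_cast (by omega : m < N + 1))
  have hb : ∀ u ∈ segment ℝ x y, ‖fderiv ℝ (∇ m (f t)) u‖ ≤
      C * (4 ^ (W + N + 1) * wt x ^ (-(W + m + 1))) := by
    intro u hu
    have hxu : ‖x - u‖ ≤ ‖x - y‖ := by
      obtain ⟨a, b, ha, hb, hab, rfl⟩ := hu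
      have : x - (a • x + b • y) = b • (x - y) := by
        rw [show a = 1 - b by linarith]; module
      rw [this, norm_smul, norm_of_nonneg hb]
      exact mul_le_of_le_one_left (norm_nonneg _) (by linarith)
    rw [norm_fderiv_iteratedFDeriv]
    refine (hf.norm_le (by omega) u).trans (mul_le_mul_of_nonneg_left ?_ hC)
    have hu4 := wt_le_of_near (hxu.trans hxy)
    have hm' : (m : ℝ) ≤ N := by exact_mod_cast hm
    push_cast
    calc wt u ^ (-(W + (m + 1))) ≤ (wt x / 4) ^ (-(W + (m + 1))) :=
          rpow_le_rpow_of_nonpos (by have := wt_pos x; positivity) (by linarith)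
            (by have : (0 : ℝ) ≤ m := m.cast_nonneg
                linarith)
      _ = 4 ^ (W + (m + 1)) * wt x ^ (-(W + m + 1)) := by
          rw [div_rpow (wt_pos x).le (by norm_num), rpow_neg (by norm_num : (0:ℝ) ≤ 4),
            div_inv_eq_mul, ← add_assoc, mul_comm]
      _ ≤ _ := by
          refine mul_le_mul_of_nonneg_right ?_ (wt_rpow_pos _ _).le
          exact rpow_le_rpow_of_exponent_le (by norm_num) (by linarith)
  have hmv := (convex_segment x y).norm_image_sub_le_of_norm_fderiv_le (𝕜 := ℝ)
    (fun u _ => hd u) hb (right_mem_segment ℝ x y) (left_mem_segment ℝ x y)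
  have hxw := near_le_wt hxy
  have e1 : ‖x - y‖ = ‖x - y‖ ^ θ * ‖x - y‖ ^ (1 - θ) := by
    rw [← rpow_add_of_nonneg (norm_nonneg _) hθ0.le (by linarith)]; simp
  have e2 : ‖x - y‖ ^ (1 - θ) ≤ wt x ^ (1 - θ) :=
    rpow_le_rpow (norm_nonneg _) hxw (by linarith)
  have e3 : wt x ^ (W + m + θ) * wt x ^ (-(W + m + 1)) * wt x ^ (1 - θ) = 1 := by
    rw [← rpow_add (wt_pos x), ← rpow_add (wt_pos x)]
    ring_nf
    simp
  have hw1 := wt_rpow_pos x (W + m + θ)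
  have hw2 := wt_rpow_pos x (-(W + m + 1))
  calc _ ≤ wt x ^ (W + m + θ) * (C * (4 ^ (W + N + 1) * wt x ^ (-(W + m + 1))) * ‖x - y‖) := by
        gcongr
    _ = wt x ^ (W + m + θ) * (C * (4 ^ (W + N + 1) * wt x ^ (-(W + m + 1))) *
        (‖x - y‖ ^ θ * ‖x - y‖ ^ (1 - θ))) := by rw [← e1]
    _ ≤ wt x ^ (W + m + θ) * (C * (4 ^ (W + N + 1) * wt x ^ (-(W + m + 1))) *
        (‖x - y‖ ^ θ * wt x ^ (1 - θ))) := by gcongr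
    _ = (4 ^ (W + N + 1) * C * ‖x - y‖ ^ θ) *
        (wt x ^ (W + m + θ) * wt x ^ (-(W + m + 1)) * wt x ^ (1 - θ)) := by ring
    _ = _ := by rw [e3, mul_one]

lemma HB.of_HV (hθ0 : 0 < θ) (hθ1 : θ ≤ 1) (hW : 0 ≤ W) (h : HV T θ (W + 1) C N f)
    (hT : 0 ≤ T) : HB T θ W ((1 + 4 ^ (W + 1 + N)) * C) N f := by
  have hC := h.nonneg hT
  have h4 : (1 : ℝ) ≤ 1 + 4 ^ (W + 1 + N) := by
    have : (0 : ℝ) ≤ 4 ^ (W + 1 + N) := by positivity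
    linarith
  have hCC : C ≤ (1 + 4 ^ (W + 1 + N)) * C := le_mul_of_one_le_left hC h4
  refine ⟨fun t ht => ((h.1 t ht).mono_W (by linarith)).mono hCC, fun t ht t' ht' =>
    ((h.2.1 t ht t' ht').mono_W (by linarith)).mono (by gcongr), fun t ht m hm x y hxy => ?_⟩
  have hf := h.1 t ht
  have hw : wt x ^ (W + m + θ) ≤ wt x ^ (W + 1 + m) := wt_rpow_mono x (by linarith)
  refine (mul_le_mul_of_nonneg_right hw (norm_nonneg _)).trans ?_
  rcases le_total ‖x - y‖ 1 with h1 | h1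
  · have h3 := (h.2.2 t ht (x - y) h1).2 m hm x
    have e : ∇ m (fun x' => f t (x' - (x - y)) - f t x') x =
        ∇ m (f t) y - ∇ m (f t) x := by
      have hs : ContDiffAt ℝ m (fun x' => f t (x' - (x - y))) x :=
        ((hf.1.comp (contDiff_id.sub contDiff_const)).of_le (by exact_mod_cast hm)).contDiffAt
      have := iteratedFDeriv_sub_apply hs (hf.contDiffAt hm x)
      rw [iteratedFDeriv_translate, sub_sub_cancel] at this
      exact this
    rw [e, norm_sub_rev] at h3
    refine h3.trans ?_
    gcongr
  · have a1 := hf.2 m hm x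
    have a2 := hf.2 m hm y
    have hy := wt_le_of_near hxy
    have hp := rpow_nonneg (by norm_num : (0 : ℝ) ≤ 4) (W + 1 + N)
    have hθ' : 1 ≤ ‖x - y‖ ^ θ := one_le_rpow h1 hθ0.le
    have hm' : (m : ℝ) ≤ N := by exact_mod_cast hm
    have hm0 : (0 : ℝ) ≤ m := m.cast_nonneg
    have hwy : wt x ^ (W + 1 + m) ≤ 4 ^ (W + 1 + N) * wt y ^ (W + 1 + m) := by
      refine (rpow_le_rpow (wt_pos x).le hy (by linarith)).trans ?_
      rw [mul_rpow (by norm_num) (wt_pos y).le]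
      exact mul_le_mul_of_nonneg_right
        (rpow_le_rpow_of_exponent_le (by norm_num) (by linarith)) (wt_rpow_pos _ _).le
    have hwx := wt_rpow_pos x (W + 1 + m)
    calc wt x ^ (W + 1 + m) * ‖∇ m (f t) x - ∇ m (f t) y‖
        ≤ wt x ^ (W + 1 + m) * (‖∇ m (f t) x‖ + ‖∇ m (f t) y‖) := by
          gcongr; exact norm_sub_le _ _
      _ ≤ wt x ^ (W + 1 + m) * ‖∇ m (f t) x‖ +
          4 ^ (W + 1 + N) * wt y ^ (W + 1 + m) * ‖∇ m (f t) y‖ := by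
          rw [mul_add]; gcongr
      _ ≤ C + 4 ^ (W + 1 + N) * C := by
          rw [mul_assoc]; gcongr
      _ = (1 + 4 ^ (W + 1 + N)) * C * 1 := by ring
      _ ≤ _ := by gcongr

end HB

section

variable {A : ℝ} {k : Spc n → ℝ}

/-- Convolution with a fixed kernel preserves Hölder continuity. -/
lemma HV.conv (hint : ∀ C g, GX N W C g → ∀ x, Integrable (fun z => k z * g (x - z)))
    (h : ∀ C g, GX N W C g → GX N V (A * C) (fun x => ∫ z, k z * g (x - z)))
    {f : 𝓣} (hf : HV T θ W C N f) :
    HV T θ V (A * C) N (fun t x => ∫ z, k z * f t (x - z)) := by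
  refine ⟨fun t ht => h _ _ (hf.1 t ht), fun t ht t' ht' => ?_, fun t ht v hv => ?_⟩
  · have := h _ _ (hf.2.1 t ht t' ht')
    rw [← mul_assoc] at this
    refine this.congr fun x => ?_
    rw [← integral_sub (hint _ _ (hf.1 t ht) x) (hint _ _ (hf.1 t' ht') x)]
    simp only [mul_sub]
  · have := h _ _ (hf.2.2 t ht v hv)
    rw [← mul_assoc] at this
    refine this.congr fun x => ?_
    rw [← integral_sub (hint _ _ (hf.1 t ht) (x - v)) (hint _ _ (hf.1 t ht) x)]
    refine integral_congr_ae (ae_of_all _ fun z => ?_)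
    simp only [mul_sub, sub_right_comm]

lemma kap1_aesm (i : Fin n) : AEStronglyMeasurable (kap1 i : 𝓕) volume :=
  ((measurable_kapE i).sub (kap2_GX i 1).choose_spec.cont.measurable).aestronglyMeasurable

lemma kap1_conv (hn : 2 ≤ n) (hW : 0 ≤ W) (i : Fin n) (N : ℕ) : ∃ A, 0 ≤ A ∧
    ∀ C (g : 𝓕), GX N W C g → GX N W (A * C) (fun x => ∫ z, kap1 i z * g (x - z)) ∧
      ∀ x, Integrable (fun z => kap1 i z * g (x - z)) := by
  have hk := kap1_integrable hn i (W + N) (by positivity)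
  refine ⟨2 ^ (W + N) * ∫ z : Spc n, |kap1 i z| * wt z ^ (W + N), ?_, fun C g hg => ?_⟩
  · have := integral_nonneg (μ := (volume : Measure (Spc n)))
      (f := fun z => |kap1 i z| * wt z ^ (W + N)) fun z =>
      mul_nonneg (abs_nonneg _) (wt_rpow_pos z _).le
    positivity
  · have hs : SCt (n := n) 0 N (fun _ => g) := fun m hm =>
      ((hg.1.continuous_iteratedFDeriv (by exact_mod_cast hm)).comp continuous_snd).continuousOn
    obtain ⟨h1, h2, -⟩ := conv_GX (ν := volume) (T := 0) le_rfl hW (K := kap1 i) (τ := fun _ => 0)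
      (z := id) (c := fun _ => C) (kap1_aesm i) aemeasurable_const aemeasurable_id
      (ae_of_all _ fun _ => by simp) (f := fun _ => g) (fun _ _ => hg) hs (hk.mul_const C)
    refine ⟨?_, h2⟩
    rw [integral_mul_const, ← mul_assoc] at h1
    exact h1

/-- Time differentiation commutes with a non-integrable convolution kernel. -/
lemma TD.conv_weight (hT : 0 ≤ T) (hW : (n : ℝ) < W) {Ck : ℝ} (hk : GX 0 n Ck k)
    {f g : 𝓣} (h : TD T f g) (hf : SG T W C 0 f) (hg : SG T W C 0 g) :
    TD T (fun t x => ∫ z, k z * f t (x - z)) (fun t x => ∫ z, k z * g t (x - z)) := by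
  intro t ht x
  have hw : ∀ y : Spc n, wt y ^ (-W) * wt y ^ W = 1 := fun y => by
    rw [← rpow_add (wt_pos y), neg_add_cancel, rpow_zero]
  have hwi : Integrable (fun z : Spc n => wt (x - z) ^ (-W)) :=
    (integrable_wt_rpow hW).comp_sub_left x
  have hc : Continuous fun z : Spc n => k z * wt (x - z) ^ (-W) :=
    hk.cont.mul ((continuous_wt_rpow _).comp (by fun_prop))
  have hK : Integrable (fun z => k z * wt (x - z) ^ (-W)) := by
    refine (hwi.const_mul Ck).mono' hc.aestronglyMeasurable (ae_of_all _ fun z => ?_)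
    rw [norm_eq_abs, abs_mul, abs_of_pos (wt_rpow_pos _ _)]
    exact mul_le_mul_of_nonneg_right (hk.abs_le_const n.cast_nonneg z) (wt_rpow_pos _ _).le
  have hTD : TD T (fun t y => wt y ^ W * f t y) (fun t y => wt y ^ W * g t y) := by
    intro t ht y
    show wt y ^ W * f t y = wt y ^ W * f 0 y + ∫ τ in (0 : ℝ)..t, wt y ^ W * g τ y
    rw [intervalIntegral.integral_const_mul, h t ht y, mul_add]
  have hb : ∀ {u : 𝓣}, SG T W C 0 u → ∀ t ∈ Icc 0 T, ∀ y, |wt y ^ W * u t y| ≤ C :=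
    fun hu t ht y => by
      rw [abs_mul, abs_of_pos (wt_rpow_pos _ _)]
      exact (hu.1 t ht).abs_le y
  have key := TD.conv (ν := volume) hc.aestronglyMeasurable aemeasurable_id hK hTD (C := C)
    (hb hf 0 ⟨le_rfl, hT⟩) ((continuous_wt_rpow W).mul (hf.1 0 ⟨le_rfl, hT⟩).cont)
    (SCt.of_cont (((continuous_wt_rpow W).comp continuous_snd).continuousOn.mul hg.2.zero_cont))
    (hb hg) t ht x
  have e : ∀ (u : 𝓕), ∫ z, k z * wt (x - z) ^ (-W) * (wt (x - z) ^ W * u (x - z)) =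
      ∫ z, k z * u (x - z) := fun u => by
    refine integral_congr_ae (ae_of_all _ fun z => ?_)
    calc _ = k z * u (x - z) * (wt (x - z) ^ (-W) * wt (x - z) ^ W) := by ring
      _ = _ := by rw [hw, mul_one]
  simp only [id, e] at key
  exact key

lemma TGen.HB_mono {f : 𝓣}
    (h : TGen T (fun N => HB T θ W C N) s p f) (hC : C ≤ C') :
    TGen T (fun N => HB T θ W C' N) s p f := h.mono fun _ _ h => h.mono hC

lemma TGen.HB_add {f g : 𝓣} (hW : 0 ≤ W) (hθ : 0 < θ)
    (h : TGen T (fun N => HB T θ W C N) s p f) (h' : TGen T (fun N => HB T θ W C' N) s p g) :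
    TGen T (fun N => HB T θ W (C + C') N) s p (fun t x => f t x + g t x) :=
  TGen.map₂ (fun f g t x => f t x + g t x) h h' (fun _ _ _ h h' => h.add h')
    fun _ _ _ _ _ h h' hg hg' => h.add h' (fun x => (hg.sct hW hθ).time_cont x)
      fun x => (hg'.sct hW hθ).time_cont x

lemma TGen.HB_smul {f : 𝓣} (h : TGen T (fun N => HB T θ W C N) s p f)
    (c : ℝ) : TGen T (fun N => HB T θ W (|c| * C) N) s p (fun t x => c * f t x) :=
  TGen.map (fun f t x => c * f t x) h (fun _ _ h => h.smul c) fun _ _ _ h _ _ => h.smul c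

lemma TGen.HB_zero : TGen T (fun N => HB T θ W 0 N) s p (fun _ (_ : Spc n) => (0 : ℝ)) := by
  refine TGen_iff_chain.2 ⟨fun _ _ _ => 0, rfl, fun j _ => ?_, fun j _ => HB.zero⟩
  intro t ht x
  simp

lemma TGen.HB_sum {ι : Type*} (hW : 0 ≤ W) (hθ : 0 < θ) (S : Finset ι)
    {F : ι → 𝓣} {c : ι → ℝ}
    (h : ∀ i ∈ S, TGen T (fun N => HB T θ W (c i) N) s p (F i)) :
    TGen T (fun N => HB T θ W (∑ i ∈ S, c i) N) s p (fun t x => ∑ i ∈ S, F i t x) := by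
  classical
  induction S using induction_on with
  | empty => simpa using TGen.HB_zero (n := n) (T := T) (θ := θ) (W := W)
  | insert a S ha ih =>
    simp only [sum_insert ha]
    exact (h a (mem_insert_self a S)).HB_add hW hθ
      (ih fun i hi => h i (mem_insert_of_mem hi))

/-- Sum of the constants of a finite family indexed by the orders that occur. -/
lemma le_sum_const {A : ℕ → ℝ} (hA : ∀ N, 0 ≤ A N) (h : N ≤ M) :
    A N ≤ ∑ i ∈ range (M + 1), A i :=
  single_le_sum (f := A) (fun i _ => hA i) (mem_range.2 (by omega))

/-- Version of `TGen.map` in which the constants may depend on the order. -/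
lemma TGen.map_const {B B₁ : ℝ → ℕ → (𝓣) → Prop}
    (L : (𝓣) → (𝓣)) (s p : ℕ)
    (hmono : ∀ C C' N f, C ≤ C' → B₁ C N f → B₁ C' N f) (hnn : ∀ C N f, B C N f → 0 ≤ C)
    (hB : ∀ N, ∃ A, 0 ≤ A ∧ ∀ C f, B C N f → B₁ (A * C) N (L f))
    (hL : ∀ C N f g, TD T f g → B C (N + 2) f → B C N g → TD T (L f) (L g)) :
    ∃ A, 0 ≤ A ∧ ∀ C f, TGen T (B C) s p f → TGen T (B₁ (A * C)) s p (L f) := by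
  choose A hA h using hB
  refine ⟨∑ i ∈ range (2 * s + p + 1), A i, sum_nonneg fun i _ => hA i,
    fun C f hf => ?_⟩
  obtain ⟨g, h0, h1, h2⟩ := TGen_iff_chain.1 hf
  refine TGen_iff_chain.2 ⟨fun j => L (g j), congrArg L h0, fun j hj => ?_, fun j hj => ?_⟩
  · have e1 := h2 j hj.le
    have e2 := h2 (j + 1) hj
    rw [show 2 * (s - j) + p = 2 * (s - (j + 1)) + p + 2 by omega] at e1
    exact hL C _ _ _ (h1 j hj) e1 e2
  · have e1 := h2 j hj
    exact hmono _ _ _ _ (mul_le_mul_of_nonneg_right (le_sum_const hA (by omega)) (hnn _ _ _ e1))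
      (h _ _ _ e1)

/-- Second order singular integrals of functions with sufficient decay. -/
lemma TGen.RK_pd (hn : 2 ≤ n) (hT : 0 ≤ T) (hθ0 : 0 < θ) (hθ1 : θ ≤ 1) (hW : (n : ℝ) < W)
    (hV : (n : ℝ) + 1 < V) (i j : Fin n) (s p : ℕ) :
    ∃ A, 0 ≤ A ∧ ∀ C (f : 𝓣), TGen T (fun N => HV T θ W C (N + 1)) s p f →
      (∃ C', ∀ t ∈ Icc 0 T, GX 1 V C' (f t)) →
      TGen T (fun N => HB T θ n (A * C) N) s p (fun t => RK i (NSdeRham.pd j (f t))) := by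
  have hn0 : (0 : ℝ) ≤ n := n.cast_nonneg
  have hW0 : 0 ≤ W := hn0.trans hW.le
  have hcommon : ∀ C N (f : 𝓣), HV T θ W C (N + 1) f → 0 ≤ C := fun C N f h => h.nonneg hT
  obtain ⟨A1, hA1, H1⟩ := TGen.map_const (n := n) (T := T) (B := fun C N => HV T θ W C (N + 1))
    (B₁ := fun C N => HB T θ n C N) (fun f t x => ∫ z, kap1 i z * NSdeRham.pd j (f t) (x - z)) s p
    (fun C C' N f hC h => h.mono hC) hcommon
    (fun N => by
      obtain ⟨A, hA, h⟩ := kap1_conv (W := W + 1) hn (by linarith) i N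
      refine ⟨(1 + 4 ^ (W + 1 + N)) * A, by positivity, fun C f hf => ?_⟩
      have := HV.conv (fun C g hg => (h C g hg).2) (fun C g hg => (h C g hg).1) (hf.pd j)
      rw [mul_assoc]
      exact (HB.of_HV hθ0 hθ1 hW0 this hT).mono_W hW.le)
    (fun C N f g hfg hf hg => by
      have hf' := (hf.mono_N (by omega : N + 1 ≤ N + 2 + 1))
      have hTD := hfg.pd hW0 (hf'.sg hW0 hθ0) (hg.sg hW0 hθ0) j
      have hk : Integrable (kap1 i : 𝓕) := by
        have := kap1_integrable hn i 0 le_rfl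
        simp only [rpow_zero, mul_one] at this
        exact (integrable_norm_iff (kap1_aesm i)).1 this
      have e1 := (hf'.pd j).sg (by linarith) hθ0
      have e2 := (hg.pd j).sg (by linarith) hθ0
      exact TD.conv (ν := volume) (kap1_aesm i) aemeasurable_id hk hTD (C := C)
        (fun x => (e1.1 0 ⟨le_rfl, hT⟩).abs_le_const (by linarith) x) (e1.1 0 ⟨le_rfl, hT⟩).cont
        (e2.2.mono_N (Nat.zero_le _)) fun t ht x => (e2.1 t ht).abs_le_const (by linarith) x)
  obtain ⟨A2, hA2, H2⟩ := TGen.map_const (n := n) (T := T) (B := fun C N => HV T θ W C (N + 1))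
    (B₁ := fun C N => HB T θ n C N) (fun f t x => ∫ z, NSdeRham.pd j (kap2 i) z * f t (x - z)) s p
    (fun C C' N f hC h => h.mono hC) hcommon
    (fun N => by
      obtain ⟨A, hA, h⟩ := smooth_conv_GX hn hW (N + 1) (NSdeRham.pd j (kap2 i)) (pd_kap2_GX i j)
      refine ⟨4 ^ ((n : ℝ) + N + 1) * A, by positivity, fun C f hf => ?_⟩
      obtain ⟨Ck, hk⟩ := pd_kap2_GX i j 0
      have := HV.conv (fun C g hg => conv_integrable hW0 (by linarith) hk
        (hg.mono_N (Nat.zero_le _))) (fun C g hg => h C g hg) hf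
      rw [mul_assoc]
      exact HB.of_HV_succ hθ0 hθ1 hn0 this hT)
    (fun C N f g hfg hf hg => by
      obtain ⟨Ck, hk⟩ := pd_kap2_GX i j 0
      exact TD.conv_weight hT hW hk hfg ((hf.sg hW0 hθ0).mono_N (Nat.zero_le _))
        ((hg.sg hW0 hθ0).mono_N (Nat.zero_le _)))
  refine ⟨A1 + A2, by positivity, fun C f hf ⟨C', hC'⟩ => ?_⟩
  have := (H1 C f hf).HB_add hn0 hθ0 (H2 C f hf)
  rw [add_mul]
  exact this.congr hT (fun N f g e h => h.congr e) fun t ht x => RK_pd_eq hn hV (hC' t ht) i j x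

end

/-- Sign of the position of `i` relative to `J`. -/
def sgn (i : Fin n) (J : Finset (Fin n)) : ℝ := (-1 : ℝ) ^ (J.filter fun j => j < i).card

lemma sgn_sq (i : Fin n) (J : Finset (Fin n)) : sgn i J * sgn i J = 1 := by
  rw [sgn, ← pow_add, ← two_mul, pow_mul]
  norm_num

lemma sgn_erase {i : Fin n} {J : Finset (Fin n)} (hi : i ∈ J) (l : Fin n) :
    sgn l (J.erase i) = if i < l then -sgn l J else sgn l J := by
  rw [sgn, sgn, Finset.filter_erase]
  split_ifs with h
  · have hm : i ∈ J.filter fun j => j < l := mem_filter.2 ⟨hi, h⟩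
    rw [← Finset.card_erase_add_one hm, pow_succ]
    ring
  · rw [Finset.erase_eq_of_notMem (a := i) fun hm => h (mem_filter.1 hm).2]

lemma sgn_insert {i : Fin n} {J : Finset (Fin n)} (hi : i ∉ J) (l : Fin n) :
    sgn l (insert i J) = if i < l then -sgn l J else sgn l J := by
  rw [sgn, sgn, Finset.filter_insert]
  split_ifs with h
  · rw [Finset.card_insert_of_notMem fun hm => hi (mem_filter.1 hm).1, pow_succ]
    ring
  · rfl

/-- Exterior derivative of a form whose coefficients are indexed by all finite sets. -/
def dG (U : Finset (Fin n) → 𝓕) (J : Finset (Fin n)) (x : Spc n) : ℝ :=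
  ∑ i : Fin n, if i ∈ J then sgn i J * pd i (U (J.erase i)) x else 0

/-- Formal adjoint of the exterior derivative for coefficients indexed by all finite sets. -/
def cG (U : Finset (Fin n) → 𝓕) (K : Finset (Fin n)) (x : Spc n) : ℝ :=
  -∑ i : Fin n, if i ∉ K then sgn i K * pd i (U (insert i K)) x else 0

section

variable {U : Finset (Fin n) → Spc n → ℝ}

lemma pd_ite_mul (P : Prop) [Decidable P] (c : ℝ) (f : 𝓕)
    (i : Fin n) (x : Spc n) :
    pd i (fun y => if P then c * f y else 0) x = if P then c * pd i f x else 0 := by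
  split_ifs
  · exact congrFun (pd_const_mul c i) x
  · simp [pd]

lemma differentiable_ite_mul (P : Prop) [Decidable P] (c : ℝ)
    (hf : Differentiable ℝ f) : Differentiable ℝ (fun y => if P then c * f y else 0) := by
  split_ifs
  · exact hf.const_mul c
  · exact differentiable_const _

lemma differentiable_pd (hf : ContDiff ℝ 2 f) (i : Fin n) :
    Differentiable ℝ (pd i f) :=
  (contDiff_pd (N := 1) hf i).differentiable one_ne_zero

lemma pd_dG (hU : ∀ I, ContDiff ℝ 2 (U I)) (J : Finset (Fin n)) (l : Fin n) (x : Spc n) :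
    pd l (dG U J) x = ∑ i, if i ∈ J then sgn i J * pd l (pd i (U (J.erase i))) x else 0 := by
  unfold dG
  rw [pd_sum _ fun i _ => differentiable_ite_mul _ _ (differentiable_pd (hU _) i)]
  exact sum_congr rfl fun i _ => pd_ite_mul _ _ _ l x

lemma pd_neg' (f : 𝓕) (i : Fin n) (x : Spc n) : pd i (fun y => -f y) x = -pd i f x := by
  have := congrFun (pd_const_mul (-1) (f := f) i) x
  simpa only [neg_one_mul] using this

lemma pd_cG (hU : ∀ I, ContDiff ℝ 2 (U I)) (J : Finset (Fin n)) (l : Fin n) (x : Spc n) :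
    pd l (cG U J) x = -∑ i, if i ∉ J then sgn i J * pd l (pd i (U (insert i J))) x else 0 := by
  unfold cG
  rw [pd_neg', pd_sum _ fun i _ => differentiable_ite_mul _ _ (differentiable_pd (hU _) i)]
  exact congrArg _ (sum_congr rfl fun i _ => pd_ite_mul _ _ _ l x)

lemma pd_comm (hf : ContDiff ℝ 2 f) (i j : Fin n) (x : Spc n) :
    pd i (pd j f) x = pd j (pd i f) x := by
  have hd : DifferentiableAt ℝ (fderiv ℝ f) x :=
    ((hf.fderiv_right (m := 1) (by norm_num)).differentiable one_ne_zero) x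
  have h : ∀ a b : Fin n, pd a (pd b f) x =
      fderiv ℝ (fderiv ℝ f) x (single a 1) (single b 1) := by
    intro a b
    show fderiv ℝ (fun y => fderiv ℝ f y (single b 1)) x _ = _
    rw [fderiv_clm_apply hd (differentiableAt_const _)]
    simp
  rw [h, h]
  exact (hf.contDiffAt.isSymmSndFDerivAt (by simp)).eq _ _

lemma sum_sum_eq_zero_of_antisymm {F : Fin n → Fin n → ℝ} (h : ∀ i l, F i l = -F l i) :
    ∑ i, ∑ l, F i l = 0 := by
  have h1 : ∑ i, ∑ l, F i l = ∑ i, ∑ l, -F i l := by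
    rw [sum_comm]
    exact sum_congr rfl fun i _ => sum_congr rfl fun l _ => h l i
  simp only [sum_neg_distrib] at h1
  linarith

lemma dG_dG (hU : ∀ I, ContDiff ℝ 2 (U I)) (J : Finset (Fin n)) (x : Spc n) :
    dG (dG U) J x = 0 := by
  have e : dG (dG U) J x = ∑ i, ∑ l, if i ∈ J ∧ l ∈ J ∧ l ≠ i then
      sgn i J * (sgn l (J.erase i) * pd i (pd l (U ((J.erase i).erase l))) x) else 0 := by
    refine sum_congr rfl fun i _ => ?_
    split_ifs with hi
    · rw [pd_dG hU, mul_sum]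
      refine sum_congr rfl fun l _ => ?_
      by_cases hl : l ∈ J ∧ l ≠ i
      · rw [if_pos (Finset.mem_erase.2 ⟨hl.2, hl.1⟩), if_pos ⟨hi, hl⟩]
      · rw [if_neg fun h => hl ⟨Finset.mem_of_mem_erase h, Finset.ne_of_mem_erase h⟩,
          if_neg fun h => hl h.2, mul_zero]
    · exact (sum_eq_zero fun l _ => if_neg fun h => hi h.1).symm
  rw [e]
  refine sum_sum_eq_zero_of_antisymm fun i l => ?_
  by_cases h : i ∈ J ∧ l ∈ J ∧ l ≠ i
  · rw [if_pos h, if_pos ⟨h.2.1, h.1, h.2.2.symm⟩, pd_comm (hU _), Finset.erase_right_comm,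
      sgn_erase h.1, sgn_erase h.2.1]
    rcases lt_or_gt_of_ne h.2.2 with h1 | h1
    · rw [if_neg h1.not_gt, if_pos h1]; ring
    · rw [if_pos h1, if_neg h1.not_gt]; ring
  · rw [if_neg h, if_neg fun h' => h ⟨h'.2.1, h'.1, h'.2.2.symm⟩, neg_zero]

lemma cG_cG (hU : ∀ I, ContDiff ℝ 2 (U I)) (J : Finset (Fin n)) (x : Spc n) :
    cG (cG U) J x = 0 := by
  have e : cG (cG U) J x = ∑ i, ∑ l, if i ∉ J ∧ l ∉ J ∧ l ≠ i then
      sgn i J * (sgn l (insert i J) * pd i (pd l (U (insert l (insert i J)))) x) else 0 := by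
    rw [cG, ← sum_neg_distrib]
    refine sum_congr rfl fun i _ => ?_
    split_ifs with hi
    · rw [neg_zero]
      exact (sum_eq_zero fun l _ => if_neg fun h => h.1 hi).symm
    · rw [pd_cG hU, mul_neg, neg_neg, mul_sum]
      refine sum_congr rfl fun l _ => ?_
      by_cases hl : l ∉ J ∧ l ≠ i
      · rw [if_pos (by simp [hl]), if_pos ⟨hi, hl⟩]
      · rw [if_neg (by rw [Finset.mem_insert]; tauto), if_neg fun h => hl h.2, mul_zero]
  rw [e]
  refine sum_sum_eq_zero_of_antisymm fun i l => ?_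
  by_cases h : i ∉ J ∧ l ∉ J ∧ l ≠ i
  · rw [if_pos h, if_pos ⟨h.2.1, h.1, h.2.2.symm⟩, pd_comm (hU _), Finset.insert_comm,
      sgn_insert h.1, sgn_insert h.2.1]
    rcases lt_or_gt_of_ne h.2.2 with h1 | h1
    · rw [if_neg h1.not_gt, if_pos h1]; ring
    · rw [if_pos h1, if_neg h1.not_gt]; ring
  · rw [if_neg h, if_neg fun h' => h ⟨h'.2.1, h'.1, h'.2.2.symm⟩, neg_zero]

/-- The Hodge Laplacian acts coefficient-wise. -/
lemma dG_cG_add (hU : ∀ I, ContDiff ℝ 2 (U I)) (J : Finset (Fin n)) (x : Spc n) :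
    dG (cG U) J x + cG (dG U) J x = -lap (U J) x := by
  have e1 : dG (cG U) J x = ∑ i, ∑ l, if i ∈ J ∧ l ∉ J.erase i then
      -(sgn i J * (sgn l (J.erase i) * pd i (pd l (U (insert l (J.erase i)))) x)) else 0 := by
    refine sum_congr rfl fun i _ => ?_
    split_ifs with hi
    · rw [pd_cG hU, mul_neg, mul_sum, ← sum_neg_distrib]
      refine sum_congr rfl fun l _ => ?_
      by_cases hl : l ∉ J.erase i
      · rw [if_pos hl, if_pos ⟨hi, hl⟩]
      · rw [if_neg hl, if_neg fun h => hl h.2, mul_zero, neg_zero]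
    · exact (sum_eq_zero fun l _ => if_neg fun h => hi h.1).symm
  have e2 : cG (dG U) J x = ∑ i, ∑ l, if l ∉ J ∧ i ∈ insert l J then
      -(sgn l J * (sgn i (insert l J) * pd i (pd l (U ((insert l J).erase i))) x)) else 0 := by
    rw [cG, ← sum_neg_distrib, sum_comm]
    refine sum_congr rfl fun l _ => ?_
    split_ifs with hl
    · rw [neg_zero]
      exact (sum_eq_zero fun l _ => if_neg fun h => h.1 hl).symm
    · rw [pd_dG hU, mul_sum, ← sum_neg_distrib]
      refine sum_congr rfl fun i _ => ?_
      by_cases hi : i ∈ insert l J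
      · rw [if_pos hi, if_pos ⟨hl, hi⟩, pd_comm (hU _)]
      · rw [if_neg hi, if_neg fun h => hi h.2, mul_zero, neg_zero]
  rw [e1, e2, ← sum_add_distrib, lap, ← sum_neg_distrib]
  refine sum_congr rfl fun i _ => ?_
  rw [← sum_add_distrib, Finset.sum_eq_single i]
  · by_cases hi : i ∈ J
    · rw [if_pos ⟨hi, Finset.notMem_erase i J⟩, if_neg fun h => h.1 hi, Finset.insert_erase hi,
        sgn_erase hi, if_neg (lt_irrefl i), ← mul_assoc, sgn_sq, one_mul, add_zero]
    · rw [if_neg fun h => hi h.1, if_pos ⟨hi, mem_insert_self i J⟩, Finset.erase_insert hi,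
        sgn_insert hi, if_neg (lt_irrefl i), ← mul_assoc, sgn_sq, one_mul, zero_add]
  · intro l _ hl
    by_cases h : i ∈ J ∧ l ∉ J
    · rw [if_pos ⟨h.1, fun h' => h.2 (Finset.mem_of_mem_erase h')⟩,
        if_pos ⟨h.2, mem_insert_of_mem h.1⟩, Finset.erase_insert_of_ne hl,
        sgn_erase h.1, sgn_insert h.2]
      rcases lt_or_gt_of_ne hl with h1 | h1
      · rw [if_neg h1.not_gt, if_pos h1]; ring
      · rw [if_pos h1, if_neg h1.not_gt]; ring
    · rw [if_neg fun h' => h ⟨h'.1, fun h2 => h'.2 (Finset.mem_erase.2 ⟨hl, h2⟩)⟩,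
        if_neg fun h' => h ⟨(Finset.mem_insert.1 h'.2).resolve_left hl.symm, h'.1⟩, add_zero]
  · exact fun h => absurd (mem_univ i) h

end

section

/-- Extension by zero of the coefficients of a form to all finite sets. -/
def ext (u : FormS n q) (I : Finset (Fin n)) (x : Spc n) : ℝ :=
  if h : I.card = q then u ⟨I, h⟩ x else 0

lemma ext_coe (u : FormS n q) (I : Idx n q) : ext u I.1 = u I := by
  funext x
  rw [ext, dif_pos I.2]

lemma ext_ne (u : FormS n q) {I : Finset (Fin n)} (h : I.card ≠ q) : ext u I = fun _ => 0 := by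
  funext x
  rw [ext, dif_neg h]

lemma pd_zero (i : Fin n) (x : Spc n) : pd i (fun _ => 0) x = 0 := by
  simp [pd]

lemma dS_eq (u : FormS n q) (J : Idx n (q + 1)) : dS u J = dG (ext u) J.1 := by
  funext x
  refine sum_congr rfl fun i _ => ?_
  by_cases h : i ∈ J.1
  · rw [dif_pos h, if_pos h, ← ext_coe u]
    rfl
  · rw [dif_neg h, if_neg h]

lemma coDS_eq (u : FormS n q) (K : Idx n (q - 1)) : coDS u K = cG (ext u) K.1 := by
  funext x
  refine congrArg _ (sum_congr rfl fun i _ => ?_)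
  by_cases h : i ∉ K.1
  · by_cases h' : (insert i K.1).card = q
    · rw [dif_pos ⟨h, h'⟩, if_pos h, ← ext_coe u]
      rfl
    · rw [dif_neg fun h2 => h' h2.2, if_pos h, ext_ne u h', pd_zero, mul_zero]
  · rw [dif_neg fun h2 => h h2.1, if_neg h]

lemma dLowS_eq (u : FormS n (q - 1)) (J : Idx n q) : dLowS u J = dG (ext u) J.1 := by
  funext x
  refine sum_congr rfl fun i _ => ?_
  by_cases h : i ∈ J.1
  · by_cases h' : (J.1.erase i).card = q - 1
    · rw [dif_pos ⟨h, h'⟩, if_pos h, ← ext_coe u]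
      rfl
    · rw [dif_neg fun h2 => h' h2.2, if_pos h, ext_ne u h', pd_zero, mul_zero]
  · rw [dif_neg fun h2 => h h2.1, if_neg h]

lemma ext_dS (u : FormS n q) : ext (dS u) = dG (ext u) := by
  funext I x
  by_cases h : I.card = q + 1
  · exact (congrFun (ext_coe (dS u) ⟨I, h⟩) x).trans (congrFun (dS_eq u ⟨I, h⟩) x)
  · rw [ext_ne _ h]
    refine (sum_eq_zero fun i _ => ?_).symm
    split_ifs with hi
    · rw [ext_ne u, pd_zero, mul_zero]
      intro h'
      exact h (by rw [← h', Finset.card_erase_add_one hi])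
    · rfl

lemma ext_coDS (hq : 1 ≤ q) (u : FormS n q) : ext (coDS u) = cG (ext u) := by
  funext I x
  by_cases h : I.card = q - 1
  · exact (congrFun (ext_coe (coDS u) ⟨I, h⟩) x).trans (congrFun (coDS_eq u ⟨I, h⟩) x)
  · rw [ext_ne _ h, cG, sum_eq_zero, neg_zero]
    intro i _
    split_ifs with hi
    · rfl
    · rw [ext_ne u, pd_zero, mul_zero]
      intro h'
      rw [Finset.card_insert_of_notMem hi] at h'
      omega

lemma ext_dLowS (hq : 1 ≤ q) (u : FormS n (q - 1)) : ext (dLowS (q := q) u) = dG (ext u) := by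
  funext I x
  by_cases h : I.card = q
  · exact (congrFun (ext_coe (dLowS u) ⟨I, h⟩) x).trans (congrFun (dLowS_eq u ⟨I, h⟩) x)
  · rw [ext_ne _ h]
    refine (sum_eq_zero fun i _ => ?_).symm
    split_ifs with hi
    · rw [ext_ne u, pd_zero, mul_zero]
      intro h'
      have := Finset.card_erase_add_one hi
      omega
    · rfl

lemma ext_contDiff {N : WithTop ℕ∞} {u : FormS n q} (hu : ∀ I, ContDiff ℝ N (u I)) (I : Finset (Fin n)) :
    ContDiff ℝ N (ext u I) := by
  by_cases h : I.card = q
  · rw [ext_coe u ⟨I, h⟩]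
    exact hu _
  · rw [ext_ne u h]
    exact contDiff_const

lemma ext_GX (hC : 0 ≤ C) {u : FormS n q} (hu : ∀ I, GX N W C (u I))
    (I : Finset (Fin n)) : GX N W C (ext u I) := by
  by_cases h : I.card = q
  · rw [ext_coe u ⟨I, h⟩]
    exact hu _
  · rw [ext_ne u h]
    exact GX.zero.mono hC

end

section

variable {U V : Finset (Fin n) → Spc n → ℝ}

lemma newtPot_zero (x : Spc n) : newtPot (fun _ : Spc n => (0 : ℝ)) x = 0 := by
  simp [newtPot]

lemma integral_conv_sum_ite {K : 𝓕} {c : ℝ} (hn : 2 ≤ n) (hK : EK c K)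
    (hW : (n : ℝ) + 1 < W) {ι : Type*} [Fintype ι] (P : ι → Prop) [DecidablePred P] (a : ι → ℝ)
    {F : ι → 𝓕} (hF : ∀ i, GX 0 W C (F i)) (x : Spc n) :
    ∫ z, K z * (∑ i, if P i then a i * F i (x - z) else 0)
      = ∑ i, if P i then a i * ∫ z, K z * F i (x - z) else 0 := by
  have h : ∀ i, Integrable (fun z => K z * (if P i then a i * F i (x - z) else 0)) := by
    intro i
    by_cases hP : P i
    · simp only [hP, if_true]
      refine ((hK.integrable hn hW (hF i) x).const_mul (a i)).congr (Eventually.of_forall fun z => ?_)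
      simp only; ring
    · simp [hP]
  simp only [mul_sum]
  rw [integral_finsetSum _ (fun i _ => h i)]
  refine sum_congr rfl fun i _ => ?_
  by_cases hP : P i
  · simp only [hP, if_true]
    rw [← integral_const_mul]
    refine integral_congr_ae (Eventually.of_forall fun z => ?_)
    simp only; ring
  · simp [hP]

lemma newtPot_sum_ite (hn : 2 ≤ n) (hW : (n : ℝ) + 1 < W) {ι : Type*} [Fintype ι] (P : ι → Prop)
    [DecidablePred P] (a : ι → ℝ) {F : ι → 𝓕} (hF : ∀ i, GX 0 W C (F i)) (x : Spc n) :
    newtPot (fun y => ∑ i, if P i then a i * F i y else 0) x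
      = ∑ i, if P i then a i * newtPot (F i) x else 0 := by
  simp only [newtPot_eq]
  rw [integral_conv_sum_ite hn (lapE_EK hn le_rfl zero_le_one) hW P a hF x, mul_sum]
  refine sum_congr rfl fun i _ => ?_
  split_ifs <;> ring

lemma GX.ite_smul (P : Prop) [Decidable P] (ha : |a| ≤ 1) (h : GX N W C f) :
    GX N W C (fun x => if P then a * f x else 0) := by
  have h0 := h.nonneg
  by_cases hP : P
  · simp only [hP, if_true]
    exact (h.smul a).mono (by nlinarith)
  · simp only [hP, if_false]
    exact GX.zero.mono h0

lemma abs_sgn (i : Fin n) (J : Finset (Fin n)) : |sgn i J| ≤ 1 := by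
  have h := sgn_sq i J
  rw [abs_le]
  constructor <;> nlinarith

lemma dG_GX (hV : ∀ I, GX (N + 1) W C (V I)) (J : Finset (Fin n)) :
    GX N (W + 1) (n * C) (dG V J) := by
  have h := GX.sum (univ : Finset (Fin n)) (c := fun _ => C)
    (F := fun i x => if i ∈ J then sgn i J * pd i (V (J.erase i)) x else 0)
    (fun i _ => ((hV (J.erase i)).pd i).ite_smul _ (abs_sgn i J))
  simp only [sum_const, card_univ, Fintype.card_fin, nsmul_eq_mul] at h
  exact h

/-- The co-exact part of a family of coefficients, obtained from the Newton potential. -/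
def PG (V : Finset (Fin n) → 𝓕) (K : Finset (Fin n)) (x : Spc n) : ℝ :=
  -cG (fun J => newtPot (dG V J)) K x

lemma newt_dG_contDiff (hn : 2 ≤ n) (hW : (n : ℝ) + 1 < W) (hV : ∀ I, GX 4 W C (V I))
    (J : Finset (Fin n)) : ContDiff ℝ 2 (newtPot (dG V J)) :=
  newtPot_contDiff (N := 2) hn (W := W + 1) (by linarith) (dG_GX (N := 3) hV J)

lemma cG_PG (hn : 2 ≤ n) (hW : (n : ℝ) + 1 < W) (hV : ∀ I, GX 4 W C (V I))
    (K : Finset (Fin n)) (x : Spc n) : cG (PG V) K x = 0 := by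
  have h : cG (PG V) K x = - cG (cG (fun J => newtPot (dG V J))) K x := by
    have h1 : ∀ i, pd i (PG V (insert i K)) x
        = -pd i (cG (fun J => newtPot (dG V J)) (insert i K)) x := fun i => pd_neg' _ i x
    have e : ∀ U : Finset (Fin n) → 𝓕, cG U K x
        = -∑ i : Fin n, if i ∉ K then sgn i K * pd i (U (insert i K)) x else 0 := fun _ => rfl
    rw [e, e, neg_inj, ← sum_neg_distrib]
    refine sum_congr rfl fun i _ => ?_
    rw [h1]
    split_ifs <;> ring
  rw [h, cG_cG (newt_dG_contDiff hn hW hV), neg_zero]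

lemma dG_newt_dG (hn : 2 ≤ n) (hW : (n : ℝ) + 1 < W) (hV : ∀ I, GX 4 W C (V I))
    (J : Finset (Fin n)) (x : Spc n) : dG (fun J => newtPot (dG V J)) J x = 0 := by
  have hf : ∀ J, GX 3 (W + 1) (n * C) (dG V J) := fun J => dG_GX (N := 3) hV J
  have hW' : (n : ℝ) + 1 < W + 1 := by linarith
  have h : dG (fun J => newtPot (dG V J)) J x
      = newtPot (fun y => dG (dG V) J y) x := by
    rw [show (fun y => dG (dG V) J y) = fun y => ∑ i, if i ∈ J then
      sgn i J * pd i (dG V (J.erase i)) y else 0 from rfl, dG, newtPot_sum_ite hn (W := W + 1 + 1) (by linarith) (fun i => i ∈ J) (fun i => sgn i J)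
      (F := fun i => pd i (dG V (J.erase i))) (C := n * C)
      (fun i => ((hf (J.erase i)).mono_N (by norm_num : 0 + 1 ≤ 3)).pd i) x]
    refine sum_congr rfl fun i _ => ?_
    have := congrFun (pd_newtPot hn hW' ((hf (J.erase i)).mono_N (by norm_num : 1 ≤ 3)) i) x
    rw [← this]
  rw [h, show (fun y => dG (dG V) J y) = fun _ => 0 from
    funext fun y => dG_dG (fun I => (hV I).1.of_le (by norm_num)) J y, newtPot_zero]

lemma dG_PG (hn : 2 ≤ n) (hW : (n : ℝ) + 1 < W) (hV : ∀ I, GX 4 W C (V I))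
    (J : Finset (Fin n)) (x : Spc n) : dG (PG V) J x = cLap n * cRho n * dG V J x := by
  have hU := newt_dG_contDiff hn hW hV
  have h : dG (PG V) J x = - dG (cG (fun J => newtPot (dG V J))) J x := by
    conv_lhs => unfold dG
    conv_rhs => rw [show dG (cG (fun J => newtPot (dG V J))) J x = ∑ i, if i ∈ J then
      sgn i J * pd i (cG (fun J => newtPot (dG V J)) (J.erase i)) x else 0 from rfl]
    rw [← sum_neg_distrib]
    refine sum_congr rfl fun i _ => ?_
    split_ifs
    · rw [show PG V (J.erase i) = fun y => -(cG (fun J => newtPot (dG V J)) (J.erase i) y) from rfl,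
        pd_neg']; ring
    · simp
  have h1 := dG_cG_add hU J x
  have h2 : cG (dG fun J => newtPot (dG V J)) J x = 0 := by
    have : (dG fun J => newtPot (dG V J)) = fun _ _ => 0 := by
      funext I y; exact dG_newt_dG hn hW hV I y
    rw [this]
    simp [cG, pd_zero]
  have h3 := lap_newtPot hn (W := W + 1) (by linarith)
    ((dG_GX (N := 3) hV J).mono_N (by norm_num : 2 ≤ 3)) x
  rw [h]
  linarith

lemma PG_eq (hn : 2 ≤ n) (hW : (n : ℝ) + 1 < W) (hV : ∀ I, GX 4 W C (V I))
    (K : Finset (Fin n)) (x : Spc n) :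
    PG V K x = ∑ i, if i ∉ K then sgn i K * (cLap n * ∑ j, if j ∈ insert i K then
      sgn j (insert i K) * RK i (pd j (V ((insert i K).erase j))) x else 0) else 0 := by
  have hf : ∀ J, GX 3 (W + 1) (n * C) (dG V J) := fun J => dG_GX (N := 3) hV J
  unfold PG cG
  rw [neg_neg]
  refine sum_congr rfl fun i _ => ?_
  have h1 := congrFun (pd_newtPot_eq_RK hn (W := W + 1) (by linarith)
    ((hf (insert i K)).mono_N (by norm_num : 1 ≤ 3)) i) x
  rw [h1]
  have h2 := integral_conv_sum_ite hn (kapE_EK (n := n) (ε := 0) i) (W := W + 1) (C := C) (by linarith)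
    (fun j => j ∈ insert i K) (fun j => sgn j (insert i K))
    (F := fun j => pd j (V ((insert i K).erase j)))
    (fun j => ((hV ((insert i K).erase j)).mono_N (by norm_num : 0 + 1 ≤ 4)).pd j) x
  simp only [RK] at h2 ⊢
  rw [← h2]
  rfl

end

section

lemma ext_newtPot (f : FormS n q) :
    ext (fun J y => newtPot (f J) y) = fun J => newtPot (ext f J) := by
  funext J x
  by_cases h : J.card = q
  · rw [ext, dif_pos h]
    congr 1
    funext y
    rw [ext, dif_pos h]
  · rw [ext_ne _ h, ext_ne _ h, newtPot_zero]

lemma PhiOp_dT (v : FormT n q) (K : Idx n q) (t : ℝ) (x : Spc n) :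
    PhiOp (dT v) K t x = PG (ext fun I => v I t) K.1 x := by
  unfold PhiOp PG
  rw [coDS_eq (q := q + 1)]
  have h := ext_newtPot (fun J => dT v J t)
  have h' : ext (fun J => dT v J t) = dG (ext fun I => v I t) := ext_dS _
  rw [h'] at h
  rw [← h]

end

/-- The parameters of the problem, with the auxiliary exponents `θ` and `η`. -/
structure Par (n : ℕ) where
  (T δ θ η μ : ℝ)
  (s p : ℕ)
  hn : 2 ≤ n
  hT : 0 < T
  hμ : 0 < μ
  hθ0 : 0 < θ
  hθ1 : θ < 1
  hη0 : 0 < η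
  hδ : (n : ℝ) / 2 < δ
  hη1 : δ + η ≤ n
  hη2 : δ + 1 + η ≤ 2 * δ
  hs : 1 ≤ s
  hp : 2 ≤ p

namespace Par

variable (P : Par n)

lemma δ_pos : 1 < P.δ := by
  have h : (2 : ℝ) ≤ n := by exact_mod_cast P.hn
  linarith [P.hδ]

lemma n_lt : (n : ℝ) < 2 * P.δ := by linarith [P.hδ]

/-- The class of right-hand sides with parabolic weighted bounds of weight `W`. -/
def CG (W C : ℝ) (f : 𝓣) : Prop := TGen P.T (SG P.T W C) P.s P.p f

/-- The class of functions with parabolic weighted Hölder bounds of weight `W`. -/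
def CH (W C : ℝ) (f : 𝓣) : Prop :=
  TGen P.T (fun N => HB P.T P.θ W C N) P.s P.p f

/-- The Leray–Helmholtz projection of the volume heat potential, for forms indexed by finsets. -/
def RG (f : Finset (Fin n) → 𝓣) (K : Finset (Fin n)) (t : ℝ) : 𝓕 :=
  PG (fun I => VP P.T 0 (gam P.μ) (f I) t) K

end Par

section

variable {P : Par n} {f g : Finset (Fin n) → ℝ → Spc n → ℝ}

lemma Par.CG.sg {u : 𝓣} (h : P.CG W C u) : SG P.T W C (2 * P.s + P.p) u := TGen.base h

lemma Par.four_le (P : Par n) : 4 ≤ 2 * P.s + P.p := by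
  have := P.hs; have := P.hp; omega

lemma exists_VP_GX (P : Par n) (hW : 0 ≤ W) (N : ℕ) : ∃ A, 0 ≤ A ∧ ∀ C f, SG P.T W C N f →
    HV P.T P.θ W (A * C) N (VP P.T 0 (gam P.μ : 𝓕) f) :=
  VP_HV P.hn P.hθ0 P.hθ1.le le_rfl (by linarith [P.hθ1]) (gam_prof P.hμ P.hθ0 P.hθ1.le) P.hT.le hW N

lemma VP_GX4 (P : Par n) : ∃ A, 0 ≤ A ∧ ∀ C (f : Finset (Fin n) → 𝓣),
    (∀ I, P.CG (2 * P.δ + 1) C (f I)) → ∀ t ∈ Icc 0 P.T, ∀ I,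
      GX 4 (2 * P.δ + 1) (A * C) (VP P.T 0 (gam P.μ) (f I) t) := by
  obtain ⟨A, hA, h⟩ := exists_VP_GX P (W := 2 * P.δ + 1) (by linarith [P.δ_pos]) (2 * P.s + P.p)
  exact ⟨A, hA, fun C f hf t ht I => ((h C _ (hf I).sg).1 t ht).mono_N P.four_le⟩

lemma TGen.ite_smul_HB (Q : Prop) [Decidable Q] {u : 𝓣}
    (hC : 0 ≤ C) (h : Q → TGen T (fun N => HB T θ W C N) s p u) :
    TGen T (fun N => HB T θ W (|a| * C) N) s p (fun t x => if Q then a * u t x else 0) := by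
  by_cases hQ : Q
  · simpa only [hQ, if_true] using (h hQ).HB_smul a
  · simp only [hQ, if_false]
    exact TGen.HB_zero.HB_mono (by positivity)

lemma RG_eq (P : Par n) (hf : ∀ I, P.CG (2 * P.δ + 1) C (f I)) (ht : t ∈ Icc 0 P.T)
    (K : Finset (Fin n)) (x : Spc n) : P.RG f K t x =
      ∑ i, if i ∉ K then sgn i K * (cLap n * ∑ j, if j ∈ insert i K then sgn j (insert i K) *
        RK i (pd j (VP P.T 0 (gam P.μ) (f ((insert i K).erase j)) t)) x else 0) else 0 := by
  obtain ⟨A, hA, h⟩ := VP_GX4 P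
  exact PG_eq P.hn (by linarith [P.n_lt]) (h C f hf t ht) K x

lemma RG_CH (P : Par n) : ∃ A, 0 ≤ A ∧ ∀ C (f : Finset (Fin n) → 𝓣), 0 ≤ C →
    (∀ I, P.CG (2 * P.δ + 1) C (f I)) → ∀ K, P.CH (P.δ + P.η) (A * C) (P.RG f K) := by
  have hδ := P.δ_pos
  obtain ⟨A1, hA1, H1⟩ := TGen.VP (n := n) P.hn P.hμ P.hT.le P.hθ0 P.hθ1
    (W := 2 * P.δ + 1) (by linarith) P.s P.p (by linarith [P.hp])
  have H2 := fun i j : Fin n => TGen.RK_pd P.hn P.hT.le P.hθ0 P.hθ1.le (W := 2 * P.δ)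
    (V := 2 * P.δ + 1) P.n_lt (by linarith [P.n_lt]) i j P.s P.p
  choose A2 hA2 H2 using H2
  obtain ⟨A4, hA4, H4⟩ := VP_GX4 P
  have hn0 : (0 : ℝ) ≤ n := by positivity
  have nn0 : ∀ i K j, 0 ≤ |sgn j (insert i K)| * (A2 i j * A1) := fun i K j =>
    mul_nonneg (abs_nonneg _) (mul_nonneg (hA2 i j) hA1)
  have nn : ∀ K : Finset (Fin n), 0 ≤ ∑ i : Fin n, |sgn i K| * (|cLap n| *
      ∑ j, |sgn j (insert i K)| * (A2 i j * A1)) := fun K => sum_nonneg fun i _ =>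
    mul_nonneg (abs_nonneg _) (mul_nonneg (abs_nonneg _) (sum_nonneg fun j _ => nn0 i K j))
  refine ⟨∑ K : Finset (Fin n), ∑ i : Fin n, |sgn i K| * (|cLap n| * ∑ j, |sgn j (insert i K)| *
    (A2 i j * A1)), sum_nonneg fun K _ => nn K, fun C f hC hf K => ?_⟩
  have key : TGen P.T (fun N => HB P.T P.θ n ((∑ i : Fin n, |sgn i K| * (|cLap n| *
      ∑ j, |sgn j (insert i K)| * (A2 i j * (A1 * C))))) N) P.s P.p (P.RG f K) := by
    refine TGen.congr P.hT.le (TGen.HB_sum hn0 P.hθ0 univ fun i _ => ?_)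
      (fun N f g e h => HB.congr h e) fun t ht x => RG_eq P hf ht K x
    refine TGen.ite_smul_HB _ (mul_nonneg (abs_nonneg _) (sum_nonneg fun j _ =>
      mul_nonneg (abs_nonneg _) (mul_nonneg (hA2 i j) (by positivity)))) fun hi => TGen.HB_smul ?_ _
    refine TGen.HB_sum hn0 P.hθ0 univ fun j _ => ?_
    refine TGen.ite_smul_HB _ (mul_nonneg (hA2 i j) (by positivity)) fun hj => ?_
    refine H2 i j _ _ ?_ ⟨A4 * C, fun t ht => (H4 C f hf t ht _).mono_N (by norm_num)⟩
    have := H1 C _ (hf ((insert i K).erase j))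
    rwa [show 2 * P.δ + 1 - 1 = 2 * P.δ by ring] at this
  have key2 : TGen P.T (fun N => HB P.T P.θ n ((∑ K : Finset (Fin n), ∑ i : Fin n, |sgn i K| *
      (|cLap n| * ∑ j, |sgn j (insert i K)| * (A2 i j * A1))) * C) N) P.s P.p (P.RG f K) := by
    refine key.HB_mono ?_
    have e : (∑ i : Fin n, |sgn i K| * (|cLap n| *
        ∑ j, |sgn j (insert i K)| * (A2 i j * (A1 * C)))) = (∑ i : Fin n, |sgn i K| *
      (|cLap n| * ∑ j, |sgn j (insert i K)| * (A2 i j * A1))) * C := by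
      simp only [sum_mul, mul_assoc, mul_sum]
    rw [e]
    refine mul_le_mul_of_nonneg_right ?_ hC
    exact single_le_sum (f := fun K => ∑ i : Fin n, |sgn i K| *
      (|cLap n| * ∑ j, |sgn j (insert i K)| * (A2 i j * A1))) (fun K _ => nn K)
      (mem_univ K)
  exact key2.mono fun N f h => h.mono_W P.hη1

lemma dG_RG (P : Par n) (hf : ∀ I, P.CG (2 * P.δ + 1) C (f I)) (ht : t ∈ Icc 0 P.T)
    (J : Finset (Fin n)) (x : Spc n) : dG (fun K => P.RG f K t) J x =
      cLap n * cRho n * dG (fun I => VP P.T 0 (gam P.μ) (f I) t) J x := by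
  obtain ⟨A, hA, h⟩ := VP_GX4 P
  exact dG_PG P.hn (by linarith [P.n_lt]) (h C f hf t ht) J x

lemma cG_RG (P : Par n) (hf : ∀ I, P.CG (2 * P.δ + 1) C (f I)) (ht : t ∈ Icc 0 P.T)
    (J : Finset (Fin n)) (x : Spc n) : cG (fun K => P.RG f K t) J x = 0 := by
  obtain ⟨A, hA, h⟩ := VP_GX4 P
  exact cG_PG P.hn (by linarith [P.n_lt]) (h C f hf t ht) J x

lemma pd_VP_CH (P : Par n) (i : Fin n) : ∃ A, 0 ≤ A ∧ ∀ C (f : 𝓣),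
    P.CG (2 * P.δ + 1) C f →
      P.CH (2 * P.δ) (A * C) (fun t => pd i (VP P.T 0 (gam P.μ) f t)) := by
  have hδ := P.δ_pos
  obtain ⟨A1, hA1, H1⟩ := TGen.VP (n := n) P.hn P.hμ P.hT.le P.hθ0 P.hθ1
    (W := 2 * P.δ + 1) (by linarith) P.s P.p (by linarith [P.hp])
  obtain ⟨A2, hA2, H2⟩ := TGen.map_const (T := P.T) (n := n)
    (B := fun C N f => HV P.T P.θ (2 * P.δ) C (N + 1) f)
    (B₁ := fun C N f => HB P.T P.θ (2 * P.δ) C N f) (fun f t => pd i (f t)) P.s P.p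
    (fun C C' N f h hf => hf.mono h) (fun C N f h => h.nonneg P.hT.le)
    (fun N => ⟨1 + 4 ^ (2 * P.δ + 1 + N), by positivity, fun C f h =>
      HB.of_HV P.hθ0 P.hθ1.le (by linarith) (h.pd i) P.hT.le⟩)
    (fun C N f g hfg h1 h2 => TD.pd (N := 0) (W := 2 * P.δ) (C := C) (by linarith) hfg
      ((h1.mono_N (by omega)).sg (by linarith) P.hθ0) ((h2.mono_N (by omega)).sg (by linarith) P.hθ0) i)
  refine ⟨A2 * A1, by positivity, fun C f hf => ?_⟩
  have := H1 C f hf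
  rw [show 2 * P.δ + 1 - 1 = 2 * P.δ by ring] at this
  rw [mul_assoc]
  exact H2 _ _ this

lemma dRG_CH (P : Par n) : ∃ A, 0 ≤ A ∧ ∀ C (f : Finset (Fin n) → 𝓣), 0 ≤ C →
    (∀ I, P.CG (2 * P.δ + 1) C (f I)) → ∀ J,
      P.CH (P.δ + 1 + P.η) (A * C) (fun t => dG (fun K => P.RG f K t) J) := by
  have hδ := P.δ_pos
  have H1 := fun i => pd_VP_CH P i
  choose A hA H using H1
  refine ⟨|cLap n * cRho n| * ∑ i, A i, mul_nonneg (abs_nonneg _)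
    (sum_nonneg fun i _ => hA i), fun C f hC hf J => ?_⟩
  have key : P.CH (2 * P.δ) (|cLap n * cRho n| * ∑ i, |sgn i J| * (A i * C))
      (fun t => dG (fun K => P.RG f K t) J) := by
    refine TGen.congr P.hT.le (TGen.HB_smul (TGen.HB_sum (by linarith) P.hθ0 univ
      fun i _ => ?_) (cLap n * cRho n)) (fun N f g e h => HB.congr h e)
      fun t ht x => dG_RG P hf ht J x
    exact TGen.ite_smul_HB _ (mul_nonneg (hA i) hC) fun hj => H i C _ (hf _)
  refine TGen.mono (TGen.HB_mono key ?_) (fun N f h => h.mono_W P.hη2)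
  rw [mul_assoc, sum_mul]
  refine mul_le_mul_of_nonneg_left (sum_le_sum fun i _ => ?_) (abs_nonneg _)
  exact mul_le_of_le_one_left (mul_nonneg (hA i) hC) (abs_sgn i J)

end

variable {P : Par n}

section

variable {U V : Finset (Fin n) → Spc n → ℝ}

lemma dG_lin (hU : ∀ I, Differentiable ℝ (U I)) (hV : ∀ I, Differentiable ℝ (V I)) (a b : ℝ)
    (J : Finset (Fin n)) (x : Spc n) :
    dG (fun I y => a * U I y + b * V I y) J x = a * dG U J x + b * dG V J x := by
  unfold dG
  rw [mul_sum, mul_sum, ← sum_add_distrib]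
  refine sum_congr rfl fun i _ => ?_
  split_ifs with h
  · rw [congrFun (pd_add ((hU _).const_mul a) ((hV _).const_mul b) i) x,
      congrFun (pd_const_mul a i) x, congrFun (pd_const_mul b i) x]
    ring
  · ring

lemma cG_lin (hU : ∀ I, Differentiable ℝ (U I)) (hV : ∀ I, Differentiable ℝ (V I)) (a b : ℝ)
    (J : Finset (Fin n)) (x : Spc n) :
    cG (fun I y => a * U I y + b * V I y) J x = a * cG U J x + b * cG V J x := by
  unfold cG
  rw [mul_neg, mul_neg, ← neg_add, mul_sum, mul_sum, ← sum_add_distrib]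
  refine neg_inj.2 (sum_congr rfl fun i _ => ?_)
  split_ifs with h
  · ring
  · rw [congrFun (pd_add ((hU _).const_mul a) ((hV _).const_mul b) i) x,
      congrFun (pd_const_mul a i) x, congrFun (pd_const_mul b i) x]
    ring

lemma newtPot_lin (hn : 2 ≤ n) (hW : (n : ℝ) + 1 < W) (hf : GX 0 W C f)
    (hg : GX 0 W C g) (a b : ℝ) (x : Spc n) :
    newtPot (fun y => a * f y + b * g y) x = a * newtPot f x + b * newtPot g x := by
  have := newtPot_sum_ite hn hW (ι := Bool) (fun _ => True) (fun i => if i then a else b)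
    (F := fun i => if i then f else g) (C := C) (by rintro (_ | _) <;> simpa) x
  simpa using this

lemma PG_lin (hn : 2 ≤ n) (hW : (n : ℝ) + 1 < W) (hU : ∀ I, GX 4 W C (U I))
    (hV : ∀ I, GX 4 W C (V I)) (a b : ℝ) (K : Finset (Fin n)) (x : Spc n) :
    PG (fun I y => a * U I y + b * V I y) K x = a * PG U K x + b * PG V K x := by
  have e : (fun J => newtPot (dG (fun I y => a * U I y + b * V I y) J)) =
      fun J y => a * newtPot (dG U J) y + b * newtPot (dG V J) y := by
    funext J y
    rw [show dG (fun I y => a * U I y + b * V I y) J = fun z => a * dG U J z + b * dG V J z from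
      funext fun z => dG_lin (fun I => (hU I).1.differentiable (by norm_num))
        (fun I => (hV I).1.differentiable (by norm_num)) a b J z]
    exact newtPot_lin (W := W + 1) hn (by linarith) (dG_GX (fun I => (hU I).mono_N (by norm_num)) J)
      (dG_GX (fun I => (hV I).mono_N (by norm_num)) J) a b y
  unfold PG
  rw [e, cG_lin (fun I => (newt_dG_contDiff hn hW hU I).differentiable (by norm_num))
    (fun I => (newt_dG_contDiff hn hW hV I).differentiable (by norm_num))]
  ring

end

section

lemma VP_lin (P : Par n) {f g : 𝓣} (hf : SG P.T 0 C 0 f) (hg : SG P.T 0 C 0 g) (a b : ℝ)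
     (ht : t ∈ Icc 0 P.T) (x : Spc n) :
    VP P.T 0 (gam P.μ) (fun t y => a * f t y + b * g t y) t x =
      a * VP P.T 0 (gam P.μ) f t x + b * VP P.T 0 (gam P.μ) g t x := by
  unfold VP
  rw [← integral_const_mul, ← integral_const_mul, ← integral_add
    ((VP_integrable P.hn P.hμ P.hT.le hf ht x).const_mul a)
    ((VP_integrable P.hn P.hμ P.hT.le hg ht x).const_mul b)]
  exact integral_congr_ae (Eventually.of_forall fun p => by simp only; ring)

lemma RG_lin (P : Par n) {f g : Finset (Fin n) → 𝓣}
    (hf : ∀ I, P.CG (2 * P.δ + 1) C (f I)) (hg : ∀ I, P.CG (2 * P.δ + 1) C (g I)) (a b : ℝ)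
     (ht : t ∈ Icc 0 P.T) (K : Finset (Fin n)) (x : Spc n) :
    P.RG (fun I t y => a * f I t y + b * g I t y) K t x =
      a * P.RG f K t x + b * P.RG g K t x := by
  obtain ⟨A, hA, h⟩ := VP_GX4 P
  have hδ := P.δ_pos
  unfold Par.RG
  rw [← PG_lin P.hn (by linarith [P.n_lt]) (h C f hf t ht) (h C g hg t ht) a b K x]
  congr 1
  funext I y
  exact VP_lin P (((hf I).sg.mono_W (by linarith)).mono_N (by omega))
    (((hg I).sg.mono_W (by linarith)).mono_N (by omega)) a b ht y

lemma VP_zero (P : Par n) (t : ℝ) :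
    VP P.T 0 (gam P.μ) (fun _ (_ : Spc n) => (0 : ℝ)) t = fun _ => 0 := by
  funext x; simp [VP]

/-- Extension by zero of a time-dependent form to all finsets of indices. -/
def extT (m : FormT n q) (J : Finset (Fin n)) (t : ℝ) : 𝓕 := ext (fun I => m I t) J

lemma extT_coe (m : FormT n q) (I : Idx n q) : extT m I.1 = m I := by
  funext t; exact ext_coe _ I

lemma extT_ne (m : FormT n q) {J : Finset (Fin n)} (h : J.card ≠ q) :
    extT m J = fun _ _ => 0 := by
  funext t; exact ext_ne _ h

lemma VP_extT (P : Par n) (m : FormT n q) (J : Finset (Fin n)) (t : ℝ) :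
    VP P.T 0 (gam P.μ) (extT m J) t = ext (fun I => VP P.T 0 (gam P.μ) (m I) t) J := by
  by_cases h : J.card = q
  · rw [show J = (⟨J, h⟩ : Idx n q).1 from rfl, extT_coe, ext_coe]
  · rw [extT_ne m h, VP_zero, ext_ne _ h]

lemma RG_extT (P : Par n) (m : FormT n q) (K : Idx n q) (t : ℝ) (x : Spc n) :
    P.RG (extT m) K.1 t x = PhiOp (dT fun I => VP P.T 0 (gam P.μ) (m I)) K t x := by
  rw [PhiOp_dT]
  unfold Par.RG
  simp only [VP_extT]

lemma RG_extT_ne (P : Par n) (m : FormT n q) {K : Finset (Fin n)} (h : K.card ≠ q) (t : ℝ) :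
    P.RG (extT m) K t = fun _ => 0 := by
  funext x
  unfold Par.RG PG
  simp only [VP_extT]
  have h1 : (dG fun I => ext (fun I => VP P.T 0 (gam P.μ) (m I) t) I) =
    ext (dS fun I => VP P.T 0 (gam P.μ) (m I) t) := (ext_dS _).symm
  rw [h1, ← ext_newtPot, ← ext_coDS (q := q + 1) (by omega), ext_ne _ (by simpa using h)]
  simp

lemma ext_RG (P : Par n) (m : FormT n q) (t : ℝ) :
    ext (fun I : Idx n q => P.RG (extT m) I.1 t) = fun K => P.RG (extT m) K t := by
  funext K
  by_cases h : K.card = q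
  · exact ext_coe (fun I : Idx n q => P.RG (extT m) I.1 t) ⟨K, h⟩
  · rw [ext_ne _ h, RG_extT_ne P m h]

lemma extT_CG (hC : 0 ≤ C) {m : FormT n q} (h : ∀ I, P.CG W C (m I)) (J : Finset (Fin n)) :
    P.CG W C (extT m J) := by
  by_cases hJ : J.card = q
  · rw [show J = (⟨J, hJ⟩ : Idx n q).1 from rfl, extT_coe]; exact h _
  · rw [extT_ne m hJ]; exact TGen.SG_zero.SG_mono hC

/-- The slice of `Φ d` at time `t` only depends on the slice of the form. -/
lemma PhiOp_dT_congr (h : ∀ J : Idx n (q + 1), dT v J t = dT w J t)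
    (K : Idx n q) (x : Spc n) : PhiOp (dT v) K t x = PhiOp (dT w) K t x := by
  unfold PhiOp
  simp only [h]

lemma dT_eq (u : FormT n q) (J : Idx n (q + 1)) (t : ℝ) :
    dT u J t = dG (ext fun I => u I t) J.1 := dS_eq _ J

lemma coDT_eq (u : FormT n q) (K : Idx n (q - 1)) (t : ℝ) :
    coDT u K t = cG (ext fun I => u I t) K.1 := coDS_eq _ K

lemma VP_sum_ite (P : Par n) {ι : Type*} [Fintype ι] (Q : ι → Prop) [DecidablePred Q] (a : ι → ℝ)
    {F : ι → 𝓣} (hF : ∀ i, SG P.T 0 C 0 (F i)) (ht : t ∈ Icc 0 P.T)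
    (x : Spc n) :
    VP P.T 0 (gam P.μ) (fun t y => ∑ i, if Q i then a i * F i t y else 0) t x =
      ∑ i, if Q i then a i * VP P.T 0 (gam P.μ) (F i) t x else 0 := by
  unfold VP
  have e : ∀ i, (if Q i then a i * ∫ p, kf 0 (gam P.μ) (t - p.1) p.2 * F i p.1 (x - p.2)
      ∂slabM n P.T else 0) =
      ∫ p, (if Q i then a i else 0) * (kf 0 (gam P.μ) (t - p.1) p.2 * F i p.1 (x - p.2))
      ∂slabM n P.T := fun i => by
    rw [integral_const_mul]; split_ifs <;> simp
  simp only [e]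
  rw [← integral_finsetSum _ fun i _ => (VP_integrable P.hn P.hμ P.hT.le (hF i) ht x).const_mul _]
  refine integral_congr_ae (Eventually.of_forall fun p => ?_)
  simp only [mul_sum]
  refine sum_congr rfl fun i _ => ?_
  split_ifs <;> ring

lemma VP_dLowT (P : Par n) (hC : 0 ≤ C) {p : FormT n (q - 1)} (hp : ∀ I, SG P.T 0 C 1 (p I))
    (J : Idx n q) (ht : t ∈ Icc 0 P.T) (x : Spc n) :
    VP P.T 0 (gam P.μ) (dLowT p J) t x =
      dLowS (fun K => VP P.T 0 (gam P.μ) (p K) t) J x := by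
  have hp' : ∀ I, SG P.T 0 C 1 (extT p I) := fun I => by
    by_cases h : I.card = q - 1
    · rw [show I = (⟨I, h⟩ : Idx n (q - 1)).1 from rfl, extT_coe]; exact hp _
    · rw [extT_ne p h]; exact SG.zero.mono hC
  have e : dLowT p J = fun t y => ∑ i, if i ∈ J.1 then sgn i J.1 *
      pd i (extT p (J.1.erase i) t) y else 0 := by
    funext τ
    exact dLowS_eq _ J
  rw [e, VP_sum_ite P (C := C) _ _ (F := fun i t => pd i (extT p (J.1.erase i) t))
    (fun i => ((hp' _).pd i).mono_W (by norm_num)) ht, dLowS_eq]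
  refine sum_congr rfl fun i _ => ?_
  rw [← pd_VP P.hn P.hμ P.hT.le (hp' _) ht, VP_extT]

end

section

lemma volPot_congr {f g : 𝓣} (h : ∀ τ ∈ Ioc 0 t, ∀ x, f τ x = g τ x)
    (x : Spc n) : volPot μ f t x = volPot μ g t x := by
  unfold volPot
  refine setIntegral_congr_fun measurableSet_Ioc fun τ hτ => ?_
  simp only [h τ hτ]

lemma ite_SG (Q : Prop) [Decidable Q] {u : 𝓣}
    (hC : 0 ≤ C) (ha : |a| ≤ 1) (h : SG T W C N u) :
    SG T W C N (fun t x => if Q then a * u t x else 0) := by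
  by_cases hQ : Q
  · simp only [hQ, if_true]
    exact (h.smul a).mono (mul_le_of_le_one_left hC ha)
  · simp only [hQ, if_false]
    exact SG.zero.mono hC

lemma extT_SG (hC : 0 ≤ C) {p : FormT n q} (hp : ∀ I, SG T W C N (p I))
    (I : Finset (Fin n)) : SG T W C N (extT p I) := by
  by_cases h : I.card = q
  · rw [show I = (⟨I, h⟩ : Idx n q).1 from rfl, extT_coe]; exact hp _
  · rw [extT_ne p h]; exact SG.zero.mono hC

lemma dLowT_SG (hC : 0 ≤ C) {p : FormT n (q - 1)}
    (hp : ∀ I, SG T W C (N + 1) (p I)) (J : Idx n q) : SG T (W + 1) (n * C) N (dLowT p J) := by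
  have e : dLowT p J = fun t y => ∑ i, if i ∈ J.1 then sgn i J.1 *
      pd i (extT p (J.1.erase i) t) y else 0 := by
    funext τ
    exact dLowS_eq _ J
  rw [e]
  have := SG.sum (T := T) (W := W + 1) (N := N) (univ : Finset (Fin n)) (c := fun _ => C)
    (F := fun i t y => if i ∈ J.1 then sgn i J.1 * pd i (extT p (J.1.erase i) t) y else 0)
    fun i _ => ite_SG _ hC (abs_sgn _ _) ((extT_SG hC hp _).pd i)
  simpa using this

lemma PhiOp_volPotF (P : Par n) (hq : 1 ≤ q) (hC : 0 ≤ C) {m : FormT n q}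
    (hm : ∀ I, P.CG (2 * P.δ + 1) C (m I)) {p : FormT n (q - 1)} (hp : ∀ K, SG P.T 0 C 2 (p K))
    {N : FormT n q} (hN : ∀ I, ∀ t ∈ Icc 0 P.T, ∀ x, N I t x = m I t x + dLowT p I t x)
    (K : Idx n q) (ht : t ∈ Icc 0 P.T) (x : Spc n) :
    PhiOp (dT (volPotF P.μ N)) K t x = P.RG (extT m) K.1 t x := by
  have hδ := P.δ_pos
  have hm0 : ∀ I, SG P.T 0 C 0 (m I) := fun I => ((hm I).sg.mono_W (by linarith)).mono_N (by omega)
  have hd0 : ∀ I, SG P.T 0 (n * C) 0 (dLowT p I) := fun I =>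
    (dLowT_SG hC (fun K => (hp K).mono_N (by norm_num)) I).mono_W (by norm_num)
  rw [RG_extT]
  refine PhiOp_dT_congr (fun J => ?_) K x
  rw [dT_eq, dT_eq]
  funext x
  obtain ⟨A, hA, hVm⟩ := exists_VP_GX P (n := n) (W := 0) le_rfl 2
  have e : (ext fun I => volPotF P.μ N I t) = fun I y =>
      1 * ext (fun I => VP P.T 0 (gam P.μ) (m I) t) I y +
        1 * dG (ext fun K => VP P.T 0 (gam P.μ) (p K) t) I y := by
    rw [← ext_dLowS hq]
    funext I y
    unfold ext
    split_ifs with h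
    · have h1 : ∀ I, SG P.T 0 (C + n * C) 0 (fun t x => m I t x + dLowT p I t x) := fun I =>
        (hm0 I).add (hd0 I)
      show volPot P.μ (N ⟨I, h⟩) t y = 1 * VP P.T 0 (gam P.μ) (m ⟨I, h⟩) t y +
        1 * dLowS (fun K => VP P.T 0 (gam P.μ) (p K) t) ⟨I, h⟩ y
      rw [volPot_congr (g := fun t x => m ⟨I, h⟩ t x + dLowT p ⟨I, h⟩ t x) fun τ hτ x =>
        hN _ τ ⟨hτ.1.le, hτ.2.trans ht.2⟩ x, volPot_eq_VP P.hn P.hμ P.hT.le (h1 _) ht]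
      have := VP_lin P (C := C + n * C) ((hm0 ⟨I, h⟩).mono (by nlinarith [Nat.cast_nonneg (α := ℝ) n]))
        ((hd0 ⟨I, h⟩).mono (by linarith)) 1 1 ht y
      simp only [one_mul] at this ⊢
      rw [this, VP_dLowT P hC (fun K => (hp K).mono_N (by norm_num)) _ ht]
    · simp
  have hp2 : ∀ I, ContDiff ℝ 2 (ext (fun K => VP P.T 0 (gam P.μ) (p K) t) I) :=
    ext_contDiff fun K => ((hVm C _ (hp K)).1 t ht).1
  have hm2 : ∀ I, ContDiff ℝ 2 (ext (fun I => VP P.T 0 (gam P.μ) (m I) t) I) :=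
    ext_contDiff fun I => ((hVm C _ (((hm I).sg.mono_W (by linarith)).mono_N
      (le_trans (by norm_num) P.four_le))).1 t ht).1
  rw [e, dG_lin (fun I => (hm2 I).differentiable (by norm_num)) (fun I => ?_), dG_dG hp2]
  · ring
  · have := fun y => dG_lin (J := I) (x := y) (U := ext fun K => VP P.T 0 (gam P.μ) (p K) t)
      (V := ext fun K => VP P.T 0 (gam P.μ) (p K) t)
      (fun I => (hp2 I).differentiable (by norm_num))
      (fun I => (hp2 I).differentiable (by norm_num)) 1 0
    unfold dG
    exact Differentiable.fun_sum fun i _ => differentiable_ite_mul _ _ (differentiable_pd (hp2 _) i)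

/-- The part `M₁((du, 0), w)` of the nonlinearity. -/
def Mb (M₁ : M1Type n q) (u w : FormT n q) : FormT n q := fun I t x =>
  M₁ (fun J => dT u J t x, 0) (fib w t x) I

lemma Mb_eq (M₁ : M1Type n q) (u w : FormT n q) (I : Idx n q) :
    Mb M₁ u w I = fun t x => ∑ J, ∑ K, M₁ (fun j => if J = j then 1 else 0, 0)
      (fun j => if K = j then 1 else 0) I * (dT u J t x * w K t x) := by
  funext t x
  have h1 : M₁ (fun J => dT u J t x, 0) =
      ∑ J, dT u J t x • M₁ (fun j => if J = j then 1 else 0, 0) :=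
    LinearMap.pi_apply_eq_sum_univ
      (M₁ ∘ₗ LinearMap.inl ℝ (Fib n (q + 1)) (Fib n (q - 1))) (fun J => dT u J t x)
  have h2 : ∀ (L : Fib n q →ₗ[ℝ] Fib n q), L (fib w t x) =
    ∑ K, w K t x • L (fun j => if K = j then 1 else 0) :=
    fun L => LinearMap.pi_apply_eq_sum_univ L _
  unfold Mb
  rw [h1]
  simp only [LinearMap.sum_apply, LinearMap.smul_apply, h2, Finset.sum_apply, Pi.smul_apply,
    smul_eq_mul, mul_sum]
  rw [sum_comm]
  apply sum_congr rfl
  intro J _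
  apply sum_congr rfl
  intro K _
  ring

namespace Par

/-- The class defining the auxiliary Banach space: weighted parabolic bounds for `u` and `du`. -/
def XG (P : Par n) (C : ℝ) (u : FormT n q) : Prop :=
  (∀ I, P.CG P.δ C (u I)) ∧ ∀ J, P.CG (P.δ + 1) C (dT u J)

/-- The improved class containing the values of the nonlinearity. -/
def XH (P : Par n) (C : ℝ) (u : FormT n q) : Prop :=
  (∀ I, P.CH (P.δ + P.η) C (u I)) ∧ ∀ J, P.CH (P.δ + 1 + P.η) C (dT u J)

/-- The bilinear map `(u, w) ↦ Φ d Ψ M₁(du, w)`, cut off outside `[0, T]`. -/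
def BX (P : Par n) (M₁ : M1Type n q) (u w : FormT n q) : FormT n q := fun I t x =>
  if t ∈ Icc 0 P.T then P.RG (extT (Mb M₁ u w)) I.1 t x else 0

end Par

lemma XG_nonneg [Nonempty (Idx n q)] (h : P.XG C u) : 0 ≤ C :=
  ((h.1 (Classical.arbitrary _)).sg.1 0 ⟨le_rfl, P.hT.le⟩).nonneg

lemma Mb_CG (P : Par n) (M₁ : M1Type n q) : ∃ A, 0 ≤ A ∧ ∀ C C' (u w : FormT n q), 0 ≤ C → 0 ≤ C' →
    P.XG C u → P.XG C' w → ∀ I, P.CG (2 * P.δ + 1) (A * (C * C')) (Mb M₁ u w I) := by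
  have hδ := P.δ_pos
  set a : Idx n q → Idx n (q + 1) → Idx n q → ℝ := fun I J K =>
    M₁ (fun j => if J = j then 1 else 0, 0) (fun j => if K = j then 1 else 0) I with ha
  refine ⟨∑ I, ∑ J, ∑ K, |a I J K| * 2 ^ (3 * P.s + P.p), by positivity,
    fun C C' u w hC hC' hu hw I => ?_⟩
  rw [Mb_eq]
  have key : P.CG (P.δ + 1 + P.δ) (∑ J, ∑ K, |a I J K| * (2 ^ (3 * P.s + P.p) * (C * C')))
      (fun t x => ∑ J, ∑ K, a I J K * (dT u J t x * w K t x)) :=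
    TGen.SG_sum _ fun J _ => TGen.SG_sum _ fun K _ => TGen.SG_smul
      (TGen.SG_mul (hu.2 J) (hw.1 K) hC hC') _
  rw [show P.δ + 1 + P.δ = 2 * P.δ + 1 by ring] at key
  refine TGen.SG_mono key ?_
  rw [sum_mul]
  refine le_trans (le_of_eq ?_) (single_le_sum (f := fun I => (∑ J, ∑ K, |a I J K| *
    2 ^ (3 * P.s + P.p)) * (C * C')) (fun I _ => by positivity) (mem_univ I))
  simp only [sum_mul, mul_assoc]

lemma dT_BX (P : Par n) (M₁ : M1Type n q) (u w : FormT n q) (J : Idx n (q + 1))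
    (ht : t ∈ Icc 0 P.T) :
    dT (P.BX M₁ u w) J t = dG (fun K => P.RG (extT (Mb M₁ u w)) K t) J.1 := by
  rw [dT_eq, ← ext_RG]
  congr 1; congr 1
  funext I x
  simp only [Par.BX, ht, if_true]

lemma coDT_BX (P : Par n) (M₁ : M1Type n q) (u w : FormT n q) (J : Idx n (q - 1))
    (ht : t ∈ Icc 0 P.T) :
    coDT (P.BX M₁ u w) J t = cG (fun K => P.RG (extT (Mb M₁ u w)) K t) J.1 := by
  rw [coDT_eq, ← ext_RG]
  congr 1; congr 1
  funext I x
  simp only [Par.BX, ht, if_true]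

lemma BX_XH (P : Par n) (M₁ : M1Type n q) : ∃ A, 0 ≤ A ∧ ∀ C C' (u w : FormT n q), 0 ≤ C → 0 ≤ C' →
    P.XG C u → P.XG C' w → P.XH (A * (C * C')) (P.BX M₁ u w) := by
  obtain ⟨A0, hA0, H0⟩ := Mb_CG P M₁
  obtain ⟨A1, hA1, H1⟩ := RG_CH P
  obtain ⟨A2, hA2, H2⟩ := dRG_CH P
  refine ⟨(A1 + A2) * A0, by positivity, fun C C' u w hC hC' hu hw => ?_⟩
  have h0 : ∀ I, P.CG (2 * P.δ + 1) (A0 * (C * C')) (extT (Mb M₁ u w) I) :=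
    extT_CG (by positivity) (H0 C C' u w hC hC' hu hw)
  have hX : 0 ≤ A0 * (C * C') := by positivity
  rw [mul_assoc]
  refine ⟨fun I => ?_, fun J => ?_⟩
  · refine TGen.congr P.hT.le (TGen.HB_mono (H1 _ _ hX h0 I.1) (by nlinarith))
      (fun N f g e h => HB.congr h e) fun t ht x => ?_
    simp only [Par.BX, ht, if_true]
  · refine TGen.congr P.hT.le (TGen.HB_mono (H2 _ _ hX h0 J.1) (by nlinarith))
      (fun N f g e h => HB.congr h e) fun t ht x => ?_
    rw [dT_BX P M₁ u w J ht]

lemma BX_coClosed (P : Par n) {M₁ : M1Type n q}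
    (hu : P.XG C u) (hw : P.XG C' w) (hC : 0 ≤ C) (hC' : 0 ≤ C') :
    CoClosed P.T (P.BX M₁ u w) := by
  obtain ⟨A0, hA0, H0⟩ := Mb_CG P M₁
  intro K t ht x
  rw [coDT_BX P M₁ u w K ht]
  exact cG_RG P (extT_CG (by positivity) (H0 C C' u w hC hC' hu hw)) ht _ x

end

section

variable {M₁ : M1Type n q}

lemma XG_mono (h : P.XG C u) (hC : C ≤ C') : P.XG C' u :=
  ⟨fun I => (h.1 I).SG_mono hC, fun J => (h.2 J).SG_mono hC⟩

lemma Par.XG.contDiff (h : P.XG C u) (I : Idx n q) (ht : t ∈ Icc 0 P.T) :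
    ContDiff ℝ 2 (u I t) :=
  (((h.1 I).sg.1 t ht).mono_N (le_trans (by norm_num) P.four_le)).1

lemma dT_lin (hu : P.XG C u) (hv : P.XG C' v) (a b : ℝ) (J : Idx n (q + 1))
    (ht : t ∈ Icc 0 P.T) (x : Spc n) :
    dT (a • u + b • v) J t x = a * dT u J t x + b * dT v J t x := by
  rw [dT_eq, dT_eq, dT_eq]
  rw [← dG_lin (fun I => (ext_contDiff (N := 2) (fun I => hu.contDiff I ht) I).differentiable
      (by norm_num)) (fun I => (ext_contDiff (N := 2) (fun I => hv.contDiff I ht) I).differentiable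
      (by norm_num))]
  congr 1
  funext I y
  unfold ext
  split_ifs <;> simp

lemma coDT_lin (hu : P.XG C u) (hv : P.XG C' v) (a b : ℝ) (J : Idx n (q - 1))
    (ht : t ∈ Icc 0 P.T) (x : Spc n) :
    coDT (a • u + b • v) J t x = a * coDT u J t x + b * coDT v J t x := by
  rw [coDT_eq, coDT_eq, coDT_eq]
  rw [← cG_lin (fun I => (ext_contDiff (N := 2) (fun I => hu.contDiff I ht) I).differentiable
      (by norm_num)) (fun I => (ext_contDiff (N := 2) (fun I => hv.contDiff I ht) I).differentiable
      (by norm_num))]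
  congr 1
  funext I y
  unfold ext
  split_ifs <;> simp

lemma CG_congr {f g : 𝓣} (h : P.CG W C f)
    (e : ∀ t ∈ Icc 0 P.T, ∀ x, g t x = f t x) : P.CG W C g :=
  TGen.congr P.hT.le h (fun _ _ _ e h => SG.congr h e) e

lemma XG_lin (hu : P.XG C u) (hv : P.XG C' v) (a b : ℝ) :
    P.XG (|a| * C + |b| * C') (a • u + b • v) := by
  refine ⟨fun I => ((hu.1 I).SG_smul a).SG_add ((hv.1 I).SG_smul b), fun J => ?_⟩
  exact CG_congr (((hu.2 J).SG_smul a).SG_add ((hv.2 J).SG_smul b)) fun t ht x =>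
    dT_lin hu hv a b J ht x

lemma CoClosed_lin (hu : P.XG C u) (hv : P.XG C' v) (cu : CoClosed P.T u) (cv : CoClosed P.T v)
    (a b : ℝ) : CoClosed P.T (a • u + b • v) := fun K t ht x => by
  rw [coDT_lin hu hv a b K ht, cu K t ht, cv K t ht]; ring

lemma dT_congr (e : EqOnT T u v) (J : Idx n (q + 1)) (ht : t ∈ Icc 0 T) :
    dT u J t = dT v J t := by
  unfold dT
  rw [show (fun I => u I t) = fun I => v I t from funext fun I => funext fun x => e I t ht x]

lemma coDT_congr (e : EqOnT T u v) (J : Idx n (q - 1)) (ht : t ∈ Icc 0 T) :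
    coDT u J t = coDT v J t := by
  unfold coDT
  rw [show (fun I => u I t) = fun I => v I t from funext fun I => funext fun x => e I t ht x]

lemma XG_congr (h : P.XG C u) (e : EqOnT P.T v u) : P.XG C v :=
  ⟨fun I => CG_congr (h.1 I) (e I), fun J => CG_congr (h.2 J) fun t ht x =>
    congrFun (dT_congr e J ht) x⟩

lemma CoClosed_congr (h : CoClosed T u) (e : EqOnT T v u) : CoClosed T v :=
  fun K t ht x => by rw [coDT_congr e K ht]; exact h K t ht x

lemma VP_congr {f g : 𝓣}
    (h : ∀ τ ∈ Icc 0 T, ∀ x, f τ x = g τ x) (x : Spc n) : VP T r ζ f t x = VP T r ζ g t x := by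
  unfold VP
  refine integral_congr_ae ?_
  filter_upwards [slabM_ae (n := n) (T := T) (P := fun τ => ∀ x, f τ x = g τ x)
    fun τ hτ => h τ ⟨hτ.1.le, hτ.2⟩] with p hp
  rw [hp]

lemma RG_congr {f g : Finset (Fin n) → 𝓣}
    (h : ∀ I, ∀ t ∈ Icc 0 P.T, ∀ x, f I t x = g I t x) (K : Finset (Fin n)) (t : ℝ) :
    P.RG f K t = P.RG g K t := by
  unfold Par.RG
  rw [show (fun I => VP P.T 0 (gam P.μ) (f I) t) = fun I => VP P.T 0 (gam P.μ) (g I) t from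
    funext fun I => funext fun x => VP_congr (h I) x]

lemma BX_of_Mb_lin {u₁ w₁ u₂ w₂ : FormT n q} {c : ℝ} (hc : 0 ≤ c)
    (h₁ : ∀ I, P.CG (2 * P.δ + 1) c (Mb M₁ u₁ w₁ I))
    (h₂ : ∀ I, P.CG (2 * P.δ + 1) c (Mb M₁ u₂ w₂ I))
    (e : ∀ I, ∀ t ∈ Icc 0 P.T, ∀ x,
      Mb M₁ u w I t x = a * Mb M₁ u₁ w₁ I t x + b * Mb M₁ u₂ w₂ I t x) :
    P.BX M₁ u w = a • P.BX M₁ u₁ w₁ + b • P.BX M₁ u₂ w₂ := by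
  funext I t x
  simp only [Par.BX, Pi.add_apply, Pi.smul_apply, smul_eq_mul]
  split_ifs with ht
  · rw [← RG_lin P (extT_CG hc h₁) (extT_CG hc h₂) a b ht]
    refine congrFun (RG_congr (fun J t ht x => ?_) _ _) x
    by_cases hJ : J.card = q
    · rw [show J = (⟨J, hJ⟩ : Idx n q).1 from rfl, extT_coe, extT_coe, extT_coe]
      exact e _ t ht x
    · simp only [extT_ne _ hJ]; ring
  · ring

lemma BX_lin_left (hC : 0 ≤ C) (hu : P.XG C u) (hv : P.XG C v) (hw : P.XG C w) (a b : ℝ) :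
    P.BX M₁ (a • u + b • v) w = a • P.BX M₁ u w + b • P.BX M₁ v w := by
  obtain ⟨A, hA, H⟩ := Mb_CG P M₁
  refine BX_of_Mb_lin (by positivity) (H C C u w hC hC hu hw) (H C C v w hC hC hv hw) ?_
  intro I t ht x
  have e : ((fun J => dT (a • u + b • v) J t x, 0) : Fib n (q + 1) × Fib n (q - 1)) =
      a • ((fun J => dT u J t x, 0) : Fib n (q + 1) × Fib n (q - 1)) +
        b • ((fun J => dT v J t x, 0) : Fib n (q + 1) × Fib n (q - 1)) := by
    ext J
    · simpa using dT_lin hu hv a b J ht x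
    · simp
  unfold Mb
  rw [e, map_add, map_smul, map_smul]
  simp

lemma BX_lin_right (hC : 0 ≤ C) (hu : P.XG C u) (hv : P.XG C v) (hw : P.XG C w) (a b : ℝ) :
    P.BX M₁ w (a • u + b • v) = a • P.BX M₁ w u + b • P.BX M₁ w v := by
  obtain ⟨A, hA, H⟩ := Mb_CG P M₁
  refine BX_of_Mb_lin (by positivity) (H C C w u hC hC hw hu) (H C C w v hC hC hw hv) ?_
  intro I t ht x
  unfold Mb
  rw [show fib (a • u + b • v) t x = a • fib u t x + b • fib v t x from rfl, map_add, map_smul,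
    map_smul]
  simp

lemma M2_SG (M₂ : M2Type n q) (hC : 0 ≤ C) (hu : P.XG C u) (hw : P.XG C w) :
    ∃ c, 0 ≤ c ∧ ∀ K, SG P.T 0 c 2 (fun t x => M₂ (fib u t x) (fib w t x) K) := by
  have hδ := P.δ_pos
  have e : ∀ K, (fun t x => M₂ (fib u t x) (fib w t x) K) = fun t x => ∑ I, ∑ J,
      M₂ (fun j => if I = j then 1 else 0) (fun j => if J = j then 1 else 0) K *
        (u I t x * w J t x) := fun K => by
    funext t x
    rw [LinearMap.pi_apply_eq_sum_univ M₂ (fib u t x)]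
    simp only [LinearMap.sum_apply, LinearMap.smul_apply,
      LinearMap.pi_apply_eq_sum_univ _ (fib w t x), Finset.sum_apply, Pi.smul_apply, smul_eq_mul,
      mul_sum]
    rw [sum_comm]
    apply sum_congr rfl
    intro I _
    apply sum_congr rfl
    intro J _
    simp only [fib]
    ring
  set a : Idx n (q - 1) → Idx n q → Idx n q → ℝ := fun K I J =>
    M₂ (fun j => if I = j then 1 else 0) (fun j => if J = j then 1 else 0) K with ha
  refine ⟨∑ K, ∑ I, ∑ J, |a K I J| * (2 ^ 2 * (C * C)), by positivity, fun K => ?_⟩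
  rw [e]
  have h2 : ∀ u : FormT n q, P.XG C u → ∀ I, SG P.T 0 C 2 (u I) := fun u hu I =>
    ((hu.1 I).sg.mono_W (by linarith)).mono_N (le_trans (by norm_num) P.four_le)
  have key : SG P.T (0 + 0) (∑ I, ∑ J, |a K I J| * (2 ^ 2 * (C * C))) 2
      (fun t x => ∑ I, ∑ J, a K I J * (u I t x * w J t x)) :=
    SG.sum _ fun I _ => SG.sum _ fun J _ => ((h2 u hu I).mul (h2 w hw J)).smul _
  rw [add_zero] at key
  exact key.mono (single_le_sum (f := fun K => ∑ I, ∑ J, |a K I J| * (2 ^ 2 * (C * C)))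
    (fun I _ => by positivity) (mem_univ K))

lemma ddFib_eq (h : CoClosed T u) (ht : t ∈ Icc 0 T) (x : Spc n) :
    ddFib u t x = (fun J => dT u J t x, 0) := by
  unfold ddFib
  congr 1
  funext K
  exact h K t ht x

lemma PhiNpot_eq (M₂ : M2Type n q) (hq : 1 ≤ q) (hC : 0 ≤ C) (hu : P.XG C u)
    (cu : CoClosed P.T u) : EqOnT P.T (PhiNpot P.μ M₁ M₂ u) (P.BX M₁ u u) := by
  intro I t ht x
  obtain ⟨A, hA, H⟩ := Mb_CG P M₁
  obtain ⟨c, hc, Hc⟩ := M2_SG M₂ hC hu hu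
  have h0 : 0 ≤ A * (C * C) := by positivity
  simp only [Par.BX, ht, if_true]
  refine PhiOp_volPotF P hq (C := A * (C * C) + c) (by positivity)
    (fun I => (H C C u u hC hC hu hu I).SG_mono (by linarith))
    (fun K => (Hc K).mono (by linarith)) (fun I t ht x => ?_) I ht x
  unfold Nop Mb
  rw [ddFib_eq cu ht]

lemma PhiBop_eq (M₂ : M2Type n q) (hq : 1 ≤ q) (hC : 0 ≤ C) (hu : P.XG C u) (hv : P.XG C v)
    (cu : CoClosed P.T u) (cv : CoClosed P.T v) :
    EqOnT P.T (PhiLmap P.μ M₁ M₂ v u) (u + P.BX M₁ v u + P.BX M₁ u v) := by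
  intro I t ht x
  obtain ⟨A, hA, H⟩ := Mb_CG P M₁
  obtain ⟨c, hc, Hc⟩ := M2_SG M₂ hC hu hv
  obtain ⟨c', hc', Hc'⟩ := M2_SG M₂ hC hv hu
  have h0 : 0 ≤ A * (C * C) := by positivity
  have h1 := H C C u v hC hC hu hv
  have h2 := H C C v u hC hC hv hu
  have key : PhiOp (dT (volPotF P.μ (Bop M₁ M₂ v u))) I t x =
      P.RG (extT (Mb M₁ u v + Mb M₁ v u)) I.1 t x := by
    refine PhiOp_volPotF P hq (C := A * (C * C) + A * (C * C) + (c + c')) (by positivity)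
      (m := Mb M₁ u v + Mb M₁ v u)
      (fun I => TGen.SG_mono ((h1 I).SG_add (h2 I)) (by linarith))
      (p := fun K t' x' => M₂ (fib u t' x') (fib v t' x') K + M₂ (fib v t' x') (fib u t' x') K)
      (fun K => ((Hc K).add (Hc' K)).mono (by linarith)) (fun I t ht x => ?_) I ht x
    unfold Bop Wop
    rw [ddFib_eq cu ht, ddFib_eq cv ht]
    rfl
  have lin := RG_lin P (extT_CG h0 h2) (extT_CG h0 h1) 1 1 ht I.1 x
  have ee : (fun J t y => 1 * extT (Mb M₁ v u) J t y + 1 * extT (Mb M₁ u v) J t y) =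
      extT (Mb M₁ u v + Mb M₁ v u) := by
    funext J t y
    unfold extT ext
    split_ifs
    · simp [add_comm]
    · simp
  rw [ee] at lin
  simp only [PhiLmap, Pi.add_apply, key, lin, Par.BX, ht, if_true]
  ring

end

section tDeriv

variable {f h : ℝ → Spc n → ℝ} {B : ℕ → (ℝ → Spc n → ℝ) → Prop}

/-- Spatial regularity, jointly continuous on the time slab. -/
def RB (T : ℝ) (N : ℕ) (f : 𝓣) : Prop :=
  (∀ t ∈ Icc 0 T, ContDiff ℝ N (f t)) ∧ SCt T N f

lemma SG.rb (h : SG T W C N f) : RB T N f := ⟨h.contDiff, h.2⟩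

lemma RB.congr (h : RB T N f) {g : 𝓣}
    (e : ∀ t ∈ Icc 0 T, ∀ x, g t x = f t x) : RB T N g :=
  ⟨fun t ht => by rw [funext (e t ht)]; exact h.1 t ht, h.2.congr e⟩

lemma tDeriv_congr (e : ∀ t ∈ Icc 0 T, ∀ x, h t x = f t x) (j : ℕ)
    (ht : t ∈ Icc 0 T) (x : Spc n) : tDeriv T j h t x = tDeriv T j f t x :=
  iteratedDerivWithin_congr (fun τ hτ => e τ hτ x) ht

lemma tDeriv_of_chain (hT : 0 < T) {g : ℕ → 𝓣} (h0 : g 0 = f)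
    (hd : ∀ j < s, TD T (g j) (g (j + 1))) (hg : ∀ j ≤ s, SCt T 0 (g j)) {j : ℕ} (hj : j ≤ s) :
    ∀ t ∈ Icc 0 T, ∀ x, tDeriv T j f t x = g j t x := by
  induction j with
  | zero => intro t _ x; simp [tDeriv, h0]
  | succ j ih =>
    intro t ht x
    rw [tDeriv, iteratedDerivWithin_succ]
    change derivWithin (fun τ => tDeriv T j f τ x) _ t = _
    rw [derivWithin_congr (f := fun τ => g j τ x) (fun τ hτ => ih (by omega) τ hτ x)
        (ih (by omega) t ht x)]
    exact ((hd j hj).hasDeriv ((hg _ hj).time_cont x) ht).derivWithin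
      (uniqueDiffOn_Icc hT t ht)

lemma TGen.tDeriv (hT : 0 < T) (hB : ∀ N f, B N f → RB T N f)
    (hc : ∀ N f g, (∀ t ∈ Icc 0 T, ∀ x, g t x = f t x) → B N f → B N g)
    (h : TGen T B s p f) : (∀ j < s, TD T (tDeriv T j f) (tDeriv T (j + 1) f)) ∧
      ∀ j ≤ s, B (2 * (s - j) + p) (NSdeRham.tDeriv T j f) := by
  obtain ⟨g, h0, hd, hg⟩ := TGen_iff_chain.1 h
  have e : ∀ j ≤ s, ∀ t ∈ Icc 0 T, ∀ x, NSdeRham.tDeriv T j f t x = g j t x := fun j hj =>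
    tDeriv_of_chain hT h0 hd (fun i hi => fun m hm => (hB _ _ (hg i hi)).2 m (by omega)) hj
  exact ⟨fun j hj => (hd j hj).congr hT.le (e j hj.le) (e _ hj), fun j hj => hc _ _ _ (e j hj) (hg j hj)⟩

lemma TGen.of_tDeriv (hd : ∀ j < s, TD T (NSdeRham.tDeriv T j f) (NSdeRham.tDeriv T (j + 1) f))
    (hB : ∀ j ≤ s, B (2 * (s - j) + p) (NSdeRham.tDeriv T j f)) : TGen T B s p f :=
  TGen_iff_chain.2 ⟨fun j => NSdeRham.tDeriv T j f, by funext t x; simp [NSdeRham.tDeriv], hd, hB⟩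

lemma TGen.SG_tDeriv (hT : 0 < T) (h : TGen T (SG T W C) s p f) :
    (∀ j < s, TD T (NSdeRham.tDeriv T j f) (NSdeRham.tDeriv T (j + 1) f)) ∧
      ∀ j ≤ s, SG T W C (2 * (s - j) + p) (NSdeRham.tDeriv T j f) :=
  h.tDeriv hT (fun _ _ h => h.rb) fun _ _ _ e h => h.congr e

lemma anisoReg_iff (hT : 0 < T) : AnisoReg T p s f ↔ TGen T (RB T) s p f := by
  constructor
  · rintro ⟨h1, h2, h3⟩
    have hc : ∀ j ≤ s, SCt T (2 * (s - j) + p) (NSdeRham.tDeriv T j f) := by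
      intro j hj m hm
      rw [continuousOn_iff_continuous_domRestrict]
      exact (h3 j m hj (by omega)).comp (Continuous.prodMk
        (Continuous.subtype_mk (continuous_fst.comp continuous_subtype_val) fun z => z.2.1)
        (continuous_snd.comp continuous_subtype_val))
    refine TGen.of_tDeriv (fun j hj => ?_) fun j hj =>
      ⟨fun t ht => by exact_mod_cast h2 j hj t ht, hc j hj⟩
    have hh : ∀ i ≤ s, ∀ x, ContinuousOn (fun t => NSdeRham.tDeriv T i f t x) (Icc 0 T) :=
      fun i hi x => SCt.time_cont (hc i hi) x
    refine TD.of_hasDeriv (hh _ hj) (hh _ hj.le) fun x t ht => ?_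
    have hd := (h1 x).differentiableOn_iteratedDerivWithin (m := j) (by exact_mod_cast hj)
      (uniqueDiffOn_Icc hT) t (Set.Ioo_subset_Icc_self ht)
    have := hd.hasDerivWithinAt.hasDerivAt (Icc_mem_nhds ht.1 ht.2)
    simpa only [NSdeRham.tDeriv, iteratedDerivWithin_succ] using this
  · intro h
    obtain ⟨hd, hg⟩ := h.tDeriv hT (fun _ _ h => h) fun _ _ _ e h => h.congr e
    have hc : ∀ j ≤ s, ∀ x, ContinuousOn (fun t => NSdeRham.tDeriv T j f t x) (Icc 0 T) :=
      fun j hj x => (hg j hj).2.time_cont x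
    refine ⟨fun x => contDiffOn_of_continuousOn_differentiableOn_deriv (n := s)
      (fun m hm => hc m (by exact_mod_cast hm) x) (fun m hm t ht => ?_),
      fun j hj t ht => by exact_mod_cast (hg j hj).1 t ht, fun j m hj hm => ?_⟩
    · have hm' : m < s := by exact_mod_cast hm
      exact ((hd m hm').hasDeriv (hc _ hm' x) ht).differentiableWithinAt
    · exact ((hg j hj).2 m (by omega)).comp_continuous
        (f := fun z : Icc (0 : ℝ) T × Spc n => ((z.1 : ℝ), z.2)) (by fun_prop)
        fun z => ⟨z.1.2, trivial⟩

/-- Joint linear structure of the regularity class. -/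
lemma TGen.rb_lin (hT : 0 < T) (hf : TGen T (RB T) s p f) (hh : TGen T (RB T) s p h) (a b : ℝ) :
    TGen T (RB T) s p (fun t x => a * f t x + b * h t x) ∧ ∀ j ≤ s, ∀ t ∈ Icc 0 T, ∀ x,
      NSdeRham.tDeriv T j (fun t x => a * f t x + b * h t x) t x =
        a * NSdeRham.tDeriv T j f t x + b * NSdeRham.tDeriv T j h t x := by
  obtain ⟨hd, hg⟩ := hf.tDeriv hT (fun _ _ h => h) fun _ _ _ e h => h.congr e
  obtain ⟨hd', hg'⟩ := hh.tDeriv hT (fun _ _ h => h) fun _ _ _ e h => h.congr e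
  have hR : ∀ j ≤ s, RB T (2 * (s - j) + p) fun t x =>
      a * NSdeRham.tDeriv T j f t x + b * NSdeRham.tDeriv T j h t x := fun j hj =>
    ⟨fun t ht => (contDiff_const.mul ((hg j hj).1 t ht)).add
      (contDiff_const.mul ((hg' j hj).1 t ht)),
      SCt.add (fun t ht => contDiff_const.mul ((hg j hj).1 t ht))
        (fun t ht => contDiff_const.mul ((hg' j hj).1 t ht))
        ((hg j hj).2.smul (hg j hj).1 a) ((hg' j hj).2.smul (hg' j hj).1 b)⟩
  have hD : ∀ j < s, TD T (fun t x => a * NSdeRham.tDeriv T j f t x + b * NSdeRham.tDeriv T j h t x)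
      (fun t x => a * NSdeRham.tDeriv T (j + 1) f t x + b * NSdeRham.tDeriv T (j + 1) h t x) :=
    fun j hj => ((hd j hj).smul a).add ((hd' j hj).smul b)
      (fun x => ((hg _ hj).2.time_cont x).const_mul a)
      fun x => ((hg' _ hj).2.time_cont x).const_mul b
  have h0 : (fun t x => a * NSdeRham.tDeriv T 0 f t x + b * NSdeRham.tDeriv T 0 h t x) =
      fun t x => a * f t x + b * h t x := by funext t x; simp [NSdeRham.tDeriv]
  exact ⟨TGen_iff_chain.2 ⟨_, h0, hD, hR⟩, fun j hj => tDeriv_of_chain hT h0 hD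
    (fun i hi m hm => (hR i hi).2 m (by omega)) hj⟩

end tDeriv

section interpolation

variable {S H β l : ℝ}

lemma le_rpow_mul_rpow {d x y : ℝ} (hd : 0 ≤ d) (hx : d ≤ x) (hy : d ≤ y) (h0 : 0 ≤ β)
    (h1 : β ≤ 1) : d ≤ x ^ (1 - β) * y ^ β := by
  rcases hd.eq_or_lt with rfl | hd'
  · positivity
  calc d = d ^ (1 - β) * d ^ β := by rw [← rpow_add hd', sub_add_cancel, rpow_one]
    _ ≤ _ := mul_le_mul (rpow_le_rpow hd hx (by linarith)) (rpow_le_rpow hd hy h0)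
      (by positivity) (rpow_nonneg (hd.trans hx) _)

lemma eAniso0_le {F : Type*} [NormedAddCommGroup F] {Z : ℝ} {v : ℝ → Spc n → F} (hl : 0 < l)
    (hV : 0 ≤ V) (hZ : 0 ≤ Z) (ha : ∀ t ∈ Icc 0 T, ∀ x, wt x ^ V * ‖v t x‖ ≤ Z)
    (hb : ∀ t ∈ Icc 0 T, ∀ x y, ‖x - y‖ ≤ max 1 (‖x‖ / 2) →
      wt x ^ (V + l) * ‖v t x - v t y‖ ≤ Z * ‖x - y‖ ^ l)
    (hc : ∀ t ∈ Icc 0 T, ∀ t' ∈ Icc 0 T, ∀ x,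
      wt x ^ V * ‖v t x - v t' x‖ ≤ Z * |t - t'| ^ (l / 2)) :
    eAniso0 T l V v ≤ ofReal ((5 + 2 ^ (V + l)) * Z) := by
  have ha' : ∀ t ∈ Icc 0 T, ∀ x, ‖v t x‖ ≤ Z := fun t ht x =>
    (le_mul_of_one_le_left (norm_nonneg _) (one_le_wt_rpow x hV)).trans (ha t ht x)
  have h2 : (0 : ℝ) < 2 ^ (V + l) := by positivity
  rw [show (5 + 2 ^ (V + l)) * Z = (Z + 2 * Z + Z + 2 ^ (V + l) * Z) + Z by ring,
    ofReal_add (by positivity) hZ]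
  refine add_le_add (iSup_le fun t => ?_) ?_
  · rw [eHol0, if_neg hl.ne', ofReal_add (by positivity) (by positivity),
      ofReal_add (by positivity) hZ, ofReal_add hZ (by positivity)]
    refine add_le_add (add_le_add (add_le_add (iSup₂_le fun x _ =>
      ofReal_le_ofReal (ha' _ t.2 x)) (iSup_le fun x => iSup₂_le fun y h =>
        ofReal_le_ofReal ?_)) (iSup_le fun x => ofReal_le_ofReal (ha _ t.2 x)))
        (iSup_le fun x => iSup₂_le fun y h => ofReal_le_ofReal ?_)
    · have hr : 0 < ‖x - y‖ := norm_pos_iff.2 (sub_ne_zero.2 h.2.2)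
      have hrl := rpow_pos_of_pos hr l
      rw [div_le_iff₀ hrl]
      rcases le_total ‖x - y‖ 1 with h1 | h1
      · have := (le_mul_of_one_le_left (norm_nonneg _) (one_le_wt_rpow x (by linarith))).trans
          (hb _ t.2 x y (h1.trans (le_max_left _ _)))
        nlinarith [mul_nonneg hZ hrl.le]
      · have := one_le_rpow h1 hl.le
        have := norm_sub_le (v t x) (v t y)
        nlinarith [ha' _ t.2 x, ha' _ t.2 y]
    · have hr : 0 < ‖x - y‖ := norm_pos_iff.2 (sub_ne_zero.2 h.1)
      rw [div_le_iff₀ (rpow_pos_of_pos hr l), mul_assoc]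
      have hw : wt2 x y ≤ 2 * wt x := by
        have hx := wt_pos x
        refine max_le (by linarith) (le_of_sq_le_sq ?_ (by linarith))
        have : ‖y‖ ≤ ‖x‖ + ‖x - y‖ := by
          rw [norm_sub_rev]; simpa using norm_add_le x (y - x)
        rw [mul_pow, wt_sq, wt_sq]
        nlinarith [norm_nonneg y, norm_nonneg x, h.2]
      refine (mul_le_mul_of_nonneg_right (rpow_le_rpow ((wt_pos x).le.trans (le_max_left _ _))
        hw (by linarith)) (norm_nonneg _)).trans ?_
      rw [mul_rpow (by norm_num) (wt_pos x).le, mul_assoc]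
      exact mul_le_mul_of_nonneg_left (hb _ t.2 x y (h.2.trans (le_max_right _ _))) h2.le
  · rw [if_neg hl.ne']
    refine iSup_le fun t => iSup₂_le fun t' h => iSup_le fun x => ofReal_le_ofReal ?_
    rw [div_le_iff₀ (rpow_pos_of_pos (abs_pos.2 (sub_ne_zero.2 h)) _)]
    exact hc _ t.2 _ t'.2 x

/-- Interpolation between sup bounds and Hölder bounds. -/
lemma eAniso0_interp (hθ : 0 < θ) (hW : 0 ≤ W) (hl : 0 < l) (hlθ : l ≤ θ * β) (hβ : β ≤ 1)
    (hθ1 : θ ≤ 1)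
    (hSH : S ≤ H) {f : 𝓣} (hT : 0 ≤ T) (hS : SG T W S N f) (hH : HB T θ W H N f)
    {a : ℕ} (ha : a ≤ N) : eAniso0 T l (W + a) (fun t => ∇ a (f t)) ≤
      ofReal ((5 + 2 ^ (W + N + 1)) * ((1 + 4 ^ (W + N)) * (S ^ (1 - β) * H ^ β))) := by
  have hS0 : 0 ≤ S := (hS.1 0 ⟨le_rfl, hT⟩).nonneg
  have hH0 := hS0.trans hSH
  have haN : (a : ℝ) ≤ N := by exact_mod_cast ha
  have hVa : 0 ≤ W + a := by positivity
  have hlb : l / θ ≤ β := by rw [div_le_iff₀ hθ]; linarith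
  have hl0 : 0 < l / θ := by positivity
  have e1 : θ * (l / θ) = l := by field_simp
  have hβ0 : 0 ≤ β := hl0.le.trans hlb
  have h41 : (1 : ℝ) ≤ 4 ^ (W + N) := one_le_rpow (by norm_num) (by positivity)
  set Z := (1 + 4 ^ (W + N)) * (S ^ (1 - β) * H ^ β) with hZd
  have key : S ^ (1 - l / θ) * H ^ (l / θ) ≤ S ^ (1 - β) * H ^ β := by
    rcases hS0.eq_or_lt with h0 | h0
    · rcases eq_or_ne (l / θ) 1 with h | h
      · have : β = 1 := le_antisymm hβ (h ▸ hlb)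
        rw [h, this]
      · rw [← h0, zero_rpow (by intro h'; exact h (by linarith)), zero_mul]
        positivity
    · have hH' := h0.trans_le hSH
      rw [show 1 - l / θ = (1 - β) + (β - l / θ) by ring, rpow_add h0, mul_assoc]
      refine mul_le_mul_of_nonneg_left ?_ (by positivity)
      calc _ ≤ H ^ (β - l / θ) * H ^ (l / θ) := mul_le_mul_of_nonneg_right
            (rpow_le_rpow hS0 hSH (by linarith)) (by positivity)
        _ = H ^ β := by rw [← rpow_add hH']; ring_nf
  have aux : ∀ {d r : ℝ}, 0 ≤ d → 0 ≤ r → d ≤ (1 + 4 ^ (W + N)) * S → d ≤ H * r →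
      d ≤ Z * r ^ (l / θ) := by
    intro d r hd hr h1 h2
    refine (le_rpow_mul_rpow hd h1 h2 hl0.le (hlb.trans hβ)).trans ?_
    rw [mul_rpow (by positivity) hS0, mul_rpow hH0 hr]
    have : ((1 : ℝ) + 4 ^ (W + N)) ^ (1 - l / θ) ≤ 1 + 4 ^ (W + N) :=
      rpow_le_self_of_one_le (by linarith) (by linarith)
    calc _ = (1 + 4 ^ (W + N)) ^ (1 - l / θ) * (S ^ (1 - l / θ) * H ^ (l / θ)) * r ^ (l / θ) := by
          ring
      _ ≤ _ := mul_le_mul_of_nonneg_right (mul_le_mul this key (by positivity) (by linarith))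
          (by positivity)
  have hsup : ∀ t ∈ Icc 0 T, ∀ x, wt x ^ (W + a) * ‖∇ a (f t) x‖ ≤ S :=
    fun t ht x => (hS.1 t ht).2 a ha x
  have hZ0 : 0 ≤ Z := by positivity
  refine (eAniso0_le (Z := Z) hl hVa hZ0 ?_ ?_ ?_).trans (ofReal_le_ofReal
    (mul_le_mul_of_nonneg_right (by
      have : (2 : ℝ) ^ (W + a + l) ≤ 2 ^ (W + N + 1) :=
        rpow_le_rpow_of_exponent_le (by norm_num) (by nlinarith)
      linarith) hZ0))
  · intro t ht x
    have hd : 0 ≤ wt x ^ (W + a) * ‖∇ a (f t) x‖ := by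
      have := wt_rpow_pos x (W + a); positivity
    have := aux (r := 1) hd zero_le_one ((hsup t ht x).trans (by nlinarith))
      (by linarith [hsup t ht x])
    simpa using this
  · intro t ht x y hxy
    have hx := wt_pos x
    have h4 : wt x ^ (W + a) ≤ 4 ^ (W + N) * wt y ^ (W + a) := by
      refine (rpow_le_rpow hx.le (wt_le_of_near hxy) hVa).trans ?_
      rw [mul_rpow (by norm_num) (wt_pos y).le]
      exact mul_le_mul_of_nonneg_right (rpow_le_rpow_of_exponent_le (by norm_num)
        (by linarith)) (wt_rpow_pos y _).le
    have := aux (d := wt x ^ (W + a) * ‖∇ a (f t) x - ∇ a (f t) y‖)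
      (r := (‖x - y‖ / wt x) ^ θ) (by have := wt_rpow_pos x (W + a); positivity) (by positivity)
      (by
        refine (mul_le_mul_of_nonneg_left (norm_sub_le _ _) (wt_rpow_pos x _).le).trans ?_
        rw [mul_add, add_mul, one_mul]
        refine add_le_add (hsup t ht x) ?_
        refine (mul_le_mul_of_nonneg_right h4 (norm_nonneg _)).trans ?_
        rw [mul_assoc]
        exact mul_le_mul_of_nonneg_left (hsup t ht y) (by positivity))
      (by
        have := hH.2.2 t ht a ha x y hxy
        rw [rpow_add hx] at this
        rw [div_rpow (norm_nonneg _) hx.le, ← mul_div_assoc,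
          le_div_iff₀ (rpow_pos_of_pos hx _)]
        linarith)
    rw [← rpow_mul (by positivity), e1, div_rpow (norm_nonneg _) hx.le, ← mul_div_assoc,
      le_div_iff₀ (rpow_pos_of_pos hx _)] at this
    rw [rpow_add hx]
    linarith
  · intro t ht t' ht' x
    have := aux (d := wt x ^ (W + a) * ‖∇ a (f t) x - ∇ a (f t') x‖)
      (r := |t - t'| ^ (θ / 2)) (by have := wt_rpow_pos x (W + a); positivity) (by positivity)
      (by
        refine (mul_le_mul_of_nonneg_left (norm_sub_le _ _) (wt_rpow_pos x _).le).trans ?_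
        rw [mul_add]
        nlinarith [hsup t ht x, hsup t' ht' x])
      (by
        have := (hH.2.1 t ht t' ht').2 a ha x
        rwa [show (fun x => f t x - f t' x) = f t - f t' from rfl, iteratedFDeriv_sub_apply
          ((hS.1 t ht).contDiffAt ha x) ((hS.1 t' ht').contDiffAt ha x)] at this)
    rwa [← rpow_mul (abs_nonneg _), show θ / 2 * (l / θ) = l / 2 by field_simp] at this

end interpolation

section spaces

variable {lam lam' δ : ℝ} {k : ℕ}

lemma iSup_ofReal_add {ι : Sort*} {F : Type*} [NormedAddCommGroup F] {c d : ι → ℝ} {f g : ι → F}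
    (hc : ∀ i, 0 ≤ c i) (hd : ∀ i, 0 ≤ d i) :
    ⨆ i, ofReal (c i * ‖f i + g i‖ / d i) ≤
      (⨆ i, ofReal (c i * ‖f i‖ / d i)) + ⨆ i, ofReal (c i * ‖g i‖ / d i) := by
  refine iSup_le fun i => le_trans ?_ (add_le_add (le_iSup _ i) (le_iSup _ i))
  have := hc i
  have := hd i
  rw [← ofReal_add (by positivity) (by positivity), ← add_div, ← mul_add]
  exact ofReal_le_ofReal (div_le_div_of_nonneg_right
    (mul_le_mul_of_nonneg_left (norm_add_le _ _) (hc i)) (hd i))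

lemma eAniso0_add {F : Type*} [NormedAddCommGroup F] (hl : lam ≠ 0)
    {u v w : ℝ → Spc n → F} (e : ∀ t ∈ Icc 0 T, ∀ x, w t x = u t x + v t x) :
    eAniso0 T lam V w ≤ eAniso0 T lam V u + eAniso0 T lam V v := by
  have hw := fun x : Spc n => (wt_rpow_pos x V).le
  simp only [eAniso0, if_neg hl]
  rw [add_add_add_comm]
  refine add_le_add (iSup_le fun t => le_trans ?_
    (add_le_add (le_iSup _ t) (le_iSup _ t))) ?_
  · simp only [eHol0, if_neg hl, eOHold, eWSup, eWHold]
    rw [show ∀ a b c d a' b' c' d' : ℝ≥0∞, a + b + c + d + (a' + b' + c' + d') =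
      a + a' + (b + b') + (c + c') + (d + d') by intros; ring]
    refine add_le_add (add_le_add (add_le_add ?_ ?_) ?_) ?_
    · refine iSup₂_le fun x h => le_trans ?_ (add_le_add (le_iSup₂ x h) (le_iSup₂ x h))
      rw [e t t.2, ← ofReal_add (norm_nonneg _) (norm_nonneg _)]
      exact ofReal_le_ofReal (norm_add_le _ _)
    · refine iSup_le fun x => iSup₂_le fun y h => le_trans ?_
        (add_le_add (le_iSup_of_le x (le_iSup₂ y h)) (le_iSup_of_le x (le_iSup₂ y h)))
      rw [e t t.2, e t t.2, add_sub_add_comm]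
      simpa using iSup_ofReal_add (ι := Unit) (c := fun _ => 1) (f := fun _ => u t x - u t y)
        (g := fun _ => v t x - v t y) (d := fun _ => ‖x - y‖ ^ lam) (by simp)
        fun _ => rpow_nonneg (norm_nonneg _) _
    · refine iSup_le fun x => le_trans ?_ (add_le_add (le_iSup _ x) (le_iSup _ x))
      rw [e t t.2]
      simpa using iSup_ofReal_add (ι := Unit) (c := fun _ => wt x ^ V) (f := fun _ => u t x)
        (g := fun _ => v t x) (d := fun _ => 1) (fun _ => hw x) (by simp)
    · refine iSup_le fun x => iSup₂_le fun y h => le_trans ?_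
        (add_le_add (le_iSup_of_le x (le_iSup₂ y h)) (le_iSup_of_le x (le_iSup₂ y h)))
      rw [e t t.2, e t t.2, add_sub_add_comm]
      simpa using iSup_ofReal_add (ι := Unit) (c := fun _ => wt2 x y ^ (V + lam))
        (f := fun _ => u t x - u t y) (g := fun _ => v t x - v t y) (d := fun _ => ‖x - y‖ ^ lam)
        (fun _ => rpow_nonneg ((wt_pos x).le.trans (le_max_left _ _)) _)
        fun _ => rpow_nonneg (norm_nonneg _) _
  · refine iSup_le fun t => iSup₂_le fun t' h => iSup_le fun x => le_trans ?_
      (add_le_add (le_iSup_of_le t (le_iSup_of_le t' (le_iSup₂ h x)))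
        (le_iSup_of_le t (le_iSup_of_le t' (le_iSup₂ h x))))
    rw [e t t.2, e t' t'.2, add_sub_add_comm]
    simpa using iSup_ofReal_add (ι := Unit) (c := fun _ => wt x ^ V)
        (f := fun _ => u t x - u t' x) (g := fun _ => v t x - v t' x)
        (d := fun _ => |(t : ℝ) - t'| ^ (lam / 2)) (fun _ => hw x)
        fun _ => rpow_nonneg (abs_nonneg _) _

lemma le_eAnisoKS {u : 𝓣} {j a : ℕ} (hj : j ≤ s) (ha : a ≤ 2 * (s - j) + p)
     (ht : t ∈ Icc 0 T) (x : Spc n) :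
    ofReal (wt x ^ (δ + a) * ‖mixDeriv T a j u t x‖) ≤ eAnisoKS T p s lam δ u := by
  obtain ⟨b, m, rfl, hb, hm⟩ : ∃ b m, a = b + m ∧ b ≤ p ∧ m + 2 * j ≤ 2 * s :=
    ⟨min a p, a - min a p, by omega, by omega, by omega⟩
  have h1 : ofReal (wt x ^ (δ + (b + m : ℕ)) * ‖mixDeriv T (b + m) j u t x‖) ≤
      eAniso0 T lam (δ + b + m) (mixDeriv T (b + m) j u) := by
    have : δ + (b + m : ℕ) = δ + b + m := by push_cast; ring
    rw [this]
    refine le_trans ?_ (le_self_add.trans' (le_iSup _ ⟨t, ht⟩))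
    have := le_iSup (fun x => ofReal (wt x ^ (δ + b + m) * ‖mixDeriv T (b + m) j u t x‖)) x
    unfold eHol0
    split_ifs
    · exact this
    · exact this.trans (le_add_left le_rfl |>.trans le_self_add)
  refine h1.trans ?_
  have hs : ∀ {m i : ℕ} (F : ℕ → ℝ≥0∞), i < m → F i ≤ ∑ i ∈ range m, F i :=
    fun F h => single_le_sum (fun _ _ => zero_le) (mem_range.2 h)
  rw [← if_pos (c := m + 2 * j ≤ 2 * s) (t := eAniso0 _ _ _ _) (e := 0) hm]
  exact (hs (fun j : ℕ => if m + 2 * j ≤ 2 * s then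
    eAniso0 T lam (δ + b + m) (mixDeriv T (b + m) j u) else 0) (by omega : j < s + 1)).trans
    ((hs (fun m : ℕ => ∑ j ∈ range (s + 1), if m + 2 * j ≤ 2 * s then
    eAniso0 T lam (δ + b + m) (mixDeriv T (b + m) j u) else 0) (by omega : m < 2 * s + 1)).trans
    (hs (fun b : ℕ => ∑ m ∈ range (2 * s + 1), ∑ j ∈ range (s + 1),
    if m + 2 * j ≤ 2 * s then eAniso0 T lam (δ + b + m) (mixDeriv T (b + m) j u) else 0)
    (by omega : b < p + 1)))

lemma TGen.of_eAnisoKS (hT : 0 < T) {u : 𝓣} (hC : 0 ≤ C)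
    (h : AnisoReg T p s u) (hu : eAnisoKS T p s lam δ u ≤ ofReal C) :
    TGen T (SG T δ C) s p u := by
  obtain ⟨hd, hg⟩ := ((anisoReg_iff hT).1 h).tDeriv hT (fun _ _ h => h) fun _ _ _ e h => h.congr e
  exact TGen.of_tDeriv hd fun j hj => ⟨fun t ht => ⟨(hg j hj).1 t ht, fun a ha x =>
    (ENNReal.ofReal_le_ofReal_iff hC).1 ((le_eAnisoKS hj ha ht x).trans hu)⟩, (hg j hj).2⟩

lemma eAnisoKS_le {u : 𝓣} {Y : ℝ≥0∞} (h : ∀ j ≤ s, ∀ a ≤ 2 * (s - j) + p,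
    eAniso0 T lam (δ + a) (mixDeriv T a j u) ≤ Y) :
    eAnisoKS T p s lam δ u ≤ ((p + 1) * ((2 * s + 1) * (s + 1)) : ℕ) * Y := by
  have hs : ∀ {m : ℕ} {F : ℕ → ℝ≥0∞} {Y : ℝ≥0∞}, (∀ i ∈ range m, F i ≤ Y) →
      ∑ i ∈ range m, F i ≤ m * Y := fun {m F Y} h => by
    simpa using Finset.sum_le_card_nsmul _ _ _ h
  rw [Nat.cast_mul, Nat.cast_mul, mul_assoc, mul_assoc]
  refine hs fun b hb => hs fun m hm => hs fun j hj => ?_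
  simp only [mem_range] at hb hj
  split_ifs with hm'
  · have := h j (by omega) (b + m) (by omega)
    rwa [show δ + (b + m : ℕ) = δ + b + m by push_cast; ring] at this
  · exact zero_le

lemma eAnisoKS_add (hT : 0 < T) (hl : lam ≠ 0) {u v : 𝓣} (hu : AnisoReg T p s u)
    (hv : AnisoReg T p s v) (hk : k ≤ p) : AnisoReg T p s (u + v) ∧
      eAnisoKS T k s lam δ (u + v) ≤ eAnisoKS T k s lam δ u + eAnisoKS T k s lam δ v := by
  have h1 := (anisoReg_iff hT).1 hu
  have h2 := (anisoReg_iff hT).1 hv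
  obtain ⟨h3, h4⟩ := h1.rb_lin hT h2 1 1
  simp only [one_mul] at h3 h4
  have g1 := (h1.tDeriv hT (fun _ _ h => h) fun _ _ _ e h => h.congr e).2
  have g2 := (h2.tDeriv hT (fun _ _ h => h) fun _ _ _ e h => h.congr e).2
  refine ⟨(anisoReg_iff hT).2 h3, ?_⟩
  simp only [eAnisoKS, ← sum_add_distrib]
  refine sum_le_sum fun b hb => sum_le_sum fun m _ => sum_le_sum fun j hj => ?_
  simp only [mem_range] at hb hj
  split_ifs with hm
  · refine eAniso0_add hl fun t ht x => ?_
    unfold mixDeriv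
    rw [← fun_iteratedFDeriv_add_apply (((g1 j (by omega)).1 t ht).contDiffAt.of_le
      (by exact_mod_cast (by omega))) (((g2 j (by omega)).1 t ht).contDiffAt.of_le
      (by exact_mod_cast (by omega)))]
    congr 1
    funext x
    exact h4 j (by omega) t ht x
  · simp

lemma anisoReg_congr (hT : 0 < T) {u v : 𝓣} (e : ∀ t ∈ Icc 0 T, ∀ x, v t x = u t x)
    (h : AnisoReg T p s u) : AnisoReg T p s v :=
  (anisoReg_iff hT).2 (((anisoReg_iff hT).1 h).congr hT.le (fun _ _ _ e h => h.congr e) e)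

lemma eAnisoKS_congr {u v : 𝓣} (e : ∀ t ∈ Icc 0 T, ∀ x, v t x = u t x) :
    eAnisoKS T p s lam δ v = eAnisoKS T p s lam δ u := by
  have : ∀ m j, ∀ t ∈ Icc 0 T, mixDeriv T m j v t = mixDeriv T m j u t := fun m j t ht => by
    unfold mixDeriv
    congr 1
    funext x
    exact tDeriv_congr e j ht x
  have h0 : ∀ m j (V : ℝ), eAniso0 T lam V (mixDeriv T m j v) =
      eAniso0 T lam V (mixDeriv T m j u) := fun m j V => by
    unfold eAniso0
    simp only [this m j _ (Subtype.prop _)]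
  simp only [eAnisoKS, h0]

lemma eFn_congr {u v : 𝓣} (e : ∀ t ∈ Icc 0 T, ∀ x, v t x = u t x) :
    eFn T k s lam lam' δ v = eFn T k s lam lam' δ u := by
  simp only [eFn, eAnisoKS_congr e]

lemma FMemF_add (hT : 0 < T) (h1 : lam ≠ 0) (h2 : lam' ≠ 0)
    (hu : FMemF T k s lam lam' δ u) (hv : FMemF T k s lam lam' δ v) :
    FMemF T k s lam lam' δ (u + v) ∧
      eFF T k s lam lam' δ (u + v) ≤ eFF T k s lam lam' δ u + eFF T k s lam lam' δ v := by
  have h : eFF T k s lam lam' δ (u + v) ≤ eFF T k s lam lam' δ u + eFF T k s lam lam' δ v := by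
    simp only [eFF, ← sum_add_distrib, eFn]
    refine sum_le_sum fun I _ => ?_
    rw [add_add_add_comm]
    exact add_le_add (eAnisoKS_add hT h1 (hu.1 I) (hv.1 I) le_rfl).2
      (eAnisoKS_add hT h2 (hu.1 I) (hv.1 I) (by omega)).2
  exact ⟨⟨fun I => (eAnisoKS_add (δ := δ) hT h1 (hu.1 I) (hv.1 I) le_rfl).1,
    ne_top_of_le_ne_top (add_ne_top.2 ⟨hu.2, hv.2⟩) h⟩, h⟩

lemma eFF_congr (e : EqOnT T v u) :
    eFF T k s lam lam' δ v = eFF T k s lam lam' δ u := by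
  unfold eFF
  exact sum_congr rfl fun I _ => eFn_congr (e I)

lemma FMemF_congr (hT : 0 < T) (e : EqOnT T v u)
    (hu : FMemF T k s lam lam' δ u) : FMemF T k s lam lam' δ v :=
  ⟨fun I => anisoReg_congr hT (e I) (hu.1 I), (eFF_congr e).trans_ne hu.2⟩

lemma eFD_congr (e : EqOnT T v u) :
    eFD T k s lam lam' δ v = eFD T k s lam lam' δ u := by
  unfold eFD
  rw [eFF_congr e, eFF_congr fun J t ht x => congrFun (dT_congr e J ht) x,
    eFF_congr fun J t ht x => congrFun (coDT_congr e J ht) x]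

lemma FMemD_congr (hT : 0 < T) (e : EqOnT T v u)
    (hu : FMemD T k s lam lam' δ u) : FMemD T k s lam lam' δ v :=
  ⟨FMemF_congr hT e hu.1,
    FMemF_congr hT (fun J _ ht x => congrFun (dT_congr e J ht) x) hu.2.1,
    FMemF_congr hT (fun J _ ht x => congrFun (coDT_congr e J ht) x) hu.2.2⟩

end spaces

section forms

variable {k : ℕ} {lam lam' β : ℝ}

lemma eFn_interp (hp : P.p = k + 1) (h0 : 0 < lam) (hl : lam ≤ lam') (hβ : lam' ≤ P.θ * β)
    (hβ1 : β ≤ 1) (hW : 0 ≤ W) : ∃ A, 0 ≤ A ∧ ∀ S H (f : 𝓣), 0 ≤ S → S ≤ H →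
      P.CG W S f → P.CH (W + P.η) H f → AnisoReg P.T (k + 1) P.s f ∧
        eFn P.T k P.s lam lam' W f ≤ ofReal (A * (S ^ (1 - β) * H ^ β)) := by
  set M : ℕ := 2 * P.s + P.p with hM
  set c : ℕ → ℕ := fun p => (p + 1) * ((2 * P.s + 1) * (P.s + 1)) with hc
  set Z : ℝ := (5 + 2 ^ (W + M + 1)) * (1 + 4 ^ (W + M)) with hZ
  have hE := P.hη0
  refine ⟨(c (k + 1) + c k : ℕ) * Z, by positivity, fun S H f hS hSH hs hh => ?_⟩
  have hT := P.hT
  have g1 := (hs.SG_tDeriv hT).2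
  have g2 := (TGen.tDeriv hT (fun N f h => (HB.sg (by linarith) P.hθ0 h).rb)
    (fun _ _ _ e h => h.congr e) hh).2
  have key : ∀ l, 0 < l → l ≤ lam' → ∀ p ≤ P.p, eAnisoKS P.T p P.s l W f ≤
      c p * ofReal (Z * (S ^ (1 - β) * H ^ β)) := fun l hl0 hl p hp' => by
    refine eAnisoKS_le fun j hj a ha => ?_
    refine (eAniso0_interp P.hθ0 hW hl0 (hl.trans hβ) hβ1 P.hθ1.le hSH hT.le (g1 j hj)
      ((g2 j hj).mono_W (by linarith)) (ha.trans (by omega))).trans (ofReal_le_ofReal ?_)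
    have hH := hS.trans hSH
    have hN : ((2 * (P.s - j) + P.p : ℕ) : ℝ) ≤ M := by exact_mod_cast (by omega)
    rw [← mul_assoc, hZ]
    gcongr <;> norm_num
  refine ⟨hp ▸ (anisoReg_iff hT).2 (hs.mono fun _ _ h => h.rb),
    (add_le_add (key lam h0 hl _ hp.ge) (key lam' (h0.trans_le hl) le_rfl k (by omega))).trans ?_⟩
  have hZ0 : 0 ≤ Z := by positivity
  clear_value Z
  rw [← add_mul, mul_assoc, ofReal_mul (Nat.cast_nonneg _), ENNReal.ofReal_natCast,
    Nat.cast_add]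

lemma FMemD_interp (hp : P.p = k + 1) (h0 : 0 < lam) (hl : lam ≤ lam') (hβ : lam' ≤ P.θ * β)
    (hβ1 : β ≤ 1) (q : ℕ) : ∃ A, 0 ≤ A ∧ ∀ S H (u : FormT n q), 0 ≤ S → S ≤ H → P.XG S u →
      P.XH H u → CoClosed P.T u → FMemD P.T k P.s lam lam' P.δ u ∧
        eFD P.T k P.s lam lam' P.δ u ≤ ofReal (A * (S ^ (1 - β) * H ^ β)) := by
  have hd := P.δ_pos
  obtain ⟨A, hA, h1⟩ := eFn_interp (P := P) hp h0 hl hβ hβ1 (W := P.δ) (by linarith)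
  obtain ⟨B, hB, h2⟩ := eFn_interp (P := P) hp h0 hl hβ hβ1 (W := P.δ + 1) (by linarith)
  have key : ∀ {q : ℕ} {X : ℝ≥0∞} {V : ℝ} {u : FormT n q}, X ≠ ⊤ →
      (∀ I, AnisoReg P.T (k + 1) P.s (u I) ∧ eFn P.T k P.s lam lam' V (u I) ≤ X) →
      FMemF P.T k P.s lam lam' V u ∧ eFF P.T k P.s lam lam' V u ≤ Fintype.card (Idx n q) * X :=
    fun hX h => by
      have := (Finset.sum_le_card_nsmul univ _ _ fun I _ => (h I).2).trans_eq
        (nsmul_eq_mul _ _)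
      exact ⟨⟨fun I => (h I).1, ne_top_of_le_ne_top
        (ENNReal.mul_ne_top (ENNReal.natCast_ne_top _) hX) this⟩, this⟩
  refine ⟨Fintype.card (Idx n q) * A + Fintype.card (Idx n (q + 1)) * B +
    Fintype.card (Idx n (q - 1)) * B, by positivity, fun S H u hS hSH hu hu' cu => ?_⟩
  have hH := hS.trans hSH
  obtain ⟨m1, e1⟩ := key ENNReal.ofReal_ne_top fun I => h1 S H _ hS hSH (hu.1 I) (hu'.1 I)
  obtain ⟨m2, e2⟩ := key ENNReal.ofReal_ne_top fun J => h2 S H _ hS hSH (hu.2 J) (hu'.2 J)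
  have z : EqOnT P.T (coDT u) (fun _ _ _ => 0) := cu
  obtain ⟨m3, e3⟩ := key (q := q - 1) ENNReal.ofReal_ne_top fun _ => h2 S H _ hS hSH
    (TGen.SG_zero.SG_mono hS) (TGen.HB_zero.HB_mono hH)
  refine ⟨⟨m1, m2, FMemF_congr P.hT z m3⟩, (add_le_add_three e1 e2
    ((eFF_congr z).trans_le e3)).trans_eq ?_⟩
  simp only [← ENNReal.ofReal_natCast]
  rw [← ofReal_mul (by positivity), ← ofReal_mul (by positivity),
    ← ofReal_mul (by positivity), ← ofReal_add (by positivity) (by positivity),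
    ← ofReal_add (by positivity) (by positivity)]
  congr 1
  ring

lemma FMemD.XG (hp : P.p = k + 1) (h : FMemD P.T k P.s lam lam' P.δ u)
    (hC : 0 ≤ C) (e : eFD P.T k P.s lam lam' P.δ u ≤ ofReal C) : P.XG C u := by
  have key : ∀ {q : ℕ} {V : ℝ} {u : FormT n q}, FMemF P.T k P.s lam lam' V u →
      eFF P.T k P.s lam lam' V u ≤ ofReal C → ∀ I, P.CG V C (u I) := fun {q V u} h e I => by
    unfold Par.CG
    rw [hp]
    exact TGen.of_eAnisoKS P.hT hC (h.1 I) ((le_self_add.trans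
      (single_le_sum (f := fun I => eFn P.T k P.s lam lam' V (u I)) (fun _ _ => zero_le)
        (mem_univ I))).trans e)
  exact ⟨key h.1 ((le_self_add.trans le_self_add).trans e),
    key h.2.1 ((le_add_self.trans le_self_add).trans e)⟩

lemma FMemD.exists_XG (hp : P.p = k + 1) (h : FMemD P.T k P.s lam lam' P.δ u) :
    P.XG (eFD P.T k P.s lam lam' P.δ u).toReal u :=
  h.XG hp ENNReal.toReal_nonneg (ENNReal.ofReal_toReal (add_ne_top.2
    ⟨add_ne_top.2 ⟨h.1.2, h.2.1.2⟩, h.2.2.2⟩)).ge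

lemma FMemD_add (h0 : lam ≠ 0) (h0' : lam' ≠ 0) (hp : P.p = k + 1)
    (hu : FMemD P.T k P.s lam lam' P.δ u) (hv : FMemD P.T k P.s lam lam' P.δ v) :
    FMemD P.T k P.s lam lam' P.δ (u + v) ∧ eFD P.T k P.s lam lam' P.δ (u + v) ≤
      eFD P.T k P.s lam lam' P.δ u + eFD P.T k P.s lam lam' P.δ v := by
  have hu' := hu.exists_XG hp
  have hv' := hv.exists_XG hp
  have e1 : EqOnT P.T (dT (u + v)) (dT u + dT v) := fun J t ht x => by
    simpa using dT_lin hu' hv' 1 1 J ht x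
  have e2 : EqOnT P.T (coDT (u + v)) (coDT u + coDT v) := fun J t ht x => by
    simpa using coDT_lin hu' hv' 1 1 J ht x
  obtain ⟨a1, b1⟩ := FMemF_add P.hT h0 h0' hu.1 hv.1
  obtain ⟨a2, b2⟩ := FMemF_add P.hT h0 h0' hu.2.1 hv.2.1
  obtain ⟨a3, b3⟩ := FMemF_add P.hT h0 h0' hu.2.2 hv.2.2
  refine ⟨⟨a1, FMemF_congr P.hT e1 a2, FMemF_congr P.hT e2 a3⟩, ?_⟩
  rw [eFD, eFF_congr e1, eFF_congr e2]
  refine (add_le_add_three b1 b2 b3).trans_eq ?_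
  unfold eFD
  ring

end forms

lemma fredholm_bilinear {X : Type*} [NormedAddCommGroup X] [NormedSpace ℝ X] [CompleteSpace X]
    (B : X →L[ℝ] X →L[ℝ] X) (h1 : ∀ v, IsCompactOperator (B v))
    (h2 : ∀ v, IsCompactOperator (B.flip v)) (v : X)
    (hinj : ∀ w, w + B v w + B w v = 0 → w = 0) :
    (∀ f, ∃ u, u + B v u + B u v = f) ∧
      map (fun u => u + B u u) (nhds v) = nhds (v + B v v) := by
  have hu : IsUnit (1 + (B v + B.flip v)) := by
    rcases ((h1 v).add (h2 v)).hasEigenvalue_or_mem_resolventSet (T := B v + B.flip v)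
      (μ := (-1 : ℝ)) (by norm_num) with h | h
    · obtain ⟨w, hw, hw0⟩ := h.exists_hasEigenvector
      have := Module.End.mem_eigenspace_iff.1 hw
      refine (hw0 (hinj w ?_)).elim
      have : B v w + B w v = (-1 : ℝ) • w := this
      rw [add_assoc, this]
      simp
    · have := (spectrum.mem_resolventSet_iff.1 h).neg
      rw [neg_sub, map_neg, map_one, sub_neg_eq_add, add_comm] at this
      exact this
  set e := ContinuousLinearEquiv.ofUnit hu.unit
  have he : ∀ u, e u = u + B v u + B u v := fun u => (add_assoc _ _ _).symm
  refine ⟨fun f => ⟨e.symm f, by rw [← he, e.apply_symm_apply]⟩, ?_⟩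
  refine HasStrictFDerivAt.map_nhds_eq_of_equiv (f' := e) ?_
  refine ((hasStrictFDerivAt_id v).add (B.hasStrictFDerivAt.clm_apply
    (hasStrictFDerivAt_id v))).congr_fderiv ?_
  ext u
  simp [he, add_assoc]

lemma abs_sum_le_card {F : Fin n → ℝ} (h : ∀ i, |F i| ≤ B) : |∑ i, F i| ≤ n * B :=
  (Finset.abs_sum_le_sum_abs _ _).trans ((sum_le_sum fun i _ => h i).trans (by simp))

/-- Smallness on short time intervals of heat potentials of functions vanishing initially. -/
lemma VP_short (hn : 2 ≤ n) (hθ0 : 0 < θ) (hθ1 : θ ≤ 1) (hr : 0 ≤ r)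
    (hrθ : r + θ < 2) (hζ : Prof θ ζ) (hT : 0 ≤ T) (hW : 0 ≤ W) :
    ∃ A, 0 ≤ A ∧ ∀ (D t₀ t₁ : ℝ) (f : 𝓣), t₀ ∈ Icc 0 T → t₁ ∈ Icc 0 T →
      SCt T 0 f → (∀ t ∈ Icc 0 t₁, GX 0 W D (f t)) → (∀ t ∈ Ico 0 t₀, ∀ x, f t x = 0) →
      ∀ t ∈ Icc t₀ t₁, GX 0 W (A * (D * (t₁ - t₀) ^ (θ / 2))) (VP T r ζ f t) := by
  obtain ⟨A, hA, H⟩ := VP_HV (W := W) hn hθ0 hθ1 hr hrθ hζ hT hW 0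
  refine ⟨A, hA, fun D t₀ t₁ f h0 h1 hs hb hz t ht => ?_⟩
  have hD := (hb 0 ⟨le_rfl, h1.1⟩).nonneg
  have hg : SG T W D 0 fun τ => f (min τ t₁) := by
    refine ⟨fun τ hτ => hb _ ⟨le_min hτ.1 h1.1, min_le_right _ _⟩, SCt.of_cont ?_⟩
    exact hs.zero_cont.comp (f := fun p : ℝ × Spc n => (min p.1 t₁, p.2)) (by fun_prop)
      fun p hp => ⟨⟨le_min hp.1.1 h1.1, (min_le_right _ _).trans h1.2⟩, trivial⟩
  have hv : ∀ τ ≤ t₁, ∀ x, VP T r ζ (fun τ => f (min τ t₁)) τ x = VP T r ζ f τ x := by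
    intro τ hτ x
    refine integral_congr_ae (.of_forall fun p => ?_)
    rcases le_or_gt τ p.1 with h | h
    · simp only [kf_of_nonpos (sub_nonpos.2 h), zero_mul]
    · simp only [min_eq_left (h.le.trans hτ)]
  have h00 : ∀ x, VP T r ζ f t₀ x = 0 := by
    intro x
    refine integral_eq_zero_of_ae (slabM_ae (P := fun τ => ∀ z, kf r ζ (t₀ - τ) z * f τ (x - z) = 0)
      (fun τ hτ z => ?_) |>.mono fun p hp => hp p.2)
    rcases le_or_gt t₀ τ with h | h
    · rw [kf_of_nonpos (sub_nonpos.2 h), zero_mul]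
    · rw [hz τ ⟨hτ.1.le, h⟩, mul_zero]
  have := (H D _ hg).2.1 t ⟨h0.1.trans ht.1, ht.2.trans h1.2⟩ t₀ h0
  simp only [hv _ ht.2, hv _ (ht.1.trans ht.2), h00, sub_zero] at this
  refine this.mono ?_
  rw [mul_assoc, abs_of_nonneg (sub_nonneg.2 ht.1)]
  have : (t - t₀) ^ (θ / 2) ≤ (t₁ - t₀) ^ (θ / 2) :=
    rpow_le_rpow (sub_nonneg.2 ht.1) (by linarith [ht.2]) (by positivity)
  gcongr

lemma RK_pd_bound (hn : 2 ≤ n) {δ : ℝ} (hδ : (n : ℝ) < 2 * δ) (hδ1 : δ ≤ n) (i j : Fin n) :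
    ∃ A, 0 ≤ A ∧ ∀ D V (g : 𝓕), GX 1 (2 * δ + 1) V g → GX 0 (2 * δ) D g →
      GX 0 (2 * δ + 1) D (pd j g) → ∀ x, wt x ^ δ * |RK i (pd j g) x| ≤ A * D := by
  have h0 : (0 : ℝ) ≤ n := n.cast_nonneg
  obtain ⟨A1, hA1, H1⟩ := kap1_conv (W := 2 * δ + 1) hn (by linarith) i 0
  obtain ⟨A2, hA2, H2⟩ := smooth_conv_GX hn hδ 0 (pd j (kap2 i)) (pd_kap2_GX i j)
  refine ⟨A1 + A2, by positivity, fun D V g hV hg hp x => ?_⟩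
  rw [RK_pd_eq hn (by linarith) hV]
  have := ((H1 D _ hp).1.mono_W (by linarith : δ ≤ _)).add ((H2 D _ hg).mono_W hδ1)
  rw [add_mul]
  exact this.abs_le x

lemma RG_short (P : Par n) : ∃ A, 0 ≤ A ∧ ∀ (C D t₀ t₁ : ℝ) (f : Finset (Fin n) → 𝓣),
    t₀ ∈ Icc 0 P.T → t₁ ∈ Icc 0 P.T → (∀ I, P.CG (2 * P.δ + 1) C (f I)) →
    (∀ I, ∀ t ∈ Icc 0 t₁, GX 0 (2 * P.δ + 1) D (f I t)) →
    (∀ I, ∀ t ∈ Ico 0 t₀, ∀ x, f I t x = 0) → ∀ t ∈ Icc t₀ t₁, ∀ K x,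
      wt x ^ P.δ * |P.RG f K t x| ≤ A * (D * (t₁ - t₀) ^ (P.θ / 2)) ∧
      wt x ^ (P.δ + 1) * |dG (fun K => P.RG f K t) K x| ≤ A * (D * (t₁ - t₀) ^ (P.θ / 2)) := by
  have hδ := P.δ_pos
  have hθ0 := P.hθ0
  have hθ1 := P.hθ1
  obtain ⟨A0, hA0, H0⟩ := VP_short (W := 2 * P.δ + 1) P.hn hθ0 hθ1.le le_rfl (by linarith)
    (gam_prof (n := n) P.hμ hθ0 hθ1.le) P.hT.le (by linarith)
  have H1 := fun j => VP_short (W := 2 * P.δ + 1) P.hn hθ0 hθ1.le zero_le_one (by linarith)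
    (pd_gam_prof (n := n) P.hμ hθ0 hθ1.le j) P.hT.le (by linarith)
  choose A1 hA1 H1 using H1
  have H2 := RK_pd_bound P.hn P.n_lt (by linarith [P.hη1, P.hη0])
  choose A2 hA2 H2 using H2
  obtain ⟨A4, hA4, H4⟩ := VP_GX4 P
  set B := A0 + ∑ j, A1 j with hB
  set B2 := ∑ i, ∑ j, A2 i j with hB2
  have hB0 : 0 ≤ B := add_nonneg hA0 (sum_nonneg fun j _ => hA1 j)
  have hA2' : ∀ i, 0 ≤ ∑ j, A2 i j := fun i => sum_nonneg fun j _ => hA2 i j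
  have hB20 : 0 ≤ B2 := sum_nonneg fun i _ => hA2' i
  refine ⟨n * (|cLap n| * (n * (B2 * B))) + |cLap n * cRho n| * (n * B), by positivity,
    fun C D t₀ t₁ f h0 h1 hf hb hz t ht K x => ?_⟩
  have htT : t ∈ Icc 0 P.T := ⟨h0.1.trans ht.1, ht.2.trans h1.2⟩
  have hD := (hb ∅ 0 ⟨le_rfl, h1.1⟩).nonneg
  have ht01 : 0 ≤ (t₁ - t₀) ^ (P.θ / 2) := rpow_nonneg (by linarith [ht.1, ht.2]) _
  set E := D * (t₁ - t₀) ^ (P.θ / 2) with hE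
  have hE0 : 0 ≤ E := by positivity
  have hsg : ∀ I, SG P.T 0 C 1 (f I) := fun I =>
    ((hf I).sg.mono_N (by linarith [P.four_le])).mono_W (by linarith)
  have v0 : ∀ I, GX 0 (2 * P.δ + 1) (B * E) (VP P.T 0 (gam P.μ) (f I) t) := fun I =>
    (H0 D t₀ t₁ _ h0 h1 ((hsg I).2.mono_N zero_le_one) (hb I) (hz I) t ht).mono <|
      mul_le_mul_of_nonneg_right (le_add_of_nonneg_right (sum_nonneg fun j _ => hA1 j)) hE0
  have v1 : ∀ I j, GX 0 (2 * P.δ + 1) (B * E) (pd j (VP P.T 0 (gam P.μ) (f I) t)) := fun I j => by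
    have e : pd j (VP P.T 0 (gam P.μ) (f I) t) = VP P.T 1 (pd j (gam P.μ)) (f I) t := by
      funext y
      rw [pd_VP P.hn P.hμ P.hT.le (hsg I) htT, VP_ibp P.hn P.hμ P.hT.le (hsg I) htT]
    rw [e]
    refine (H1 j D t₀ t₁ _ h0 h1 ((hsg I).2.mono_N zero_le_one) (hb I) (hz I) t ht).mono <|
      mul_le_mul_of_nonneg_right ?_ hE0
    exact (single_le_sum (fun j _ => hA1 j) (mem_univ j)).trans
      (le_add_of_nonneg_left hA0)
  have v2 : ∀ I i j, |RK i (pd j (VP P.T 0 (gam P.μ) (f I) t)) x| ≤ B2 * (B * E) / wt x ^ P.δ := by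
    intro I i j
    rw [le_div_iff₀' (wt_rpow_pos _ _)]
    refine (H2 i j _ _ _ ((H4 C f hf t htT I).mono_N (by norm_num)) ((v0 I).mono_W (by linarith))
      (v1 I j) x).trans (mul_le_mul_of_nonneg_right ?_ (by positivity))
    exact (single_le_sum (fun j _ => hA2 i j) (mem_univ j)).trans
      (single_le_sum (f := fun i => ∑ j, A2 i j) (fun i _ => hA2' i) (mem_univ i))
  have pw := wt_rpow_pos x P.δ
  have pw1 := wt_rpow_pos x (P.δ + 1)
  constructor
  · rw [← le_div_iff₀' pw, RG_eq P hf htT]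
    have : |∑ i, if i ∉ K then sgn i K * (cLap n * ∑ j, if j ∈ insert i K then sgn j (insert i K) *
        RK i (pd j (VP P.T 0 (gam P.μ) (f ((insert i K).erase j)) t)) x else 0) else 0| ≤
        n * (|cLap n| * (n * (B2 * (B * E) / wt x ^ P.δ))) := by
      refine abs_sum_le_card fun i => ?_
      split_ifs
      · rw [abs_zero]; positivity
      · rw [abs_mul, abs_mul]
        refine (mul_le_of_le_one_left (by positivity) (abs_sgn i K)).trans
          (mul_le_mul_of_nonneg_left (abs_sum_le_card fun j => ?_) (abs_nonneg _))
        split_ifs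
        · rw [abs_mul]
          exact (mul_le_of_le_one_left (by positivity) (abs_sgn j _)).trans (v2 _ _ _)
        · rw [abs_zero]; positivity
    refine this.trans ?_
    rw [le_div_iff₀ pw]
    have h3 : 0 ≤ |cLap n * cRho n| * (n * B) * E := by positivity
    have e : n * (|cLap n| * (n * (B2 * (B * E) / wt x ^ P.δ))) * wt x ^ P.δ =
      n * (|cLap n| * (n * (B2 * B))) * E := by field_simp
    rw [e]; linarith
  · rw [← le_div_iff₀' pw1, dG_RG P hf htT, abs_mul]
    have : |dG (fun I => VP P.T 0 (gam P.μ) (f I) t) K x| ≤ n * (B * E / wt x ^ (P.δ + 1)) := by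
      refine abs_sum_le_card fun i => ?_
      split_ifs
      · rw [abs_mul, le_div_iff₀' pw1]
        refine (mul_le_mul_of_nonneg_left (mul_le_of_le_one_left (by positivity) (abs_sgn i K))
          pw1.le).trans (((v1 _ i).mono_W ?_).abs_le x)
        linarith
      · rw [abs_zero]; positivity
    refine (mul_le_mul_of_nonneg_left this (abs_nonneg _)).trans ?_
    rw [le_div_iff₀ pw1]
    have h3 : 0 ≤ n * (|cLap n| * (n * (B2 * B))) * E := by positivity
    have e : |cLap n * cRho n| * (n * (B * E / wt x ^ (P.δ + 1))) * wt x ^ (P.δ + 1) =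
      |cLap n * cRho n| * (n * B) * E := by field_simp
    rw [e]; linarith

section

variable {M₁ : M1Type n q}

lemma Par.XH.xg (h : P.XH C u) : P.XG C u := by
  have hδ := P.δ_pos
  refine ⟨fun I => TGen.mono (h.1 I) fun N f hf => (hf.sg ?_ P.hθ0).mono_W ?_,
    fun J => TGen.mono (h.2 J) fun N f hf => (hf.sg ?_ P.hθ0).mono_W ?_⟩ <;> linarith [P.hη0]

lemma Mb_bound (P : Par n) (M₁ : M1Type n q) : ∃ A, 0 ≤ A ∧ ∀ D D' (u w : FormT n q) t,
    (∀ J, GX 0 (P.δ + 1) D (dT u J t)) → (∀ K, GX 0 P.δ D' (w K t)) → 0 ≤ D → 0 ≤ D' →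
    ∀ I, GX 0 (2 * P.δ + 1) (A * (D * D')) (extT (Mb M₁ u w) I t) := by
  set a : Idx n q → Idx n (q + 1) → Idx n q → ℝ := fun I J K =>
    M₁ (fun j => if J = j then 1 else 0, 0) (fun j => if K = j then 1 else 0) I with ha
  refine ⟨∑ I, ∑ J, ∑ K, |a I J K|, by positivity, fun D D' u w t hu hw h1 h2 I => ?_⟩
  by_cases hI : I.card = q
  · rw [extT_coe (Mb M₁ u w) ⟨I, hI⟩, Mb_eq]
    have key := GX.sum univ fun J _ => GX.sum univ fun K _ =>
      ((hu J).mul (hw K)).smul (a ⟨I, hI⟩ J K)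
    rw [show P.δ + 1 + P.δ = 2 * P.δ + 1 by ring] at key
    refine key.mono ?_
    rw [sum_mul]
    refine le_trans (le_of_eq ?_) (single_le_sum (f := fun I => (∑ J, ∑ K, |a I J K|) *
      (D * D')) (fun I _ => by positivity) (mem_univ ⟨I, hI⟩))
    simp only [sum_mul, pow_zero, one_mul]
  · rw [extT_ne _ hI]
    exact GX.zero.mono (by positivity)

lemma dT_zero_of (h : ∀ I x, u I t x = 0) (J : Idx n (q + 1)) : dT u J t = 0 := by
  funext x
  change dS (fun I => u I t) J x = 0
  rw [show (fun I => u I t) = fun _ _ => 0 from funext fun I => funext (h I)]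
  exact sum_eq_zero fun i _ => by split_ifs <;> simp [pd]

lemma Mb_zero_of (h : ∀ I x, u I t x = 0) (x : Spc n) (I : Finset (Fin n)) :
    extT (Mb M₁ u w) I t x = 0 ∧ extT (Mb M₁ w u) I t x = 0 := by
  by_cases hI : I.card = q
  · rw [extT_coe (Mb M₁ u w) ⟨I, hI⟩, extT_coe (Mb M₁ w u) ⟨I, hI⟩, Mb_eq, Mb_eq]
    simp [h, dT_zero_of h]
  · simp [extT_ne _ hI]

/-- Uniqueness for the linearised Volterra equation. -/
theorem volterra_unique [Nonempty (Idx n q)] {a b : FormT n q} (ha : P.XG C a) (hb : P.XG C b)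
    (hw : P.XG C w) (e : EqOnT P.T (w + P.BX M₁ a w + P.BX M₁ w b) 0) : EqOnT P.T w 0 := by
  have hδ := P.δ_pos
  have hC := XG_nonneg hw
  have hθ0 := P.hθ0
  have hT := P.hT
  obtain ⟨A1, hA1, H1⟩ := Mb_bound P M₁
  obtain ⟨A2, hA2, H2⟩ := RG_short P
  obtain ⟨A3, hA3, H3⟩ := BX_XH P M₁
  obtain ⟨A4, hA4, H4⟩ := Mb_CG P M₁
  have gX := fun {u : FormT n q} (hu : P.XG C u) (t) (ht : t ∈ Icc 0 P.T) =>
    And.intro (fun I => ((hu.1 I).sg.1 t ht).mono_N (Nat.zero_le _))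
      (fun J => ((hu.2 J).sg.1 t ht).mono_N (Nat.zero_le _))
  have hcg : ∀ {u v : FormT n q}, P.XG C u → P.XG C v → ∀ I,
      P.CG (2 * P.δ + 1) (A4 * (C * C)) (extT (Mb M₁ u v) I) := fun hu hv =>
    extT_CG (by positivity) (H4 C C _ _ hC hC hu hv)
  have e1 : EqOnT P.T w ((-1 : ℝ) • P.BX M₁ a w + (-1 : ℝ) • P.BX M₁ w b) := by
    intro I t ht x
    have := e I t ht x
    simp only [Pi.add_apply, Pi.zero_apply, Pi.smul_apply, smul_eq_mul] at this ⊢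
    linarith
  have d1 : ∀ J, ∀ t ∈ Icc 0 P.T, ∀ x, dT w J t x = -1 * dT (P.BX M₁ a w) J t x +
      -1 * dT (P.BX M₁ w b) J t x := fun J t ht x => by
    rw [dT_congr e1 J ht]
    exact dT_lin (H3 C C _ _ hC hC ha hw).xg (H3 C C _ _ hC hC hw hb).xg _ _ J ht x
  obtain ⟨ε, hε, hε1⟩ : ∃ ε > 0, 2 * (A2 * (A1 * C)) * ε ^ (P.θ / 2) ≤ 1 / 2 := by
    have : Tendsto (fun ε : ℝ => 2 * (A2 * (A1 * C)) * ε ^ (P.θ / 2)) (nhdsWithin 0 (Ioi 0))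
        (nhds 0) := by
      have h := ((continuousAt_rpow_const 0 (P.θ / 2) (Or.inr (by positivity))).const_mul
        (2 * (A2 * (A1 * C)))).tendsto
      rw [zero_rpow (by positivity), mul_zero] at h
      exact h.mono_left nhdsWithin_le_nhds
    obtain ⟨ε, h1, h2⟩ := ((this.eventually (Iio_mem_nhds (by norm_num : (0 : ℝ) < 1 / 2))).and
      self_mem_nhdsWithin).exists
    exact ⟨ε, h2, h1.le⟩
  have step : ∀ t₀ ∈ Icc 0 P.T, (∀ t ∈ Ico 0 t₀, ∀ I x, w I t x = 0) →
      ∀ t ∈ Icc 0 (min (t₀ + ε) P.T), ∀ I x, w I t x = 0 := by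
    intro t₀ h0 hz
    set t₁ := min (t₀ + ε) P.T with ht1
    have h01 : t₀ ≤ t₁ := le_min (by linarith) h0.2
    have h1 : t₁ ∈ Icc 0 P.T := ⟨h0.1.trans h01, min_le_right _ _⟩
    have hsub : t₁ - t₀ ≤ ε := by have := min_le_left (t₀ + ε) P.T; linarith
    have hτ := fun t (ht : t ∈ Icc 0 t₁) => (⟨ht.1, ht.2.trans h1.2⟩ : t ∈ Icc 0 P.T)
    have main : ∀ m : ℕ, ∀ t ∈ Icc 0 t₁, (∀ I, GX 0 P.δ (C * (1 / 2) ^ m) (w I t)) ∧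
        ∀ J, GX 0 (P.δ + 1) (C * (1 / 2) ^ m) (dT w J t) := by
      intro m
      induction m with
      | zero => intro t ht; rw [pow_zero, mul_one]; exact gX hw t (hτ t ht)
      | succ m ih =>
        intro t ht
        set D := C * (1 / 2) ^ m with hD
        have hD0 : 0 ≤ D := by positivity
        have hDe : C * (1 / 2) ^ (m + 1) = D * (1 / 2) := by rw [hD, pow_succ]; ring
        have cont := gX hw t (hτ t ht)
        suffices h : (∀ I x, wt x ^ P.δ * |w I t x| ≤ D * (1 / 2)) ∧
            ∀ J x, wt x ^ (P.δ + 1) * |dT w J t x| ≤ D * (1 / 2) by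
          rw [hDe]
          refine ⟨fun I => ⟨(cont.1 I).1, fun j hj x => ?_⟩, fun I => ⟨(cont.2 I).1, fun j hj x => ?_⟩⟩
          · obtain rfl : j = 0 := by omega
            simpa using h.1 I x
          · obtain rfl : j = 0 := by omega
            simpa using h.2 I x
        rcases lt_or_ge t t₀ with htt | htt
        · have z := hz t ⟨ht.1, htt⟩
          have : 0 ≤ D * (1 / 2) := by positivity
          simp [z, dT_zero_of z, hD0]
        have r1 := H2 _ _ t₀ t₁ _ h0 h1 (hcg ha hw) (fun I t ht => H1 C D a w t
          (gX ha t (hτ t ht)).2 (ih t ht).1 hC hD0 I) (fun I t ht x => (Mb_zero_of (hz t ht) x I).2)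
          t ⟨htt, ht.2⟩
        have r2 := H2 _ _ t₀ t₁ _ h0 h1 (hcg hw hb) (fun I t ht => H1 D C w b t
          (ih t ht).2 (gX hb t (hτ t ht)).1 hD0 hC I) (fun I t ht x => (Mb_zero_of (hz t ht) x I).1)
          t ⟨htt, ht.2⟩
        have fin : A2 * (A1 * (C * D) * (t₁ - t₀) ^ (P.θ / 2)) +
            A2 * (A1 * (D * C) * (t₁ - t₀) ^ (P.θ / 2)) ≤ D * (1 / 2) := by
          have : (t₁ - t₀) ^ (P.θ / 2) ≤ ε ^ (P.θ / 2) :=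
            rpow_le_rpow (by linarith) hsub (by positivity)
          calc _ = D * (2 * (A2 * (A1 * C)) * (t₁ - t₀) ^ (P.θ / 2)) := by ring
            _ ≤ D * (2 * (A2 * (A1 * C)) * ε ^ (P.θ / 2)) := by gcongr
            _ ≤ _ := by gcongr
        have tri : ∀ (a b c p q : ℝ), 0 ≤ c → c * |a| ≤ p → c * |b| ≤ q →
            c * |-1 * a + -1 * b| ≤ p + q := fun a b c p q hc h1 h2 => by
          have h3 : |-1 * a + -1 * b| ≤ |a| + |b| := by
            refine (abs_add_le _ _).trans (le_of_eq ?_)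
            simp
          nlinarith [mul_le_mul_of_nonneg_left h3 hc]
        refine ⟨fun I x => ?_, fun J x => ?_⟩
        · rw [e1 I t (hτ t ht) x]
          have hB : ∀ u v, P.BX M₁ u v I t x = P.RG (extT (Mb M₁ u v)) I.1 t x :=
            fun u v => if_pos (hτ t ht)
          simp only [Pi.add_apply, Pi.smul_apply, smul_eq_mul, hB]
          exact (tri _ _ _ _ _ (wt_rpow_pos _ _).le (r1 I.1 x).1 (r2 I.1 x).1).trans fin
        · rw [d1 J t (hτ t ht) x, dT_BX _ _ _ _ _ (hτ t ht), dT_BX _ _ _ _ _ (hτ t ht)]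
          exact (tri _ _ _ _ _ (wt_rpow_pos _ _).le (r1 J.1 x).2 (r2 J.1 x).2).trans fin
    intro t ht I x
    have lim : Tendsto (fun m : ℕ => C * (1 / 2 : ℝ) ^ m) atTop (nhds 0) := by
      simpa using (tendsto_pow_atTop_nhds_zero_of_lt_one (r := (1 / 2 : ℝ)) (by norm_num)
        (by norm_num)).const_mul C
    have := ge_of_tendsto' lim fun m => ((main m t ht).1 I).abs_le_const (by linarith) x
    exact abs_eq_zero.1 (le_antisymm this (abs_nonneg _))
  have all : ∀ m : ℕ, ∀ t ∈ Icc 0 (min (m * ε) P.T), ∀ I x, w I t x = 0 := by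
    intro m
    induction m with
    | zero =>
      refine fun t ht => step 0 ⟨le_rfl, hT.le⟩ (fun t ht => absurd ht.2 ht.1.not_gt) t
        ⟨ht.1, ht.2.trans (min_le_min (by simp [hε.le]) le_rfl)⟩
    | succ m ih =>
      intro t ht
      refine step (min (m * ε) P.T) ⟨le_min (by positivity) hT.le, min_le_right _ _⟩
        (fun t ht => ih t ⟨ht.1, ht.2.le⟩) t
        ⟨ht.1, ht.2.trans (le_min ?_ (min_le_right _ _))⟩
      push_cast
      rw [min_add]
      refine le_min ((min_le_left _ _).trans (by linarith)) ((min_le_right _ _).trans (by linarith))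
  intro I t ht x
  obtain ⟨m, hm⟩ := exists_nat_gt (P.T / ε)
  rw [div_lt_iff₀ hε] at hm
  exact all m t ⟨ht.1, le_min (ht.2.trans hm.le) ht.2⟩ I x

end

section

lemma Ultrafilter.exists_close {α Z E : Type*} [MetricSpace Z] [NormedAddCommGroup E] [ProperSpace E]
    (U : Ultrafilter α) {K : Set Z} (hK : IsCompact K) {H : ℝ} {G : α → Z → E}
    (hb : ∀ᶠ a in U, ∀ z ∈ K, ‖G a z‖ ≤ H)
    (he : ∀ ε > 0, ∃ d > 0, ∀ᶠ a in U, ∀ z ∈ K, ∀ z' ∈ K, dist z z' < d →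
      ‖G a z - G a z'‖ ≤ ε) (hε : 0 < ε) :
    ∃ S ∈ U, ∀ a ∈ S, ∀ b ∈ S, ∀ z ∈ K, ‖G a z - G b z‖ ≤ ε := by
  obtain ⟨d, hd, h1⟩ := he (ε / 4) (by positivity)
  obtain ⟨t, htK, htf, hcov⟩ := hK.finite_cover_balls hd
  have hl : ∀ z ∈ t, ∃ l, ∀ᶠ a in U, ‖G a z - l‖ < ε / 4 := fun z hz => by
    obtain ⟨l, -, hl⟩ := (isCompact_closedBall (0 : E) H).ultrafilter_le_nhds
      (U.map fun a => G a z) (by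
        rw [le_principal_iff]
        exact hb.mono fun a ha => by simpa using ha z (htK hz))
    have := hl (Metric.ball_mem_nhds l (show 0 < ε / 4 by positivity))
    exact ⟨l, Filter.Eventually.mono (f := (U : Filter α)) this fun a ha => by simpa [dist_eq_norm] using ha⟩
  choose! l hl using hl
  refine ⟨_, h1.and ((eventually_all_finite htf).2 hl), fun a ha b hb z hz => ?_⟩
  obtain ⟨y, hy, hzy⟩ := Set.mem_iUnion₂.1 (hcov hz)
  have e1 := ha.1 z hz y (htK hy) hzy
  have e2 := hb.1 z hz y (htK hy) hzy
  have e3 := ha.2 y hy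
  have e4 := hb.2 y hy
  calc ‖G a z - G b z‖ = ‖(G a z - G a y) + (G a y - l y) - (G b y - l y) - (G b z - G b y)‖ := by
        congr 1; abel
    _ ≤ ‖G a z - G a y‖ + ‖G a y - l y‖ + ‖G b y - l y‖ + ‖G b z - G b y‖ :=
        (norm_sub_le _ _).trans (add_le_add ((norm_sub_le _ _).trans
          (add_le_add (norm_add_le _ _) le_rfl)) le_rfl)
    _ ≤ ε := by linarith

variable {η H : ℝ} {α : Type*}

lemma HB.exists_close (U : Ultrafilter α) (hθ : 0 < θ) (hW : 0 ≤ W) (hη : 0 < η)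
    {F : α → 𝓣} (h : ∀ᶠ a in U, HB T θ (W + η) H N (F a)) (hε : 0 < ε) :
    ∃ S ∈ U, ∀ a ∈ S, ∀ b ∈ S, SG T W ε N (fun t x => F a t x - F b t x) := by
  set H' := max H 1
  have hH' : 0 < H' := lt_max_of_lt_right one_pos
  have h : ∀ᶠ a in U, HB T θ (W + η) H' N (F a) := by
    filter_upwards [h] with a ha using ha.mono (le_max_left _ _)
  obtain ⟨R, hR1, hR⟩ : ∃ R : ℝ, 1 ≤ R ∧ 2 * H' ≤ ε * R ^ η :=
    ((eventually_ge_atTop 1).and ((tendsto_rpow_atTop hη).const_mul_atTop hε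
      |>.eventually_ge_atTop (2 * H'))).exists
  have hR0 : 0 < R := by linarith
  set K : Set (ℝ × Spc n) := Icc 0 T ×ˢ Metric.closedBall 0 R
  have hK : IsCompact K := isCompact_Icc.prod (isCompact_closedBall _ _)
  have key : ∀ m ≤ N, ∃ S ∈ U, ∀ a ∈ S, ∀ b ∈ S, ∀ z ∈ K,
      ‖∇ m (F a z.1) z.2 - ∇ m (F b z.1) z.2‖ ≤
        ε / R ^ (W + m) := fun m hm => by
    have : FiniteDimensional ℝ (ContinuousMultilinearMap ℝ (fun _ : Fin m => Spc n) ℝ) :=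
      FiniteDimensional.of_injective
        (ContinuousMultilinearMap.toMultilinearMapLinear : ContinuousMultilinearMap ℝ
          (fun _ : Fin m => Spc n) ℝ →ₗ[ℝ] MultilinearMap ℝ (fun _ : Fin m => Spc n) ℝ)
        ContinuousMultilinearMap.toMultilinearMap_injective
    have := FiniteDimensional.proper_real (ContinuousMultilinearMap ℝ (fun _ : Fin m => Spc n) ℝ)
    refine Ultrafilter.exists_close U hK (H := H')
      (G := fun a z => ∇ m (F a z.1) z.2) ?_ (fun e he => ?_) (by positivity)
    · filter_upwards [h] with a ha z hz
      exact (ha.1 z.1 hz.1).norm_le_const (by positivity) hm z.2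
    have ht : Tendsto (fun r : ℝ => H' * r ^ (θ / 2) + H' * r ^ θ) (nhds 0) (nhds 0) := by
      have : Continuous fun r : ℝ => H' * r ^ (θ / 2) + H' * r ^ θ := by
        fun_prop (disch := positivity)
      simpa [zero_rpow hθ.ne', zero_rpow (half_pos hθ).ne'] using this.tendsto 0
    obtain ⟨d, hd, hd'⟩ := Metric.eventually_nhds_iff.1 (ht.eventually (gt_mem_nhds he))
    refine ⟨min d 1, lt_min hd one_pos, ?_⟩
    filter_upwards [h] with a ha z hz z' hz' hzz
    have hr0 := dist_nonneg (x := z) (y := z')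
    have e0 := hd' (y := dist z z') (by
      simpa [abs_of_nonneg hr0] using hzz.trans_le (min_le_left _ _))
    have d1 : |z.1 - z'.1| ≤ dist z z' := le_max_left _ _
    have d2 : ‖z.2 - z'.2‖ ≤ dist z z' := by
      rw [← dist_eq_norm]; exact le_max_right _ _
    have e1 := ((ha.2.1 z.1 hz.1 z'.1 hz'.1).norm_le_const (by positivity) hm z.2)
    have e2 := ha.2.2 z'.1 hz'.1 m hm z.2 z'.2
      (le_max_of_le_left (d2.trans (hzz.le.trans (min_le_right _ _))))
    rw [fun_iteratedFDeriv_sub_apply ((ha.1 z.1 hz.1).contDiffAt hm _)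
      ((ha.1 z'.1 hz'.1).contDiffAt hm _)] at e1
    have e3 : ‖∇ m (F a z'.1) z.2 - ∇ m (F a z'.1) z'.2‖ ≤
        H' * ‖z.2 - z'.2‖ ^ θ :=
      (le_mul_of_one_le_left (norm_nonneg _) (one_le_wt_rpow _ (by positivity))).trans e2
    have e4 : H' * |z.1 - z'.1| ^ (θ / 2) + H' * ‖z.2 - z'.2‖ ^ θ ≤
        H' * dist z z' ^ (θ / 2) + H' * dist z z' ^ θ := by gcongr
    exact (norm_sub_le_norm_sub_add_norm_sub _ _ _).trans
      ((add_le_add e1 e3).trans (e4.trans e0.le))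
  choose! S hSU hS using key
  refine ⟨_, inter_mem h ((biInter_finset_mem (range (N + 1))).2 fun m hm =>
    hSU m (Finset.mem_range_succ_iff.1 hm)), fun a ha b hb => ⟨fun t ht => ⟨(ha.1.1 t ht).1.sub (hb.1.1 t ht).1, fun m hm x => ?_⟩, ?_⟩⟩
  · rw [fun_iteratedFDeriv_sub_apply ((ha.1.1 t ht).contDiffAt hm _)
      ((hb.1.1 t ht).contDiffAt hm _)]
    rcases le_total (wt x) R with hx | hx
    · have e := hS m hm a (Set.mem_iInter₂.1 ha.2 m (Finset.mem_range_succ_iff.2 hm)) b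
        (Set.mem_iInter₂.1 hb.2 m (Finset.mem_range_succ_iff.2 hm)) (t, x)
        ⟨ht, by simpa using (norm_le_wt x).trans hx⟩
      exact (mul_le_mul (rpow_le_rpow (wt_pos x).le hx (by positivity)) e (norm_nonneg _)
        (by positivity)).trans_eq (mul_div_cancel₀ _ (rpow_pos_of_pos hR0 _).ne')
    · have e1 := (ha.1.1 t ht).2 m hm x
      have e2 := (hb.1.1 t ht).2 m hm x
      have hw : wt x ^ (W + η + m) = wt x ^ (W + m) * wt x ^ η := by
        rw [← rpow_add (wt_pos x)]; ring_nf
      rw [hw] at e1 e2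
      have e3 := norm_sub_le (∇ m (F a t) x) (∇ m (F b t) x)
      have p1 := wt_rpow_pos x (W + m)
      have p2 := wt_rpow_pos x η
      have e4 : R ^ η ≤ wt x ^ η := by gcongr
      refine le_of_mul_le_mul_right ?_ p2
      have e5 := mul_le_mul_of_nonneg_left e3 (mul_pos p1 p2).le
      nlinarith
  · refine (((ha.1.sg (by positivity) hθ).add ((hb.1.sg (by positivity) hθ).smul (-1))).congr
      fun t _ x => ?_).2
    ring

lemma TGen.exists_close (hT : 0 < T) (U : Ultrafilter α) (hθ : 0 < θ) (hW : 0 ≤ W) (hη : 0 < η) (hε : 0 < ε)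
    {F : α → 𝓣} (h : ∀ᶠ a in U, TGen T (fun N => HB T θ (W + η) H N) s p (F a)) :
    ∃ S ∈ U, ∀ a ∈ S, ∀ b ∈ S, TGen T (SG T W ε) s p (fun t x => F a t x - F b t x) := by
  induction s generalizing F with
  | zero => exact HB.exists_close U hθ hW hη h hε
  | succ s ih =>
    choose! G hG using fun a (h : TGen T (fun N => HB T θ (W + η) H N) (s + 1) p (F a)) => h.2
    obtain ⟨S, hSU, hS⟩ := HB.exists_close U hθ hW hη (h.mono fun a ha => ha.1) hε
    obtain ⟨S', hSU', hS'⟩ := ih (h.mono fun a ha => (hG a ha).2)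
    have hc : ∀ a, TGen T (fun N => HB T θ (W + η) H N) (s + 1) p (F a) →
        ∀ x, ContinuousOn (fun t => G a t x) (Icc 0 T) := fun a ha =>
      ((hG a ha).2.base.sct (by positivity) hθ).time_cont
    refine ⟨_, inter_mem h (inter_mem hSU hSU'), fun a ha b hb => ⟨hS a ha.2.1 b hb.2.1,
      fun t x => G a t x - G b t x, ?_, hS' a ha.2.2 b hb.2.2⟩⟩
    refine ((hG a ha.1).1.add ((hG b hb.1).1.smul (-1)) (hc a ha.1) fun x =>
      (hc b hb.1 x).const_smul (-1 : ℝ)).congr hT.le (fun t _ x => ?_) fun t _ x => ?_ <;> ring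

lemma SG.tsum (hW : 0 ≤ W) {F : ℕ → 𝓣} {c : ℕ → ℝ} (hc : Summable c)
    (h : ∀ i, SG T W (c i) N (F i)) : SG T W (∑' i, c i) N (fun t x => ∑' i, F i t x) := by
  have hb : ∀ m ≤ N, ∀ i, ∀ t ∈ Icc 0 T, ∀ x, ‖∇ m (F i t) x‖ ≤ c i :=
    fun m hm i t ht x => ((h i).1 t ht).norm_le_const hW hm x
  have e : ∀ m ≤ N, ∀ t ∈ Icc 0 T, ∀ x, ∇ m (fun x => ∑' i, F i t x) x =
      ∑' i, ∇ m (F i t) x := fun m hm t ht x =>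
    iteratedFDeriv_tsum_apply (N := N) (v := fun _ => c) (fun i => ((h i).1 t ht).1) (fun _ _ => hc)
      (fun k i x hk => hb k (by exact_mod_cast hk) i t ht x) (by exact_mod_cast hm) x
  refine ⟨fun t ht => ⟨contDiff_tsum (v := fun _ => c) (fun i => ((h i).1 t ht).1) (fun _ _ => hc)
    fun k i x hk => hb k (by exact_mod_cast hk) i t ht x, fun m hm x => ?_⟩, fun m hm => ?_⟩
  · rw [e m hm t ht, ← le_div_iff₀' (wt_rpow_pos x _)]
    exact tsum_of_norm_bounded (hc.hasSum.div_const _) fun i =>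
      (le_div_iff₀' (wt_rpow_pos x _)).2 (((h i).1 t ht).2 m hm x)
  · exact (continuousOn_tsum (fun i => (h i).2 m hm) hc fun i p hp => hb m hm i p.1 hp.1 p.2).congr
      fun p hp => e m hm p.1 hp.1 p.2

lemma TD.tsum (hW : 0 ≤ W) {F G : ℕ → 𝓣} {c : ℕ → ℝ} (hc : Summable c)
    (hF : ∀ i, SG T W (c i) 0 (F i)) (hG : ∀ i, SG T W (c i) 0 (G i)) (h : ∀ i, TD T (F i) (G i)) :
    TD T (fun t x => ∑' i, F i t x) (fun t x => ∑' i, G i t x) := by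
  intro t ht x
  have hb : ∀ {F : ℕ → 𝓣}, (∀ i, SG T W (c i) 0 (F i)) → ∀ i, ∀ t ∈ Icc 0 T,
    ‖F i t x‖ ≤ c i := fun h i t ht => ((h i).1 t ht).abs_le_const hW x
  have hs : ∀ {F : ℕ → 𝓣}, (∀ i, SG T W (c i) 0 (F i)) → ∀ t ∈ Icc 0 T,
    Summable fun i => F i t x := fun h t ht => hc.of_norm_bounded fun i => hb h i t ht
  have hI : Set.uIoc 0 t ⊆ Icc 0 T := fun r hr => by
    rw [uIoc_of_le ht.1] at hr; exact ⟨hr.1.le, hr.2.trans ht.2⟩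
  have key := intervalIntegral.hasSum_integral_of_dominated_convergence (μ := volume)
    (F := fun i τ => G i τ x) (f := fun τ => ∑' i, G i τ x) (a := 0) (b := t) (fun i _ => c i)
    (fun i => by
      rw [uIoc_of_le ht.1]
      exact (TD.intervalIntegrable ((hG i).2.time_cont x) ht).aestronglyMeasurable)
    (fun i => ae_of_all _ fun τ hτ => hb hG i τ (hI hτ)) (ae_of_all _ fun _ _ => hc)
    intervalIntegrable_const (ae_of_all _ fun τ hτ => (hs hG τ (hI hτ)).hasSum)
  refine ((hs hF t ht).hasSum.unique ?_)
  have h0 := (hs hF 0 ⟨le_rfl, ht.1.trans ht.2⟩).hasSum.add key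
  exact h0.congr_fun fun i => h i t ht x

lemma TGen.tsum (hW : 0 ≤ W) {F : ℕ → 𝓣} {c : ℕ → ℝ} (hc : Summable c)
    (h : ∀ i, TGen T (SG T W (c i)) s p (F i)) :
    TGen T (SG T W (∑' i, c i)) s p (fun t x => ∑' i, F i t x) := by
  induction s generalizing F with
  | zero => exact SG.tsum hW hc h
  | succ s ih =>
    choose G hG using fun i => (h i).2
    exact ⟨SG.tsum hW hc fun i => (h i).1, _, TD.tsum hW hc (fun i => (h i).1.mono_N (Nat.zero_le _))
      (fun i => (hG i).2.base.mono_N (Nat.zero_le _)) fun i => (hG i).1,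
      ih fun i => (hG i).2⟩

end

section

variable {M₁ : M1Type n q}

lemma CG_of_forall_gt {f : 𝓣} (h : ∀ D > C, P.CG W D f) : P.CG W C f := by
  have h' := fun D hD => TGen.SG_tDeriv P.hT (h D hD)
  exact TGen.of_tDeriv (h' (C + 1) (by simp)).1 fun j hj =>
    ⟨fun t ht => ⟨(((h' (C + 1) (by simp)).2 j hj).1 t ht).1, fun m hm x =>
      le_of_forall_gt_imp_ge_of_dense fun D hD => (((h' D hD).2 j hj).1 t ht).2 m hm x⟩,
      ((h' (C + 1) (by simp)).2 j hj).2⟩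

/-- Co-closed forms with finite `XG`-bound, as a subspace of all forms vanishing off `[0,T]`. -/
def Par.XSub (P : Par n) (q : ℕ) : Submodule ℝ (FormT n q) where
  carrier := {u | (∀ I, ∀ t ∉ Icc 0 P.T, u I t = 0) ∧ CoClosed P.T u ∧ ∃ C, 0 ≤ C ∧ P.XG C u}
  zero_mem' := by
    have h0 : ∀ W, P.CG W 0 fun _ _ => 0 := fun W => TGen.SG_zero
    have hd : dT (0 : FormT n q) = 0 := funext fun J => funext fun t => dT_zero_of (fun _ _ => rfl) J
    exact ⟨fun _ _ _ => rfl, fun K t _ x => by simp [coDT, coDS, pd], 0, le_rfl,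
      fun I => h0 _, fun J => by rw [hd]; exact h0 _⟩
  add_mem' := by
    rintro u v ⟨u1, u2, C, hC, hu⟩ ⟨v1, v2, D, hD, hv⟩
    have e : u + v = (1 : ℝ) • u + (1 : ℝ) • v := by simp
    refine ⟨fun I t ht => ?_, e ▸ CoClosed_lin hu hv u2 v2 1 1, _, ?_, e ▸ XG_lin hu hv 1 1⟩
    · change u I t + v I t = 0
      rw [u1 I t ht, v1 I t ht, add_zero]
    · positivity
  smul_mem' := by
    rintro c u ⟨u1, u2, C, hC, hu⟩
    have h1 := CoClosed_lin hu hu u2 u2 c 0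
    have h2 := XG_lin hu hu c 0
    rw [zero_smul, add_zero] at h1 h2
    refine ⟨fun I t ht => ?_, h1, _, ?_, h2⟩
    · change c • u I t = 0
      rw [u1 I t ht, smul_zero]
    · positivity

/-- `XSub` with its own norm topology. -/
def Par.XSp (P : Par n) (q : ℕ) : Type := P.XSub q

instance : AddCommGroup (P.XSp q) := inferInstanceAs (AddCommGroup (P.XSub q))

instance : Module ℝ (P.XSp q) := inferInstanceAs (Module ℝ (P.XSub q))

instance : Norm (P.XSp q) := ⟨fun u => sInf {C | 0 ≤ C ∧ P.XG C u.1}⟩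

lemma XSp_norm_nonneg (u : P.XSp q) : 0 ≤ ‖u‖ := sInf_nonneg fun _ h => h.1

lemma XSp_XG (u : P.XSp q) : P.XG ‖u‖ u.1 := by
  have key : ∀ D > ‖u‖, P.XG D u.1 := fun D hD => by
    obtain ⟨C, hC, h⟩ := exists_lt_of_csInf_lt u.2.2.2 hD
    exact XG_mono hC.2 h.le
  exact ⟨fun I => CG_of_forall_gt fun D hD => (key D hD).1 I,
    fun J => CG_of_forall_gt fun D hD => (key D hD).2 J⟩

lemma XSp_norm_le (hC : 0 ≤ C) {u : P.XSp q} (h : P.XG C u.1) : ‖u‖ ≤ C :=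
  csInf_le ⟨0, fun _ h => h.1⟩ ⟨hC, h⟩

lemma XSp_core : NormedSpace.Core ℝ (P.XSp q) where
  norm_nonneg := XSp_norm_nonneg
  norm_smul := by
    have key : ∀ (c : ℝ) (u : P.XSp q), ‖c • u‖ ≤ |c| * ‖u‖ := fun c u => by
      have h := XG_lin (XSp_XG u) (XSp_XG u) c 0
      rw [abs_zero, zero_mul, add_zero, zero_smul, add_zero] at h
      exact XSp_norm_le (mul_nonneg (abs_nonneg _) (XSp_norm_nonneg u)) h
    intro c u
    rcases eq_or_ne c 0 with rfl | hc
    · exact le_antisymm (by simpa using key 0 u) (by simpa using XSp_norm_nonneg _)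
    · refine le_antisymm (key c u) ?_
      have h := key c⁻¹ (c • u)
      rw [inv_smul_smul₀ hc, abs_inv] at h
      rw [norm_eq_abs]
      calc |c| * ‖u‖ ≤ |c| * (|c|⁻¹ * ‖c • u‖) := by gcongr
        _ = ‖c • u‖ := by rw [mul_inv_cancel_left₀ (abs_ne_zero.2 hc)]
  norm_triangle := fun u v => by
    have h := XG_lin (XSp_XG u) (XSp_XG v) 1 1
    rw [abs_one, one_mul, one_mul, one_smul, one_smul] at h
    exact XSp_norm_le (add_nonneg (XSp_norm_nonneg u) (XSp_norm_nonneg v)) h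
  norm_eq_zero_iff := fun u => by
    refine ⟨fun h => ?_, fun h => ?_⟩
    · have h1 := XSp_XG u
      rw [h] at h1
      refine Subtype.ext (funext fun I => funext fun t => ?_)
      by_cases ht : t ∈ Icc 0 P.T
      · funext x
        exact abs_nonpos_iff.1 (((h1.1 I).sg.1 t ht).abs_le_const (by linarith [P.δ_pos]) x)
      · exact u.2.1 I t ht
    · refine le_antisymm (XSp_norm_le le_rfl ?_) (XSp_norm_nonneg u)
      obtain ⟨C, hC, hx⟩ := u.2.2.2
      have h2 := XG_lin hx hx 0 0
      rw [abs_zero, zero_mul, add_zero, zero_smul, add_zero] at h2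
      rw [h]; exact h2

instance : NormedAddCommGroup (P.XSp q) := NormedAddCommGroup.ofCore XSp_core

instance : NormedSpace ℝ (P.XSp q) := NormedSpace.ofCore XSp_core

lemma pd_tsum {F : ℕ → 𝓕} {c : ℕ → ℝ} (hc : Summable c) (hW : 0 ≤ W)
    (h : ∀ i, GX 1 W (c i) (F i)) (j : Fin n) (x : Spc n) :
    HasSum (fun i => pd j (F i) x) (pd j (fun x => ∑' i, F i x) x) := by
  have hb : ∀ i x, ‖fderiv ℝ (F i) x‖ ≤ c i := fun i x => by
    have := (h i).norm_le_const hW le_rfl x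
    rwa [norm_iteratedFDeriv_one] at this
  have h1 := hasFDerivAt_tsum hc (fun i x => ((h i).1.differentiable one_ne_zero x).hasFDerivAt)
    hb (hc.of_norm_bounded fun i => (h i).abs_le_const hW x) x
  have h2 := (hc.of_norm_bounded fun i => hb i x).hasSum.mapL
    (ContinuousLinearMap.apply ℝ ℝ (single j (1 : ℝ)))
  unfold pd
  rw [h1.fderiv]
  exact h2

lemma dS_hasSum {V : ℕ → FormS n q} {V' : FormS n q} {x : Spc n}
    (h : ∀ I j, HasSum (fun i => pd j (V i I) x) (pd j (V' I) x)) :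
    (∀ J, HasSum (fun i => dS (V i) J x) (dS V' J x)) ∧
      ∀ K, HasSum (fun i => coDS (V i) K x) (coDS V' K x) := by
  unfold dS coDS
  refine ⟨fun J => hasSum_sum fun i _ => ?_, fun K => (hasSum_sum fun i _ => ?_).neg⟩ <;>
  split_ifs
  exacts [(h _ i).mul_left _, hasSum_zero, (h _ i).mul_left _, hasSum_zero]

lemma XG_tsum {U : ℕ → FormT n q} {c : ℕ → ℝ} (hc : Summable c) (h : ∀ i, P.XG (c i) (U i)) :
    P.XG (∑' i, c i) (fun I t x => ∑' i, U i I t x) ∧ ∀ K, ∀ t ∈ Icc 0 P.T, ∀ x,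
      HasSum (fun i => coDT (U i) K t x) (coDT (fun I t x => ∑' i, U i I t x) K t x) := by
  have hδ : 0 ≤ P.δ := by linarith [P.δ_pos]
  have hpd : ∀ I, ∀ t ∈ Icc 0 P.T, ∀ j x, HasSum (fun i => pd j (U i I t) x)
      (pd j (fun x => ∑' i, U i I t x) x) := fun I t ht j x =>
    pd_tsum hc hδ (fun i => (((h i).1 I).sg.mono_N (by linarith [P.four_le])).1 t ht) j x
  have hS := fun t ht x => dS_hasSum (V := fun i I => U i I t) (x := x) fun I j => hpd I t ht j x
  exact ⟨⟨fun I => TGen.tsum hδ hc fun i => (h i).1 I, fun J => CG_congr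
    (TGen.tsum (by positivity) hc fun i => (h i).2 J) fun t ht x =>
      ((hS t ht x).1 J).tsum_eq.symm⟩, fun K t ht x => (hS t ht x).2 K⟩

lemma XSp_sum_apply (S : Finset ℕ) (U : ℕ → P.XSp q) (I : Idx n q) (t : ℝ) (x : Spc n) :
    (∑ i ∈ S, U i).1 I t x = ∑ i ∈ S, (U i).1 I t x := by
  have h : (∑ i ∈ S, U i).1 = ∑ i ∈ S, (U i).1 := map_sum (P.XSub q).subtype U S
  rw [h]; simp

instance : CompleteSpace (P.XSp q) := by
  refine NormedAddCommGroup.completeSpace_of_summable_imp_tendsto fun U hU => ?_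
  have hδ : 0 ≤ P.δ := by linarith [P.δ_pos]
  have h := XG_tsum hU fun i => XSp_XG (U i)
  let V : P.XSp q := ⟨fun I t x => ∑' i, (U i).1 I t x, fun I t ht => funext fun x => by
    simp [fun i => (U i).2.1 I t ht], fun K t ht x => by
      have h0 := h.2 K t ht x
      simp only [fun i => (U i).2.2.1 K t ht x] at h0
      exact h0.unique hasSum_zero, _, tsum_nonneg fun i => norm_nonneg (U i), h.1⟩
  refine ⟨V, tendsto_iff_norm_sub_tendsto_zero.2 ?_⟩
  · refine squeeze_zero (fun _ => norm_nonneg _) (fun m => ?_) (tendsto_sum_nat_add fun i => ‖U i‖)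
    rw [norm_sub_rev]
    refine XSp_norm_le (tsum_nonneg fun i => norm_nonneg _) (XG_congr
      (XG_tsum ((summable_nat_add_iff m).2 hU) fun i => XSp_XG (U (i + m))).1 fun I t ht x => ?_)
    have hs : Summable fun i => (U i).1 I t x := hU.of_norm_bounded fun i =>
      (((XSp_XG (U i)).1 I).sg.1 t ht).abs_le_const hδ x
    have e := hs.sum_add_tsum_nat_add m
    change (∑' i, (U i).1 I t x) - (∑ i ∈ range m, U i).1 I t x = _
    rw [XSp_sum_apply, ← e]
    ring

end

section

section Limits

variable {H : ℝ} {α : Type*} {l : Filter α} [l.NeBot] {F : α → ℝ → Spc n → ℝ}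
  {f : ℝ → Spc n → ℝ}

lemma HB.of_tendsto (hF : ∀ a, HB T θ W H N (F a)) (hV : 0 ≤ V)
    (hf : ∀ t ∈ Icc 0 T, ContDiff ℝ N (f t))
    (h : ∀ ε > 0, ∀ᶠ a in l, SG T V ε N (fun t x => F a t x - f t x)) : HB T θ W H N f := by
  have hc : ∀ t ∈ Icc 0 T, ∀ m ≤ N, ∀ x, Tendsto (fun a => ∇ m (F a t) x) l
      (nhds (∇ m (f t) x)) := fun t ht m hm x => by
    rw [tendsto_iff_norm_sub_tendsto_zero, Metric.tendsto_nhds]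
    intro ε hε
    filter_upwards [h (ε / 2) (half_pos hε)] with a ha
    have e := (ha.1 t ht).norm_le_const hV hm x
    rw [fun_iteratedFDeriv_sub_apply (((hF a).1 t ht).contDiffAt hm x)
      ((hf t ht).of_le (by exact_mod_cast hm)).contDiffAt] at e
    rw [dist_zero_right, norm_norm]
    linarith
  have hsub : ∀ a, ∀ t ∈ Icc 0 T, ∀ t' ∈ Icc 0 T, ∀ m ≤ N, ∀ x,
      ∇ m (fun x => F a t x - F a t' x) x =
        ∇ m (F a t) x - ∇ m (F a t') x :=
    fun a t ht t' ht' m hm x => fun_iteratedFDeriv_sub_apply (((hF a).1 t ht).contDiffAt hm x)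
      (((hF a).1 t' ht').contDiffAt hm x)
  refine ⟨fun t ht => ⟨hf t ht, fun m hm x => le_of_tendsto ((hc t ht m hm x).norm.const_mul _)
    (Eventually.of_forall fun a => ((hF a).1 t ht).2 m hm x)⟩, fun t ht t' ht' =>
    ⟨(hf t ht).sub (hf t' ht'), fun m hm x => ?_⟩, fun t ht m hm x y hxy =>
    le_of_tendsto (((hc t ht m hm x).sub (hc t ht m hm y)).norm.const_mul _)
    (Eventually.of_forall fun a => (hF a).2.2 t ht m hm x y hxy)⟩
  rw [fun_iteratedFDeriv_sub_apply ((hf t ht).of_le (by exact_mod_cast hm)).contDiffAt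
      ((hf t' ht').of_le (by exact_mod_cast hm)).contDiffAt]
  refine le_of_tendsto (((hc t ht m hm x).sub (hc t' ht' m hm x)).norm.const_mul _)
    (Eventually.of_forall fun a => ?_)
  rw [← hsub a t ht t' ht' m hm x]
  exact ((hF a).2.1 t ht t' ht').2 m hm x

lemma TGen.HB_of_tendsto (hT : 0 < T) (hθ : 0 < θ) (hW : 0 ≤ W)
    (hF : ∀ a, TGen T (fun N => HB T θ W H N) s p (F a)) (hV : 0 ≤ V)
    (hf : TGen T (SG T V C) s p f)
    (h : ∀ ε > 0, ∀ᶠ a in l, TGen T (SG T V ε) s p (fun t x => F a t x - f t x)) :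
    TGen T (fun N => HB T θ W H N) s p f := by
  induction s generalizing F f with
  | zero => exact HB.of_tendsto hF hV (SG.contDiff hf) h
  | succ s ih =>
    obtain ⟨hf, g, hg, hg'⟩ := hf
    choose G hG hG' using fun a => (hF a).2
    refine ⟨HB.of_tendsto (fun a => (hF a).1) hV hf.contDiff fun ε hε => (h ε hε).mono
      fun a ha => ha.1, g, hg, ih hG' hg' fun ε hε => (h ε hε).mono fun a ha => ?_⟩
    obtain ⟨-, k, hk, hk'⟩ := ha
    have c1 := fun a => ((hG' a).base.sct hW hθ).time_cont
    have c2 := hg'.base.2.time_cont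
    refine hk'.congr hT.le (fun N f g e h => h.congr e) fun t ht x => ?_
    have e : TD T (fun t x => F a t x - f t x) fun t x => G a t x - g t x :=
      ((hG a).add (hg.smul (-1)) (c1 a) fun x => (c2 x).const_smul (-1 : ℝ)).congr
        hT.le (fun t _ x => by ring) fun t _ x => by ring
    exact TD.unique hT e hk (fun x => (c1 a x).sub (c2 x)) hk'.base.2.time_cont t ht x

end Limits

variable {H : ℝ} {M₁ : M1Type n q}

lemma dT_sub (hu : P.XG C u) (hv : P.XG H v) (J : Idx n (q + 1))
    (ht : t ∈ Icc 0 P.T) (x : Spc n) : dT (u - v) J t x = dT u J t x - dT v J t x := by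
  have := dT_lin hu hv 1 (-1) J ht x
  rw [one_smul, neg_one_smul, ← sub_eq_add_neg] at this
  linarith

/-- Elements of `XSp` obeying the stronger bound `XH`. -/
def XHSet (P : Par n) (q : ℕ) (H : ℝ) : Set (P.XSp q) := {u | P.XH H u.1}

lemma isCompact_XHSet : IsCompact (XHSet P q H) := by
  have hδ : 0 ≤ P.δ := by linarith [P.δ_pos]
  have hδ' : 0 ≤ P.δ + 1 := by positivity
  refine isCompact_iff_totallyBounded_isComplete.2 ⟨totallyBounded_iff_ultrafilter.2 fun U hU =>
    Metric.cauchy_iff.2 ⟨U.neBot, fun ε hε => ?_⟩, IsClosed.isComplete ?_⟩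
  · have hU : ∀ᶠ u in (U : Filter (P.XSp q)), P.XH H u.1 := le_principal_iff.1 hU
    choose S hSU hS using fun I => TGen.exists_close P.hT U P.hθ0 hδ P.hη0 (half_pos hε)
      (hU.mono fun u hu => hu.1 I)
    choose S' hSU' hS' using fun J => TGen.exists_close P.hT U P.hθ0 hδ' P.hη0 (half_pos hε)
      (hU.mono fun u hu => hu.2 J)
    refine ⟨_, inter_mem (iInter_mem.2 hSU) (iInter_mem.2 hSU'), fun u hu v hv => ?_⟩
    rw [dist_eq_norm]
    refine (XSp_norm_le (u := u - v) (half_pos hε).le ⟨fun I => hS I u (mem_iInter.1 hu.1 I) v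
      (mem_iInter.1 hv.1 I), fun J => CG_congr (hS' J u (mem_iInter.1 hu.2 J) v
      (mem_iInter.1 hv.2 J)) fun t ht x => dT_sub (XSp_XG u) (XSp_XG v) J ht x⟩).trans_lt
      (half_lt_self hε)
  · refine IsSeqClosed.isClosed fun U u hU hu => ?_
    have h : ∀ ε > 0, ∀ᶠ a in atTop, P.XG ε ((U a).1 - u.1) := fun ε hε => by
      filter_upwards [(tendsto_iff_norm_sub_tendsto_zero.1 hu).eventually (gt_mem_nhds hε)] with a ha
      exact XG_mono (XSp_XG (U a - u)) ha.le
    refine ⟨fun I => TGen.HB_of_tendsto P.hT P.hθ0 (add_nonneg hδ P.hη0.le) (fun a => (hU a).1 I) hδ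
      ((XSp_XG u).1 I) fun ε hε => (h ε hε).mono fun a ha => ha.1 I, fun J =>
      TGen.HB_of_tendsto P.hT P.hθ0 (add_nonneg hδ' P.hη0.le) (fun a => (hU a).2 J) hδ'
      ((XSp_XG u).2 J) fun ε hε => (h ε hε).mono fun a ha => CG_congr (ha.2 J) fun t ht x =>
      (dT_sub (XSp_XG (U a)) (XSp_XG u) J ht x).symm⟩

end

section

variable {lam lam' δ : ℝ} {k : ℕ}

lemma eAniso0_neg {F : Type*} [NormedAddCommGroup F] (v : ℝ → Spc n → F) :
    eAniso0 T lam δ (fun t x => -v t x) = eAniso0 T lam δ v := by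
  have h : ∀ a b : F, ‖-a - -b‖ = ‖a - b‖ := fun a b => by rw [← neg_sub', norm_neg]
  simp only [eAniso0, eHol0, eOHold, eWSup, eWHold, norm_neg, h]

lemma tDeriv_neg (u : 𝓣) (j : ℕ) (t : ℝ) (x : Spc n) :
    tDeriv T j (-u) t x = -tDeriv T j u t x := by
  unfold tDeriv
  exact iteratedDerivWithin_fun_neg _

lemma mixDeriv_neg (u : 𝓣) (m j : ℕ) (t : ℝ) (x : Spc n) :
    mixDeriv T m j (-u) t x = -mixDeriv T m j u t x := by
  have h : (fun x => tDeriv T j (-u) t x) = -fun x => tDeriv T j u t x := funext fun x =>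
    tDeriv_neg u j t x
  rw [mixDeriv, h, iteratedFDeriv_neg_apply]; rfl

lemma AnisoReg.neg {u : 𝓣} (h : AnisoReg T k s u) : AnisoReg T k s (-u) := by
  refine ⟨fun x => (h.1 x).neg, fun j hj t ht => ?_, fun j m hj hm => ?_⟩
  · simp only [tDeriv_neg]
    exact (h.2.1 j hj t ht).neg
  · simp only [mixDeriv_neg]
    exact (h.2.2 j m hj hm).neg

lemma eAnisoKS_neg (u : 𝓣) : eAnisoKS T k s lam δ (-u) = eAnisoKS T k s lam δ u := by
  have h : ∀ m j, mixDeriv T m j (-u) = fun t x => -mixDeriv T m j u t x := fun m j =>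
    funext fun t => funext fun x => mixDeriv_neg u m j t x
  simp only [eAnisoKS, h, eAniso0_neg]

lemma FMemF_neg (h : FMemF T k s lam lam' δ u) :
    FMemF T k s lam lam' δ (-u) ∧ eFF T k s lam lam' δ (-u) = eFF T k s lam lam' δ u := by
  have e : eFF T k s lam lam' δ (-u) = eFF T k s lam lam' δ u := by
    simp only [eFF, eFn, Pi.neg_apply, eAnisoKS_neg]
  exact ⟨⟨fun I => (h.1 I).neg, e.trans_ne h.2⟩, e⟩

lemma FMemD_neg (h : FMemD T k s lam lam' δ u) :
    FMemD T k s lam lam' δ (-u) ∧ eFD T k s lam lam' δ (-u) = eFD T k s lam lam' δ u := by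
  have hp : ∀ (i : Fin n) (f : 𝓕) x, pd i (-f) x = -pd i f x := fun i f x => by
    unfold pd
    rw [fderiv_neg]; rfl
  have e1 : dT (-u) = -dT u := by
    funext J t x
    change ∑ i : Fin n, _ = -∑ i : Fin n, _
    rw [← sum_neg_distrib]
    refine sum_congr rfl fun i _ => ?_
    split_ifs
    · rw [← mul_neg, ← hp]; rfl
    · simp
  have e2 : coDT (-u) = -coDT u := by
    funext J t x
    change -∑ i : Fin n, _ = - -∑ i : Fin n, _
    refine congrArg _ ?_
    rw [← sum_neg_distrib]
    refine (sum_congr rfl fun i _ => ?_)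
    split_ifs
    · rw [← mul_neg, ← hp]; rfl
    · simp
  obtain ⟨h1, h2, h3⟩ := h
  have g1 := FMemF_neg h1
  have g2 := FMemF_neg h2
  have g3 := FMemF_neg h3
  rw [← e1] at g2
  rw [← e2] at g3
  exact ⟨⟨g1.1, g2.1, g3.1⟩, by rw [eFD, g1.2, g2.2, g3.2, eFD]⟩

end

/-- A bilinear compact operator on a Banach space `X`, together with an extended norm `e`
dominating the norm of `X` and controlling the values of the operator. -/
structure Smoothing {X : Type*} [NormedAddCommGroup X] [NormedSpace ℝ X]
    (B : X →L[ℝ] X →L[ℝ] X) (e : X → ℝ≥0∞) (A : ℝ) : Prop where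
  left : ∀ v, IsCompactOperator (B v)
  right : ∀ v, IsCompactOperator (B.flip v)
  add : ∀ x y, e (x + y) ≤ e x + e y
  neg : ∀ x, e (-x) = e x
  norm : ∀ x, ofReal ‖x‖ ≤ e x
  nonneg : 0 ≤ A
  bound : ∀ x y, e (B x y) ≤ ofReal (A * (‖x‖ * ‖y‖))
  inj : ∀ a b w, w + B a w + B w b = 0 → w = 0

namespace Smoothing

variable {X : Type*} [NormedAddCommGroup X] [NormedSpace ℝ X]
 {B : X →L[ℝ] X →L[ℝ] X} {e : X → ℝ≥0∞} {A : ℝ}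

lemma sub (h : Smoothing B e A) (x y : X) : e (x - y) ≤ e x + e y := by
  rw [sub_eq_add_neg, ← h.neg y]; exact h.add _ _

lemma ne_top (h : Smoothing B e A) (x y : X) : e (B x y) ≠ ⊤ := ((h.bound x y).trans_lt ENNReal.ofReal_lt_top).ne

lemma zero (h : Smoothing B e A) : e 0 = 0 := by simpa using h.bound 0 0

lemma bound_mul (h : Smoothing B e A) (x y : X) {K : ℝ} (hK : ‖x‖ ≤ K) : e (B x y) ≤ ofReal (A * K) * e y := by
  have hA := h.nonneg
  refine (h.bound x y).trans ?_
  rw [← mul_assoc, ofReal_mul (by positivity)]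
  exact mul_le_mul' (ofReal_le_ofReal (by gcongr)) (h.norm y)

lemma bound_mul' (h : Smoothing B e A) (x y : X) {K : ℝ} (hK : ‖y‖ ≤ K) : e (B x y) ≤ ofReal (A * K) * e x := by
  have hA := h.nonneg
  refine (h.bound x y).trans ?_
  rw [mul_comm ‖x‖, ← mul_assoc, ofReal_mul (by positivity)]
  exact mul_le_mul' (ofReal_le_ofReal (by gcongr)) (h.norm x)

lemma norm_le_one (h : Smoothing B e A) {x : X} (hx : e x ≤ 1) : ‖x‖ ≤ 1 :=
  ENNReal.ofReal_le_one.1 ((h.norm x).trans hx)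

lemma eq_zero (h : Smoothing B e A) {x : X} (hx : e x = 0) : x = 0 := by
  have := (h.norm x).trans hx.le
  simpa using this

lemma lipschitz (h : Smoothing B e A) (x y : X) (hxy : e (y - x) ≤ 1) :
    e (B y y - B x x) ≤ ofReal (A * (‖x‖ + 1) + A * ‖x‖) * e (y - x) := by
  have hA := h.nonneg
  have hy : ‖y‖ ≤ ‖x‖ + 1 := by
    have := norm_add_le x (y - x)
    rw [add_sub_cancel] at this
    linarith [h.norm_le_one hxy]
  have e1 : B y y - B x x = B (y - x) y + B x (y - x) := by
    simp only [map_sub, sub_apply]; abel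
  rw [e1, ofReal_add (by positivity) (by positivity), add_mul]
  exact (h.add _ _).trans (add_le_add (h.bound_mul' _ _ hy) (h.bound_mul _ _ le_rfl))

lemma continuous (h : Smoothing B e A) (x : X) {ε : ℝ≥0∞} (hε : ε ≠ 0) : ∃ ρ : ℝ≥0∞, ρ ≠ 0 ∧ ∀ y, e (y - x) < ρ →
    e (B y y - B x x) < ε ∧ e (y + B y y - (x + B x x)) < ε := by
  set K := ofReal (A * (‖x‖ + 1) + A * ‖x‖)
  have hK : K + 1 ≠ ⊤ := by simp [K]
  refine ⟨min 1 (ε / (K + 1)), ?_, fun y hy => ?_⟩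
  · simp [hε, hK]
  have h1 := h.lipschitz x y (hy.le.trans (min_le_left _ _))
  have h2 : (K + 1) * e (y - x) < ε := by
    rw [mul_comm]
    exact ENNReal.mul_lt_of_lt_div (hy.trans_le (min_le_right _ _))
  have h3 : y + B y y - (x + B x x) = (B y y - B x x) + (y - x) := by abel
  refine ⟨h1.trans_lt (lt_of_le_of_lt (by gcongr; exact le_self_add) h2), ?_⟩
  rw [h3]
  refine (h.add _ _).trans_lt (lt_of_le_of_lt ?_ h2)
  rw [add_mul, one_mul]
  exact add_le_add h1 le_rfl

lemma remainder (h : Smoothing B e A) (x : X) (hε : 0 < ε) : ∃ ρ : ℝ, 0 < ρ ∧ ∀ y,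
    e (y - x) < ofReal ρ →
    e (y + B y y - (x + B x x) - (y - x + B x (y - x) + B (y - x) x)) ≤
      ofReal ε * e (y - x) := by
  have hA := h.nonneg
  refine ⟨ε / (A + 1), by positivity, fun y hy => ?_⟩
  have e1 : y + B y y - (x + B x x) - (y - x + B x (y - x) + B (y - x) x) =
      B (y - x) (y - x) := by
    simp only [map_sub, sub_apply]; abel
  have h1 : ‖y - x‖ ≤ ε / (A + 1) :=
    (ENNReal.ofReal_le_ofReal_iff (by positivity)).1 ((h.norm _).trans hy.le)
  rw [e1]
  refine (h.bound_mul _ _ h1).trans ?_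
  gcongr
  rw [mul_div_assoc', div_le_iff₀ (by positivity)]
  nlinarith

lemma bound_deriv (h : Smoothing B e A) (v u : X) :
    e (u + B v u + B u v) ≤ ofReal (1 + A * ‖v‖ + A * ‖v‖) * e u := by
  have hA := h.nonneg
  rw [ofReal_add (by positivity) (by positivity),
    ofReal_add (by positivity) (by positivity), add_mul, add_mul, ENNReal.ofReal_one,
    one_mul]
  exact (h.add _ _).trans (add_le_add ((h.add _ _).trans (add_le_add le_rfl
    (h.bound_mul _ _ le_rfl))) (h.bound_mul' _ _ le_rfl))

lemma injective (h : Smoothing B e A) {u v : X} (huv : u + B u u = v + B v v) : u = v := by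
  refine sub_eq_zero.1 (h.inj u v _ ?_)
  rw [← sub_eq_zero] at huv
  rw [← huv]
  simp only [map_sub, sub_apply]; abel

lemma surjective [CompleteSpace X] (h : Smoothing B e A) (v : X) {f : X} (hf : e f ≠ ⊤) :
    ∃ u, e u ≠ ⊤ ∧ u + B v u + B u v = f := by
  obtain ⟨u, hu⟩ := (fredholm_bilinear B h.left h.right v (h.inj v v)).1 f
  refine ⟨u, ?_, hu⟩
  have e1 : u = f - B v u - B u v := by rw [← hu]; abel
  rw [e1]
  exact ne_top_of_le_ne_top (add_ne_top.2 ⟨add_ne_top.2 ⟨hf, h.ne_top _ _⟩,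
    h.ne_top _ _⟩) ((h.sub _ _).trans (add_le_add (h.sub _ _) le_rfl))

lemma isOpen [CompleteSpace X] (h : Smoothing B e A) (u : X) {r : ℝ≥0∞} (hr : r ≠ 0) :
    ∃ ε : ℝ≥0∞, ε ≠ 0 ∧ ∀ f, e (f - (u + B u u)) < ε → ∃ v, e (v - u) < r ∧ v + B v v = f := by
  have hA := h.nonneg
  have hm := (fredholm_bilinear B h.left h.right u (h.inj u u)).2
  have hr2 : r / 2 ≠ 0 := by simp [hr]
  have hS : ∀ᶠ v in nhds u, ofReal (A * (‖v - u‖ * ‖v‖) + A * (‖u‖ * ‖v - u‖)) < r / 2 := by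
    have hc : Continuous fun v : X =>
        ofReal (A * (‖v - u‖ * ‖v‖) + A * (‖u‖ * ‖v - u‖)) := by
      exact ENNReal.continuous_ofReal.comp (by fun_prop)
    exact hc.continuousAt.eventually_lt continuousAt_const (by simpa using pos_iff_ne_zero.2 hr2)
  have h1 : (fun v => v + B v v) '' {v | ofReal
      (A * (‖v - u‖ * ‖v‖) + A * (‖u‖ * ‖v - u‖)) < r / 2} ∈ nhds (u + B u u) := hm ▸ image_mem_map hS
  obtain ⟨ε, hε, h2⟩ := Metric.mem_nhds_iff.1 h1
  refine ⟨min (ofReal ε) (r / 2), by simp [hε, hr], fun f hf => ?_⟩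
  obtain ⟨v, hv, hvf⟩ := h2 (show f ∈ Metric.ball _ _ by
    rw [mem_ball_iff_norm]
    exact (ENNReal.ofReal_lt_ofReal_iff hε).1
      ((h.norm _).trans_lt (hf.trans_le (min_le_left _ _))))
  refine ⟨v, ?_, hvf⟩
  have e1 : v - u = (f - (u + B u u)) - (B (v - u) v + B u (v - u)) := by
    rw [← hvf]; simp only [map_sub, sub_apply]; abel
  rw [e1]
  refine (h.sub _ _).trans_lt ?_
  rw [← ENNReal.add_halves r]
  refine ENNReal.add_lt_add (hf.trans_le (min_le_right _ _)) (lt_of_le_of_lt ?_ hv)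
  rw [ofReal_add (by positivity) (by positivity)]
  exact (h.add _ _).trans (add_le_add (h.bound _ _) (h.bound _ _))

end Smoothing

section Concrete

variable {H H' : ℝ} {k : ℕ} {lam lam' β : ℝ} (M₁ : M1Type n q)

lemma XH_mono (h : P.XH H u) (hH : H ≤ H') : P.XH H' u :=
  ⟨fun I => TGen.HB_mono (h.1 I) hH, fun J => TGen.HB_mono (h.2 J) hH⟩

lemma XH_sub (hu : P.XH H u) (hv : P.XH H' v) : P.XH (H + H') (u - v) := by
  have hW : 0 ≤ P.δ := by linarith [P.δ_pos]
  have hη := P.hη0.le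
  have key : ∀ {W : ℝ} {f g : 𝓣}, 0 ≤ W → P.CH W H f → P.CH W H' g →
      P.CH W (H + H') fun t x => f t x + -1 * g t x := fun hW hf hg => by
    have := TGen.HB_add hW P.hθ0 hf (TGen.HB_smul hg (-1))
    rwa [abs_neg, abs_one, one_mul] at this
  refine ⟨fun I => TGen.congr P.hT.le (key (by positivity) (hu.1 I) (hv.1 I))
    (fun N f g e h => h.congr e) fun t _ x => ?_, fun J => TGen.congr P.hT.le (key (by positivity)
    (hu.2 J) (hv.2 J)) (fun N f g e h => h.congr e) fun t ht x => ?_⟩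
  · change u I t x - v I t x = _
    ring
  · rw [dT_sub hu.xg hv.xg J ht]; ring

/-- The bilinear map `BX` on `XSp`. -/
def bxFun (u w : P.XSp q) : P.XSp q := ⟨P.BX M₁ u.1 w.1, fun _ _ ht => funext fun _ => if_neg ht,
  BX_coClosed P (XSp_XG u) (XSp_XG w) (norm_nonneg u) (norm_nonneg w), by
    obtain ⟨A, hA, h⟩ := BX_XH P M₁
    exact ⟨_, by positivity, (h _ _ _ _ (norm_nonneg u) (norm_nonneg w) (XSp_XG u)
      (XSp_XG w)).xg⟩⟩

lemma bxFun_lin (u v w : P.XSp q) (a b : ℝ) :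
    bxFun M₁ (a • u + b • v) w = a • bxFun M₁ u w + b • bxFun M₁ v w ∧
    bxFun M₁ w (a • u + b • v) = a • bxFun M₁ w u + b • bxFun M₁ w v := by
  have hu := XG_mono (XSp_XG u) (le_max_left ‖u‖ (max ‖v‖ ‖w‖))
  have hv := XG_mono (XSp_XG v) ((le_max_left ‖v‖ ‖w‖).trans (le_max_right ‖u‖ _))
  have hw := XG_mono (XSp_XG w) ((le_max_right ‖v‖ ‖w‖).trans (le_max_right ‖u‖ _))
  have h0 := (norm_nonneg u).trans (le_max_left ‖u‖ (max ‖v‖ ‖w‖))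
  exact ⟨Subtype.ext (BX_lin_left h0 hu hv hw a b), Subtype.ext (BX_lin_right h0 hu hv hw a b)⟩

lemma exists_bxFun_bound : ∃ A, 0 ≤ A ∧ ∀ u w : P.XSp q,
    P.XH (A * (‖u‖ * ‖w‖)) (bxFun M₁ u w).1 ∧ ‖bxFun M₁ u w‖ ≤ A * ‖u‖ * ‖w‖ := by
  obtain ⟨A, hA, h⟩ := BX_XH P M₁
  refine ⟨A, hA, fun u w => ?_⟩
  have h1 := h _ _ _ _ (norm_nonneg u) (norm_nonneg w) (XSp_XG u) (XSp_XG w)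
  refine ⟨h1, ?_⟩
  rw [mul_assoc]
  exact XSp_norm_le (u := bxFun M₁ u w) (by positivity) h1.xg

/-- `bxFun` as a continuous bilinear map. -/
def bxL (P : Par n) (M₁ : M1Type n q) : P.XSp q →L[ℝ] P.XSp q →L[ℝ] P.XSp q :=
  LinearMap.mkContinuous₂ (LinearMap.mk₂ ℝ (bxFun M₁)
    (fun u v w => by simpa using (bxFun_lin M₁ u v w 1 1).1)
    (fun a u w => by simpa using (bxFun_lin M₁ u u w a 0).1)
    (fun w u v => by simpa using (bxFun_lin M₁ u v w 1 1).2)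
    (fun a w u => by simpa using (bxFun_lin M₁ u u w a 0).2))
    (exists_bxFun_bound (P := P) M₁).choose fun u w =>
      ((exists_bxFun_bound (P := P) M₁).choose_spec.2 u w).2

lemma bxL_apply (u w : P.XSp q) : (bxL P M₁ u w).1 = P.BX M₁ u.1 w.1 := rfl

lemma bxL_compact (v : P.XSp q) :
    IsCompactOperator (bxL P M₁ v) ∧ IsCompactOperator ((bxL P M₁).flip v) := by
  obtain ⟨A, hA, h⟩ := exists_bxFun_bound (P := P) M₁
  refine ⟨⟨XHSet P q (A * ‖v‖), isCompact_XHSet, mem_of_superset (Metric.ball_mem_nhds 0 one_pos)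
    fun u hu => XH_mono (h v u).1 ?_⟩, ⟨XHSet P q (A * ‖v‖), isCompact_XHSet, mem_of_superset
    (Metric.ball_mem_nhds 0 one_pos) fun u hu => XH_mono (h u v).1 ?_⟩⟩ <;>
  have := (mem_ball_zero_iff.1 hu).le
  · gcongr; exact mul_le_of_le_one_right (norm_nonneg _) this
  · gcongr; exact mul_le_of_le_one_left (norm_nonneg _) this

/-- The norm `eFD` on `XSp`, infinite outside the space of `FMemD`. -/
def eX (k : ℕ) (lam lam' : ℝ) (x : P.XSp q) : ℝ≥0∞ :=
  if FMemD P.T k P.s lam lam' P.δ x.1 then eFD P.T k P.s lam lam' P.δ x.1 else ⊤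

lemma eX_of {x : P.XSp q} (h : FMemD P.T k P.s lam lam' P.δ x.1) :
    eX k lam lam' x = eFD P.T k P.s lam lam' P.δ x.1 := if_pos h

lemma eX_ne_top {x : P.XSp q} : eX k lam lam' x ≠ ⊤ ↔ FMemD P.T k P.s lam lam' P.δ x.1 := by
  refine ⟨fun h => by_contra fun hx => h (if_neg hx), fun h => ?_⟩
  rw [eX_of h]
  exact add_ne_top.2 ⟨add_ne_top.2 ⟨h.1.2, h.2.1.2⟩, h.2.2.2⟩

lemma eX_interp (hp : P.p = k + 1) (h0 : 0 < lam) (hl : lam ≤ lam') (hβ : lam' ≤ P.θ * β)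
    (hβ1 : β ≤ 1) : ∃ A, 0 ≤ A ∧ ∀ S H (x : P.XSp q), ‖x‖ ≤ S → S ≤ H → P.XH H x.1 →
      eX k lam lam' x ≤ ofReal (A * (S ^ (1 - β) * H ^ β)) := by
  obtain ⟨A, hA, h⟩ := FMemD_interp hp h0 hl hβ hβ1 q
  refine ⟨A, hA, fun S H x hS hSH hx => ?_⟩
  have h1 := h S H x.1 ((norm_nonneg x).trans hS) hSH (XG_mono (XSp_XG x) hS) hx x.2.2.1
  rw [eX_of h1.1]
  exact h1.2

lemma bxL_smoothing [Nonempty (Idx n q)] (hp : P.p = k + 1) (h0 : 0 < lam) (hl : lam ≤ lam')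
    (hβ0 : 0 ≤ β) (hβ : lam' ≤ P.θ * β) (hβ1 : β ≤ 1) :
    ∃ A, Smoothing (bxL P M₁) (eX k lam lam') A := by
  obtain ⟨A, hA, h⟩ := exists_bxFun_bound (P := P) M₁
  obtain ⟨A', hA', h'⟩ := eX_interp (q := q) hp h0 hl hβ hβ1
  refine ⟨A' * A, fun v => (bxL_compact M₁ v).1, fun v => (bxL_compact M₁ v).2, fun x y => ?_,
    fun x => ?_, fun x => ?_, by positivity, fun x y => ?_, fun a b w e => ?_⟩
  · by_cases hx : FMemD P.T k P.s lam lam' P.δ x.1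
    · by_cases hy : FMemD P.T k P.s lam lam' P.δ y.1
      · have := FMemD_add h0.ne' (h0.trans_le hl).ne' hp hx hy
        rw [eX_of hx, eX_of hy, eX_of this.1]
        exact this.2
      · rw [eX, eX, eX, if_neg hy, add_top]; exact le_top
    · rw [eX, eX, if_neg hx, top_add]; exact le_top
  · by_cases hx : FMemD P.T k P.s lam lam' P.δ x.1
    · have := FMemD_neg hx
      rw [eX_of hx, eX_of this.1]
      exact this.2
    · rw [eX, eX, if_neg hx, if_neg fun hn => hx ?_]
      have := (FMemD_neg hn).1
      rwa [show -(-x : P.XSp q).1 = x.1 from neg_neg x.1] at this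
  · by_cases hx : FMemD P.T k P.s lam lam' P.δ x.1
    · have hn := eX_ne_top.2 hx
      rw [eX_of hx] at hn ⊢
      rw [← ENNReal.ofReal_toReal hn]
      exact ofReal_le_ofReal (XSp_norm_le ENNReal.toReal_nonneg (hx.exists_XG hp))
    · rw [eX, if_neg hx]; exact le_top
  · have hS : 0 ≤ A * (‖x‖ * ‖y‖) := by positivity
    have h1 := h' _ _ (bxL P M₁ x y) ((h x y).2.trans_eq (mul_assoc _ _ _)) le_rfl (h x y).1
    rwa [← rpow_add_of_nonneg hS (by linarith) hβ0, sub_add_cancel, rpow_one,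
      ← mul_assoc] at h1
  · set K := max ‖a‖ (max ‖b‖ ‖w‖)
    have := volterra_unique (M₁ := M₁) (XG_mono (XSp_XG a) (le_max_left ‖a‖ (max ‖b‖ ‖w‖)))
      (XG_mono (XSp_XG b) ((le_max_left ‖b‖ ‖w‖).trans (le_max_right ‖a‖ _)))
      (XG_mono (XSp_XG w) ((le_max_right ‖b‖ ‖w‖).trans (le_max_right ‖a‖ _)))
      fun I t _ x => congrFun (congrFun (congrFun (congrArg Subtype.val e) I) t) x
    refine Subtype.ext (funext fun I => funext fun t => ?_)
    by_cases ht : t ∈ Icc 0 P.T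
    · exact funext (this I t ht)
    · exact w.2.1 I t ht

lemma bxL_subseq (hp : P.p = k + 1) (h0 : 0 < lam) (hl : lam ≤ lam')
    (hβ0 : 0 < β) (hβ : lam' ≤ P.θ * β) (hβ1 : β < 1) {x : ℕ → P.XSp q} (hx : ∀ m, ‖x m‖ ≤ C) :
    ∃ φ : ℕ → ℕ, StrictMono φ ∧ ∃ g : P.XSp q, eX k lam lam' g ≠ ⊤ ∧
      Tendsto (fun m => eX k lam lam' (bxL P M₁ (x (φ m)) (x (φ m)) - g)) atTop (nhds 0) := by
  obtain ⟨A, hA, h⟩ := exists_bxFun_bound (P := P) M₁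
  obtain ⟨A', hA', h'⟩ := eX_interp (q := q) hp h0 hl hβ hβ1.le
  have hC : 0 ≤ C := (norm_nonneg _).trans (hx 0)
  obtain ⟨g, hg, φ, hφ, hlim⟩ := (isCompact_XHSet (P := P) (q := q) (H := A * (C * C))).tendsto_subseq
    (x := fun m => bxL P M₁ (x m) (x m)) fun m => XH_mono (h (x m) (x m)).1 (by
      have := hx m
      gcongr)
  set H := A * (C * C)
  have hH : 0 ≤ H := by positivity
  refine ⟨φ, hφ, g, ((h' (max ‖g‖ H) (max ‖g‖ H) g (le_max_left _ _) le_rfl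
    (XH_mono hg (le_max_right _ _))).trans_lt ENNReal.ofReal_lt_top).ne, ?_⟩
  set ε : ℕ → ℝ := fun m => ‖bxL P M₁ (x (φ m)) (x (φ m)) - g‖
  have hε : Tendsto ε atTop (nhds 0) := tendsto_iff_norm_sub_tendsto_zero.1 hlim
  have key : Tendsto (fun m => ofReal (A' * (ε m ^ (1 - β) * (H + H + ε m) ^ β))) atTop
      (nhds 0) := by
    have := ENNReal.tendsto_ofReal (((hε.rpow_const (p := 1 - β) (Or.inr (by linarith))).mul
      ((hε.const_add (H + H)).rpow_const (p := β) (Or.inr hβ0.le))).const_mul A')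
    rwa [zero_rpow (by linarith), zero_mul, mul_zero, ENNReal.ofReal_zero] at this
  refine tendsto_of_tendsto_of_tendsto_of_le_of_le tendsto_const_nhds key (fun _ => zero_le)
    fun m => h' _ _ _ le_rfl (by linarith) (XH_mono (XH_sub (XH_mono (h (x (φ m)) (x (φ m))).1 ?_)
      hg) (le_add_of_nonneg_right (norm_nonneg _)))
  change _ ≤ A * (C * C)
  gcongr <;> exact hx _

end Concrete

section Transport

variable {k : ℕ} {lam lam' β : ℝ} {M₁ : M1Type n q}

lemma BX_congr {u' w' : FormT n q} (e : EqOnT P.T u u') (e' : EqOnT P.T w w') :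
    P.BX M₁ u w = P.BX M₁ u' w' := by
  funext I t x
  refine if_congr Iff.rfl (congrFun (RG_congr (fun J t ht x => ?_) _ _) x) rfl
  have : (fun I => Mb M₁ u w I t) = fun I => Mb M₁ u' w' I t := funext fun I => funext fun x => by
    unfold Mb fib
    simp only [dT_congr e _ ht, e' _ t ht]
  exact congrFun (congrFun (congrArg ext this) J) x

lemma XSp_ext {x y : P.XSp q} (h : EqOnT P.T x.1 y.1) : x = y := by
  refine Subtype.ext (funext fun I => funext fun t => ?_)
  by_cases ht : t ∈ Icc 0 P.T
  · exact funext (h I t ht)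
  · exact (x.2.1 I t ht).trans (y.2.1 I t ht).symm

variable {x y : P.XSp q}

lemma EqOnT.fMemD (h : EqOnT P.T u x.1) (hx : eX k lam lam' x ≠ ⊤) :
    FMemD P.T k P.s lam lam' P.δ u ∧ CoClosed P.T u :=
  ⟨FMemD_congr P.hT h (eX_ne_top.1 hx), CoClosed_congr x.2.2.1 h⟩

lemma EqOnT.eFD_eq (h : EqOnT P.T u x.1) (hx : eX k lam lam' x ≠ ⊤) :
    eFD P.T k P.s lam lam' P.δ u = eX k lam lam' x := by
  rw [eX_of (eX_ne_top.1 hx)]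
  exact eFD_congr h

lemma EqOnT.eFD_le (h : EqOnT P.T u x.1) : eFD P.T k P.s lam lam' P.δ u ≤ eX k lam lam' x := by
  by_cases hx : eX k lam lam' x = ⊤
  · rw [hx]; exact le_top
  · exact (h.eFD_eq hx).le

lemma exists_EqOnT (hp : P.p = k + 1) (hu : FMemD P.T k P.s lam lam' P.δ u)
    (cu : CoClosed P.T u) : ∃ x : P.XSp q, EqOnT P.T u x.1 ∧ eX k lam lam' x ≠ ⊤ := by
  have e : EqOnT P.T (fun I t x => if t ∈ Icc 0 P.T then u I t x else 0) u :=
    fun I t ht x => if_pos ht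
  exact ⟨⟨_, fun I t ht => funext fun x => if_neg ht, CoClosed_congr cu e, _,
    ENNReal.toReal_nonneg, XG_congr (hu.exists_XG hp) e⟩, fun I t ht x => (e I t ht x).symm,
    eX_ne_top.2 (FMemD_congr P.hT e hu)⟩

lemma EqOnT.add_X (hu : EqOnT P.T u x.1) (hv : EqOnT P.T v y.1) : EqOnT P.T (u + v) (x + y).1 :=
  fun I t ht z => congrArg₂ (· + ·) (hu I t ht z) (hv I t ht z)

lemma EqOnT.sub_X (hu : EqOnT P.T u x.1) (hv : EqOnT P.T v y.1) : EqOnT P.T (u - v) (x - y).1 :=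
  fun I t ht z => congrArg₂ (· - ·) (hu I t ht z) (hv I t ht z)

lemma EqOnT.phiNpot (M₂ : M2Type n q) (hq : 1 ≤ q) (hu : EqOnT P.T u x.1) :
    EqOnT P.T (PhiNpot P.μ M₁ M₂ u) (bxL P M₁ x x).1 := fun I t ht z => by
  rw [PhiNpot_eq M₂ hq (norm_nonneg x) (XG_congr (XSp_XG x) hu) (CoClosed_congr x.2.2.1 hu) I t ht,
    BX_congr hu hu, bxL_apply]

lemma EqOnT.phiNmap (M₂ : M2Type n q) (hq : 1 ≤ q) (hu : EqOnT P.T u x.1) :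
    EqOnT P.T (PhiNmap P.μ M₁ M₂ u) (x + bxL P M₁ x x).1 := hu.add_X (hu.phiNpot M₂ hq)

lemma EqOnT.phiLmap (M₂ : M2Type n q) (hq : 1 ≤ q) (hv : EqOnT P.T v y.1) (hu : EqOnT P.T u x.1) :
    EqOnT P.T (PhiLmap P.μ M₁ M₂ v u) (x + bxL P M₁ y x + bxL P M₁ x y).1 := fun I t ht z => by
  rw [PhiBop_eq M₂ hq ((norm_nonneg x).trans (le_max_left _ ‖y‖))
    (XG_mono (XG_congr (XSp_XG x) hu) (le_max_left _ _))
    (XG_mono (XG_congr (XSp_XG y) hv) (le_max_right _ _)) (CoClosed_congr x.2.2.1 hu)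
    (CoClosed_congr y.2.2.1 hv) I t ht, BX_congr hu hv, BX_congr hv hu]
  exact congrArg (fun a => a + _ + _) (hu I t ht z)

end Transport

end

/-- the map `Φ_q d_q Ψ_{μ,q}𝒩_q` on
`𝓕^{k,𝐬(s,λ,λ',δ)}_{T,Λ^q,𝒟_{d⊕d*}} ∩ 𝒮_{d^*}` is continuous and compact, and
`I + Φ_q d_q Ψ_{μ,q}𝒩_q` is continuous, Fredholm, injective and open. -/
theorem stmt16 (n q s k : ℕ) (hn : 2 ≤ n) (hq1 : 1 ≤ q) (hq2 : q ≤ n - 1)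
    (hs : 1 ≤ s) (hk : 1 ≤ k) (lam lam' δ μ T : ℝ)
    (h1 : 0 < lam) (h2 : lam < lam') (h3 : lam' < 1)
    (hδ1 : (n : ℝ) / 2 < δ) (hδ2 : δ < n) (hδ3 : δ ≠ (n : ℝ) - 1)
    (hμ : 0 < μ) (hT : 0 < T) (M₁ : M1Type n q) (M₂ : M2Type n q) :
    -- `Φ d Ψ𝒩` maps the space into itself
    (∀ u : FormT n q, FMemD T k s lam lam' δ u → CoClosed T u →
      FMemD T k s lam lam' δ (PhiNpot μ M₁ M₂ u) ∧ CoClosed T (PhiNpot μ M₁ M₂ u)) ∧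
    -- `Φ d Ψ𝒩` is continuous
    (∀ u : FormT n q, FMemD T k s lam lam' δ u → CoClosed T u → ∀ ε : ℝ≥0∞, ε ≠ 0 →
      ∃ ρ : ℝ≥0∞, ρ ≠ 0 ∧ ∀ v : FormT n q, FMemD T k s lam lam' δ v → CoClosed T v →
        eFD T k s lam lam' δ (v - u) < ρ →
        eFD T k s lam lam' δ (PhiNpot μ M₁ M₂ v - PhiNpot μ M₁ M₂ u) < ε) ∧
    -- `Φ d Ψ𝒩` is compact
    (∀ u : ℕ → FormT n q,
      (∃ C : ℝ≥0∞, C ≠ ⊤ ∧ ∀ m, FMemD T k s lam lam' δ (u m) ∧ CoClosed T (u m) ∧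
        eFD T k s lam lam' δ (u m) ≤ C) →
      ∃ φ : ℕ → ℕ, StrictMono φ ∧ ∃ g : FormT n q,
        FMemD T k s lam lam' δ g ∧ CoClosed T g ∧
        Tendsto (fun m => eFD T k s lam lam' δ (PhiNpot μ M₁ M₂ (u (φ m)) - g))
          atTop (nhds 0)) ∧
    -- `I + Φ d Ψ𝒩` is continuous
    (∀ u : FormT n q, FMemD T k s lam lam' δ u → CoClosed T u → ∀ ε : ℝ≥0∞, ε ≠ 0 →
      ∃ ρ : ℝ≥0∞, ρ ≠ 0 ∧ ∀ v : FormT n q, FMemD T k s lam lam' δ v → CoClosed T v →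
        eFD T k s lam lam' δ (v - u) < ρ →
        eFD T k s lam lam' δ (PhiNmap μ M₁ M₂ v - PhiNmap μ M₁ M₂ u) < ε) ∧
    -- `I + Φ d Ψ𝒩` is Fredholm: its Fréchet derivative `I + Φ d Ψ B_q(v,·)` at any
    -- point `v` is bounded, with finite dimensional kernel and cokernel and closed range
    (∀ v : FormT n q, FMemD T k s lam lam' δ v → CoClosed T v →
      (∀ ε : ℝ, 0 < ε → ∃ ρ : ℝ, 0 < ρ ∧
        ∀ u : FormT n q, FMemD T k s lam lam' δ u → CoClosed T u →
        eFD T k s lam lam' δ (u - v) < ENNReal.ofReal ρ →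
        eFD T k s lam lam' δ
            (PhiNmap μ M₁ M₂ u - PhiNmap μ M₁ M₂ v - PhiLmap μ M₁ M₂ v (u - v)) ≤
          ENNReal.ofReal ε * eFD T k s lam lam' δ (u - v)) ∧
      (∃ C : ℝ, 0 < C ∧ ∀ u : FormT n q, FMemD T k s lam lam' δ u → CoClosed T u →
        (FMemD T k s lam lam' δ (PhiLmap μ M₁ M₂ v u) ∧
          CoClosed T (PhiLmap μ M₁ M₂ v u)) ∧
        eFD T k s lam lam' δ (PhiLmap μ M₁ M₂ v u) ≤
          ENNReal.ofReal C * eFD T k s lam lam' δ u) ∧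
      (∃ d : ℕ, ∀ (mm : ℕ) (g : Fin mm → FormT n q),
        (∀ i, FMemD T k s lam lam' δ (g i) ∧ CoClosed T (g i) ∧
          eFD T k s lam lam' δ (PhiLmap μ M₁ M₂ v (g i)) = 0) →
        (∀ c : Fin mm → ℝ, eFD T k s lam lam' δ (∑ i, c i • g i) = 0 → ∀ i, c i = 0) →
        mm ≤ d) ∧
      (∀ f : FormT n q, FMemD T k s lam lam' δ f → CoClosed T f →
        (∀ ε : ℝ≥0∞, ε ≠ 0 → ∃ u : FormT n q, FMemD T k s lam lam' δ u ∧ CoClosed T u ∧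
          eFD T k s lam lam' δ (PhiLmap μ M₁ M₂ v u - f) < ε) →
        ∃ u : FormT n q, FMemD T k s lam lam' δ u ∧ CoClosed T u ∧
          eFD T k s lam lam' δ (PhiLmap μ M₁ M₂ v u - f) = 0) ∧
      (∃ (d : ℕ) (g : Fin d → FormT n q),
        (∀ i, FMemD T k s lam lam' δ (g i) ∧ CoClosed T (g i)) ∧
        ∀ f : FormT n q, FMemD T k s lam lam' δ f → CoClosed T f →
          ∃ (c : Fin d → ℝ) (u : FormT n q), FMemD T k s lam lam' δ u ∧ CoClosed T u ∧
            eFD T k s lam lam' δ (f - PhiLmap μ M₁ M₂ v u - ∑ i, c i • g i) = 0)) ∧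
    -- `I + Φ d Ψ𝒩` is injective
    (∀ u v : FormT n q, FMemD T k s lam lam' δ u → CoClosed T u →
      FMemD T k s lam lam' δ v → CoClosed T v →
      EqOnT T (PhiNmap μ M₁ M₂ u) (PhiNmap μ M₁ M₂ v) → EqOnT T u v) ∧
    -- `I + Φ d Ψ𝒩` is open
    (∀ u : FormT n q, FMemD T k s lam lam' δ u → CoClosed T u → ∀ r : ℝ≥0∞, r ≠ 0 →
      ∃ ε : ℝ≥0∞, ε ≠ 0 ∧ ∀ f : FormT n q, FMemD T k s lam lam' δ f → CoClosed T f →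
        eFD T k s lam lam' δ (f - PhiNmap μ M₁ M₂ u) < ε →
        ∃ v : FormT n q, FMemD T k s lam lam' δ v ∧ CoClosed T v ∧
          eFD T k s lam lam' δ (v - u) < r ∧ EqOnT T (PhiNmap μ M₁ M₂ v) f) := by
  have hn0 : (2 : ℝ) ≤ n := by exact_mod_cast hn
  obtain ⟨P, rfl, rfl, rfl, rfl, hp, hθ⟩ : ∃ P : Par n, P.T = T ∧ P.μ = μ ∧ P.s = s ∧ P.δ = δ ∧
      P.p = k + 1 ∧ lam' < P.θ :=
    ⟨{ T := T, δ := δ, θ := (1 + lam') / 2, η := min (n - δ) (δ - 1), μ := μ, s := s, p := k + 1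
       hn := hn, hT := hT, hμ := hμ, hθ0 := by linarith, hθ1 := by linarith
       hη0 := lt_min (by linarith) (by linarith), hδ := hδ1
       hη1 := by linarith [min_le_left (n - δ) (δ - 1)]
       hη2 := by linarith [min_le_right (n - δ) (δ - 1)], hs := hs, hp := by omega },
      rfl, rfl, rfl, rfl, rfl, by change lam' < (1 + lam') / 2; linarith⟩
  have hne : Nonempty (Idx n q) := by
    obtain ⟨I, -, hI⟩ := Finset.exists_subset_card_eq
      (show q ≤ (Finset.univ : Finset (Fin n)).card by rw [Finset.card_fin]; omega)
    exact ⟨⟨I, hI⟩⟩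
  have hβ0 : 0 < lam' / P.θ := div_pos (h1.trans h2) P.hθ0
  have hβ1 : lam' / P.θ < 1 := (div_lt_one P.hθ0).2 hθ
  have hβ : lam' ≤ P.θ * (lam' / P.θ) := (mul_div_cancel₀ _ P.hθ0.ne').ge
  obtain ⟨A, hS⟩ := bxL_smoothing (q := q) M₁ hp h1 h2.le hβ0.le hβ hβ1.le
  set B := bxL P M₁
  have lift := fun (u : FormT n q) hu cu => exists_EqOnT (lam := lam) (lam' := lam') (u := u) hp hu cu
  have fin : ∀ {x y : P.XSp q}, eX k lam lam' x ≠ ⊤ → eX k lam lam' y ≠ ⊤ →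
      eX k lam lam' (x - y) ≠ ⊤ := fun hx hy =>
    ne_top_of_le_ne_top (ENNReal.add_ne_top.2 ⟨hx, hy⟩) (hS.sub _ _)
  have self : ∀ x : P.XSp q, EqOnT P.T x.1 x.1 := fun x _ _ _ _ => rfl
  refine ⟨fun u hu cu => ?_, fun u hu cu ε hε => ?_, fun u hu => ?_, fun u hu cu ε hε => ?_,
    fun v hv cv => ?_, fun u v hu cu hv cv h => ?_, fun u hu cu r hr => ?_⟩
  · obtain ⟨x, hx, -⟩ := lift u hu cu
    exact (hx.phiNpot M₂ hq1).fMemD (hS.ne_top x x)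
  · obtain ⟨x, hx, fx⟩ := lift u hu cu
    obtain ⟨ρ, hρ, h⟩ := hS.continuous x hε
    refine ⟨ρ, hρ, fun v hv cv huv => ?_⟩
    obtain ⟨y, hy, fy⟩ := lift v hv cv
    rw [(hy.sub_X hx).eFD_eq (fin fy fx)] at huv
    exact ((hy.phiNpot M₂ hq1).sub_X (hx.phiNpot M₂ hq1)).eFD_le.trans_lt (h y huv).1
  · obtain ⟨C, hC, hu⟩ := hu
    choose x hx fx using fun m => lift (u m) (hu m).1 (hu m).2.1
    have hb : ∀ m, ‖x m‖ ≤ C.toReal := fun m => by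
      refine (ENNReal.ofReal_le_iff_le_toReal hC).1 ((hS.norm (x m)).trans ?_)
      rw [← (hx m).eFD_eq (fx m)]
      exact (hu m).2.2
    obtain ⟨φ, hφ, g, hg, hlim⟩ := bxL_subseq M₁ hp h1 h2.le hβ0 hβ hβ1 hb
    have hg' := (self g).fMemD hg
    exact ⟨φ, hφ, g.1, hg'.1, hg'.2, tendsto_of_tendsto_of_tendsto_of_le_of_le tendsto_const_nhds
      hlim (fun _ => zero_le) fun m => (((hx (φ m)).phiNpot M₂ hq1).sub_X (self g)).eFD_le⟩
  · obtain ⟨x, hx, fx⟩ := lift u hu cu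
    obtain ⟨ρ, hρ, h⟩ := hS.continuous x hε
    refine ⟨ρ, hρ, fun v hv cv huv => ?_⟩
    obtain ⟨y, hy, fy⟩ := lift v hv cv
    rw [(hy.sub_X hx).eFD_eq (fin fy fx)] at huv
    exact ((hy.phiNmap M₂ hq1).sub_X (hx.phiNmap M₂ hq1)).eFD_le.trans_lt (h y huv).2
  · obtain ⟨y, hy, fy⟩ := lift v hv cv
    have surj : ∀ f : FormT n q, FMemD P.T k P.s lam lam' P.δ f → CoClosed P.T f →
        ∃ u : FormT n q, FMemD P.T k P.s lam lam' P.δ u ∧ CoClosed P.T u ∧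
          EqOnT P.T (PhiLmap P.μ M₁ M₂ v u - f) 0 := fun f hf cf => by
      obtain ⟨z, hz, fz⟩ := lift f hf cf
      obtain ⟨x, fx, e⟩ := hS.surjective y fz
      have hx := (self x).fMemD fx
      refine ⟨x.1, hx.1, hx.2, ?_⟩
      have := (hy.phiLmap (M₁ := M₁) M₂ hq1 (self x)).sub_X hz
      rw [show x + bxL P M₁ y x + bxL P M₁ x y = z from e, sub_self] at this
      exact this
    have zero : ∀ {w : FormT n q}, EqOnT P.T w 0 → eFD P.T k P.s lam lam' P.δ w = 0 := fun {w} h =>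
      le_antisymm ((EqOnT.eFD_le (x := (0 : P.XSp q)) h).trans_eq hS.zero) zero_le
    refine ⟨fun ε hε => ?_, ⟨1 + A * ‖y‖ + A * ‖y‖, ?_, fun u hu cu => ?_⟩,
      ⟨0, fun mm g hg h => ?_⟩, fun f hf cf _ => ?_, ⟨0, Fin.elim0, fun i => i.elim0,
      fun f hf cf => ⟨Fin.elim0, ?_⟩⟩⟩
    · obtain ⟨ρ, hρ, h⟩ := hS.remainder y hε
      refine ⟨ρ, hρ, fun u hu cu huv => ?_⟩
      obtain ⟨x, hx, fx⟩ := lift u hu cu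
      rw [(hx.sub_X hy).eFD_eq (fin fx fy)] at huv ⊢
      exact (((hx.phiNmap M₂ hq1).sub_X (hy.phiNmap M₂ hq1)).sub_X
        (hy.phiLmap M₂ hq1 (hx.sub_X hy))).eFD_le.trans (h x huv)
    · have := hS.nonneg
      positivity
    · obtain ⟨x, hx, fx⟩ := lift u hu cu
      have h := hS.bound_deriv y x
      have hL := hy.phiLmap (M₁ := M₁) M₂ hq1 hx
      rw [hx.eFD_eq fx]
      exact ⟨hL.fMemD (ne_top_of_le_ne_top (ENNReal.mul_ne_top ENNReal.ofReal_ne_top fx) h),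
        hL.eFD_le.trans h⟩
    · by_contra hm
      have hg0 : ∀ i, EqOnT P.T (g i) 0 := fun i => by
        obtain ⟨x, hx, fx⟩ := lift (g i) (hg i).1 (hg i).2.1
        have hL := hy.phiLmap (M₁ := M₁) M₂ hq1 hx
        have hb := ne_top_of_le_ne_top (ENNReal.mul_ne_top ENNReal.ofReal_ne_top fx)
          (hS.bound_deriv y x)
        have h0 := hS.inj y y x (hS.eq_zero ((hL.eFD_eq hb).symm.trans (hg i).2.2))
        rw [h0] at hx
        exact hx
      refine one_ne_zero (h (fun _ => 1) (zero fun I t ht x => ?_) ⟨0, by omega⟩)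
      simp only [one_smul, Finset.sum_apply]
      exact Finset.sum_eq_zero fun i _ => hg0 i I t ht x
    · obtain ⟨u, hu, cu, h⟩ := surj f hf cf
      exact ⟨u, hu, cu, zero h⟩
    · obtain ⟨u, hu, cu, h⟩ := surj f hf cf
      refine ⟨u, hu, cu, zero fun I t ht x => ?_⟩
      have h := h I t ht x
      simp only [Pi.sub_apply, Pi.zero_apply] at h
      simp only [Finset.univ_eq_empty, Finset.sum_empty, sub_zero, Pi.sub_apply, Pi.zero_apply]
      linarith
  · obtain ⟨x, hx, -⟩ := lift u hu cu
    obtain ⟨y, hy, -⟩ := lift v hv cv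
    have e : x = y := hS.injective (XSp_ext fun I t ht z =>
      ((hx.phiNmap M₂ hq1 I t ht z).symm.trans (h I t ht z)).trans (hy.phiNmap M₂ hq1 I t ht z))
    rw [← e] at hy
    exact fun I t ht z => (hx I t ht z).trans (hy I t ht z).symm
  · obtain ⟨x, hx, fx⟩ := lift u hu cu
    obtain ⟨ε, hε, h⟩ := hS.isOpen x hr
    refine ⟨ε, hε, fun f hf cf hfu => ?_⟩
    obtain ⟨z, hz, fz⟩ := lift f hf cf
    have fN : eX k lam lam' (x + B x x) ≠ ⊤ :=
      ne_top_of_le_ne_top (ENNReal.add_ne_top.2 ⟨fx, hS.ne_top x x⟩) (hS.add _ _)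
    rw [(hz.sub_X (hx.phiNmap M₂ hq1)).eFD_eq (fin fz fN)] at hfu
    obtain ⟨v, hv, e⟩ := h z hfu
    have fv : eX k lam lam' v ≠ ⊤ := by
      rw [← sub_add_cancel v x]
      exact ne_top_of_le_ne_top (ENNReal.add_ne_top.2 ⟨hv.ne_top, fx⟩) (hS.add _ _)
    have hv' := (self v).fMemD fv
    have hN := (self v).phiNmap (M₁ := M₁) M₂ hq1
    rw [show v + bxL P M₁ v v = z from e] at hN
    exact ⟨v.1, hv'.1, hv'.2, ((self v).sub_X hx).eFD_le.trans_lt hv,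
      fun I t ht y => (hN I t ht y).trans (hz I t ht y).symm⟩
end NSdeRham

end
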